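/- Let n ≥ 2 and s ∈ (0,1). There exists γ₁* ∈ (0,∞), depending only on n and s, such that for every α > 0 and m > 0, the ball of volume m is a global minimizer of F_{s,α}(F) = P(F) − α s(1−s) P_s(F) over sets of finite perimeter with |F| = m if and only if α·m^{(1−s)/n} ≤ γ₁*. -/

import Mathlib

open MeasureTheory Metric Set Filter
open scoped ENNReal Pointwise symmDiff Classical

noncomputable section

abbrev Euc (n : ℕ) := EuclideanSpace ℝ (Fin n)

/-- Divergence of a vector field on ℝⁿ. -/
def divg {n : ℕ} (g : Euc n → Euc n) (x : Euc n) : ℝ :=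
  ∑ i : Fin n, fderiv ℝ g x (EuclideanSpace.single i 1) i

/-- The admissible values in the variational definition of the perimeter:
values `∫_E div g` over C¹ compactly supported vector fields with `‖g‖ ≤ 1`. -/
def perimVals {n : ℕ} (E : Set (Euc n)) : Set ℝ :=
  {r | ∃ g : Euc n → Euc n, ContDiff ℝ 1 g ∧ HasCompactSupport g ∧
        (∀ x, ‖g x‖ ≤ 1) ∧ r = ∫ x in E, divg g x}

/-- Perimeter: total variation of the characteristic function. -/
def perim {n : ℕ} (E : Set (Euc n)) : ℝ := sSup (perimVals E)

/-- A set has finite perimeter if the variational quantities are bounded above. -/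
def HasFinitePerim {n : ℕ} (E : Set (Euc n)) : Prop := BddAbove (perimVals E)

/-- Characteristic function of a set. -/
def chi {n : ℕ} (E : Set (Euc n)) : Euc n → ℝ := E.indicator 1

/-- Nonlocal perimeter associated with a kernel `K`. -/
def PK {n : ℕ} (K : Euc n → ℝ) (E : Set (Euc n)) : ℝ :=
  ∫ x, ∫ y, K (x - y) * |chi E x - chi E y|

/-- Fractional `s`-perimeter. -/
def Ps (n : ℕ) (s : ℝ) (E : Set (Euc n)) : ℝ :=
  ∫ x : Euc n, ∫ y : Euc n, |chi E x - chi E y| / ‖x - y‖ ^ ((n : ℝ) + s)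

/-- The energy `J_α(E) = P(E) - α s (1-s) P_K(E)`. -/
def Jen {n : ℕ} (K : Euc n → ℝ) (s α : ℝ) (E : Set (Euc n)) : ℝ :=
  perim E - α * s * (1 - s) * PK K E

/-- The energy `F_{s,α}(E) = P(E) - α s (1-s) P_s(E)`. -/
def Fen (n : ℕ) (s α : ℝ) (E : Set (Euc n)) : ℝ :=
  perim E - α * s * (1 - s) * Ps n s E

/-- ω_n : volume of the unit ball of ℝⁿ. -/
def ballVol (n : ℕ) : ℝ := (volume (ball (0 : Euc n) 1)).toReal

/-- Volume-constrained global minimizer of `J_α` (volume `m`). -/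
def IsJMin {n : ℕ} (K : Euc n → ℝ) (s α m : ℝ) (E : Set (Euc n)) : Prop :=
  MeasurableSet E ∧ HasFinitePerim E ∧ volume E = ENNReal.ofReal m ∧
    ∀ F : Set (Euc n), MeasurableSet F → HasFinitePerim F →
      volume F = ENNReal.ofReal m → Jen K s α E ≤ Jen K s α F

/-- Volume-constrained global minimizer of `F_{s,α}` (volume `m`). -/
def IsFMin (n : ℕ) (s α m : ℝ) (E : Set (Euc n)) : Prop :=
  MeasurableSet E ∧ HasFinitePerim E ∧ volume E = ENNReal.ofReal m ∧
    ∀ F : Set (Euc n), MeasurableSet F → HasFinitePerim F →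
      volume F = ENNReal.ofReal m → Fen n s α E ≤ Fen n s α F

set_option linter.all false
set_option linter.unusedVariables false
set_option linter.deprecated false
variable {n m : ℕ}
local notation:max "Ec" x:max => Euc (x+1)
local notation:max "Bu" x:max => ball (0 : Euc (x+1)) 1
local notation:max "Rp" x:max => ((x:ℝ)+1)
local notation "oR" => ENNReal.ofReal
local notation "mLe" => mul_le_mul_of_nonneg_left
local notation "mRi" => mul_le_mul_of_nonneg_right
local notation "msB" => measurableSet_ball
local notation "MS" => MeasurableSet
local notation "oRle" => ENNReal.ofReal_le_ofReal

/-- admissible fields -/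
def Adm (g : Euc n → Euc n) : Prop :=
  ContDiff ℝ 1 g ∧ HasCompactSupport g ∧ ∀ x, ‖g x‖ ≤ 1
theorem adm_zero : Adm (fun _ : Euc n => (0 : Euc n)) :=
  ⟨contDiff_const, HasCompactSupport.zero, fun x => by simp⟩
theorem divg_trace (g : Euc n → Euc n) (x : Euc n) :
    divg g x = LinearMap.trace ℝ (Euc n) (fderiv ℝ g x : Euc n →ₗ[ℝ] Euc n) := by
  rw [LinearMap.trace_eq_matrix_trace ℝ (EuclideanSpace.basisFun (Fin n) ℝ).toBasis]
  simp [divg, Matrix.trace, LinearMap.toMatrix_apply]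
theorem divg_cont {g : Euc n → Euc n} (h : ContDiff ℝ 1 g) : Continuous (divg g) := by
  unfold divg
  refine continuous_finsetSum _ fun i _ => ?_
  have h1 := h.continuous_fderiv (by simp)
  have h2 : Continuous fun x => fderiv ℝ g x (EuclideanSpace.single i 1) :=
    h1.clm_apply continuous_const
  exact (PiLp.continuous_apply 2 _ i).comp h2
theorem divg_supp {g : Euc n → Euc n} (h : HasCompactSupport g) :
    HasCompactSupport (divg g) := by
  refine (h.fderiv ℝ).mono ?_
  intro x hx
  simp only [Function.mem_support] at hx ⊢
  intro h0
  apply hx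
  simp [divg, h0]
theorem divg_int {g : Euc n → Euc n} (h : ContDiff ℝ 1 g) (h' : HasCompactSupport g) :
    Integrable (divg g) := (divg_cont h).integrable_of_hasCompactSupport (divg_supp h')
theorem le_perim {E : Set (Euc n)} (hE : HasFinitePerim E) {g : Euc n → Euc n}
    (hg : Adm g) : ∫ x in E, divg g x ≤ perim E :=
  le_csSup hE ⟨g, hg.1, hg.2.1, hg.2.2, rfl⟩
theorem zero_mem_perimVals (E : Set (Euc n)) : (0 : ℝ) ∈ perimVals E :=
  ⟨_, adm_zero.1, adm_zero.2.1, adm_zero.2.2, by simp [divg]⟩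
theorem perim_le {E : Set (Euc n)} {M : ℝ}
    (h : ∀ g : Euc n → Euc n, Adm g → ∫ x in E, divg g x ≤ M) : perim E ≤ M := by
  refine csSup_le ⟨0, zero_mem_perimVals E⟩ ?_
  rintro r ⟨g, h1, h2, h3, rfl⟩
  exact h g ⟨h1, h2, h3⟩
theorem finPerim_of {E : Set (Euc n)} {M : ℝ}
    (h : ∀ g : Euc n → Euc n, Adm g → ∫ x in E, divg g x ≤ M) : HasFinitePerim E := by
  refine ⟨M, ?_⟩
  rintro r ⟨g, h1, h2, h3, rfl⟩
  exact h g ⟨h1, h2, h3⟩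
theorem perim_nonneg (E : Set (Euc n)) : 0 ≤ perim E := by
  by_cases h : HasFinitePerim E
  · exact le_csSup h (zero_mem_perimVals E)
  · exact (Real.sSup_of_not_bddAbove h).ge
/-- similarity `x ↦ l U x + c` -/
def sim (l : ℝ) (U : Euc n ≃ₗᵢ[ℝ] Euc n) (c : Euc n) (x : Euc n) : Euc n := l • U x + c
theorem sim_inv {l : ℝ} (hl : 0 < l) (U : Euc n ≃ₗᵢ[ℝ] Euc n) (c x : Euc n) :
    sim l U c (sim l⁻¹ U.symm (-(l⁻¹ • U.symm c)) x) = x := by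
  simp [sim, smul_smul, hl.ne']
theorem sim_inv' {l : ℝ} (hl : 0 < l) (U : Euc n ≃ₗᵢ[ℝ] Euc n) (c x : Euc n) :
    (sim l⁻¹ U.symm (-(l⁻¹ • U.symm c)) (sim l U c x)) = x := by
  simp [sim, smul_smul, hl.ne']
theorem sim_cont (l : ℝ) (U : Euc n ≃ₗᵢ[ℝ] Euc n) (c : Euc n) :
    Continuous (sim l U c) := by unfold sim; fun_prop
theorem sim_map {l : ℝ} (hl : 0 < l) (U : Euc n ≃ₗᵢ[ℝ] Euc n) (c : Euc n) :
    Measure.map (sim l U c) volume = oR ((l ^ n)⁻¹) • (volume : Measure (Euc n)) := by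
  have h1 : sim l U c = (fun x => x + c) ∘ (fun x => l • x) ∘ U := rfl
  rw [h1, ← Measure.map_map (by fun_prop) (by fun_prop),
    ← Measure.map_map (by fun_prop) (by fun_prop), U.measurePreserving.map_eq,
    Measure.map_addHaar_smul volume hl.ne', Measure.map_smul,
    (measurePreserving_add_right volume c).map_eq]
  simp [abs_of_pos hl]
theorem sim_emb {l : ℝ} (hl : 0 < l) (U : Euc n ≃ₗᵢ[ℝ] Euc n) (c : Euc n) :
    MeasurableEmbedding (sim l U c) := by
  let e : Euc n ≃ₜ Euc n :=
    { toFun := sim l U c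
      invFun := sim l⁻¹ U.symm (-(l⁻¹ • U.symm c))
      left_inv := sim_inv' hl U c
      right_inv := sim_inv hl U c
      continuous_toFun := sim_cont _ _ _
      continuous_invFun := sim_cont _ _ _ }
  exact e.measurableEmbedding
theorem sim_integral {l : ℝ} (hl : 0 < l) (U : Euc n ≃ₗᵢ[ℝ] Euc n) (c : Euc n)
    (E : Set (Euc n)) (f : Euc n → ℝ) :
    ∫ x in (sim l U c) ⁻¹' E, f (sim l U c x) = (l ^ n)⁻¹ * ∫ x in E, f x := by
  rw [← (sim_emb hl U c).setIntegral_map, sim_map hl, Measure.restrict_smul, integral_smul_measure,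
    ENNReal.toReal_ofReal (by positivity), smul_eq_mul]
theorem sim_lintegral {l : ℝ} (hl : 0 < l) (U : Euc n ≃ₗᵢ[ℝ] Euc n) (c : Euc n)
    (f : Euc n → ℝ≥0∞) :
    ∫⁻ x, f (sim l U c x) = oR ((l ^ n)⁻¹) * ∫⁻ x, f x := by
  rw [← (sim_emb hl U c).lintegral_map, sim_map hl, lintegral_smul_measure, smul_eq_mul]
theorem sim_volume {l : ℝ} (hl : 0 < l) (U : Euc n ≃ₗᵢ[ℝ] Euc n) (c : Euc n)
    (E : Set (Euc n)) :
    volume ((sim l U c) ⁻¹' E) = oR ((l ^ n)⁻¹) * volume E := by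
  rw [← (sim_emb hl U c).map_apply, sim_map hl]; simp
theorem sim_vals {l : ℝ} (hl : 0 < l) (U : Euc n ≃ₗᵢ[ℝ] Euc n) (c : Euc n)
    {E : Set (Euc n)} {r : ℝ} (hr : r ∈ perimVals E) :
    l * (l ^ n)⁻¹ * r ∈ perimVals ((sim l U c) ⁻¹' E) := by
  obtain ⟨g, h1, h2, h3, rfl⟩ := hr
  have hs : ∀ x, HasFDerivAt (sim l U c) (l • (U.toContinuousLinearEquiv : Euc n →L[ℝ] Euc n)) x :=
    fun x => (((U.toContinuousLinearEquiv : Euc n →L[ℝ] Euc n).hasFDerivAt (x := x)).const_smul l).add_const c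
  have hsc : ContDiff ℝ 1 (sim l U c) := by
    unfold sim
    exact (U.contDiff.const_smul l).add contDiff_const
  refine ⟨fun x => U.symm (g (sim l U c x)), U.symm.contDiff.comp (h1.comp hsc), ?_, ?_, ?_⟩
  · let e : Euc n ≃ₜ Euc n :=
      { toFun := sim l U c
        invFun := sim l⁻¹ U.symm (-(l⁻¹ • U.symm c))
        left_inv := sim_inv' hl U c
        right_inv := sim_inv hl U c
        continuous_toFun := sim_cont _ _ _
        continuous_invFun := sim_cont _ _ _ }
    have : HasCompactSupport (g ∘ e) := h2.comp_homeomorph e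
    exact this.comp_left (g := U.symm) (by simp)
  · intro x; simpa using h3 _
  · have hd : ∀ x, divg (fun x => U.symm (g (sim l U c x))) x = l * divg g (sim l U c x) := by
      intro x
      have hg : HasFDerivAt g (fderiv ℝ g (sim l U c x)) (sim l U c x) :=
        (h1.differentiable (by simp) _).hasFDerivAt
      have h4 := (U.symm.toContinuousLinearEquiv : Euc n →L[ℝ] Euc n).hasFDerivAt.comp x
        (hg.comp x (hs x))
      have h5 : fderiv ℝ (fun x => U.symm (g (sim l U c x))) x = _ := h4.fderiv
      rw [divg_trace, divg_trace, h5]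
      have := LinearMap.trace_conj' (R := ℝ) (M := Euc n) (N := Euc n)
        (fderiv ℝ g (sim l U c x) : Euc n →ₗ[ℝ] Euc n) U.symm.toLinearEquiv
      rw [← this, ← smul_eq_mul, ← map_smul]
      congr 1
      ext y
      simp [LinearEquiv.conj_apply]
    simp_rw [hd]
    rw [integral_const_mul, sim_integral hl U c E (divg g)]
    ring
theorem sim_perim_aux {l : ℝ} (hl : 0 < l) (U : Euc n ≃ₗᵢ[ℝ] Euc n) (c : Euc n)
    {E : Set (Euc n)} (hE : HasFinitePerim ((sim l U c) ⁻¹' E)) : HasFinitePerim E ∧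
      perim E ≤ (l * (l ^ n)⁻¹)⁻¹ * perim ((sim l U c) ⁻¹' E) := by
  have hp : 0 < l * (l ^ n)⁻¹ := by positivity
  have : ∀ r ∈ perimVals E, r ≤ (l * (l ^ n)⁻¹)⁻¹ * perim ((sim l U c) ⁻¹' E) := by
    intro r hr
    rw [le_inv_mul_iff₀ hp]
    exact le_csSup hE (sim_vals hl U c hr)
  exact ⟨⟨_, this⟩, csSup_le ⟨0, zero_mem_perimVals E⟩ this⟩
theorem sim_perim {l : ℝ} (hl : 0 < l) (U : Euc n ≃ₗᵢ[ℝ] Euc n) (c : Euc n)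
    {E : Set (Euc n)} (hE : HasFinitePerim E) : HasFinitePerim ((sim l U c) ⁻¹' E) ∧
      perim ((sim l U c) ⁻¹' E) = l * (l ^ n)⁻¹ * perim E := by
  have hp : 0 < l * (l ^ n)⁻¹ := by positivity
  have h0 : (sim l⁻¹ U.symm (-(l⁻¹ • U.symm c))) ⁻¹' ((sim l U c) ⁻¹' E) = E := by
    rw [← preimage_comp]
    have : (sim l U c) ∘ (sim l⁻¹ U.symm (-(l⁻¹ • U.symm c))) = id :=
      funext fun x => sim_inv hl U c x
    rw [this, preimage_id]
  have h1 := sim_perim_aux (E := (sim l U c) ⁻¹' E) (inv_pos.2 hl) U.symm (-(l⁻¹ • U.symm c))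
    (by rw [h0]; exact hE)
  have h2 := sim_perim_aux hl U c h1.1
  refine ⟨h1.1, le_antisymm ?_ ?_⟩
  · have h3 := h1.2
    rw [h0] at h3
    rwa [inv_pow, inv_inv, mul_inv, inv_inv] at h3
  · rw [← le_inv_mul_iff₀ hp]; exact h2.2
theorem integral_divg {g : Euc n → Euc n} (h : ContDiff ℝ 1 g) (h' : HasCompactSupport g) :
    ∫ x, divg g x = 0 := by
  unfold divg
  have hi : ∀ i : Fin n, ContDiff ℝ 1 (fun x => g x i) := fun i =>
    (EuclideanSpace.proj (𝕜 := ℝ) i).contDiff.comp h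
  have hf : ∀ (i : Fin n) x v, fderiv ℝ g x v i = fderiv ℝ (fun x => g x i) x v := by
    intro i x v
    have := ((EuclideanSpace.proj (𝕜 := ℝ) i).hasFDerivAt.comp x
      (h.differentiable (by simp) x).hasFDerivAt).fderiv
    have h2 : fderiv ℝ (fun x => g x i) x = _ := this
    rw [h2]; rfl
  have hcs : ∀ i : Fin n, HasCompactSupport (fun x => g x i) := fun i =>
    h'.comp_left (g := fun y : Euc n => y i) rfl
  have hint : ∀ i : Fin n, Integrable
      (fun x => fderiv ℝ (fun x => g x i) x (EuclideanSpace.single i 1)) := fun i =>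
    (((hi i).continuous_fderiv (by simp)).clm_apply continuous_const).integrable_of_hasCompactSupport
      ((hcs i).fderiv_apply ℝ _)
  simp_rw [hf]
  rw [integral_finset_sum _ (fun i _ => hint i)]
  refine Finset.sum_eq_zero fun i _ => ?_
  have := integral_mul_fderiv_eq_neg_fderiv_mul_of_integrable (𝕜 := ℝ) (μ := volume)
    (f := fun _ : Euc n => (1 : ℝ)) (g := fun x => g x i) (v := EuclideanSpace.single i 1)
    (by simp) (by simpa using hint i)
    (by simpa using (hi i).continuous.integrable_of_hasCompactSupport (hcs i))
    (by fun_prop) (fun x _ => (hi i).differentiable (by simp) x)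
  simpa using this
theorem compl_perim {E : Set (Euc n)} (hm : MS E) (hE : HasFinitePerim E) :
    HasFinitePerim Eᶜ ∧ perim Eᶜ = perim E := by
  have key : ∀ A : Set (Euc n), MS A → HasFinitePerim A →
      ∀ g : Euc n → Euc n, Adm g → ∫ x in Aᶜ, divg g x ≤ perim A := by
    intro A hA hAf g hg
    have h1 := integral_add_compl hA (divg_int hg.1 hg.2.1)
    rw [integral_divg hg.1 hg.2.1] at h1
    have h2 : Adm (fun x => -g x) := ⟨hg.1.neg, hg.2.1.neg, fun x => by simpa using hg.2.2 x⟩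
    have h3 : ∀ x, divg (fun x => -g x) x = - divg g x := by
      intro x
      have : fderiv ℝ (fun x => -g x) x = - fderiv ℝ g x := fderiv_neg
      simp [divg, this]
    have h4 := le_perim hAf h2
    simp_rw [h3] at h4
    rw [integral_neg] at h4
    linarith
  have h1 := finPerim_of (key E hm hE)
  refine ⟨h1, le_antisymm (perim_le (key E hm hE)) ?_⟩
  have := perim_le (key Eᶜ hm.compl h1)
  rwa [compl_compl] at this
open ContinuousLinearMap in
theorem moll_grad {F : Set (Euc n)} (hF : MS F) (hfin : volume F ≠ ∞)
    (hP : HasFinitePerim F) {ρ : Euc n → ℝ} (hρ : ContDiff ℝ 1 ρ) (hc : HasCompactSupport ρ)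
    (h0 : ∀ x, 0 ≤ ρ x) (h1 : ∫ x, ρ x = 1) (hev : ∀ x, ρ (-x) = ρ x) :
    ∃ u : Euc n → ℝ, (u = convolution ρ (chi F) (lsmul ℝ ℝ) volume) ∧ ContDiff ℝ 1 u ∧
      (∀ x, 0 ≤ u x ∧ u x ≤ 1) ∧ Integrable u ∧ ∫ x, u x = (volume F).toReal ∧
      ∀ Z : Euc n → Euc n, Measurable Z → (∀ x, ‖Z x‖ ≤ 1) → HasCompactSupport Z →
        - ∫ x, fderiv ℝ u x (Z x) ≤ perim F := by
  have hχi : Integrable (chi F) := by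
    unfold chi
    exact (integrable_indicator_iff hF).2 (integrableOn_const (hs := hfin))
  have hχl := hχi.locallyIntegrable
  have hρi : Integrable ρ := hρ.continuous.integrable_of_hasCompactSupport hc
  set u := convolution ρ (chi F) (lsmul ℝ ℝ) volume with hu
  have hu2 : u = convolution (chi F) ρ (lsmul ℝ ℝ) volume := by
    rw [hu, ← convolution_flip]
    congr 1
    ext; simp
  have hud : ∀ x, HasFDerivAt u (convolution (chi F) (fderiv ℝ ρ) ((lsmul ℝ ℝ).precompR (Euc n)) volume x) x := by
    intro x
    rw [hu2]
    exact hc.hasFDerivAt_convolution_right _ hχl hρ x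
  have huc : ContDiff ℝ 1 u := by
    rw [hu2]
    exact hc.contDiff_convolution_right _ hχl hρ
  refine ⟨u, rfl, huc, ?_, ?_, ?_, ?_⟩
  · intro x
    have e : u x = ∫ t, ρ t * chi F (x - t) := by
      rw [hu]; simp [convolution]
    have hi1 : ∀ t, 0 ≤ chi F t ∧ chi F t ≤ 1 := fun t => by
      unfold chi; by_cases h : t ∈ F <;> simp [h]
    rw [e]
    refine ⟨integral_nonneg fun t => mul_nonneg (h0 _) (hi1 _).1, ?_⟩
    rw [← h1]
    refine integral_mono_of_nonneg (ae_of_all _ fun t => mul_nonneg (h0 _) (hi1 _).1) hρi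
      (ae_of_all _ fun t => mul_le_of_le_one_right (h0 _) (hi1 _).2)
  · exact hρi.integrable_convolution _ hχi
  · rw [hu, integral_convolution _ hρi hχi, h1]
    simp [chi, integral_indicator_one hF, Measure.real]
  · intro Z hZm hZ1 hZc
    have hZl : LocallyIntegrable Z := by
      refine (locallyIntegrable_const (1 : ℝ)).mono hZm.aestronglyMeasurable (ae_of_all _ fun x => ?_)
      simpa using hZ1 x
    set g := convolution Z ρ ((lsmul ℝ ℝ).flip) volume with hg
    have hgd : ∀ x, HasFDerivAt g (convolution Z (fderiv ℝ ρ) ((lsmul ℝ ℝ).flip.precompR (Euc n)) volume x) x := by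
      intro x
      exact hc.hasFDerivAt_convolution_right _ hZl hρ x
    have hgc : ContDiff ℝ 1 g := hc.contDiff_convolution_right _ hZl hρ
    have hge : ∀ x, g x = ∫ t, ρ (x - t) • Z t := by
      intro x; rw [hg]; simp [convolution]
    have hg1 : ∀ x, ‖g x‖ ≤ 1 := by
      intro x
      rw [hge]
      have hi : Integrable (fun t => ρ (x - t)) := hρi.comp_sub_left x
      calc ‖∫ t, ρ (x - t) • Z t‖ ≤ ∫ t, ρ (x - t) := by
            refine norm_integral_le_of_norm_le hi (ae_of_all _ fun t => ?_)
            rw [norm_smul, Real.norm_of_nonneg (h0 _)]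
            exact mul_le_of_le_one_right (h0 _) (hZ1 t)
        _ = 1 := by rw [integral_sub_left_eq_self (fun t => ρ t) volume x, h1]
    have hgs : HasCompactSupport g := hZc.convolution _ hc
    have hρ'c : Continuous (fderiv ℝ ρ) := hρ.continuous_fderiv one_ne_zero
    have hcf : HasCompactSupport (fderiv ℝ ρ) := hc.fderiv (𝕜 := ℝ)
    have hdg : ∀ x, divg g x = ∫ t, fderiv ℝ ρ (x - t) (Z t) := by
      intro x
      have hce := hcf.convolutionExists_right ((lsmul ℝ ℝ).flip.precompR (Euc n)) hZl hρ'c x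
      have hce' : Integrable (fun t => (((lsmul ℝ ℝ).flip.precompR (Euc n)) (Z t)) (fderiv ℝ ρ (x - t))) := hce
      unfold divg
      rw [(hgd x).fderiv]
      unfold convolution
      have key : ∀ i : Fin n, (∫ t, (((lsmul ℝ ℝ).flip.precompR (Euc n)) (Z t)) (fderiv ℝ ρ (x - t))) (EuclideanSpace.single i 1) i
          = ∫ t, fderiv ℝ ρ (x - t) (EuclideanSpace.single i 1) * Z t i := by
        intro i
        rw [ContinuousLinearMap.integral_apply hce']
        have h2 := (hce'.apply_continuousLinearMap (EuclideanSpace.single i (1:ℝ)))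
        have h3 := (EuclideanSpace.proj (𝕜 := ℝ) i).integral_comp_comm h2
        refine h3.symm.trans ?_
        simp
      rw [Finset.sum_congr rfl fun i _ => key i, ← integral_finsetSum]
      · congr 1; ext t
        conv_rhs => rw [← (EuclideanSpace.basisFun (Fin n) ℝ).sum_repr (Z t)]
        simp [mul_comm]
      · intro i _
        have h2 := (hce'.apply_continuousLinearMap (EuclideanSpace.single i (1:ℝ)))
        have h3 := (EuclideanSpace.proj (𝕜 := ℝ) i).integrable_comp h2
        simpa using h3
    have hodd : ∀ x, fderiv ℝ ρ (-x) = - fderiv ℝ ρ x := by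
      intro x
      have h2 : HasFDerivAt ρ (fderiv ℝ ρ (-x)) (-x) :=
        (hρ.differentiable one_ne_zero (-x)).hasFDerivAt
      have h4 : HasFDerivAt (fun x => ρ (-x)) _ x := h2.comp x (hasFDerivAt_id x).neg
      have h3 : (fun x => ρ (-x)) = ρ := funext hev
      rw [h3] at h4
      rw [h4.fderiv]; ext; simp
    have hdu : ∀ x, fderiv ℝ u x (Z x) = ∫ t, chi F t * fderiv ℝ ρ (x - t) (Z x) := by
      intro x
      have hce := hcf.convolutionExists_right ((lsmul ℝ ℝ).precompR (Euc n)) hχl hρ'c x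
      have hce' : Integrable (fun t => (((lsmul ℝ ℝ).precompR (Euc n)) (chi F t)) (fderiv ℝ ρ (x - t))) := hce
      rw [(hud x).fderiv]
      unfold convolution
      rw [ContinuousLinearMap.integral_apply hce']
      simp
    have hZi : Integrable Z := by
      rw [← integrableOn_iff_integrable_of_support_subset (subset_tsupport Z)]
      exact hZl.integrableOn_isCompact hZc
    have hρ'i : Integrable (fun x => ‖fderiv ℝ ρ x‖) :=
      (hρ'c.integrable_of_hasCompactSupport hcf).norm
    have hprod : Integrable (fun p : Euc n × Euc n => chi F p.2 * fderiv ℝ ρ (p.1 - p.2) (Z p.1)) (volume.prod volume) := by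
      have h2 := hχi.convolution_integrand (lsmul ℝ ℝ) hρ'i
      refine h2.mono ?_ (ae_of_all _ fun p => ?_)
      · have hm : Measurable (chi F) := measurable_one.indicator hF
        refine Measurable.aestronglyMeasurable ?_
        refine (hm.comp measurable_snd).mul ?_
        have h3 : Measurable fun p : Euc n × Euc n => fderiv ℝ ρ (p.1 - p.2) :=
          hρ'c.measurable.comp (measurable_fst.sub measurable_snd)
        exact (measurable_fst.comp ((h3.prodMk (hZm.comp measurable_fst)).prodMk measurable_const : Measurable fun p : Euc n × Euc n => (((fderiv ℝ ρ (p.1 - p.2) , Z p.1)), (0:ℝ)))) |> fun h4 => by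
          have h5 : Continuous fun q : (Euc n →L[ℝ] ℝ) × Euc n => q.1 q.2 := by fun_prop
          exact h5.measurable.comp h4
      · simp only [norm_mul, lsmul_apply, smul_eq_mul, norm_norm]
        refine mLe ?_ (norm_nonneg _)
        refine (le_opNorm _ _).trans ?_
        exact mul_le_of_le_one_right (norm_nonneg _) (hZ1 _)
    have hswap := integral_integral_swap (f := fun x t => chi F t * fderiv ℝ ρ (x - t) (Z x)) hprod
    have hfin2 : ∫ x in F, divg g x = - ∫ x, fderiv ℝ u x (Z x) := by
      rw [← integral_indicator hF, ← integral_neg]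
      have e1 : ∀ y, F.indicator (divg g) y = - ∫ x, chi F y * fderiv ℝ ρ (x - y) (Z x) := by
        intro y
        rw [integral_const_mul, ← mul_neg, ← integral_neg]
        by_cases hy : y ∈ F
        · simp only [indicator_of_mem hy, hdg, chi, Pi.one_apply, one_mul]
          congr 1; ext t
          rw [← neg_sub t y, hodd]; simp
        · simp [indicator_of_notMem hy, chi]
      simp_rw [e1, hdu]
      rw [integral_neg, integral_neg]
      congr 1
      exact hswap.symm
    rw [← hfin2]
    exact le_perim hP ⟨hgc, hgs, hg1⟩
theorem chi_int {F : Set (Euc n)} (hF : MS F) (hfin : volume F ≠ ∞) :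
    Integrable (chi F) := by
  unfold chi
  exact (integrable_indicator_iff hF).2 (integrableOn_const (hs := hfin))
theorem chi01 (F : Set (Euc n)) (t : Euc n) : 0 ≤ chi F t ∧ chi F t ≤ 1 := by
  unfold chi; by_cases h : t ∈ F <;> simp [h]
theorem chi_integral {F : Set (Euc n)} (hF : MS F) :
    ∫ x, chi F x = (volume F).toReal := by
  simp [chi, integral_indicator_one hF, Measure.real]
theorem moll_ball {u : Euc n → ℝ} {P : ℝ} (hu : ContDiff ℝ 1 u)
    (h : ∀ Z : Euc n → Euc n, Measurable Z → (∀ x, ‖Z x‖ ≤ 1) → HasCompactSupport Z →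
        - ∫ x, fderiv ℝ u x (Z x) ≤ P) (R : ℝ) :
    ∫ x in closedBall (0 : Euc n) R, ‖fderiv ℝ u x‖ ≤ P := by
  set g : Euc n → Euc n := fun x => (InnerProductSpace.toDual ℝ (Euc n)).symm (fderiv ℝ u x) with hg
  have hgc : Continuous g := (InnerProductSpace.toDual ℝ (Euc n)).symm.continuous.comp
    (hu.continuous_fderiv one_ne_zero)
  have hgn : ∀ x, ‖g x‖ = ‖fderiv ℝ u x‖ := fun x => LinearIsometryEquiv.norm_map _ _
  have hgi : ∀ x v, fderiv ℝ u x v = inner ℝ (g x) v := fun x v => by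
    simp [hg]
  have := h ((closedBall (0 : Euc n) R).indicator fun x => -(‖g x‖⁻¹ • g x))
    ((hgc.norm.measurable.inv.smul hgc.measurable).neg.indicator measurableSet_closedBall)
    (fun x => by
      refine (norm_indicator_le_norm_self _ _).trans ?_
      rw [norm_neg, norm_smul, norm_inv, norm_norm]
      exact inv_mul_le_one) 
    (HasCompactSupport.intro (isCompact_closedBall (0 : Euc n) R) fun x hx => by simp [hx])
  refine le_trans (le_of_eq ?_) this
  rw [← integral_neg, ← integral_indicator measurableSet_closedBall]
  congr 1; ext x
  by_cases hx : x ∈ closedBall (0 : Euc n) R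
  · rw [indicator_of_mem hx, indicator_of_mem hx, map_neg, neg_neg, hgi, real_inner_smul_right,
      real_inner_self_eq_norm_sq, ← hgn]
    by_cases h0 : ‖g x‖ = 0
    · simp [h0]
    · field_simp
  · simp [hx]
open ContinuousLinearMap in
theorem L0 {F : Set (Euc n)} (hF : MS F) (hfin : volume F ≠ ∞)
    (hP : HasFinitePerim F) {δ : ℝ} (hδ : 0 < δ) :
    ∃ η : Euc n → ℝ, ContDiff ℝ 1 η ∧ HasCompactSupport η ∧ (∀ x, 0 ≤ η x ∧ η x ≤ 1) ∧
      ∫ x, |η x - chi F x| ≤ δ ∧ ∫ x, ‖fderiv ℝ η x‖ ≤ perim F + δ := by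
  have hχi := chi_int hF hfin
  let b : ℕ → ContDiffBump (0 : Euc n) := fun k => ⟨1 / (k + 1), 2 * (1 / (k + 1)), by positivity, by
    have : (0:ℝ) < 1 / (k + 1) := by positivity
    linarith⟩
  have hae := ContDiffBump.ae_convolution_tendsto_right_of_locallyIntegrable (μ := volume) (φ := b)
    (l := atTop) (K := 2) (g := chi F)
    (by simpa [b] using (tendsto_one_div_add_atTop_nhds_zero_nat (𝕜 := ℝ)).const_mul 2)
    (Eventually.of_forall fun k => le_rfl) hχi.locallyIntegrable
  have hM := fun k => moll_grad hF hfin hP (ρ := (b k).normed volume) ((b k).contDiff_normed)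
    (b k).hasCompactSupport_normed (fun x => (b k).nonneg_normed x) (b k).integral_normed
    (b k).normed_neg
  choose u hu1 hu2 hu3 hu4 hu5 hu6 using hM
  -- Scheffe
  have hlim : Tendsto (fun k => ∫ x, |u k x - chi F x|) atTop (nhds 0) := by
    have h1 : Tendsto (fun k => ∫ x, max (chi F x - u k x) 0) atTop (nhds (∫ x : Euc n, (0:ℝ))) := by
      refine tendsto_integral_of_dominated_convergence (chi F) (fun k => ?_) hχi (fun k => ?_) ?_
      · exact ((hχi.sub (hu4 k)).pos_part).aestronglyMeasurable
      · refine ae_of_all _ fun x => ?_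
        rw [Real.norm_of_nonneg (le_max_right _ _)]
        exact max_le (by linarith [(hu3 k x).1]) (chi01 F x).1
      · filter_upwards [hae] with x hx
        have : Tendsto (fun k => u k x) atTop (nhds (chi F x)) := by
          simpa [hu1] using hx
        have := ((tendsto_const_nhds (x := chi F x)).sub this).max (tendsto_const_nhds (x := (0:ℝ)))
        simpa using this
    have h2 : ∀ k, ∫ x, |u k x - chi F x| = 2 * ∫ x, max (chi F x - u k x) 0 := by
      intro k
      have : ∀ x, |u k x - chi F x| = (u k x - chi F x) + 2 * max (chi F x - u k x) 0 := by
        intro x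
        rcases le_total (u k x) (chi F x) with h | h
        · rw [abs_of_nonpos (by linarith), max_eq_left (by linarith)]; ring
        · rw [abs_of_nonneg (by linarith), max_eq_right (by linarith)]; ring
      simp_rw [this]
      rw [integral_add (f := fun x => u k x - chi F x) (g := fun x => 2 * max (chi F x - u k x) 0)
        ((hu4 k).sub hχi) (((hχi.sub (hu4 k)).pos_part).const_mul 2),
        integral_sub (hu4 k) hχi, hu5, chi_integral hF, integral_const_mul]
      ring
    simp_rw [h2]
    simpa using h1.const_mul 2
  obtain ⟨k, hk⟩ := (hlim.eventually (gt_mem_nhds (half_pos hδ))).exists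
  -- cutoff
  let ψ : ContDiffBump (0 : Euc n) := ⟨1, 2, by norm_num, by norm_num⟩
  obtain ⟨C, hC⟩ := (ψ.contDiff (n := 1)).continuous_fderiv one_ne_zero |>.norm.bounded_above_of_compact_support
    (ψ.hasCompactSupport.fderiv (𝕜 := ℝ)).norm
  have hC0 : 0 ≤ C := (norm_nonneg _).trans (hC 0)
  have htail : Tendsto (fun R : ℕ => ∫ x, (1 - ψ (((R:ℝ)+1)⁻¹ • x)) * u k x) atTop
      (nhds (∫ x : Euc n, (0:ℝ))) := by
    have hR : Tendsto (fun R : ℕ => ((R:ℝ)+1)⁻¹) atTop (nhds 0) := by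
      simpa using (tendsto_one_div_add_atTop_nhds_zero_nat (𝕜 := ℝ))
    refine tendsto_integral_of_dominated_convergence (u k) (fun R => ?_) (hu4 k) (fun R => ?_) ?_
    · exact ((continuous_const.sub (ψ.continuous.comp (continuous_const_smul _))).mul
        (hu2 k).continuous).aestronglyMeasurable
    · refine ae_of_all _ fun x => ?_
      rw [Real.norm_of_nonneg (mul_nonneg (by linarith [ψ.le_one (x := ((R:ℝ)+1)⁻¹ • x)]) (hu3 k x).1)]
      exact mul_le_of_le_one_left (hu3 k x).1 (by linarith [ψ.nonneg (x := ((R:ℝ)+1)⁻¹ • x)])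
    · refine ae_of_all _ fun x => ?_
      have h1 : Tendsto (fun R : ℕ => ψ (((R:ℝ)+1)⁻¹ • x)) atTop (nhds (ψ ((0:ℝ) • x))) :=
        (ψ.continuous.tendsto _).comp (hR.smul_const x)
      have h2 : ψ ((0:ℝ) • x) = 1 := by
        rw [zero_smul]; exact ψ.one_of_mem_closedBall (by simp [ψ])
      rw [h2] at h1
      simpa using ((tendsto_const_nhds (x := (1:ℝ))).sub h1).mul_const (u k x)
  have hR2 : Tendsto (fun R : ℕ => ((R:ℝ)+1)⁻¹ * (C * (volume F).toReal)) atTop (nhds 0) := by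
    simpa using (tendsto_one_div_add_atTop_nhds_zero_nat (𝕜 := ℝ)).mul_const (C * (volume F).toReal)
  rw [integral_zero] at htail
  obtain ⟨R, hR, hR'⟩ := ((htail.eventually (gt_mem_nhds (half_pos hδ))).and
    (hR2.eventually (gt_mem_nhds hδ))).exists
  set r : ℝ := ((R:ℝ)+1)⁻¹ with hr
  have hr0 : 0 < r := by positivity
  have hψ01 : ∀ x, 0 ≤ ψ x ∧ ψ x ≤ 1 := fun x => ⟨ψ.nonneg, ψ.le_one⟩
  have hψd : ContDiff ℝ 1 fun x : Euc n => ψ (r • x) := ψ.contDiff.comp (contDiff_const_smul r)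
  have hηd : ContDiff ℝ 1 fun x => ψ (r • x) * u k x := hψd.mul (hu2 k)
  have hψs : ∀ x, x ∉ closedBall (0 : Euc n) (2 / r) → ψ (r • x) = 0 := by
    intro x hx
    refine ψ.zero_of_le_dist ?_
    simp only [mem_closedBall, dist_zero_right, not_le] at hx
    rw [dist_zero_right, norm_smul, Real.norm_of_nonneg hr0.le]
    rw [div_lt_iff₀ hr0] at hx
    simp only [ψ]; linarith
  have hηs : HasCompactSupport fun x => ψ (r • x) * u k x :=
    HasCompactSupport.intro (isCompact_closedBall (0 : Euc n) (2/r)) fun x hx => by simp [hψs x hx]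
  refine ⟨fun x => ψ (r • x) * u k x, hηd, hηs, fun x => ?_, ?_, ?_⟩
  · exact ⟨mul_nonneg (hψ01 _).1 (hu3 k x).1, mul_le_one₀ (hψ01 _).2 (hu3 k x).1 (hu3 k x).2⟩
  · have hi2 : Integrable fun x => (1 - ψ (r • x)) * u k x := by
      have : (fun x => (1 - ψ (r • x)) * u k x) = fun x => u k x - ψ (r • x) * u k x := by ext; ring
      rw [this]
      exact (hu4 k).sub (hηd.continuous.integrable_of_hasCompactSupport hηs)
    have hi3 := ((hu4 k).sub hχi).abs
    calc ∫ x, |ψ (r • x) * u k x - chi F x|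
        ≤ ∫ x, (|u k x - chi F x| + (1 - ψ (r • x)) * u k x) := by
          refine integral_mono_of_nonneg (ae_of_all _ fun x => abs_nonneg _) (hi3.add hi2)
            (ae_of_all _ fun x => ?_)
          have := abs_sub (u k x - chi F x) ((1 - ψ (r • x)) * u k x)
          rw [abs_of_nonneg (a := (1 - ψ (r • x)) * u k x)
            (mul_nonneg (by linarith [(hψ01 (r • x)).2]) (hu3 k x).1)] at this
          refine le_trans (le_of_eq ?_) this
          simp only; ring_nf
      _ = _ := integral_add hi3 hi2
      _ ≤ δ := by linarith
  · have hb := moll_ball (hu2 k) (hu6 k) (2 / r)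
    have hi1 : Integrable ((closedBall (0:Euc n) (2/r)).indicator fun x => ‖fderiv ℝ (u k) x‖) :=
      (integrable_indicator_iff measurableSet_closedBall).2
        (((hu2 k).continuous_fderiv one_ne_zero).norm.continuousOn.integrableOn_compact
          (isCompact_closedBall _ _))
    have hi2 : Integrable fun x => r * C * u k x := (hu4 k).const_mul _
    calc ∫ x, ‖fderiv ℝ (fun x => ψ (r • x) * u k x) x‖ ≤
        ∫ x, ((closedBall (0:Euc n) (2/r)).indicator (fun x => ‖fderiv ℝ (u k) x‖) x + r * C * u k x) := by
          refine integral_mono_of_nonneg (ae_of_all _ fun x => norm_nonneg _) (hi1.add hi2)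
            (ae_of_all _ fun x => ?_)
          have hd1 : HasFDerivAt (fun x => ψ (r • x)) ((fderiv ℝ ψ (r • x)).comp (r • ContinuousLinearMap.id ℝ (Euc n))) x :=
            ((ψ.contDiff (n := 1)).differentiable one_ne_zero _).hasFDerivAt.comp x
              ((hasFDerivAt_id x).const_smul r)
          have hd2 := hd1.mul ((hu2 k).differentiable one_ne_zero x).hasFDerivAt
          change ‖fderiv ℝ (fun x => ψ (r • x) * u k x) x‖ ≤ _
          have hd3 : fderiv ℝ (fun x => ψ (r • x) * u k x) x = _ := hd2.fderiv
          rw [hd3]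
          refine (norm_add_le _ _).trans (add_le_add ?_ ?_)
          · rw [norm_smul, Real.norm_of_nonneg (hψ01 _).1]
            by_cases hx : x ∈ closedBall (0:Euc n) (2/r)
            · rw [indicator_of_mem hx]
              exact mul_le_of_le_one_left (norm_nonneg _) (hψ01 _).2
            · simp [hψs x hx, hx]
          · rw [norm_smul, Real.norm_of_nonneg (hu3 k x).1, mul_comm]
            refine mRi ?_ (hu3 k x).1
            have : (fderiv ℝ ψ (r • x)).comp (r • ContinuousLinearMap.id ℝ (Euc n)) = r • fderiv ℝ ψ (r • x) := by
              ext; simp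
            rw [this, norm_smul, Real.norm_of_nonneg hr0.le]
            exact mLe (by simpa using hC (r • x)) hr0.le
      _ = _ := integral_add hi1 hi2
      _ ≤ perim F + δ := by
        rw [integral_indicator measurableSet_closedBall, integral_const_mul, hu5]
        have : r * C * (volume F).toReal = r * (C * (volume F).toReal) := by ring
        linarith
theorem divg_smul {η : Euc n → ℝ} {X : Euc n → Euc n} {x : Euc n}
    (hη : DifferentiableAt ℝ η x) (hX : DifferentiableAt ℝ X x) :
    divg (fun x => η x • X x) x = η x * divg X x + fderiv ℝ η x (X x) := by
  have h : fderiv ℝ (fun x => η x • X x) x = _ := (hη.hasFDerivAt.smul hX.hasFDerivAt).fderiv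
  unfold divg
  rw [h]
  simp only [ContinuousLinearMap.add_apply, ContinuousLinearMap.smul_apply,
    ContinuousLinearMap.smulRight_apply, PiLp.add_apply, PiLp.smul_apply, smul_eq_mul,
    Finset.sum_add_distrib, ← Finset.mul_sum]
  congr 1
  conv_rhs => rw [← (EuclideanSpace.basisFun (Fin n) ℝ).sum_repr (X x)]
  rw [map_sum]
  refine Finset.sum_congr rfl fun i _ => ?_
  simp [mul_comm]
theorem ibp {η : Euc n → ℝ} {X : Euc n → Euc n} (hη : ContDiff ℝ 1 η)
    (hc : HasCompactSupport η) (hX : ContDiff ℝ 1 X) :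
    ∫ x, fderiv ℝ η x (X x) = - ∫ x, η x * divg X x := by
  have h := integral_divg (g := fun x => η x • X x) (hη.smul hX) hc.smul_right
  have e : ∀ x, divg (fun x => η x • X x) x = η x * divg X x + fderiv ℝ η x (X x) := fun x =>
    divg_smul (hη.differentiable one_ne_zero x) (hX.differentiable one_ne_zero x)
  simp_rw [e] at h
  rw [integral_add] at h
  · linarith
  · exact (hη.continuous.mul (divg_cont hX)).integrable_of_hasCompactSupport hc.mul_right
  · refine (((hη.continuous_fderiv one_ne_zero)).clm_apply hX.continuous).integrable_of_hasCompactSupport ?_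
    exact HasCompactSupport.intro (hc.fderiv (𝕜 := ℝ)).isCompact fun x hx => by
      rw [image_eq_zero_of_notMem_tsupport hx]; rfl
theorem divg_id (x : Euc n) : divg (fun x : Euc n => x) x = n := by
  unfold divg
  simp
theorem ball_perim_bd {g : Euc n → Euc n} (hg : Adm g) :
    ∫ x in ball (0 : Euc n) 1, divg g x ≤ n * ballVol n := by
  have hlim : Tendsto (fun k : ℕ => ∫ x : Euc n, Real.smoothTransition ((1 - ‖x‖^2) * (k+2)) * divg g x) atTop
      (nhds (∫ x, (ball (0 : Euc n) 1).indicator (divg g) x)) := by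
    refine tendsto_integral_of_dominated_convergence (fun x => |divg g x|) (fun k => ?_)
      (divg_int hg.1 hg.2.1).abs (fun k => ae_of_all _ fun x => ?_) (ae_of_all _ fun x => ?_)
    · refine Continuous.aestronglyMeasurable ?_
      have := divg_cont hg.1
      have := (Real.smoothTransition.contDiff (n := 0)).continuous
      fun_prop
    · rw [norm_mul, Real.norm_of_nonneg (Real.smoothTransition.nonneg _)]
      exact mul_le_of_le_one_left (norm_nonneg _) (Real.smoothTransition.le_one _)
    · by_cases hx : x ∈ ball (0 : Euc n) 1
      · rw [indicator_of_mem hx]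
        refine tendsto_const_nhds.congr' ?_
        have hx' : ‖x‖ < 1 := by simpa using hx
        have h1 : 0 < 1 - ‖x‖^2 := by nlinarith [norm_nonneg x]
        filter_upwards [eventually_ge_atTop (Nat.ceil (1 / (1 - ‖x‖^2)))] with k hk
        have hk' : 1 / (1 - ‖x‖^2) ≤ k := Nat.ceil_le.1 hk
        rw [div_le_iff₀ h1] at hk'
        rw [Real.smoothTransition.one_of_one_le (by nlinarith), one_mul]
      · rw [indicator_of_notMem hx]
        refine tendsto_const_nhds.congr fun k => ?_
        have hx' : 1 ≤ ‖x‖ := by simpa using hx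
        rw [Real.smoothTransition.zero_of_nonpos, zero_mul]
        have : 1 - ‖x‖^2 ≤ 0 := by nlinarith
        exact mul_nonpos_of_nonpos_of_nonneg this (by positivity)
  rw [integral_indicator msB] at hlim
  have hlim2 : Tendsto (fun k : ℕ => (1 / √(1 - 1 / ((k:ℝ)+1))) * (n * ballVol n)) atTop (nhds (n * ballVol n)) := by
    have h := (tendsto_one_div_add_atTop_nhds_zero_nat (𝕜 := ℝ))
    have h2 := (((tendsto_const_nhds (x := (1:ℝ))).sub h).sqrt)
    have h3 := ((tendsto_const_nhds (x := (1:ℝ))).div h2 (by simp)).mul_const (n * ballVol n)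
    simpa using h3
  refine le_of_tendsto_of_tendsto hlim hlim2 ?_
  filter_upwards [eventually_ge_atTop 1] with k hk
  have hk1 : (1:ℝ) ≤ k := by exact_mod_cast hk
  set c : ℝ := (k:ℝ) + 2 with hc
  set S := Real.smoothTransition with hS
  set v : Euc n → ℝ := fun x => S ((1 - ‖x‖^2) * c) with hv
  have hSd : ContDiff ℝ 1 S := Real.smoothTransition.contDiff
  have hvd : ContDiff ℝ 1 v := hSd.comp ((contDiff_const.sub (contDiff_norm_sq ℝ)).mul contDiff_const)
  have hvs : ∀ x : Euc n, x ∉ ball (0 : Euc n) 1 → v x = 0 := by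
    intro x hx
    have hx' : 1 ≤ ‖x‖ := by simpa using hx
    have : 1 - ‖x‖^2 ≤ 0 := by nlinarith
    exact Real.smoothTransition.zero_of_nonpos (mul_nonpos_of_nonpos_of_nonneg this (by positivity))
  have hvc : HasCompactSupport v := HasCompactSupport.intro (isCompact_closedBall (0 : Euc n) 1)
    fun x hx => hvs x fun h => hx (ball_subset_closedBall h)
  have hfd : ∀ x w : Euc n, fderiv ℝ v x w = - (deriv S ((1 - ‖x‖^2) * c) * (2 * c) * inner ℝ x w) := by
    intro x w
    have h1 : HasFDerivAt (fun x : Euc n => (1 - ‖x‖^2) * c) _ x :=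
      (((hasStrictFDerivAt_norm_sq x).hasFDerivAt).const_sub 1).mul_const c
    have h2 := ((hSd.differentiable one_ne_zero _).hasDerivAt (x := (1 - ‖x‖^2) * c)).comp_hasFDerivAt x h1
    have h3 : fderiv ℝ v x = _ := h2.fderiv
    rw [h3]
    simp; ring
  have hS' : ∀ t, 0 ≤ deriv S t := fun t => Real.smoothTransition.monotone.deriv_nonneg
  have hS0 : ∀ t, 1 < t → deriv S t = 0 := by
    intro t ht
    have : S =ᶠ[nhds t] fun _ => 1 := by
      filter_upwards [lt_mem_nhds ht] with y hy
      exact Real.smoothTransition.one_of_one_le hy.le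
    rw [this.deriv_eq]; simp
  have hq : (0:ℝ) < 1 - 1/((k:ℝ)+1) := by
    have : 1/((k:ℝ)+1) < 1 := by rw [div_lt_one (by positivity)]; linarith
    linarith
  have hptw : ∀ x, - fderiv ℝ v x (g x) ≤ (1 / √(1 - 1 / ((k:ℝ)+1))) * (- fderiv ℝ v x x) := by
    intro x
    rw [hfd, hfd, neg_neg, neg_neg, real_inner_self_eq_norm_sq]
    by_cases h : 1 < (1 - ‖x‖^2) * c
    · rw [hS0 _ h]; simp
    have h1 : inner ℝ x (g x) ≤ ‖x‖ := (real_inner_le_norm _ _).trans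
      (mul_le_of_le_one_right (norm_nonneg _) (hg.2.2 x))
    have h2 : √(1 - 1 / ((k:ℝ)+1)) ≤ ‖x‖ := by
      rw [Real.sqrt_le_left (norm_nonneg _)]
      have : (1 - ‖x‖^2) ≤ 1 / c := by rw [le_div_iff₀ (by positivity)]; linarith
      have : 1 / c ≤ 1 / ((k:ℝ)+1) := one_div_le_one_div_of_le (by positivity) (by linarith)
      linarith
    have h3 : ‖x‖ ≤ (1 / √(1 - 1 / ((k:ℝ)+1))) * ‖x‖^2 := by
      rw [one_div, inv_mul_eq_div, le_div_iff₀ (Real.sqrt_pos.2 hq)]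
      nlinarith [norm_nonneg x]
    have h4 : 0 ≤ deriv S ((1 - ‖x‖^2) * c) * (2 * c) := mul_nonneg (hS' _) (by positivity)
    calc _ ≤ deriv S ((1 - ‖x‖^2) * c) * (2 * c) * ((1 / √(1 - 1 / ((k:ℝ)+1))) * ‖x‖^2) :=
          mLe (h1.trans h3) h4
      _ = _ := by ring
  have hint : ∀ X : Euc n → Euc n, Continuous X → Integrable fun x => - fderiv ℝ v x (X x) := fun X hX =>
    ((((hvd.continuous_fderiv one_ne_zero)).clm_apply hX).integrable_of_hasCompactSupport 
      (HasCompactSupport.intro (hvc.fderiv (𝕜 := ℝ)).isCompact fun x hx => by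
      rw [image_eq_zero_of_notMem_tsupport hx]; rfl)).neg
  have h1 := integral_mono (hint g hg.1.continuous) ((hint _ continuous_id).const_mul (1 / √(1 - 1 / ((k:ℝ)+1)))) hptw
  rw [integral_const_mul, integral_neg, integral_neg, ibp hvd hvc hg.1, ibp hvd hvc contDiff_id, neg_neg, neg_neg] at h1
  refine h1.trans (mLe ?_ (by positivity))
  have : ∀ x : Euc n, divg id x = n := divg_id
  simp_rw [this]
  rw [integral_mul_const, mul_comm]
  refine mLe ?_ (by positivity)
  unfold ballVol
  rw [← chi_integral msB]
  refine integral_mono (hvd.continuous.integrable_of_hasCompactSupport hvc) (chi_int msB measure_ball_lt_top.ne) fun x => ?_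
  by_cases hx : x ∈ ball (0 : Euc n) 1
  · simp only [chi, indicator_of_mem hx]; exact Real.smoothTransition.le_one _
  · simp [hvs x hx, (chi01 _ _).1]
theorem ball_fin : HasFinitePerim (ball (0 : Euc n) 1) :=
  finPerim_of fun _ hg => ball_perim_bd hg
theorem ball_perim_le : perim (ball (0 : Euc n) 1) ≤ n * ballVol n :=
  perim_le fun _ hg => ball_perim_bd hg
def cs (t : ℝ) (y : Euc m) : Ec m := WithLp.toLp 2 (Fin.cons t y.ofLp : Fin (m+1) → ℝ)
@[simp] theorem cs_zero (t : ℝ) (y : Euc m) : (cs t y) 0 = t := rfl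
@[simp] theorem cs_succ (t : ℝ) (y : Euc m) (i : Fin m) : (cs t y) i.succ = y i := rfl
theorem cs_norm (t : ℝ) (y : Euc m) : ‖cs t y‖^2 = t^2 + ‖y‖^2 := by
  rw [EuclideanSpace.norm_sq_eq, EuclideanSpace.norm_sq_eq, Fin.sum_univ_succ]
  simp
theorem cs_add (t t' : ℝ) (y y' : Euc m) : cs (t+t') (y+y') = cs t y + cs t' y' := by
  ext i; refine Fin.cases ?_ (fun j => ?_) i <;> simp
theorem cs_smul (c t : ℝ) (y : Euc m) : cs (c*t) (c•y) = c • cs t y := by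
  ext i; refine Fin.cases ?_ (fun j => ?_) i <;> simp
def csl : (ℝ × Euc m) →L[ℝ] Ec m := LinearMap.toContinuousLinearMap
  { toFun := fun p => cs p.1 p.2
    map_add' := fun p q => cs_add _ _ _ _
    map_smul' := fun c p => cs_smul _ _ _ }
theorem csl_apply (p : ℝ × Euc m) : csl p = cs p.1 p.2 := rfl
theorem cs_cont : Continuous fun p : ℝ × Euc m => cs p.1 p.2 := csl.continuous
def cse (m : ℕ) : (ℝ × Euc m) ≃ᵐ Ec m :=
  ((MeasurableEquiv.refl ℝ).prodCongr (MeasurableEquiv.toLp 2 (Fin m → ℝ)).symm).trans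
    ((MeasurableEquiv.piFinSuccAbove (fun _ => ℝ) 0).symm.trans (MeasurableEquiv.toLp 2 (Fin (m+1) → ℝ)))
theorem cse_apply (p : ℝ × Euc m) : cse m p = cs p.1 p.2 := by
  ext i
  refine Fin.cases ?_ (fun j => ?_) i <;> simp [cse, cs, MeasurableEquiv.piFinSuccAbove, Fin.insertNthEquiv] <;> rfl
theorem cse_mp (m : ℕ) : MeasurePreserving (cse m) volume volume := by
  unfold cse
  refine MeasurePreserving.trans (μb := volume) ?_ (MeasurePreserving.trans (μb := volume) ?_ ?_)
  · exact (MeasurePreserving.id volume).prod ((PiLp.volume_preserving_toLp (Fin m)).symm)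
  · exact (volume_preserving_piFinSuccAbove (fun _ => ℝ) 0).symm
  · exact PiLp.volume_preserving_toLp (Fin (m+1))
theorem cs_int {φ : Ec m → ℝ} (h : Integrable φ) :
    Integrable (fun p : ℝ × Euc m => φ (cs p.1 p.2)) (volume.prod volume) := by
  have := (cse_mp m).integrable_comp_of_integrable h
  refine this.congr (ae_of_all _ fun p => ?_)
  simp [cse_apply]
theorem cs_integral {φ : Ec m → ℝ} (h : Integrable φ) :
    ∫ x, φ x = ∫ t : ℝ, ∫ y : Euc m, φ (cs t y) := by
  rw [← (cse_mp m).integral_comp (cse m).measurableEmbedding]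
  simp_rw [cse_apply]
  exact integral_prod _ (cs_int h)
/-- profile of the unit ball -/
def fb (m : ℕ) (t : ℝ) : ℝ := ballVol m * √(1 - t^2) ^ m
theorem ballVol_pos (m : ℕ) : 0 < ballVol m :=
  ENNReal.toReal_pos (measure_ball_pos _ _ one_pos).ne' measure_ball_lt_top.ne
theorem fb_cont (m : ℕ) : Continuous (fb m) := by unfold fb; fun_prop
theorem fb_nonneg (m : ℕ) (t : ℝ) : 0 ≤ fb m t := mul_nonneg (ballVol_pos m).le (by positivity)
theorem fb_pos (m : ℕ) {t : ℝ} (h : |t| < 1) : 0 < fb m t := by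
  have : 0 < 1 - t^2 := by nlinarith [sq_abs t, abs_nonneg t]
  exact mul_pos (ballVol_pos m) (pow_pos (Real.sqrt_pos.2 this) m)
theorem fb_zero (hm : 1 ≤ m) {t : ℝ} (h : 1 ≤ |t|) : fb m t = 0 := by
  have : 1 - t^2 ≤ 0 := by nlinarith [sq_abs t, abs_nonneg t]
  rw [fb, Real.sqrt_eq_zero_of_nonpos this, zero_pow (by omega), mul_zero]
theorem fb_le (m : ℕ) (t : ℝ) : fb m t ≤ ballVol m := by
  refine mul_le_of_le_one_right (ballVol_pos m).le (pow_le_one₀ (by positivity) ?_)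
  rw [Real.sqrt_le_left zero_le_one]; nlinarith [sq_nonneg t]
theorem fb_int (hm : 1 ≤ m) {k : ℝ → ℝ} (hk : Continuous k) : Integrable fun t => k t * fb m t :=
  (hk.mul (fb_cont m)).integrable_of_hasCompactSupport
    (HasCompactSupport.intro (isCompact_Icc (a := (-1:ℝ)) (b := 1)) fun t ht => by
      have : 1 ≤ |t| := by
        by_contra h; push Not at h; exact ht ⟨(abs_lt.1 h).1.le, (abs_lt.1 h).2.le⟩
      simp [fb_zero hm this])
theorem ball_ridge (hm : 1 ≤ m) {k : ℝ → ℝ} (hk : Continuous k) :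
    ∫ x in Bu m, k (x 0) = ∫ t, k t * fb m t := by
  rw [← integral_indicator msB, cs_integral]
  · congr 1; ext t
    have : ∀ y : Euc m, (Bu m).indicator (fun x => k (x 0)) (cs t y) =
        (ball (0 : Euc m) (√(1-t^2))).indicator (fun _ => k t) y := by
      intro y
      simp only [indicator, mem_ball, dist_zero_right, cs_zero]
      congr 1
      rw [eq_iff_iff, Real.lt_sqrt (norm_nonneg _), ← sq_lt_one_iff₀ (norm_nonneg _), cs_norm]
      constructor <;> intro h <;> linarith
    simp_rw [this]
    rw [integral_indicator msB, setIntegral_const, smul_eq_mul, mul_comm]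
    congr 1
    haveI : Nonempty (Fin m) := ⟨⟨0, hm⟩⟩
    rw [Measure.real, Measure.addHaar_ball _ _ (Real.sqrt_nonneg _), ENNReal.toReal_mul,
      ENNReal.toReal_ofReal (by positivity), fb, mul_comm]
    simp [ballVol]
  · rw [integrable_indicator_iff msB]
    have : Continuous fun x : Ec m => k (x 0) := by fun_prop
    exact (this.continuousOn.integrableOn_compact (isCompact_closedBall _ _)).mono_set ball_subset_closedBall
theorem fb_total (hm : 1 ≤ m) : ∫ t, fb m t = ballVol (m+1) := by
  have := ball_ridge hm (k := fun _ => 1) continuous_const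
  simp only [one_mul] at this
  rw [← this]
  simp [ballVol, Measure.real]
theorem fb_even (m : ℕ) (t : ℝ) : fb m (-t) = fb m t := by simp [fb]
theorem fb_half (hm : 1 ≤ m) : ∫ t in (0:ℝ)..1, fb m t = ballVol (m+1) / 2 := by
  have h1 : ∫ t, fb m t = ∫ t in (-1:ℝ)..1, fb m t := by
    rw [intervalIntegral.integral_of_le (by norm_num), ← integral_indicator measurableSet_Ioc]
    congr 1; ext t
    by_cases ht : t ∈ Ioc (-1:ℝ) 1
    · simp [ht]
    · rw [indicator_of_notMem ht]
      refine fb_zero hm ?_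
      by_contra h; push Not at h; exact ht ⟨(abs_lt.1 h).1, (abs_lt.1 h).2.le⟩
  have h2 : ∫ t in (-1:ℝ)..0, fb m t = ∫ t in (0:ℝ)..1, fb m t := by
    have := intervalIntegral.integral_comp_neg (a := 0) (b := 1) (fb m)
    simp_rw [fb_even] at this
    rw [this]; norm_num
  have hi : ∀ a b, IntervalIntegrable (fb m) volume a b := fun a b => (fb_cont m).intervalIntegrable a b
  rw [fb_total hm, ← intervalIntegral.integral_add_adjacent_intervals (hi (-1) 0) (hi 0 1), h2] at h1
  linarith
/-- inverse of the profile primitive -/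
theorem fb_inv (hm : 1 ≤ m) : ∃ Q : ℝ → ℝ, ∀ v, |v| < ballVol (m+1) / 2 →
    |Q v| < 1 ∧ ∫ t in (0:ℝ)..(Q v), fb m t = v ∧ HasDerivAt Q (fb m (Q v))⁻¹ v := by
  set G : ℝ → ℝ := fun r => ∫ t in (0:ℝ)..r, fb m t with hG
  have hd : ∀ r, HasStrictDerivAt G (fb m r) r := fun r =>
    intervalIntegral.integral_hasStrictDerivAt_right ((fb_cont m).intervalIntegrable _ _)
      (fb_cont m).aestronglyMeasurable.stronglyMeasurableAtFilter (fb_cont m).continuousAt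
  have hGc : Continuous G := continuous_iff_continuousAt.2 fun r => (hd r).hasDerivAt.continuousAt
  have hmono : StrictMonoOn G (Icc (-1) 1) := strictMonoOn_of_deriv_pos (convex_Icc _ _) hGc.continuousOn
    fun x hx => by
      rw [interior_Icc] at hx
      rw [(hd x).hasDerivAt.deriv]; exact fb_pos m (abs_lt.2 hx)
  have h1 : G 1 = ballVol (m+1) / 2 := fb_half hm
  have h2 : G (-1) = -(ballVol (m+1) / 2) := by
    rw [← h1, hG]
    have := intervalIntegral.integral_comp_neg (a := 0) (b := 1) (fb m)
    simp_rw [fb_even] at this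
    simp only
    rw [this, intervalIntegral.integral_symm]; norm_num
  have hex : ∀ v, |v| < ballVol (m+1) / 2 → ∃ r, |r| < 1 ∧ G r = v := by
    intro v hv
    have := intermediate_value_Icc (show (-1:ℝ) ≤ 1 by norm_num) hGc.continuousOn
    rw [abs_lt] at hv
    obtain ⟨r, hr, hr'⟩ := this (show v ∈ Icc (G (-1)) (G 1) from ⟨by rw [h2]; exact hv.1.le, by rw [h1]; exact hv.2.le⟩)
    refine ⟨r, ?_, hr'⟩
    rw [abs_lt]
    refine ⟨lt_of_le_of_ne hr.1 ?_, lt_of_le_of_ne hr.2 ?_⟩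
    · rintro rfl; linarith
    · rintro rfl; linarith
  choose! Q hQ1 hQ2 using hex
  refine ⟨Q, fun v hv => ⟨hQ1 v hv, hQ2 v hv, ?_⟩⟩
  have hne := (fb_pos m (hQ1 v hv)).ne'
  have hst := (hd (Q v)).to_localInverse hne
  rw [hQ2 v hv] at hst
  refine hst.hasDerivAt.congr_of_eventuallyEq ?_
  have hF := ((hd (Q v)).hasStrictFDerivAt_equiv hne)
  have e1 := hF.eventually_right_inverse
  rw [hQ2 v hv] at e1
  have hli : (hd (Q v)).localInverse G (fb m (Q v)) (Q v) hne = hF.localInverse G _ _ := rfl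
  have e2 : ∀ᶠ y in nhds v, |hF.localInverse G _ _ y| < 1 := by
    have hc := hst.hasDerivAt.continuousAt
    have : (hF.localInverse G _ _) v = Q v := by
      have := hF.localInverse_apply_image
      rwa [hQ2 v hv] at this
    have hc' : Tendsto (fun y => |hF.localInverse G _ _ y|) (nhds v) (nhds |Q v|) := by
      have h5 := (hc.tendsto).abs
      rw [hli, this] at h5
      exact h5
    exact hc'.eventually (gt_mem_nhds (hQ1 v hv))
  have e3 : ∀ᶠ y in nhds v, |y| < ballVol (m+1) / 2 := (continuous_abs.tendsto v).eventually (gt_mem_nhds hv)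
  filter_upwards [e1, e2, e3] with y h1 h2 h3
  have a1 := abs_lt.1 (hQ1 y h3)
  have a2 := abs_lt.1 h2
  exact hmono.injOn ⟨a1.1.le, a1.2.le⟩ ⟨a2.1.le, a2.2.le⟩ ((hQ2 y h3).trans h1.symm)
def sl (η : Ec m → ℝ) (t : ℝ) : ℝ := ∫ y : Euc m, η (cs t y)
/-- nonnegative C¹ compactly supported -/
def NC (η : Euc n → ℝ) : Prop := ContDiff ℝ 1 η ∧ HasCompactSupport η ∧ ∀ x, 0 ≤ η x
theorem cs_ge (t : ℝ) (y : Euc m) : |t| ≤ ‖cs t y‖ ∧ ‖y‖ ≤ ‖cs t y‖ := by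
  have := cs_norm t y
  constructor
  · rw [← sq_le_sq₀ (abs_nonneg _) (norm_nonneg _), sq_abs]; nlinarith [norm_nonneg y]
  · rw [← sq_le_sq₀ (norm_nonneg _) (norm_nonneg _)]; nlinarith
theorem cpt_bd {η : Euc n → ℝ} (hc : HasCompactSupport η) : ∃ ρ : ℝ, ∀ x, ρ < ‖x‖ → η x = 0 := by
  obtain ⟨ρ, hρ⟩ := hc.isCompact.isBounded.subset_closedBall 0
  refine ⟨ρ, fun x hx => image_eq_zero_of_notMem_tsupport fun h => ?_⟩
  have := hρ h
  simp at this; linarith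
theorem sl_cont {η : Ec m → ℝ} (h : Continuous η) (hc : HasCompactSupport η) :
    Continuous (sl η) := by
  obtain ⟨ρ, hρ⟩ := cpt_bd hc
  have e : sl η = fun t => ∫ y in closedBall (0 : Euc m) ρ, η (cs t y) := by
    ext t
    rw [sl, ← integral_indicator measurableSet_closedBall]
    congr 1; ext y
    by_cases hy : y ∈ closedBall (0 : Euc m) ρ
    · simp [hy]
    · rw [indicator_of_notMem hy]
      refine hρ _ (lt_of_lt_of_le ?_ (cs_ge t y).2)
      simpa using hy
  rw [e]
  exact continuous_parametric_integral_of_continuous (f := fun t y => η (cs t y)) (h.comp cs_cont)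
    (isCompact_closedBall _ _)
theorem sl_supp {η : Ec m → ℝ} (hc : HasCompactSupport η) : HasCompactSupport (sl η) := by
  obtain ⟨ρ, hρ⟩ := cpt_bd hc
  refine HasCompactSupport.intro (isCompact_Icc (a := -ρ) (b := ρ)) fun t ht => ?_
  have ht' : ρ < |t| := by
    by_contra h; push Not at h; exact ht (abs_le.1 h)
  have : ∀ y : Euc m, η (cs t y) = 0 := fun y => hρ _ (lt_of_lt_of_le ht' (cs_ge t y).1)
  simp [sl, this]
theorem sl_int {η : Ec m → ℝ} (h : Continuous η) (hc : HasCompactSupport η) :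
    Integrable (sl η) := (sl_cont h hc).integrable_of_hasCompactSupport (sl_supp hc)
theorem sl_nonneg {η : Ec m → ℝ} (h : ∀ x, 0 ≤ η x) (t : ℝ) : 0 ≤ sl η t :=
  integral_nonneg fun y => h _
theorem sl_ridge {η : Ec m → ℝ} (h : Continuous η) (hc : HasCompactSupport η) {k : ℝ → ℝ}
    (hk : Continuous k) : ∫ x, k (x 0) * η x = ∫ t, k t * sl η t := by
  rw [cs_integral]
  · simp [sl, integral_const_mul]
  · have : Continuous fun x : Ec m => k (x 0) := by fun_prop
    exact (this.mul h).integrable_of_hasCompactSupport hc.mul_left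
theorem cs_hasFDeriv {η : Ec m → ℝ} (h : ContDiff ℝ 1 η) (t : ℝ) (y : Euc m) :
    HasFDerivAt (fun y => η (cs t y)) ((fderiv ℝ η (cs t y)).comp (csl.comp (ContinuousLinearMap.inr ℝ ℝ (Euc m)))) y := by
  have h1 : HasFDerivAt (fun y : Euc m => cs t y) (csl.comp (ContinuousLinearMap.inr ℝ ℝ (Euc m))) y := by
    have := csl.hasFDerivAt.comp y (hasFDerivAt_prodMk_right t y)
    exact this
  exact (h.differentiable one_ne_zero _).hasFDerivAt.comp y h1
theorem slice_nc {η : Ec m → ℝ} (h : NC η) (t : ℝ) : NC fun y : Euc m => η (cs t y) := by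
  obtain ⟨ρ, hρ⟩ := cpt_bd h.2.1
  refine ⟨?_, ?_, fun y => h.2.2 _⟩
  · have : ContDiff ℝ 1 fun y : Euc m => csl (t, y) := csl.contDiff.comp (contDiff_const.prodMk contDiff_id)
    exact h.1.comp this
  · refine HasCompactSupport.intro (isCompact_closedBall (0 : Euc m) ρ) fun y hy => ?_
    exact hρ _ (lt_of_lt_of_le (by simpa using hy) (cs_ge t y).2)
theorem norm_split (L : Ec m →L[ℝ] ℝ) {T : ℝ} (hT : |T| ≤ 1) :
    -T * L (cs 1 0) + √(1 - T^2) * ‖L.comp (csl.comp (ContinuousLinearMap.inr ℝ ℝ (Euc m)))‖ ≤ ‖L‖ := by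
  set M := L.comp (csl.comp (ContinuousLinearMap.inr ℝ ℝ (Euc m))) with hM
  set g := (InnerProductSpace.toDual ℝ (Euc m)).symm M with hg
  have hgn : ‖g‖ = ‖M‖ := LinearIsometryEquiv.norm_map _ _
  set v := ‖g‖⁻¹ • g with hv
  have hMv : M v = ‖M‖ := by
    have : M v = inner ℝ g v := by simp [hg]
    rw [this, hv, real_inner_smul_right, real_inner_self_eq_norm_sq, ← hgn]
    by_cases h0 : ‖g‖ = 0
    · simp [h0]
    · field_simp
  have hvn : ‖v‖ ≤ 1 := by
    rw [hv, norm_smul, norm_inv, norm_norm]; exact inv_mul_le_one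
  have hT2 : 0 ≤ 1 - T^2 := by nlinarith [sq_abs T, abs_nonneg T]
  have e : cs (-T) (√(1-T^2) • v) = (-T) • cs 1 0 + √(1-T^2) • csl ((0:ℝ), v) := by
    rw [csl_apply, ← cs_smul, ← cs_smul, ← cs_add]; simp
  have h1 : L (cs (-T) (√(1-T^2) • v)) = -T * L (cs 1 0) + √(1 - T^2) * ‖M‖ := by
    rw [e, map_add, map_smul, map_smul, ← hMv]
    rfl
  rw [← h1]
  refine (le_abs_self _).trans ((L.le_opNorm _).trans (mul_le_of_le_one_right (norm_nonneg _) ?_))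
  rw [← sq_le_one_iff₀ (norm_nonneg _), cs_norm, norm_smul, Real.norm_of_nonneg (Real.sqrt_nonneg _), mul_pow,
    Real.sq_sqrt hT2]
  have : ‖v‖^2 ≤ 1 := by nlinarith [norm_nonneg v]
  nlinarith [mLe this hT2]
theorem rpow_cont {η : Euc n → ℝ} (h : NC η) {p : ℝ} (hp : 0 < p) :
    Continuous (fun x => η x ^ p) ∧ HasCompactSupport (fun x => η x ^ p) ∧ ∀ x, 0 ≤ η x ^ p := by
  refine ⟨h.1.continuous.rpow_const fun x => Or.inr hp.le, ?_, fun x => Real.rpow_nonneg (h.2.2 x) _⟩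
  exact HasCompactSupport.intro h.2.1.isCompact fun x hx => by
    rw [image_eq_zero_of_notMem_tsupport hx, Real.zero_rpow hp.ne']
def Qm (m : ℕ) : Prop := ∀ η : Euc m → ℝ, NC η →
  (m:ℝ)^m * ballVol m * (∫ x, η x ^ (Rp m/m))^m ≤ (∫ x, η x) * (∫ x, ‖fderiv ℝ η x‖)^m
/-- the cost -/
def Th (m : ℕ) (R w : ℝ) : ℝ := R * w + m * w ^ (-(1/(m:ℝ)))
theorem Th_meas (m : ℕ) (R : ℝ) : Measurable (Th m R) := by unfold Th; fun_prop
theorem iic_deriv {f : ℝ → ℝ} (hf : Continuous f) (hi : Integrable f) (t : ℝ) :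
    HasDerivAt (fun t => ∫ s in Iic t, f s) (f t) t := by
  have e : (fun t => ∫ s in Iic t, f s) = fun t => (∫ s in Iic 0, f s) + ∫ s in (0:ℝ)..t, f s := by
    ext t
    rw [← intervalIntegral.integral_Iic_sub_Iic hi.integrableOn hi.integrableOn]; ring
  rw [e]
  exact (intervalIntegral.integral_hasDerivAt_right (hf.intervalIntegrable _ _)
    hf.aestronglyMeasurable.stronglyMeasurableAtFilter hf.continuousAt).const_add _
theorem STEP (hm : 1 ≤ m) (hQ : Qm m) {η : Ec m → ℝ} (h : NC η) {R : ℝ} (hR : 0 < R)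
    (g f : ℝ → ℝ) (hg : g = sl η) (hf : f = sl fun x => η x ^ (Rp m/m))
    (hRa : R * ∫ t, f t < ballVol (m+1)) :
    ∃ T : ℝ → ℝ, (∀ t, |T t| < 1) ∧
      (∀ t, ∫ r in (0:ℝ)..(T t), fb m r = R * ((∫ s in Iic t, f s) - (∫ s, f s)/2)) ∧
      (∀ t, HasDerivAt T (R * f t / fb m (T t)) t) ∧
      Integrable (fun t => f t * Th m R (g t / fb m (T t))) ∧
      ∫ t, f t * Th m R (g t / fb m (T t)) ≤ ∫ x, ‖fderiv ℝ η x‖ := by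
  obtain ⟨Q, hQQ⟩ := fb_inv hm
  have hm0 : (0:ℝ) < m := by exact_mod_cast hm
  have hp := rpow_cont h (p := Rp m/m) (by positivity)
  have hfc : Continuous f := hf ▸ sl_cont hp.1 hp.2.1
  have hfi : Integrable f := hf ▸ sl_int hp.1 hp.2.1
  have hf0 : ∀ t, 0 ≤ f t := fun t => by rw [hf]; exact sl_nonneg hp.2.2 t
  have hgc : Continuous g := hg ▸ sl_cont h.1.continuous h.2.1
  have hg0 : ∀ t, 0 ≤ g t := fun t => by rw [hg]; exact sl_nonneg h.2.2 t
  have hgi : Integrable g := hg ▸ sl_int h.1.continuous h.2.1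
  set a := ∫ t, f t with ha
  set V : ℝ → ℝ := fun t => ∫ s in Iic t, f s with hV
  have hV0 : ∀ t, 0 ≤ V t := fun t => integral_nonneg hf0
  have hVa : ∀ t, V t ≤ a := fun t => setIntegral_le_integral hfi (ae_of_all _ hf0)
  have hin : ∀ t, |R * (V t - a/2)| < ballVol (m+1) / 2 := by
    intro t
    rw [abs_lt]
    have := hV0 t; have := hVa t
    constructor <;> nlinarith
  set T : ℝ → ℝ := fun t => Q (R * (V t - a/2)) with hT
  have hT1 : ∀ t, |T t| < 1 := fun t => (hQQ _ (hin t)).1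
  have hTd : ∀ t, HasDerivAt T (R * f t / fb m (T t)) t := by
    intro t
    have h1 : HasDerivAt (fun t => R * (V t - a/2)) (R * f t) t :=
      ((iic_deriv hfc hfi t).sub_const _).const_mul R
    have := (hQQ _ (hin t)).2.2.comp t h1
    rwa [inv_mul_eq_div] at this
  have hTc : Continuous T := continuous_iff_continuousAt.2 fun t => (hTd t).continuousAt
  have hfbp : ∀ t, 0 < fb m (T t) := fun t => fb_pos m (hT1 t)
  have hTdc : Continuous fun t => R * f t / fb m (T t) :=
    (continuous_const.mul hfc).div ((fb_cont m).comp hTc) fun t => (hfbp t).ne'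
  have hTC : ContDiff ℝ 1 T := by
    rw [contDiff_one_iff_deriv]
    refine ⟨fun t => (hTd t).differentiableAt, ?_⟩
    rw [show deriv T = fun t => R * f t / fb m (T t) from funext fun t => (hTd t).deriv]
    exact hTdc
  -- gradient integral
  set J := csl.comp (ContinuousLinearMap.inr ℝ ℝ (Euc m)) with hJ
  have hdc := h.1.continuous_fderiv one_ne_zero
  have hds : HasCompactSupport (fderiv ℝ η) := h.2.1.fderiv (𝕜 := ℝ)
  have hx0 : Continuous fun x : Ec m => T (x 0) := hTc.comp (by fun_prop)
  have i1 : Integrable fun x => -T (x 0) * fderiv ℝ η x (cs 1 0) := 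
    (hx0.neg.mul (hdc.clm_apply continuous_const)).integrable_of_hasCompactSupport
      (HasCompactSupport.intro hds.isCompact fun x hx => by
        simp [image_eq_zero_of_notMem_tsupport hx])
  have i2 : Integrable fun x => √(1 - T (x 0)^2) * ‖(fderiv ℝ η x).comp J‖ := by
    refine Continuous.integrable_of_hasCompactSupport ?_ (HasCompactSupport.intro hds.isCompact fun x hx => by
        simp [image_eq_zero_of_notMem_tsupport hx])
    exact ((continuous_const.sub (hx0.pow 2)).sqrt).mul (hdc.clm_comp continuous_const).norm
  have i3 : Integrable fun x => ‖fderiv ℝ η x‖ := hdc.norm.integrable_of_hasCompactSupport hds.norm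
  have k1 : ∫ x, (-T (x 0) * fderiv ℝ η x (cs 1 0) + √(1 - T (x 0)^2) * ‖(fderiv ℝ η x).comp J‖) ≤ ∫ x, ‖fderiv ℝ η x‖ :=
    integral_mono (i1.add i2) i3 fun x => norm_split _ (hT1 _).le
  rw [integral_add i1 i2] at k1
  have k2 : ∫ x, -T (x 0) * fderiv ℝ η x (cs 1 0) = ∫ t, (R * f t / fb m (T t)) * g t := by
    rw [hg, ← sl_ridge h.1.continuous h.2.1 hTdc]
    have hX : ContDiff ℝ 1 fun x : Ec m => T (x 0) • (cs 1 0 : Ec m) := by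
      refine ContDiff.smul (hTC.comp ?_) contDiff_const
      exact (EuclideanSpace.proj (𝕜 := ℝ) (0 : Fin (m+1))).contDiff
    have hib := ibp h.1 h.2.1 hX
    have hdv : ∀ x : Ec m, divg (fun x : Ec m => T (x 0) • (cs 1 0 : Ec m)) x = R * f (x 0) / fb m (T (x 0)) := by
      intro x
      have hd0 : HasFDerivAt (fun x : Ec m => T (x 0)) ((R * f (x 0) / fb m (T (x 0))) • (EuclideanSpace.proj (𝕜 := ℝ) (0 : Fin (m+1)))) x := 
        HasDerivAt.comp_hasFDerivAt (h₂ := T) (f := fun x : Ec m => x 0) x (hTd (x 0)) (EuclideanSpace.proj (𝕜 := ℝ) (0 : Fin (m+1))).hasFDerivAt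
      rw [divg_smul hd0.differentiableAt (differentiableAt_const _), hd0.fderiv]
      simp [divg]
    simp_rw [hdv] at hib
    have : ∀ x, -T (x 0) * fderiv ℝ η x (cs 1 0) = -(fderiv ℝ η x (T (x 0) • cs 1 0)) := by
      intro x; rw [map_smul, smul_eq_mul]; ring
    simp_rw [this]
    rw [integral_neg, hib, neg_neg]
    congr 1; ext x; ring
  set G : ℝ → ℝ := fun t => ∫ y : Euc m, ‖fderiv ℝ (fun y => η (cs t y)) y‖ with hG
  have k3e : ∀ t, ∫ y : Euc m, √(1 - T ((cs t y) 0)^2) * ‖(fderiv ℝ η (cs t y)).comp J‖ = √(1 - T t^2) * G t := by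
    intro t
    rw [hG]
    simp only [cs_zero]
    rw [integral_const_mul]
    congr 2; ext y
    rw [(cs_hasFDeriv h.1 t y).fderiv]
  have k3 : ∫ x, √(1 - T (x 0)^2) * ‖(fderiv ℝ η x).comp J‖ = ∫ t, √(1 - T t^2) * G t := by
    rw [cs_integral i2]
    simp_rw [k3e]
  have i4 : Integrable fun t => √(1 - T t^2) * G t := by
    have := (cs_int i2).integral_prod_left
    simp_rw [k3e] at this
    exact this
  have i5 : Integrable fun t => (R * f t / fb m (T t)) * g t :=
    (hTdc.mul hgc).integrable_of_hasCompactSupport (by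
      rw [hg]; exact (sl_supp h.2.1).mul_left)
  rw [k2, k3, ← integral_add i5 i4] at k1
  have hG0 : ∀ t, 0 ≤ G t := fun t => integral_nonneg fun y => norm_nonneg _
  have key : ∀ t, f t * Th m R (g t / fb m (T t)) ≤ (R * f t / fb m (T t)) * g t + √(1 - T t^2) * G t := by
    intro t
    have e1 : f t * Th m R (g t / fb m (T t)) = (R * f t / fb m (T t)) * g t
        + f t * m * (g t / fb m (T t)) ^ (-(1/(m:ℝ))) := by
      unfold Th; ring
    rw [e1]
    refine add_le_add_right ?_ _
    rcases (hg0 t).eq_or_lt with h0 | h0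
    · rw [← h0, zero_div, Real.zero_rpow (by simp; omega), mul_zero]
      exact mul_nonneg (Real.sqrt_nonneg _) (hG0 t)
    have hw : 0 < g t / fb m (T t) := div_pos h0 (hfbp t)
    rw [← pow_le_pow_iff_left₀ (by have := hf0 t; positivity) (mul_nonneg (Real.sqrt_nonneg _) (hG0 t)) (n := m) (by omega)]
    rw [mul_pow, mul_pow, mul_pow, ← Real.rpow_natCast (_ ^ (-(1/(m:ℝ)))), ← Real.rpow_mul hw.le,
      show -(1/(m:ℝ)) * m = -1 by field_simp, Real.rpow_neg_one, inv_div]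
    have hq := hQ _ (slice_nc h t)
    have e2 : ∫ y : Euc m, η (cs t y) ^ (Rp m/m) = f t := by rw [hf]; rfl
    have e3 : ∫ y : Euc m, η (cs t y) = g t := by rw [hg]; rfl
    rw [e2, e3] at hq
    have hs : 0 ≤ √(1 - T t^2)^m := by positivity
    rw [fb, ← mul_div_assoc, div_le_iff₀ h0]
    change _ ≤ g t * G t ^ m at hq
    nlinarith [mLe hq hs]
  have hnn : ∀ t, 0 ≤ f t * Th m R (g t / fb m (T t)) := fun t => by
    have : 0 ≤ g t / fb m (T t) := div_nonneg (hg0 t) (hfbp t).le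
    exact mul_nonneg (hf0 t) (by unfold Th; positivity)
  have i6 : Integrable fun t => f t * Th m R (g t / fb m (T t)) := by
    refine (i5.add i4).mono' ?_ (ae_of_all _ fun t => ?_)
    · exact (hfc.measurable.mul ((Th_meas m R).comp (hgc.div ((fb_cont m).comp hTc) fun t => (hfbp t).ne').measurable)).aestronglyMeasurable
    · rw [Real.norm_of_nonneg (hnn t)]; exact key t
  exact ⟨T, hT1, fun t => (hQQ _ (hin t)).2.1, hTd, i6, (integral_mono i6 (i5.add i4) key).trans k1⟩
theorem Th_ge (hm : 1 ≤ m) {R w : ℝ} (hR : 0 < R) (hw : 0 < w) :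
    (m+1) * R ^ (1/((m:ℝ)+1)) ≤ Th m R w := by
  have hm0 : (0:ℝ) < m := by exact_mod_cast hm
  have := Real.geom_mean_le_arith_mean2_weighted (w₁ := 1/((m:ℝ)+1)) (w₂ := m/((m:ℝ)+1)) (p₁ := R * w)
    (p₂ := w ^ (-(1/(m:ℝ)))) (by positivity) (by positivity) (by positivity) (by positivity) (by field_simp; ring)
  rw [← Real.rpow_mul hw.le, Real.mul_rpow hR.le hw.le, mul_assoc, ← Real.rpow_add hw,
    show 1/((m:ℝ)+1) + -(1/(m:ℝ)) * (m/((m:ℝ)+1)) = 0 by field_simp; ring, Real.rpow_zero, mul_one] at this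
  have h2 := mLe this (show (0:ℝ) ≤ m+1 by positivity)
  refine h2.trans (le_of_eq ?_)
  unfold Th
  field_simp
theorem sl_zero {η : Ec m → ℝ} (h : NC η) {p : ℝ} (hp : 0 < p) {t : ℝ} (h0 : sl η t = 0) :
    sl (fun x => η x ^ p) t = 0 := by
  have hs := slice_nc h t
  have := (integral_eq_zero_iff_of_nonneg hs.2.2 (hs.1.continuous.integrable_of_hasCompactSupport hs.2.1)).1 h0
  unfold sl
  rw [integral_eq_zero_of_ae]
  filter_upwards [this] with y hy
  simp only [Pi.zero_apply] at hy ⊢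
  rw [hy, Real.zero_rpow hp.ne']
theorem sl_total {η : Ec m → ℝ} (h : Continuous η) (hc : HasCompactSupport η) :
    ∫ t, sl η t = ∫ x, η x := by
  have := sl_ridge h hc (k := fun _ => 1) continuous_const
  simpa using this.symm
theorem Rn (hm : 1 ≤ m) (hQ : Qm m) {η : Ec m → ℝ} (h : NC η) :
    Rp m^(m+1) * ballVol (m+1) * (∫ x, η x ^ (Rp m/m))^m ≤ (∫ x, ‖fderiv ℝ η x‖)^(m+1) := by
  have hm0 : (0:ℝ) < m := by exact_mod_cast hm
  have hp0 : 0 < Rp m/m := by positivity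
  have hp := rpow_cont h hp0
  set a := ∫ x, η x ^ (Rp m/m) with ha
  set G := ∫ x, ‖fderiv ℝ η x‖ with hG
  have hG0 : 0 ≤ G := integral_nonneg fun x => norm_nonneg _
  have ha0 : 0 ≤ a := integral_nonneg hp.2.2
  rcases ha0.eq_or_lt with h0 | h0
  · rw [← h0, zero_pow (by omega), mul_zero]; positivity
  have hω := ballVol_pos (m+1)
  have key : ∀ R, 0 < R → R < ballVol (m+1) / a → Rp m^(m+1) * R * a^(m+1) ≤ G^(m+1) := by
    intro R hR hRa
    have hat := sl_total hp.1 hp.2.1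
    obtain ⟨T, hT1, -, -, hi, hle⟩ := STEP hm hQ h hR _ _ rfl rfl (by
      rw [hat]; rwa [lt_div_iff₀ h0] at hRa)
    have h1 : Rp m * R ^ (1/((m:ℝ)+1)) * a ≤ G := by
      refine le_trans ?_ hle
      rw [ha, ← hat, mul_comm, ← integral_mul_const]
      refine integral_mono ((sl_int hp.1 hp.2.1).mul_const _) hi fun t => ?_
      rcases (sl_nonneg h.2.2 t).eq_or_lt with h2 | h2
      · simp [sl_zero h hp0 h2.symm]
      · exact mLe (Th_ge hm hR (div_pos h2 (fb_pos m (hT1 t)))) (sl_nonneg hp.2.2 t)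
    have h2 := pow_le_pow_left₀ (by positivity) h1 (m+1)
    rw [mul_pow, mul_pow, ← Real.rpow_natCast (R ^ _), ← Real.rpow_mul hR.le] at h2
    rwa [show 1/((m:ℝ)+1) * ((m+1 : ℕ):ℝ) = 1 by push_cast; field_simp, Real.rpow_one] at h2
  have h3 : ballVol (m+1) / a ≤ G^(m+1) / (Rp m^(m+1) * a^(m+1)) := by
    refine le_of_forall_lt_imp_le_of_dense fun R hR => ?_
    rcases le_or_gt R 0 with hR0 | hR0
    · exact hR0.trans (by positivity)
    · rw [le_div_iff₀ (by positivity)]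
      linarith [key R hR0 hR]
  rw [div_le_div_iff₀ h0 (by positivity)] at h3
  have : (Rp m^(m+1) * ballVol (m+1) * a^m) * a ≤ G^(m+1) * a := by
    calc _ = ballVol (m + 1) * ((↑m + 1) ^ (m + 1) * a ^ (m + 1)) := by ring
      _ ≤ _ := h3
  exact le_of_mul_le_mul_right this h0
theorem Q_succ (hm : 1 ≤ m) (hQ : Qm m) : Qm (m+1) := by
  intro η h
  have hm0 : (0:ℝ) < m := by exact_mod_cast hm
  have hR := Rn hm hQ h
  have hH := integral_mul_le_Lp_mul_Lq_of_nonneg (μ := volume) (p := (m:ℝ)+1) (q := Rp m/m)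
    (f := fun x => η x ^ (1/((m:ℝ)+1))) (g := η)
    (by rw [Real.holderConjugate_iff]; constructor; · linarith
        · field_simp; ring)
    (ae_of_all _ fun x => Real.rpow_nonneg (h.2.2 x) _) (ae_of_all _ h.2.2)
    (by
      have := rpow_cont h (p := 1/((m:ℝ)+1)) (by positivity)
      exact this.1.memLp_of_hasCompactSupport this.2.1) (h.1.continuous.memLp_of_hasCompactSupport h.2.1)
  have e1 : ∀ x, (η x ^ (1/((m:ℝ)+1))) ^ Rp m = η x := fun x => by
    rw [← Real.rpow_mul (h.2.2 x), one_div_mul_cancel (by positivity), Real.rpow_one]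
  have e2 : ∀ x, η x ^ (1/((m:ℝ)+1)) * η x = η x ^ ((((m+1:ℕ):ℝ)+1)/((m+1:ℕ):ℝ)) := fun x => by
    rcases (h.2.2 x).eq_or_lt with h0 | h0
    · rw [← h0, mul_zero, Real.zero_rpow (by positivity)]
    · nth_rewrite 2 [← Real.rpow_one (η x)]
      rw [← Real.rpow_add h0]; congr 1; push_cast; field_simp; ring
  simp_rw [e1, e2] at hH
  set b := ∫ x, η x ^ ((((m+1:ℕ):ℝ)+1)/((m+1:ℕ):ℝ))
  set a := ∫ x, η x ^ (Rp m/m)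
  set g := ∫ x, η x
  set G := ∫ x, ‖fderiv ℝ η x‖
  have hg0 : 0 ≤ g := integral_nonneg h.2.2
  have ha0 : 0 ≤ a := integral_nonneg fun x => Real.rpow_nonneg (h.2.2 x) _
  have hb0 : 0 ≤ b := integral_nonneg fun x => Real.rpow_nonneg (h.2.2 x) _
  have h2 : b^(m+1) ≤ g * a^m := by
    refine (pow_le_pow_left₀ hb0 hH (m+1)).trans (le_of_eq ?_)
    rw [mul_pow, ← Real.rpow_natCast (g ^ _), ← Real.rpow_mul hg0, ← Real.rpow_natCast (a ^ _),
      ← Real.rpow_mul ha0, ← Real.rpow_natCast a m]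
    rw [show 1/((m:ℝ)+1) * ((m+1 : ℕ):ℝ) = 1 by push_cast; field_simp, Real.rpow_one]
    congr 2; push_cast; field_simp
  have hω := ballVol_pos (m+1)
  calc ((m+1:ℕ):ℝ)^(m+1) * ballVol (m+1) * b^(m+1) ≤ ((m+1:ℕ):ℝ)^(m+1) * ballVol (m+1) * (g * a^m) :=
        mLe h2 (by positivity)
    _ = g * (Rp m^(m+1) * ballVol (m+1) * a^m) := by push_cast; ring
    _ ≤ g * G^(m+1) := mLe hR hg0
theorem Q_one : Qm 1 := by
  intro η h
  have hω : ballVol 1 = 2 := by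
    unfold ballVol
    rw [EuclideanSpace.volume_ball]
    have : Real.Gamma ((1:ℝ)/2 + 1) = √Real.pi / 2 := by
      rw [Real.Gamma_add_one (by norm_num), Real.Gamma_one_half_eq]; ring
    simp only [Fintype.card_fin, Nat.cast_one, pow_one, this]
    rw [show √Real.pi / (√Real.pi/2) = 2 by
      have : 0 < √Real.pi := Real.sqrt_pos.2 Real.pi_pos
      field_simp]
    simp
  have hd := h.1.continuous_fderiv one_ne_zero
  have hds : HasCompactSupport (fderiv ℝ η) := h.2.1.fderiv (𝕜 := ℝ)
  have hGi : Integrable fun x => ‖fderiv ℝ η x‖ := hd.norm.integrable_of_hasCompactSupport hds.norm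
  set u : ℝ → ℝ := fun t => η (cs t (0 : Euc 0)) with hu
  have hl : ∀ t, HasDerivAt (fun t => cs t (0 : Euc 0)) (cs 1 0) t := by
    intro t
    have : HasDerivAt (fun t : ℝ => ((t, (0 : Euc 0)))) ((1:ℝ), (0 : Euc 0)) t := (hasDerivAt_id t).prodMk (hasDerivAt_const _ _)
    exact csl.hasFDerivAt.comp_hasDerivAt t this
  have hud : ∀ t, HasDerivAt u (fderiv ℝ η (cs t (0 : Euc 0)) (cs 1 0)) t := fun t =>
    (h.1.differentiable one_ne_zero _).hasFDerivAt.comp_hasDerivAt t (hl t)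
  have hcs : Continuous fun t : ℝ => cs t (0 : Euc 0) := continuous_iff_continuousAt.2 fun t => (hl t).continuousAt
  have hderiv : deriv u = fun t => fderiv ℝ η (cs t (0 : Euc 0)) (cs 1 0) := funext fun t => (hud t).deriv
  have huC : ContDiff ℝ 1 u := by
    rw [contDiff_one_iff_deriv, hderiv]
    exact ⟨fun t => (hud t).differentiableAt, (hd.comp hcs).clm_apply continuous_const⟩
  have hucs : HasCompactSupport u := by
    obtain ⟨ρ, hρ⟩ := cpt_bd h.2.1
    refine HasCompactSupport.intro (isCompact_Icc (a := -ρ) (b := ρ)) fun t ht => ?_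
    have ht' : ρ < |t| := by
      by_contra h; push Not at h; exact ht (abs_le.1 h)
    exact hρ _ (lt_of_lt_of_le ht' (cs_ge t _).1)
  have hui : Integrable (deriv u) := (huC.continuous_deriv le_rfl).integrable_of_hasCompactSupport hucs.deriv
  have hG : ∫ t, |deriv u t| ≤ ∫ x, ‖fderiv ℝ η x‖ := by
    rw [cs_integral hGi]
    have e : ∀ t, ∫ y : Euc 0, ‖fderiv ℝ η (cs t y)‖ = ‖fderiv ℝ η (cs t 0)‖ := by
      intro t
      rw [volume_euclideanSpace_eq_dirac]
      simp
    simp_rw [e]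
    have hi : Integrable fun t => ‖fderiv ℝ η (cs t (0 : Euc 0))‖ := by
      have := (cs_int hGi).integral_prod_left
      simp_rw [e] at this
      exact this
    refine integral_mono hui.abs hi fun t => ?_
    simp only [hderiv]
    refine ((fderiv ℝ η (cs t (0 : Euc 0))).le_opNorm (cs 1 0)).trans (mul_le_of_le_one_right (norm_nonneg _) ?_)
    rw [← sq_le_one_iff₀ (norm_nonneg _), cs_norm]; simp
  set G := ∫ x, ‖fderiv ℝ η x‖
  have hpt : ∀ t, 2 * u t ≤ G := by
    intro t
    have h1 := hucs.integral_Iic_deriv_eq huC t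
    have h2 := hucs.integral_Ioi_deriv_eq huC t
    have h3 : (∫ s in Iic t, |deriv u s|) + ∫ s in Ioi t, |deriv u s| = ∫ s, |deriv u s| := by
      rw [← compl_Iic]
      exact integral_add_compl measurableSet_Iic hui.abs
    have h4 : ∫ s in Iic t, deriv u s ≤ ∫ s in Iic t, |deriv u s| :=
      integral_mono hui.integrableOn hui.abs.integrableOn fun s => le_abs_self _
    have h5 : -∫ s in Ioi t, deriv u s ≤ ∫ s in Ioi t, |deriv u s| := by
      rw [← integral_neg]
      exact integral_mono hui.neg.integrableOn hui.abs.integrableOn fun s => neg_le_abs _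
    linarith
  have hpt2 : ∀ x, 2 * η x ≤ G := by
    intro x
    have : x = cs (x 0) (0 : Euc 0) := by
      ext i; rw [Subsingleton.elim i 0]; rfl
    rw [this]; exact hpt _
  rw [hω]
  norm_num
  rw [mul_comm 2, ← integral_mul_const, ← integral_mul_const]
  have hp := rpow_cont h (p := 2) (by norm_num)
  simp only [Real.rpow_two] at hp
  refine integral_mono ((hp.1.integrable_of_hasCompactSupport hp.2.1).mul_const _)
    ((h.1.continuous.integrable_of_hasCompactSupport h.2.1).mul_const _) fun x => ?_
  simp only
  nlinarith [mLe (hpt2 x) (h.2.2 x)]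
theorem Q_all (hm : 1 ≤ m) : Qm m := by
  induction m, hm using Nat.le_induction with
  | base => exact Q_one
  | succ m hm ih => exact Q_succ hm ih
theorem L0' {F : Set (Euc n)} (hF : MS F) (hv : volume F = volume (ball (0:Euc n) 1))
    (hP : HasFinitePerim F) {δ : ℝ} (hδ : 0 < δ) {p : ℝ} (hp1 : 1 ≤ p) (hp2 : p ≤ 2) :
    ∃ η : Euc n → ℝ, NC η ∧ (∀ x, η x ≤ 1) ∧
      ∫ x, |η x - chi F x| ≤ δ ∧ ∫ x, ‖fderiv ℝ η x‖ ≤ perim F + δ ∧ ∫ x, η x < ballVol n ∧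
      ballVol n ≤ (∫ x, η x ^ p) + δ := by
  have hfin : volume F ≠ ∞ := by rw [hv]; exact measure_ball_lt_top.ne
  have hω := ballVol_pos n
  have hχ : ∫ x, chi F x = ballVol n := by rw [chi_integral hF, hv]; rfl
  have hχi := chi_int hF hfin
  set ω := ballVol n with hωd
  set ε := min (δ / 10) (min (ω/2) 1) with hε
  have hε0 : 0 < ε := by positivity
  have hε1 : ε ≤ δ/10 := min_le_left _ _
  have hε2 : ε ≤ ω/2 := (min_le_right _ _).trans (min_le_left _ _)
  obtain ⟨η, h1, h2, h3, h4, h5⟩ := L0 hF hfin hP hε0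
  have hηi : Integrable η := h1.continuous.integrable_of_hasCompactSupport h2
  set c := ω / (ω + 2*ε) with hc
  have hc0 : 0 < c := by positivity
  have hc1 : c < 1 := by rw [hc, div_lt_one (by positivity)]; linarith
  have hce : c * (ω + 2*ε) = ω := by rw [hc]; field_simp
  have hηω : ∫ x, η x ≤ ω + ε := by
    have : ∫ x, (η x - chi F x) ≤ ∫ x, |η x - chi F x| :=
      integral_mono (hηi.sub hχi) (hηi.sub hχi).abs fun x => le_abs_self _
    rw [integral_sub hηi hχi, hχ] at this
    linarith
  have hN : NC fun x => c * η x := ⟨contDiff_const.mul h1, h2.mul_left, fun x => mul_nonneg hc0.le (h3 x).1⟩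
  have hci : Integrable fun x => c * η x := hηi.const_mul c
  have hle1 : ∀ x, c * η x ≤ 1 := fun x => mul_le_one₀ hc1.le (h3 x).1 (h3 x).2
  have hdiff : ∫ x, |c * η x - chi F x| ≤ 5 * ε := by
    have : ∫ x, |c * η x - chi F x| ≤ ∫ x, (|η x - chi F x| + (1 - c) * η x) := by
      refine integral_mono (hci.sub hχi).abs ((hηi.sub hχi).abs.add (hηi.const_mul _)) fun x => ?_
      have := abs_sub (η x - chi F x) ((1-c) * η x)
      rw [abs_of_nonneg (a := (1-c) * η x) (mul_nonneg (by linarith) (h3 x).1)] at this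
      refine le_trans (le_of_eq ?_) this
      simp only; ring_nf
    rw [integral_add (f := fun x => |η x - chi F x|) (g := fun x => (1-c) * η x) (hηi.sub hχi).abs (hηi.const_mul _), integral_const_mul] at this
    have h6 : (1-c) * ∫ x, η x ≤ (1-c) * (ω+ε) := mLe hηω (by linarith)
    nlinarith
  refine ⟨fun x => c * η x, hN, hle1, by linarith, ?_, ?_, ?_⟩
  · have : ∀ x, fderiv ℝ (fun x => c * η x) x = c • fderiv ℝ η x := fun x =>
      fderiv_const_mul (h1.differentiable one_ne_zero x) c
    simp_rw [this, norm_smul, Real.norm_of_nonneg hc0.le]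
    rw [integral_const_mul]
    have h0 : 0 ≤ ∫ x, ‖fderiv ℝ η x‖ := integral_nonneg fun x => norm_nonneg _
    nlinarith
  · rw [integral_const_mul]
    have := mLe hηω hc0.le
    nlinarith
  · have hpc := rpow_cont hN (p := p) (by linarith)
    have hpi : Integrable (fun x => (c * η x)^p) := hpc.1.integrable_of_hasCompactSupport hpc.2.1
    have : ∫ x, (chi F x - (c * η x)^p) ≤ ∫ x, 2 * |c * η x - chi F x| := by
      refine integral_mono (hχi.sub hpi) ((hci.sub hχi).abs.const_mul 2) fun x => ?_
      simp only
      have hx0 := hN.2.2 x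
      by_cases hx : x ∈ F
      · have e : chi F x = 1 := by simp [chi, hx]
        rw [e, abs_of_nonpos (by linarith [hle1 x])]
        have := one_add_mul_self_le_rpow_one_add (s := c * η x - 1) (by linarith) hp1
        rw [show 1 + (c * η x - 1) = c * η x by ring] at this
        nlinarith [hle1 x]
      · have e : chi F x = 0 := by simp [chi, hx]
        rw [e]
        have := hpc.2.2 x
        have := abs_nonneg (c * η x - 0)
        linarith
    rw [integral_sub hχi hpi, hχ, integral_const_mul] at this
    simp only
    linarith
/-- linearised isoperimetric inequality -/
theorem Rn' (hm : 1 ≤ m) {η : Ec m → ℝ} (h : NC η) {a : ℝ} (ha : 0 ≤ a)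
    (ha' : a ≤ ballVol (m+1)) : Rp m * a^(1/((m:ℝ)+1)) * (∫ x, η x ^ (Rp m/m)) ^ ((m:ℝ)/((m:ℝ)+1))
      ≤ ∫ x, ‖fderiv ℝ η x‖ := by
  have hR := Rn hm (Q_all hm) h
  have hA : 0 ≤ ∫ x, η x ^ (Rp m/m) := integral_nonneg fun x => Real.rpow_nonneg (h.2.2 x) _
  rw [← pow_le_pow_iff_left₀ (by positivity) (integral_nonneg fun x => norm_nonneg _) (n := m+1) (by omega)]
  refine le_trans ?_ hR
  rw [mul_pow, mul_pow, ← Real.rpow_natCast (a ^ _), ← Real.rpow_mul ha, ← Real.rpow_natCast (_ ^ ((m:ℝ)/_)), ← Real.rpow_mul hA]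
  rw [show 1/((m:ℝ)+1) * ((m+1 : ℕ):ℝ) = 1 by push_cast; field_simp, Real.rpow_one,
    show (m:ℝ)/((m:ℝ)+1) * ((m+1 : ℕ):ℝ) = m by push_cast; field_simp, Real.rpow_natCast]
  gcongr
theorem rn_lin {a x l : ℝ} (hx : 0 ≤ x) (hl : 0 < l) (hxa : l * x ≤ a) :
    l^(1/((m:ℝ)+1)) * x ≤ a^(1/((m:ℝ)+1)) * x ^ ((m:ℝ)/((m:ℝ)+1)) := by
  rcases hx.eq_or_lt with h0 | h0
  · rw [← h0, mul_zero]
    have : 0 ≤ a := by rw [← h0] at hxa; linarith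
    positivity
  have e : x = x^(1/((m:ℝ)+1)) * x ^ ((m:ℝ)/((m:ℝ)+1)) := by
    rw [← Real.rpow_add h0, show 1/((m:ℝ)+1) + (m:ℝ)/((m:ℝ)+1) = 1 by field_simp; ring, Real.rpow_one]
  calc l^(1/((m:ℝ)+1)) * x = (l * x)^(1/((m:ℝ)+1)) * x ^ ((m:ℝ)/((m:ℝ)+1)) := by
        rw [Real.mul_rpow hl.le hx]; nth_rewrite 1 [e]; ring
    _ ≤ _ := by gcongr
theorem cutS {η : Ec m → ℝ} (h : NC η) {S : ℝ → ℝ} (hS : ContDiff ℝ 1 S)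
    (hS0 : ∀ t, 0 ≤ S t ∧ S t ≤ 1) :
    NC (fun x => S (x 0) * η x) ∧ ∀ x, ‖fderiv ℝ (fun x => S (x 0) * η x) x‖ ≤ S (x 0) * ‖fderiv ℝ η x‖ + |deriv S (x 0)| * η x := by
  have hS1 : ContDiff ℝ 1 fun x : Ec m => S (x 0) :=
    hS.comp (EuclideanSpace.proj (𝕜 := ℝ) (0 : Fin (m+1))).contDiff
  refine ⟨⟨hS1.mul h.1, h.2.1.mul_left, fun x => mul_nonneg (hS0 _).1 (h.2.2 x)⟩, fun x => ?_⟩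
  have hd0 : HasFDerivAt (fun x : Ec m => S (x 0)) ((deriv S (x 0)) • (EuclideanSpace.proj (𝕜 := ℝ) (0 : Fin (m+1)))) x := 
        HasDerivAt.comp_hasFDerivAt (h₂ := S) (f := fun x : Ec m => x 0) x
          ((hS.differentiable one_ne_zero _).hasDerivAt) (EuclideanSpace.proj (𝕜 := ℝ) (0 : Fin (m+1))).hasFDerivAt
  have hd : fderiv ℝ (fun x => S (x 0) * η x) x = _ := (hd0.mul (h.1.differentiable one_ne_zero x).hasFDerivAt).fderiv
  rw [hd]
  refine (norm_add_le _ _).trans (add_le_add ?_ ?_)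
  · rw [norm_smul, Real.norm_of_nonneg (hS0 _).1]
  · rw [norm_smul, norm_smul, Real.norm_of_nonneg (h.2.2 x), mul_comm]
    refine mRi ?_ (h.2.2 x)
    refine mul_le_of_le_one_right (norm_nonneg _) ?_
    refine ContinuousLinearMap.opNorm_le_bound _ zero_le_one fun y => ?_
    rw [one_mul]
    exact PiLp.norm_apply_le y 0
theorem cut (hm : 1 ≤ m) {η : Ec m → ℝ} (h : NC η)
    (g f : ℝ → ℝ) (hg : g = sl η) (hf : f = sl fun x => η x ^ (Rp m/m)) {a V : ℝ} (ha : a = ∫ t, f t)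
    (haω : a ≤ ballVol (m+1)) (s : ℝ) (hV : V = ∫ t in Iic s, f t) :
    Rp m * a^(1/((m:ℝ)+1)) * V^((m:ℝ)/((m:ℝ)+1)) + Rp m * a^(1/((m:ℝ)+1)) * (a-V)^((m:ℝ)/((m:ℝ)+1))
      ≤ (∫ x, ‖fderiv ℝ η x‖) + 2 * g s := by
  have hm0 : (0:ℝ) < m := by exact_mod_cast hm
  set p := Rp m/m with hpd
  have hp0 : 0 < p := by positivity
  have hp := rpow_cont h hp0
  have hfc : Continuous f := hf ▸ sl_cont hp.1 hp.2.1
  have hfi : Integrable f := hf ▸ sl_int hp.1 hp.2.1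
  have hf0 : ∀ t, 0 ≤ f t := fun t => by rw [hf]; exact sl_nonneg hp.2.2 t
  have ha0 : 0 ≤ a := ha ▸ integral_nonneg hf0
  have hgc : Continuous g := hg ▸ sl_cont h.1.continuous h.2.1
  set S : ℕ → ℝ → ℝ := fun k t => Real.smoothTransition ((k+1) * (s - t)) with hSd
  have hSC : ∀ k, ContDiff ℝ 1 (S k) := fun k => Real.smoothTransition.contDiff.comp (contDiff_const.mul (contDiff_const.sub contDiff_id))
  have hS01 : ∀ k t, 0 ≤ S k t ∧ S k t ≤ 1 := fun k t => ⟨Real.smoothTransition.nonneg _, Real.smoothTransition.le_one _⟩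
  have hSC' : ∀ k, ContDiff ℝ 1 (fun t => 1 - S k t) := fun k => contDiff_const.sub (hSC k)
  have hS01' : ∀ k t, 0 ≤ 1 - S k t ∧ 1 - S k t ≤ 1 := fun k t => ⟨by linarith [(hS01 k t).2], by linarith [(hS01 k t).1]⟩
  -- derivative of S
  have hanti : ∀ k, Antitone (S k) := fun k x y hxy => Real.smoothTransition.monotone (by
    have : (0:ℝ) ≤ k + 1 := by positivity
    nlinarith)
  have hSl : ∀ (k : ℕ) (t : ℝ), t ≤ s - 1/((k:ℝ)+1) → S k t = 1 := fun k t ht => Real.smoothTransition.one_of_one_le (by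
    have h0 : (0:ℝ) < k + 1 := by positivity
    have : 1/((k:ℝ)+1) ≤ s - t := by linarith
    rwa [div_le_iff₀ h0, mul_comm] at this)
  have hSr : ∀ (k : ℕ) (t : ℝ), s ≤ t → S k t = 0 := fun k t ht => Real.smoothTransition.zero_of_nonpos (by
    have h0 : (0:ℝ) < k + 1 := by positivity
    nlinarith)
  have hS' : ∀ (k : ℕ) (t : ℝ), t ∉ Icc (s - 1/((k:ℝ)+1)) s → deriv (S k) t = 0 := by
    intro k t ht
    rcases lt_or_ge t (s - 1/((k:ℝ)+1)) with h1 | h1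
    · have : S k =ᶠ[nhds t] fun _ => 1 := by
        filter_upwards [gt_mem_nhds h1] with y hy using hSl k y hy.le
      rw [this.deriv_eq]; simp
    · have h2 : s < t := by by_contra h2; exact ht ⟨h1, not_lt.1 h2⟩
      have : S k =ᶠ[nhds t] fun _ => 0 := by
        filter_upwards [lt_mem_nhds h2] with y hy using hSr k y hy.le
      rw [this.deriv_eq]; simp
  have hSdc : ∀ k, Continuous (deriv (S k)) := fun k => (hSC k).continuous_deriv le_rfl
  have hScs : ∀ k, HasCompactSupport (deriv (S k)) := fun k => HasCompactSupport.intro isCompact_Icc (hS' k)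
  have hSi : ∀ k, Integrable (deriv (S k)) := fun k => (hSdc k).integrable_of_hasCompactSupport (hScs k)
  have hSabs : ∀ k t, |deriv (S k) t| = - deriv (S k) t := fun k t => abs_of_nonpos (hanti k).deriv_nonpos
  have hSint : ∀ k, ∫ t, |deriv (S k) t| = 1 := by
    intro k
    simp_rw [hSabs]
    rw [integral_neg, integral_of_hasDerivAt_of_tendsto (m := 1) (n := 0)
      (fun x => ((hSC k).differentiable one_ne_zero x).hasDerivAt) (hSi k)]
    · norm_num
    · exact tendsto_const_nhds.congr' (by filter_upwards [eventually_le_atBot (s - 1/((k:ℝ)+1))] with t ht using (hSl k t ht).symm)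
    · exact tendsto_const_nhds.congr' (by filter_upwards [eventually_ge_atTop s] with t ht using (hSr k t ht).symm)
  have hk0 := (tendsto_one_div_add_atTop_nhds_zero_nat (𝕜 := ℝ))
  -- limits of masses
  have hmass : ∀ (Z : ℕ → ℝ → ℝ) (Zl : ℝ → ℝ), (∀ k, Continuous (Z k)) → (∀ k t, 0 ≤ Z k t ∧ Z k t ≤ 1) →
      (∀ᵐ t, Tendsto (fun k => Z k t) atTop (nhds (Zl t))) → (∀ t, Zl t = 0 ∨ Zl t = 1) →
      Tendsto (fun k => ∫ x : Ec m, (Z k (x 0) * η x)^p) atTop (nhds (∫ t, Zl t * f t)) := by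
    intro Z Zl hZ hZ01 hZl hZl01
    have e : ∀ k, ∫ x : Ec m, (Z k (x 0) * η x)^p = ∫ t, (Z k t)^p * f t := by
      intro k
      rw [hf, ← sl_ridge hp.1 hp.2.1 ((hZ k).rpow_const fun t => Or.inr hp0.le)]
      congr 1; ext x
      rw [Real.mul_rpow (hZ01 k _).1 (h.2.2 x)]
    simp_rw [e]
    refine tendsto_integral_of_dominated_convergence f (fun k => ?_) hfi (fun k => ae_of_all _ fun t => ?_) ?_
    · exact (((hZ k).rpow_const fun t => Or.inr hp0.le).mul hfc).aestronglyMeasurable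
    · rw [Real.norm_of_nonneg (mul_nonneg (Real.rpow_nonneg (hZ01 k t).1 _) (hf0 t))]
      exact mul_le_of_le_one_left (hf0 t) (Real.rpow_le_one (hZ01 k t).1 (hZ01 k t).2 hp0.le)
    · filter_upwards [hZl] with t ht
      have e2 : Zl t = Zl t ^ p := by
        rcases hZl01 t with h1 | h1 <;> simp [h1, hp0.ne']
      rw [e2]
      exact (ht.rpow_const (Or.inr hp0.le)).mul_const _
  have hSlim : ∀ t, t ≠ s → Tendsto (fun k => S k t) atTop (nhds ((Iic s).indicator (fun _ => (1:ℝ)) t)) := by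
    intro t ht
    rcases lt_or_gt_of_ne ht with h1 | h1
    · rw [indicator_of_mem (show t ∈ Iic s from h1.le)]
      refine tendsto_const_nhds.congr' ?_
      filter_upwards [hk0.eventually (gt_mem_nhds (sub_pos.2 h1))] with k hk
      exact (hSl k t (by linarith)).symm
    · rw [indicator_of_notMem (show t ∉ Iic s from not_le.2 h1)]
      exact tendsto_const_nhds.congr fun k => (hSr k t h1.le).symm
  have hsae : ∀ᵐ t : ℝ, t ≠ s := by simp [ae_iff]
  have hA1 := hmass S _ (fun k => (hSC k).continuous) hS01 (by filter_upwards [hsae] with t ht using hSlim t ht)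
    (fun t => by by_cases ht : t ∈ Iic s <;> simp [ht])
  have hA2 := hmass (fun k t => 1 - S k t) (fun t => 1 - (Iic s).indicator (fun _ => (1:ℝ)) t) (fun k => (hSC' k).continuous) hS01'
    (by filter_upwards [hsae] with t ht using tendsto_const_nhds.sub (hSlim t ht))
    (fun t => by by_cases ht : t ∈ Iic s <;> simp [ht])
  have e1 : ∫ t, (Iic s).indicator (fun _ => (1:ℝ)) t * f t = V := by
    rw [hV, ← integral_indicator measurableSet_Iic]
    congr 1; ext t; by_cases ht : t ∈ Iic s <;> simp [ht]
  have e2 : ∫ t, (1 - (Iic s).indicator (fun _ => (1:ℝ)) t) * f t = a - V := by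
    rw [hV, ha, ← integral_indicator measurableSet_Iic, ← integral_sub hfi (hfi.indicator measurableSet_Iic)]
    congr 1; ext t; by_cases ht : t ∈ Iic s <;> simp [ht]
  rw [e1] at hA1
  rw [e2] at hA2
  have hq0 : 0 < (m:ℝ)/((m:ℝ)+1) := by positivity
  have hL := ((hA1.rpow_const (p := (m:ℝ)/((m:ℝ)+1)) (Or.inr hq0.le)).const_mul (Rp m * a^(1/((m:ℝ)+1)))).add
    ((hA2.rpow_const (p := (m:ℝ)/((m:ℝ)+1)) (Or.inr hq0.le)).const_mul (Rp m * a^(1/((m:ℝ)+1))))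
  refine le_of_forall_pos_le_add fun ε hε => ?_
  refine le_of_tendsto hL ?_
  obtain ⟨r, hr0, hr⟩ := Metric.continuousAt_iff.1 (hgc.continuousAt (x := s)) (ε/2) (by positivity)
  filter_upwards [hk0.eventually (gt_mem_nhds hr0)] with k hk
  obtain ⟨c1, c2⟩ := cutS h (hSC k) (hS01 k)
  obtain ⟨c3, c4⟩ := cutS h (hSC' k) (hS01' k)
  have b1 := Rn' hm c1 ha0 haω
  have b2 := Rn' hm c3 ha0 haω
  have hint : ∀ {ζ : Ec m → ℝ}, NC ζ → Integrable fun x => ‖fderiv ℝ ζ x‖ := fun hζ =>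
    (hζ.1.continuous_fderiv one_ne_zero).norm.integrable_of_hasCompactSupport (hζ.2.1.fderiv (𝕜 := ℝ)).norm
  have hx0 : Continuous fun x : Ec m => x 0 := by fun_prop
  have hdi : Integrable fun x : Ec m => |deriv (S k) (x 0)| * η x :=
    ((((hSdc k).comp hx0).abs).mul h.1.continuous).integrable_of_hasCompactSupport h.2.1.mul_left
  have b3 : (∫ x, ‖fderiv ℝ (fun x => S k (x 0) * η x) x‖) + ∫ x, ‖fderiv ℝ (fun x => (1 - S k (x 0)) * η x) x‖
      ≤ (∫ x, ‖fderiv ℝ η x‖) + 2 * ∫ x : Ec m, |deriv (S k) (x 0)| * η x := by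
    rw [← integral_add (hint c1) (hint c3), ← integral_const_mul, ← integral_add (hint h) (hdi.const_mul 2)]
    refine integral_mono ((hint c1).add (hint c3)) ((hint h).add (hdi.const_mul 2)) fun x => ?_
    have d1 := c2 x
    have d2 := c4 x
    have d3 : |deriv (fun t => 1 - S k t) (x 0)| = |deriv (S k) (x 0)| := by
      rw [deriv_const_sub, abs_neg]
    rw [d3] at d2
    simp only
    linarith
  have b4 : ∫ x : Ec m, |deriv (S k) (x 0)| * η x ≤ g s + ε/2 := by
    rw [sl_ridge h.1.continuous h.2.1 (hSdc k).abs, ← hg]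
    calc ∫ t, |deriv (S k) t| * g t ≤ ∫ t, |deriv (S k) t| * (g s + ε/2) := by
          refine integral_mono (((hSdc k).abs.mul hgc).integrable_of_hasCompactSupport ((hScs k).norm.mul_right (f' := g))) ((hSi k).abs.mul_const _) fun t => ?_
          simp only
          by_cases ht : t ∈ Icc (s - 1/((k:ℝ)+1)) s
          · refine mLe ?_ (abs_nonneg _)
            have := hr (x := t) (by rw [Real.dist_eq, abs_lt]; constructor <;> linarith [ht.1, ht.2])
            rw [Real.dist_eq] at this
            linarith [(abs_lt.1 this).2]
          · rw [hS' k t ht]; simp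
      _ = _ := by rw [integral_mul_const, hSint, one_mul]
  linarith
theorem poinc {f A h h' : ℝ → ℝ} (hf : Continuous f) (hh' : Continuous h') (hf0 : ∀ t, 0 ≤ f t)
    (hA0 : ∀ t, 0 ≤ A t) (hA : ∀ t, HasDerivAt A (-f t) t) (hh : ∀ t, HasDerivAt h (h' t) t) {x y : ℝ} (hxy : x ≤ y) :
    ∫ t in x..y, f t * |h t - h x| ≤ ∫ t in x..y, A t * |h' t| := by
  have hAc : Continuous A := continuous_iff_continuousAt.2 fun t => (hA t).continuousAt
  have hhc : Continuous h := continuous_iff_continuousAt.2 fun t => (hh t).continuousAt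
  set H : ℝ → ℝ := fun t => ∫ s in x..t, |h' s| with hH
  have hHd : ∀ t, HasDerivAt H |h' t| t := fun t => hh'.abs.integral_hasStrictDerivAt x t |>.hasDerivAt
  have hHc : Continuous H := continuous_iff_continuousAt.2 fun t => (hHd t).continuousAt
  have e := intervalIntegral.integral_eq_sub_of_hasDerivAt (f := fun t => A t * H t) (f' := fun t => -f t * H t + A t * |h' t|)
    (a := x) (b := y) (fun t _ => (hA t).mul (hHd t)) (by apply Continuous.intervalIntegrable; fun_prop)
  rw [intervalIntegral.integral_add (by apply Continuous.intervalIntegrable; fun_prop) (by apply Continuous.intervalIntegrable; fun_prop)] at e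
  have e0 : H x = 0 := by simp [hH]
  have e1 : 0 ≤ H y := intervalIntegral.integral_nonneg hxy fun t _ => abs_nonneg _
  have e2 : ∫ t in x..y, f t * |h t - h x| ≤ ∫ t in x..y, f t * H t := by
    refine intervalIntegral.integral_mono_on hxy (by apply Continuous.intervalIntegrable; fun_prop) (by apply Continuous.intervalIntegrable; fun_prop) fun t ht => ?_
    refine mLe ?_ (hf0 t)
    rw [← intervalIntegral.integral_eq_sub_of_hasDerivAt (fun s _ => hh s) (hh'.intervalIntegrable _ _)]
    exact intervalIntegral.abs_integral_le_integral_abs ht.1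
  simp only [neg_mul] at e
  rw [intervalIntegral.integral_neg, e0] at e
  nlinarith [mul_nonneg (hA0 y) e1]
theorem Th_sq (hm : 1 ≤ m) {w : ℝ} (hw : 0 < w) : (√w - 1)^2 ≤ Th m 1 w - (m+1) := by
  have hm0 : (0:ℝ) < m := by exact_mod_cast hm
  have hs : 0 < √w := Real.sqrt_pos.2 hw
  have h1 : w ^ (-(1/(m:ℝ))) ≥ 1 - 2/m * (√w - 1) := by
    have : Real.log w ≤ 2 * (√w - 1) := by
      have := Real.log_le_sub_one_of_pos hs
      rw [Real.log_sqrt hw.le] at this; linarith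
    rw [Real.rpow_def_of_pos hw]
    have h2 := Real.add_one_le_exp (Real.log w * -(1/(m:ℝ)))
    have h3 : Real.log w * (1/m) ≤ 2 * (√w-1) * (1/m) := mRi this (by positivity)
    have : 2/m * (√w - 1) = 2 * (√w-1) * (1/m) := by ring
    linarith
  have h2 : m * w ^ (-(1/(m:ℝ))) ≥ m - 2 * (√w - 1) := by
    have := mLe h1 hm0.le
    have e : m * (1 - 2/m * (√w - 1)) = m - 2 * (√w-1) := by field_simp
    linarith
  unfold Th
  have := Real.sq_sqrt hw.le
  nlinarith
set_option maxHeartbeats 2000000 in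
theorem ridge1 (hm : 1 ≤ m) {d a ω : ℝ} (hd : 0 < d) (hd1 : d ≤ 1) {c1 : ℝ} (hc1 : 0 < c1)
    (g f T : ℝ → ℝ) (hgc : Continuous g) (hfc : Continuous f) (hgs : HasCompactSupport g)
    (hf0 : ∀ t, 0 ≤ f t) (hfg : ∀ t, f t ≤ g t) (ha : a = ∫ t, f t) (hω : ω = ballVol (m+1)) (haω : a < ω) (hωa : ω ≤ a + d)
    (hg1 : ∫ t, g t ≤ a + d) (hT1 : ∀ t, |T t| < 1)
    (hT : ∀ t, HasDerivAt T (1 * f t / fb m (T t)) t)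
    (hTi : Integrable (fun t => f t * Th m 1 (g t / fb m (T t))))
    (hTh : ∫ t, f t * Th m 1 (g t / fb m (T t)) ≤ (m+1) * a + 2*d)
    (hcut : ∀ s v, v ≤ ∫ t in Iic s, f t → v ≤ a - (∫ t in Iic s, f t) → c1 * v ≤ 2*d + 2 * g s) :
    ∃ t0, ∀ k : ℝ → ℝ, LipschitzWith 1 k → (∀ r, |k r| ≤ 2) →
      |(∫ t, f t * k t) - ∫ r, k (r + t0) * fb m r| ≤ (8/c1 * (5 + ω) + 32/c1 + 2) * √d := by
  have hsd : 0 < √d := Real.sqrt_pos.2 hd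
  have hsd2 : √d * √d = d := Real.mul_self_sqrt hd.le
  have hdsd : d ≤ √d := by
    have : √d ≤ 1 := Real.sqrt_le_one.2 hd1
    nlinarith
  have hTc : Continuous T := continuous_iff_continuousAt.2 fun t => (hT t).continuousAt
  have hfs : HasCompactSupport f := HasCompactSupport.intro hgs fun t ht => by
    have := image_eq_zero_of_notMem_tsupport ht
    have := hfg t; have := hf0 t; linarith
  have hfi : Integrable f := hfc.integrable_of_hasCompactSupport hfs
  have hgi : Integrable g := hgc.integrable_of_hasCompactSupport hgs
  have hfbp : ∀ t, 0 < fb m (T t) := fun t => fb_pos m (hT1 t)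
  have hfbc : Continuous fun t => fb m (T t) := (fb_cont m).comp hTc
  have ha0 : 0 ≤ a := ha ▸ integral_nonneg hf0
  set w : ℝ → ℝ := fun t => g t / fb m (T t) with hw
  have hwc : Continuous w := hgc.div₀ hfbc fun t => (hfbp t).ne'
  set V : ℝ → ℝ := fun s => ∫ t in Iic s, f t with hV
  have hVd : ∀ t, HasDerivAt V (f t) t := fun t => iic_deriv hfc hfi t
  have hVc : Continuous V := continuous_iff_continuousAt.2 fun t => (hVd t).continuousAt
  have hV0 : ∀ t, 0 ≤ V t := fun t => integral_nonneg hf0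
  have hVa : ∀ t, V t ≤ a := fun t => by rw [ha]; exact setIntegral_le_integral hfi (ae_of_all _ hf0)
  have hVm : Monotone V := monotone_of_hasDerivAt_nonneg hVd hf0
  obtain ⟨M, hM0, hM⟩ : ∃ M : ℝ, 0 < M ∧ ∀ t, t ∉ Ioo (-M) M → f t = 0 := by
    obtain ⟨ρ, hρ⟩ := hfs.isCompact.isBounded.subset_ball 0
    refine ⟨max ρ 1, by positivity, fun t ht => ?_⟩
    by_contra h0
    have := hρ (subset_tsupport f h0)
    rw [mem_ball_zero_iff, Real.norm_eq_abs, abs_lt] at this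
    exact ht ⟨by linarith [le_max_left ρ 1], by linarith [le_max_left ρ 1]⟩
  have hVM : V (-M) = 0 := by
    rw [hV]; simp only
    rw [setIntegral_congr_fun measurableSet_Iic (g := fun _ => 0) (fun t ht => hM t fun h => by linarith [h.1, mem_Iic.1 ht])]; simp
  have hIoc : ∀ G : ℝ → ℝ, ∫ t in (-M)..M, f t * G t = ∫ t, f t * G t := by
    intro G
    rw [intervalIntegral.integral_of_le (by linarith)]
    refine setIntegral_eq_integral_of_forall_compl_eq_zero fun t ht => ?_
    rw [hM t fun h => ht ⟨h.1, h.2.le⟩, zero_mul]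
  have hVint : ∀ x y, ∫ t in x..y, f t = V y - V x := fun x y =>
    intervalIntegral.integral_eq_sub_of_hasDerivAt (fun t _ => hVd t) (hfc.intervalIntegrable _ _)
  have hVM' : V M = a := by
    have := hIoc fun _ => 1
    simp only [mul_one] at this
    rw [hVint, hVM, ← ha] at this; linarith
  -- displacement bound
  have hfw : ∫ t, f t * |w t - 1| ≤ (4 + ω) * √d := by
    have hpt : ∀ t, f t * |w t - 1| ≤ (1 + 1/√d) * (f t * Th m 1 (w t) - (m+1) * f t) + √d * f t := by
      intro t
      rcases (hf0 t).eq_or_lt with h0 | h0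
      · rw [← h0]; simp
      have hwp : 0 < w t := div_pos (h0.trans_le (hfg t)) (hfbp t)
      have h1 := Th_sq hm hwp
      set σ := √(w t)
      have hσ : σ * σ = w t := Real.mul_self_sqrt hwp.le
      have h2 : |w t - 1| ≤ (σ-1)^2 + 2 * |σ - 1| := by
        rw [← hσ, show σ*σ-1 = (σ-1)^2 + 2*(σ-1) by ring]
        refine (abs_add_le _ _).trans ?_
        rw [abs_of_nonneg (sq_nonneg _), abs_mul, abs_two]
      have h3 : 2 * |σ-1| ≤ 1/√d * (σ-1)^2 + √d := by
        have : 1/√d * (σ-1)^2 + √d - 2*|σ-1| = 1/√d * (|σ-1| - √d)^2 := by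
          rw [← sq_abs (σ-1)]; field_simp; ring
        have : 0 ≤ 1/√d * (|σ-1| - √d)^2 := by positivity
        linarith
      have h4 : (1+1/√d) * (σ-1)^2 ≤ (1+1/√d) * (Th m 1 (w t) - (m+1)) := by gcongr
      have h5 : |w t - 1| ≤ (1+1/√d) * (Th m 1 (w t) - (m+1)) + √d := by linarith
      have := mLe h5 h0.le
      linarith
    have hi1 : Integrable fun t => f t * Th m 1 (w t) - (m+1) * f t := hTi.sub (hfi.const_mul _)
    have := integral_mono (f := fun t => f t * |w t - 1|) ((hfc.mul (hwc.sub continuous_const).abs).integrable_of_hasCompactSupport hfs.mul_right)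
      ((hi1.const_mul (1+1/√d)).add (hfi.const_mul √d)) hpt
    refine this.trans ?_
    have e := integral_add (f := fun t => (1 + 1/√d) * (f t * Th m 1 (w t) - (m+1) * f t)) (g := fun t => √d * f t) (hi1.const_mul (1+1/√d)) (hfi.const_mul √d)
    simp only [Pi.add_apply]
    rw [e, integral_const_mul, integral_const_mul, integral_sub hTi (hfi.const_mul _), integral_const_mul, ← ha]
    have h6 : (1+1/√d) * ((∫ t, f t * Th m 1 (w t)) - (m+1) * a) ≤ (1+1/√d) * (2*d) := by
      gcongr; linarith
    have h7 : (1+1/√d) * (2*d) = 2 * d + 2 * √d := by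
      have e1 : d/√d = √d := Real.div_sqrt
      have e2 : 1/√d * d = d/√d := by ring
      linear_combination 2*(e2.trans e1)
    nlinarith
  set h : ℝ → ℝ := fun t => T t - t with hh
  set h' : ℝ → ℝ := fun t => f t / fb m (T t) - 1 with hh'
  have hhd : ∀ t, HasDerivAt h (h' t) t := fun t => by
    have := (hT t).sub (hasDerivAt_id t)
    rw [one_mul] at this; exact this
  have hh'c : Continuous h' := (hfc.div₀ hfbc fun t => (hfbp t).ne').sub continuous_const
  have hgh : ∫ t, g t * |h' t| ≤ (5 + ω) * √d := by
    have hpt : ∀ t, g t * |h' t| ≤ f t * |w t - 1| + (g t - f t) := by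
      intro t
      have hg0 : 0 ≤ g t := (hf0 t).trans (hfg t)
      have e : g t * h' t = f t * (w t - 1) - (g t - f t) := by
        simp only [hh', hw]; ring
      rw [← abs_of_nonneg hg0, ← abs_mul, abs_of_nonneg hg0, e]
      refine (abs_sub _ _).trans ?_
      rw [abs_mul, abs_of_nonneg (hf0 t), abs_of_nonneg (sub_nonneg.2 (hfg t))]
    have hi1 : Integrable fun t => f t * |w t - 1| := (hfc.mul (hwc.sub continuous_const).abs).integrable_of_hasCompactSupport hfs.mul_right
    have := integral_mono (f := fun t => g t * |h' t|) ((hgc.mul hh'c.abs).integrable_of_hasCompactSupport hgs.mul_right)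
      (hi1.add (hgi.sub hfi)) hpt
    refine this.trans ?_
    have e := integral_add (f := fun t => f t * |w t - 1|) (g := fun t => g t - f t) hi1 (hgi.sub hfi)
    simp only [Pi.add_apply, Pi.sub_apply]
    rw [e, integral_sub hgi hfi, ← ha]
    linarith
  have hghI : ∀ x y, x ≤ y → ∫ t in x..y, g t * |h' t| ≤ (5+ω)*√d := fun x y hxy => by
    refine le_trans ?_ hgh
    rw [intervalIntegral.integral_of_le hxy]
    exact setIntegral_le_integral ((hgc.mul hh'c.abs).integrable_of_hasCompactSupport hgs.mul_right)
      (ae_of_all _ fun t => mul_nonneg ((hf0 t).trans (hfg t)) (abs_nonneg _))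
  -- choose points
  have hIVT : ∀ v, 0 ≤ v → v ≤ a → ∃ t ∈ Icc (-M) M, V t = v := fun v h0 h1 => by
    have := intermediate_value_Icc (by linarith : -M ≤ M) hVc.continuousOn
    rw [hVM, hVM'] at this
    exact this ⟨h0, h1⟩
  obtain ⟨ts, hts, hVts⟩ := hIVT (a/2) (by linarith) (by linarith)
  have hfbt : ∫ r, fb m r = ω := by rw [fb_total hm, hω]
  have hfbi : Integrable (fb m) := by simpa using fb_int hm (k := fun _ => 1) continuous_const
  have hkc : ∀ {k : ℝ → ℝ}, LipschitzWith 1 k → Continuous k := fun hk => hk.continuous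
  refine ⟨ts - T ts, fun k hk hk2 => ?_⟩
  have hkc := hk.continuous
  set t0 := ts - T ts
  have hkfi : Integrable fun t => f t * k t := (hfc.mul hkc).integrable_of_hasCompactSupport hfs.mul_right
  have hkt : Continuous fun r => k (r + t0) := by fun_prop
  have hkfb : Integrable fun r => k (r + t0) * fb m r := fb_int hm hkt
  have hconst : 0 ≤ 8/c1 * (5+ω) := by rw [hω]; have := ballVol_pos (m+1); positivity
  by_cases hsmall : a/2 ≤ 4*d/c1
  · have b1 : |∫ t, f t * k t| ≤ 2 * a := by
      rw [ha, ← integral_const_mul]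
      refine (abs_integral_le_integral_abs).trans (integral_mono hkfi.abs (hfi.const_mul 2) fun t => ?_)
      simp only [abs_mul, abs_of_nonneg (hf0 t)]; nlinarith [hk2 t, hf0 t]
    have b2 : |∫ r, k (r + t0) * fb m r| ≤ 2 * ω := by
      rw [← hfbt, ← integral_const_mul]
      refine (abs_integral_le_integral_abs).trans (integral_mono hkfb.abs (hfbi.const_mul 2) fun t => ?_)
      simp only [abs_mul, abs_of_nonneg (fb_nonneg m t)]; nlinarith [hk2 (t+t0), fb_nonneg m t]
    have b3 := abs_sub (∫ t, f t * k t) (∫ r, k (r + t0) * fb m r)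
    have b4 : 4*a + 2*d ≤ (32/c1 + 2) * d := by
      have : (32/c1 + 2) * d = 8 * (4*d/c1) + 2*d := by ring
      linarith
    have b5 : (32/c1 + 2) * d ≤ (32/c1+2) * √d := by gcongr
    nlinarith [mul_nonneg hconst hsd.le]
  push Not at hsmall
  set v0 := 4*d/c1 with hv0
  have hv00 : 0 < v0 := by positivity
  obtain ⟨b', hb', hVb'⟩ := hIVT v0 hv00.le (by linarith)
  obtain ⟨b, hb, hVb⟩ := hIVT (a-v0) (by linarith) (by linarith)
  have hb1 : b' ≤ ts := by
    by_contra h2; push Not at h2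
    have := hVm h2.le; linarith
  have hb2 : ts ≤ b := by
    by_contra h2; push Not at h2
    have := hVm h2.le; linarith
  have hgood : ∀ s v, v0 ≤ v → v ≤ V s → v ≤ a - V s → v ≤ 4/c1 * g s := by
    intro s v hv h1 h2
    have h3 := hcut s v h1 h2
    rw [div_mul_eq_mul_div, le_div_iff₀ hc1]
    rw [hv0, div_le_iff₀ hc1] at hv
    linarith
  have hhc : Continuous h := hTc.sub continuous_id
  have R1 : ∫ t in ts..b, f t * |h t - h ts| ≤ 4/c1 * ((5+ω)*√d) := by
    refine (poinc (A := fun t => a - V t) hfc hh'c hf0 (fun t => sub_nonneg.2 (hVa t)) (fun t => by simpa using (hVd t).const_sub a) hhd hb2).trans ?_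
    refine le_trans ?_ (mLe (hghI ts b hb2) (by positivity))
    rw [← intervalIntegral.integral_const_mul]
    refine intervalIntegral.integral_mono_on hb2 (by apply Continuous.intervalIntegrable; fun_prop) (by apply Continuous.intervalIntegrable; fun_prop) fun t ht => ?_
    rw [← mul_assoc]
    refine mRi ?_ (abs_nonneg _)
    have h1 := hVm ht.1
    have h2 := hVm ht.2
    exact hgood t _ (by linarith) (by linarith) le_rfl
  have R2 : ∫ t in b'..ts, f t * |h t - h ts| ≤ 4/c1 * ((5+ω)*√d) := by
    have hn : ∀ t : ℝ, HasDerivAt (fun t : ℝ => -t) (-1) t := fun t => (hasDerivAt_id t).neg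
    have := poinc (f := fun t => f (-t)) (A := fun t => V (-t)) (h := fun t => h (-t)) (h' := fun t => -h' (-t)) (x := -ts) (y := -b')
      (by fun_prop) (by fun_prop) (fun t => hf0 _) (fun t => hV0 _)
      (fun t => by have := (hVd (-t)).comp t (hn t); rwa [mul_neg_one] at this) (fun t => by have := (hhd (-t)).comp t (hn t); rwa [mul_neg_one] at this) (by linarith)
    simp only [abs_neg, neg_neg] at this
    rw [intervalIntegral.integral_comp_neg (fun t => f t * |h t - h ts|), intervalIntegral.integral_comp_neg (fun t => V t * |h' t|)] at this
    simp only [neg_neg] at this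
    refine this.trans ?_
    refine le_trans ?_ (mLe (hghI b' ts hb1) (by positivity))
    rw [← intervalIntegral.integral_const_mul]
    refine intervalIntegral.integral_mono_on hb1 (by apply Continuous.intervalIntegrable; fun_prop) (by apply Continuous.intervalIntegrable; fun_prop) fun t ht => ?_
    rw [← mul_assoc]
    refine mRi ?_ (abs_nonneg _)
    have h1 := hVm ht.1
    have h2 := hVm ht.2
    exact hgood t _ (by linarith) le_rfl (by linarith)
  -- comparison on pieces
  set ψ : ℝ → ℝ := fun t => f t * |k t - k (T t + t0)| with hψ
  have hψc : Continuous ψ := by fun_prop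
  have hψ4 : ∀ t, ψ t ≤ 4 * f t := fun t => by
    have := abs_sub (k t) (k (T t + t0))
    have h1 := hk2 t; have h2 := hk2 (T t + t0)
    simp only [hψ]; nlinarith [hf0 t]
  have hψh : ∀ t, ψ t ≤ f t * |h t - h ts| := fun t => by
    refine mLe ?_ (hf0 t)
    have := hk.dist_le_mul t (T t + t0)
    rw [Real.dist_eq, Real.dist_eq, NNReal.coe_one, one_mul] at this
    refine this.trans (le_of_eq ?_)
    rw [← abs_neg]; congr 1; simp only [hh, t0]; ring
  have hII : ∀ x y, IntervalIntegrable ψ volume x y := fun x y => hψc.intervalIntegrable _ _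
  have p1 : ∫ t in (-M)..b', ψ t ≤ 4 * v0 := by
    have := intervalIntegral.integral_mono_on hb'.1 (hII _ _) ((hfc.const_mul 4).intervalIntegrable _ _) fun t _ => hψ4 t
    rw [intervalIntegral.integral_const_mul, hVint, hVM, hVb'] at this; linarith
  have p4 : ∫ t in b..M, ψ t ≤ 4 * v0 := by
    have := intervalIntegral.integral_mono_on hb.2 (hII _ _) ((hfc.const_mul 4).intervalIntegrable _ _) fun t _ => hψ4 t
    rw [intervalIntegral.integral_const_mul, hVint, hVM', hVb] at this; linarith
  have p2 := (intervalIntegral.integral_mono_on hb1 (hII _ _) (by apply Continuous.intervalIntegrable; fun_prop) fun t _ => hψh t).trans R2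
  have p3 := (intervalIntegral.integral_mono_on hb2 (hII _ _) (by apply Continuous.intervalIntegrable; fun_prop) fun t _ => hψh t).trans R1
  have psum : ∫ t, ψ t ≤ 8 * v0 + 2 * (4/c1 * ((5+ω)*√d)) := by
    rw [hψ, ← hIoc, ← intervalIntegral.integral_add_adjacent_intervals (hII (-M) b') (hII b' M),
      ← intervalIntegral.integral_add_adjacent_intervals (hII b' ts) (hII ts M),
      ← intervalIntegral.integral_add_adjacent_intervals (hII ts b) (hII b M)]
    linarith
  have hkTi : Integrable fun t => f t * k (T t + t0) := (hfc.mul (by fun_prop)).integrable_of_hasCompactSupport hfs.mul_right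
  have q1 : |(∫ t, f t * k t) - ∫ t, f t * k (T t + t0)| ≤ ∫ t, ψ t := by
    rw [← integral_sub hkfi hkTi]
    refine abs_integral_le_integral_abs.trans (le_of_eq ?_)
    congr 1; ext t; rw [← mul_sub, abs_mul, abs_of_nonneg (hf0 t)]
  -- substitution
  have hTm : Monotone T := monotone_of_hasDerivAt_nonneg hT fun t => by
    rw [one_mul]; exact div_nonneg (hf0 t) (hfbp t).le
  have hsub : ∀ G : ℝ → ℝ, Continuous G → ∫ t, f t * G (T t) = ∫ r in (T (-M))..(T M), G r * fb m r := by
    intro G hG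
    have := intervalIntegral.integral_comp_mul_deriv (a := -M) (b := M) (g := fun r => G r * fb m r) (fun t _ => hT t)
      (by simp only [one_mul]; exact (hfc.div₀ hfbc fun t => (hfbp t).ne').continuousOn) (hG.mul (fb_cont m))
    rw [← this, ← hIoc]
    congr 1; ext t
    have := (hfbp t).ne'
    simp only [Function.comp]; field_simp
  have hsub1 := hsub (fun _ => 1) continuous_const
  simp only [mul_one, one_mul] at hsub1
  have hTT : T (-M) ≤ T M := hTm (by linarith)
  have q2 : |(∫ t, f t * k (T t + t0)) - ∫ r, k (r + t0) * fb m r| ≤ 2 * (ω - a) := by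
    rw [hsub (fun r => k (r+t0)) hkt, intervalIntegral.integral_of_le hTT,
      ← integral_add_compl measurableSet_Ioc hkfb, sub_add_cancel_left, abs_neg]
    have e : ∫ r in (Ioc (T (-M)) (T M))ᶜ, fb m r = ω - a := by
      have := integral_add_compl (measurableSet_Ioc (a := T (-M)) (b := T M)) hfbi
      rw [hfbt, ← intervalIntegral.integral_of_le hTT, ← hsub1, ← ha] at this
      linarith
    rw [← e, ← integral_const_mul]
    refine abs_integral_le_integral_abs.trans (integral_mono hkfb.abs.integrableOn (hfbi.const_mul 2).integrableOn fun t => ?_)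
    simp only [abs_mul, abs_of_nonneg (fb_nonneg m t)]; nlinarith [hk2 (t+t0), fb_nonneg m t]
  have q3 := abs_sub_le (∫ t, f t * k t) (∫ t, f t * k (T t + t0)) (∫ r, k (r + t0) * fb m r)
  have q4 : 8 * v0 = 32/c1 * d := by rw [hv0]; ring
  have q5 : 32/c1 * d ≤ 32/c1 * √d := by gcongr
  have q6 : (8/c1 * (5 + ω) + 32/c1 + 2) * √d = 2 * (4/c1 * ((5+ω)*√d)) + 32/c1 * √d + 2 * √d := by ring
  rw [q6]
  linarith
def Cand (n : ℕ) (d : ℝ) (F : Set (Euc n)) : Prop :=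
  MS F ∧ volume F = volume (ball (0:Euc n) 1) ∧ HasFinitePerim F ∧ perim F ≤ n * ballVol n + d
theorem cand_iso {d : ℝ} {F : Set (Euc n)} (h : Cand n d F) (U : Euc n ≃ₗᵢ[ℝ] Euc n) (c : Euc n) :
    Cand n d (sim 1 U c ⁻¹' F) := by
  obtain ⟨h1, h2, h3, h4⟩ := h
  have h5 := sim_perim one_pos U c h3
  refine ⟨(sim_cont 1 U c).measurable h1, ?_, h5.1, ?_⟩
  · rw [sim_volume one_pos]; simpa using h2
  · rw [h5.2]; simpa using h4
theorem exists_iso {x y : Euc n} (h : ‖x‖ = ‖y‖) : ∃ U : Euc n ≃ₗᵢ[ℝ] Euc n, U x = y :=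
  ⟨_, Submodule.reflection_sub h⟩
theorem sim_ball (U : Euc n ≃ₗᵢ[ℝ] Euc n) (r : ℝ) : sim 1 U 0 ⁻¹' (ball (0:Euc n) r) = ball 0 r := by
  ext x; simp [sim]
theorem ridge0 (hm : 1 ≤ m) : ∃ C : ℝ, 0 < C ∧ ∀ (F : Set Ec m) (d : ℝ), 0 < d → d ≤ 1 → Cand (m+1) d F →
    ∃ t0 : ℝ, ∀ k : ℝ → ℝ, LipschitzWith 1 k → (∀ r, |k r| ≤ 2) →
      |(∫ x in F, k (x 0)) - ∫ x in Bu m, k (x 0 + t0)| ≤ C * √d := by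
  have hm0 : (0:ℝ) < m := by exact_mod_cast hm
  set q := 1/((m:ℝ)+1) with hq
  set ω := ballVol (m+1) with hω
  have hω0 : 0 < ω := ballVol_pos _
  set c1 := Rp m * ((2:ℝ)^q - 1) with hc1
  have hc10 : 0 < c1 := by
    have : (1:ℝ) < 2^q := Real.one_lt_rpow (by norm_num) (by positivity)
    rw [hc1]; exact mul_pos (by positivity) (by linarith)
  refine ⟨(8/c1 * (5 + ω) + 32/c1 + 2) + 6, by positivity, ?_⟩
  rintro F d hd hd1 ⟨hF, hv, hfp, hP⟩
  set p := Rp m/m with hp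
  have hp1 : 1 ≤ p := by rw [hp, le_div_iff₀ hm0]; linarith
  have hp2 : p ≤ 2 := by
    have : (1:ℝ) ≤ m := by exact_mod_cast hm
    rw [hp, div_le_iff₀ hm0]; linarith
  have hp0 : 0 < p := by linarith
  have hfin : volume F ≠ ∞ := by rw [hv]; exact measure_ball_lt_top.ne
  set δ := d/((m:ℝ)+2) with hδ
  have hδ0 : 0 < δ := by positivity
  have hδe : ((m:ℝ)+2) * δ = d := by rw [hδ]; field_simp
  have hδd : δ ≤ d := by nlinarith
  obtain ⟨η, hN, h1, h2, h3, h4, h5⟩ := L0' hF hv hfp hδ0 hp1 hp2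
  have hpc := rpow_cont hN hp0
  have hηi : Integrable η := hN.1.continuous.integrable_of_hasCompactSupport hN.2.1
  have hpi : Integrable (fun x => η x ^ p) := hpc.1.integrable_of_hasCompactSupport hpc.2.1
  have hχi := chi_int hF hfin
  have hple : ∀ x, η x ^ p ≤ η x := fun x => by
    have := Real.rpow_le_rpow_of_exponent_ge' (hN.2.2 x) (h1 x) zero_le_one hp1
    simpa using this
  set g := sl η with hg
  set f := sl fun x => η x ^ p with hf
  have hft : ∫ t, f t = ∫ x, η x ^ p := sl_total hpc.1 hpc.2.1
  have hgt : ∫ t, g t = ∫ x, η x := sl_total hN.1.continuous hN.2.1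
  have hpη : ∫ x, η x ^ p ≤ ∫ x, η x := integral_mono hpi hηi hple
  obtain ⟨T, t1, t2, t3, t4, t5⟩ := STEP hm (Q_all hm) hN one_pos g f hg hf (by rw [one_mul, hft]; linarith)
  set a := ∫ t, f t with ha
  rw [← hft] at h5 hpη
  have hfg : ∀ t, f t ≤ g t := fun t => by
    have a1 := slice_nc hN t
    have a2 := rpow_cont a1 hp0
    exact integral_mono (a2.1.integrable_of_hasCompactSupport a2.2.1) (a1.1.continuous.integrable_of_hasCompactSupport a1.2.1) fun y => hple _
  have hP' : ∫ x, ‖fderiv ℝ η x‖ ≤ Rp m * a + 2*d := by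
    push_cast at hP
    have : Rp m * ω ≤ Rp m * (a + δ) := by gcongr
    linarith
  have hf0 : ∀ t, 0 ≤ f t := sl_nonneg hpc.2.2
  have hfi : Integrable f := sl_int hpc.1 hpc.2.1
  have hcut : ∀ s v, v ≤ ∫ t in Iic s, f t → v ≤ a - (∫ t in Iic s, f t) → c1 * v ≤ 2*d + 2 * g s := by
    intro s v hv1 hv2
    have hc := cut hm hN g f hg hf ha (by linarith) s rfl
    set V := ∫ t in Iic s, f t
    have hV0 : 0 ≤ V := integral_nonneg hf0
    have hVa : V ≤ a := setIntegral_le_integral hfi (ae_of_all _ hf0)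
    have key : ∀ x y, 0 ≤ x → x ≤ y → x + y = a → v ≤ x → Rp m * a^q * x^((m:ℝ)/((m:ℝ)+1)) + Rp m * a^q * y^((m:ℝ)/((m:ℝ)+1)) ≤ (∫ x, ‖fderiv ℝ η x‖) + 2 * g s → c1 * v ≤ 2*d + 2 * g s := by
      intro x y hx hxy hxya hvx hh
      have r1 := rn_lin (m := m) (a := a) (l := 2) hx two_pos (by linarith)
      have r2 := rn_lin (m := m) (a := a) (x := y) (l := 1) (by linarith) one_pos (by linarith)
      rw [Real.one_rpow, one_mul] at r2
      have r1' := mLe r1 (by positivity : 0 ≤ (m:ℝ)+1)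
      have r2' := mLe r2 (by positivity : 0 ≤ (m:ℝ)+1)
      have r3 : c1 * v ≤ c1 * x := by gcongr
      have r4 : c1 * x = Rp m * (2^q*x) + Rp m * y - Rp m * a := by rw [hc1, ← hxya]; ring
      rw [← mul_assoc] at r1' r2'
      linarith
    rcases le_total V (a-V) with hh | hh
    · exact key V (a-V) hV0 hh (by ring) hv1 hc
    · exact key (a-V) V (by linarith) hh (by ring) hv2 (by linarith)
  obtain ⟨t0, ht0⟩ := ridge1 hm hd hd1 hc10 g f T (sl_cont hN.1.continuous hN.2.1) (sl_cont hpc.1 hpc.2.1) (sl_supp hN.2.1)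
    hf0 hfg ha hω (by linarith) (by linarith) (by rw [hgt]; linarith) t1 t3 t4 (t5.trans hP') hcut
  refine ⟨t0, fun k hk hk2 => ?_⟩
  have r := ht0 k hk hk2
  rw [ball_ridge hm (k := fun r => k (r + t0)) (by have := hk.continuous; fun_prop)]
  have e1 : ∫ t, f t * k t = ∫ x, k (x 0) * η x ^ p := by
    rw [sl_ridge hpc.1 hpc.2.1 hk.continuous]; congr 1; ext t; rw [mul_comm]
  have hkm : AEStronglyMeasurable (fun x : Ec m => k (x 0)) := by
    have := hk.continuous
    exact (by fun_prop : Continuous fun x : Ec m => k (x 0)).aestronglyMeasurable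
  have hb : ∀ᵐ x : Ec m, ‖k (x 0)‖ ≤ 2 := ae_of_all _ fun x => hk2 _
  have i1 : Integrable fun x : Ec m => k (x 0) * chi F x := hχi.bdd_mul hkm hb
  have i2 : Integrable fun x : Ec m => k (x 0) * η x ^ p := hpi.bdd_mul hkm hb
  have e2 : ∫ x in F, k (x 0) = ∫ x, k (x 0) * chi F x := by
    rw [← integral_indicator hF]; congr 1; ext x; by_cases hx : x ∈ F <;> simp [chi, hx]
  have e3 : |(∫ x in F, k (x 0)) - ∫ t, f t * k t| ≤ 4 * d := by
    rw [e1, e2, ← integral_sub i1 i2]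
    have : ∫ x, |k (x 0) * chi F x - k (x 0) * η x ^ p| ≤ ∫ x, (2 * |η x - chi F x| + 2 * (η x - η x ^ p)) := by
      refine integral_mono (i1.sub i2).abs (((hηi.sub hχi).abs.const_mul 2).add ((hηi.sub hpi).const_mul 2)) fun x => ?_
      simp only
      rw [← mul_sub, abs_mul]
      have a1 : |chi F x - η x ^ p| ≤ |η x - chi F x| + (η x - η x ^ p) := by
        rw [abs_sub_comm (η x)]
        have := abs_add_le (chi F x - η x) (η x - η x ^ p)
        rw [abs_of_nonneg (sub_nonneg.2 (hple x))] at this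
        simpa using this
      have := hk2 (x 0)
      nlinarith [abs_nonneg (k (x 0)), abs_nonneg (chi F x - η x ^ p)]
    refine abs_integral_le_integral_abs.trans (this.trans ?_)
    rw [integral_add (f := fun x => 2 * |η x - chi F x|) (g := fun x => 2 * (η x - η x^p)) ((hηi.sub hχi).abs.const_mul 2) ((hηi.sub hpi).const_mul 2), integral_const_mul, integral_const_mul, integral_sub hηi hpi, ← hft]
    linarith
  have e4 : d ≤ √d := by
    have h1 : √d ≤ 1 := Real.sqrt_le_one.2 hd1
    nlinarith [Real.mul_self_sqrt hd.le, Real.sqrt_nonneg d]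
  have := abs_sub_le (∫ x in F, k (x 0)) (∫ t, f t * k t) (∫ r, k (r + t0) * fb m r)
  linarith [Real.sqrt_nonneg d]
theorem ridge (hm : 1 ≤ m) : ∃ C : ℝ, 0 < C ∧ ∀ (F : Set Ec m) (d : ℝ), 0 < d → d ≤ 1 → Cand (m+1) d F →
    ∀ θ : Ec m, ‖θ‖ = 1 → ∃ t0 : ℝ, ∀ k : ℝ → ℝ, LipschitzWith 1 k → (∀ r, |k r| ≤ 2) →
      |(∫ x in F, k (inner ℝ θ x)) - ∫ x in Bu m, k (inner ℝ θ x + t0)| ≤ C * √d := by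
  obtain ⟨C, hC, h⟩ := ridge0 hm
  refine ⟨C, hC, fun F d hd hd1 hF θ hθ => ?_⟩
  obtain ⟨U, hU⟩ := exists_iso (x := EuclideanSpace.single (0 : Fin (m+1)) (1:ℝ)) (y := θ) (by simp [hθ])
  obtain ⟨t0, ht⟩ := h _ d hd hd1 (cand_iso hF U 0)
  refine ⟨t0, fun k hk hk2 => ?_⟩
  have e : ∀ x : Ec m, x 0 = inner ℝ θ (sim 1 U 0 x) := fun x => by
    simp [sim, ← hU, EuclideanSpace.inner_single_left]
  have := ht k hk hk2
  simp_rw [e] at this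
  rw [← sim_ball U 1] at this
  rw [sim_integral one_pos U 0 F (fun x => k (inner ℝ θ x)), sim_integral one_pos U 0 _ (fun x => k (inner ℝ θ x + t0))] at this
  simpa using this
def rho (x : Euc n) : ℝ := |1 - ‖x‖^2| / (1 + ‖x‖^2)
def phi (F : Set (Euc n)) (x : Euc n) : ℝ := chi F x - chi (ball (0:Euc n) 1) x
def Wd (F : Set (Euc n)) : ℝ := ∫ x, |phi F x| * rho x
theorem rho_cont : Continuous (rho (n := n)) := by
  unfold rho
  exact ((continuous_const.sub (continuous_norm.pow 2)).abs).div₀ (by fun_prop) fun x => by positivity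
theorem rho_nonneg (x : Euc n) : 0 ≤ rho x := by unfold rho; positivity
theorem rho_le (x : Euc n) : rho x ≤ 1 := by
  unfold rho
  rw [div_le_one (by positivity), abs_le]
  constructor <;> nlinarith [sq_nonneg ‖x‖]
theorem cand_fin {d : ℝ} {F : Set (Euc n)} (h : Cand n d F) : volume F ≠ ∞ := by
  rw [h.2.1]; exact measure_ball_lt_top.ne
theorem phi_int {d : ℝ} {F : Set (Euc n)} (h : Cand n d F) : Integrable (phi F) :=
  (chi_int h.1 (cand_fin h)).sub (chi_int msB measure_ball_lt_top.ne)
theorem phi_abs (F : Set (Euc n)) (x : Euc n) : |phi F x| ≤ 1 := by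
  have h1 := chi01 F x
  have h2 := chi01 (ball (0:Euc n) 1) x
  unfold phi; rw [abs_le]; constructor <;> linarith [h1.1, h1.2, h2.1, h2.2]
theorem bd_int {f ψ : Euc n → ℝ} (hf : Integrable f) (hψ : Continuous ψ) {M : ℝ} (hM : ∀ x, |ψ x| ≤ M) :
    Integrable fun x => f x * ψ x :=
  hf.mul_bdd hψ.aestronglyMeasurable (ae_of_all _ hM)
theorem Wd_int {d : ℝ} {F : Set (Euc n)} (h : Cand n d F) : Integrable fun x => |phi F x| * rho x :=
  bd_int (phi_int h).abs rho_cont (M := 1) fun x => by rw [abs_of_nonneg (rho_nonneg x)]; exact rho_le x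
theorem Wd_nonneg (F : Set (Euc n)) : 0 ≤ Wd F := integral_nonneg fun x => mul_nonneg (abs_nonneg _) (rho_nonneg x)
theorem chi_mul {F : Set (Euc n)} (hF : MS F) (ψ : Euc n → ℝ) : ∫ x in F, ψ x = ∫ x, chi F x * ψ x := by
  rw [← integral_indicator hF]; congr 1; ext x; by_cases hx : x ∈ F <;> simp [chi, hx]
theorem phi_mul {d : ℝ} {F : Set (Euc n)} (h : Cand n d F) {ψ : Euc n → ℝ} (hψ : Continuous ψ) {M : ℝ} (hM : ∀ x, |ψ x| ≤ M) :
    ∫ x, phi F x * ψ x = (∫ x in F, ψ x) - ∫ x in ball (0:Euc n) 1, ψ x := by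
  rw [chi_mul h.1, chi_mul msB, ← integral_sub (bd_int (chi_int h.1 (cand_fin h)) hψ hM)
    (bd_int (chi_int msB measure_ball_lt_top.ne) hψ hM)]
  congr 1; ext x; unfold phi; ring
theorem phi_zero {d : ℝ} {F : Set (Euc n)} (h : Cand n d F) : ∫ x, phi F x = 0 := by
  have := phi_mul h (ψ := fun _ => 1) continuous_const (M := 1) (by simp)
  simpa [h.2.1, Measure.real] using this
/-- `φ (|x|²-1) = |φ| | |x|²-1 |` type sign rule -/
theorem phi_sign (F : Set (Euc n)) (x : Euc n) {c : ℝ} (h1 : ‖x‖ < 1 → c ≤ 0) (h2 : 1 ≤ ‖x‖ → 0 ≤ c) :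
    phi F x * c = |phi F x| * |c| := by
  rw [← abs_mul, abs_of_nonneg]
  unfold phi
  rcases lt_or_ge ‖x‖ 1 with h | h
  · have : chi (ball (0:Euc n) 1) x = 1 := by simp [chi, h]
    rw [this]; nlinarith [(chi01 F x).2, h1 h]
  · have : chi (ball (0:Euc n) 1) x = 0 := by simp [chi, h]
    rw [this]; nlinarith [(chi01 F x).1, h2 h]
theorem ball_odd (θ : Euc n) : ∫ x in ball (0:Euc n) 1, (inner ℝ θ x : ℝ) = 0 := by
  have := sim_integral one_pos (LinearIsometryEquiv.neg ℝ) (0:Euc n) (ball 0 1) (fun x => inner ℝ θ x)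
  rw [sim_ball] at this
  simp only [sim, one_smul, add_zero, LinearIsometryEquiv.coe_neg, inner_neg_right, one_pow, inv_one, one_mul] at this
  rw [integral_neg] at this
  linarith
def clp (r : ℝ) : ℝ := max (-2) (min 2 r)
theorem clp_lip : LipschitzWith 1 clp := by
  have := (LipschitzWith.id (α := ℝ)).const_min 2 |>.const_max (-2)
  exact this
theorem clp_abs (r : ℝ) : |clp r| ≤ 2 := by
  unfold clp; rw [abs_le]; exact ⟨le_max_left _ _, max_le (by norm_num) (min_le_left _ _)⟩
theorem clp_eq {r : ℝ} (h : |r| ≤ 2) : clp r = r := by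
  rw [abs_le] at h
  unfold clp; rw [min_eq_right h.2, max_eq_right h.1]
theorem clp_mono : Monotone clp := fun x y h => max_le_max le_rfl (min_le_min le_rfl h)
def Cent (n : ℕ) (C d : ℝ) (F : Set (Euc n)) : Prop :=
  ∀ i, ∀ k : ℝ → ℝ, LipschitzWith 1 k → (∀ r, |k r| ≤ 2) → |∫ x, phi F x * k (x i)| ≤ C * √d
theorem center (hm : 1 ≤ m) : ∃ C : ℝ, 0 < C ∧ ∀ (F : Set Ec m) (d : ℝ), 0 < d → d ≤ 1 → Cand (m+1) d F →
    ∃ c : Ec m, Cent (m+1) C d (sim 1 (LinearIsometryEquiv.refl ℝ _) c ⁻¹' F) := by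
  obtain ⟨C, hC, h⟩ := ridge hm
  refine ⟨C, hC, fun F d hd hd1 hF => ?_⟩
  choose t ht using fun i : Fin (m+1) => h F d hd hd1 hF (EuclideanSpace.single i (1:ℝ)) (by simp)
  refine ⟨WithLp.toLp 2 t, fun i k hk hk2 => ?_⟩
  have hkc := hk.continuous
  rw [phi_mul (cand_iso hF _ _) (ψ := fun x => k (x i)) (by fun_prop) (fun x => hk2 _)]
  have := ht i (fun r => k (r - t i)) (by
    refine LipschitzWith.of_dist_le_mul fun x y => ?_
    have := hk.dist_le_mul (x - t i) (y - t i)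
    rwa [dist_sub_right] at this) (fun r => hk2 _)
  simp only [add_sub_cancel_right, EuclideanSpace.inner_single_left, map_one, one_mul] at this
  have e := sim_integral one_pos (LinearIsometryEquiv.refl ℝ _) (WithLp.toLp 2 t) F (fun x => k (x i - t i))
  simp only [sim, one_smul, LinearIsometryEquiv.coe_refl, id_eq, PiLp.add_apply, add_sub_cancel_right, one_pow, inv_one, one_mul] at e
  simp only [sim, one_smul, LinearIsometryEquiv.coe_refl, id_eq]
  rw [e]; exact this
theorem W_small {C d : ℝ} {F : Set (Euc n)} (hF : Cand n d F) (hc : Cent n C d F) : Wd F ≤ 4 * n * C * √d := by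
  set k : ℝ → ℝ := fun r => (clp r)^2 / 4 with hk
  have hkl : LipschitzWith 1 k := by
    refine LipschitzWith.of_dist_le_mul fun x y => ?_
    have h1 := clp_lip.dist_le_mul x y
    rw [Real.dist_eq, Real.dist_eq, NNReal.coe_one, one_mul] at h1 ⊢
    refine le_trans ?_ h1
    rw [hk]; simp only
    rw [show (clp x)^2/4 - (clp y)^2/4 = (clp x - clp y) * ((clp x + clp y)/4) by ring, abs_mul]
    refine mul_le_of_le_one_right (abs_nonneg _) ?_
    have a1 := abs_le.1 (clp_abs x); have a2 := abs_le.1 (clp_abs y)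
    rw [abs_le]; constructor <;> linarith [a1.1, a1.2, a2.1, a2.2]
  have hk1 : ∀ r, 0 ≤ k r ∧ k r ≤ 1 := fun r => by
    have a1 := abs_le.1 (clp_abs r)
    simp only [hk]
    constructor
    · positivity
    · nlinarith [a1.1, a1.2]
  have hk2 : ∀ r, |k r| ≤ 2 := fun r => by rw [abs_of_nonneg (hk1 r).1]; linarith [(hk1 r).2]
  have hkc := hkl.continuous
  set S : Euc n → ℝ := fun x => ∑ i, k (x i) with hS
  have hSc : Continuous S := by simp only [hS]; fun_prop
  have hS0 : ∀ x, 0 ≤ S x := fun x => Finset.sum_nonneg fun i _ => (hk1 _).1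
  have hSn : ∀ x, |S x| ≤ n := fun x => by
    rw [abs_of_nonneg (hS0 x)]
    simpa using Finset.sum_le_sum fun (i : Fin n) (_ : i ∈ Finset.univ) => (hk1 (x i)).2
  have hSb : ∀ x : Euc n, ‖x‖ ≤ 2 → S x = ‖x‖^2/4 := fun x hx => by
    rw [EuclideanSpace.norm_sq_eq, Finset.sum_div]
    refine Finset.sum_congr rfl fun i _ => ?_
    have := (PiLp.norm_apply_le x i).trans hx
    simp only [hk]; rw [clp_eq this, Real.norm_eq_abs, sq_abs]
  have hSo : ∀ x : Euc n, 2 ≤ ‖x‖ → 1 ≤ S x := fun x hx => by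
    by_cases h : ∀ i, |x i| ≤ 2
    · have : S x = ‖x‖^2/4 := by
        rw [EuclideanSpace.norm_sq_eq, Finset.sum_div]
        refine Finset.sum_congr rfl fun i _ => ?_
        simp only [hk]; rw [clp_eq (h i), Real.norm_eq_abs, sq_abs]
      rw [this]; nlinarith
    · push Not at h
      obtain ⟨i, hi⟩ := h
      have : k (x i) = 1 := by
        simp only [hk, clp]
        rcases lt_abs.1 hi with h1 | h1
        · rw [min_eq_left h1.le]; norm_num
        · rw [min_eq_right (by linarith), max_eq_left (by linarith)]; norm_num
      rw [← this]
      exact Finset.single_le_sum (f := fun i => k (x i)) (fun i _ => (hk1 _).1) (Finset.mem_univ i)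
  have hpt : ∀ x, |phi F x| * rho x ≤ 4 * (phi F x * S x) - phi F x := by
    intro x
    rw [show 4 * (phi F x * S x) - phi F x = phi F x * (4 * S x - 1) by ring, phi_sign F x (c := 4 * S x - 1)
      (fun h => by rw [hSb x (by linarith)]; nlinarith [norm_nonneg x])
      (fun h => by
        rcases le_total ‖x‖ 2 with h2 | h2
        · rw [hSb x h2]; nlinarith
        · linarith [hSo x h2])]
    refine mLe ?_ (abs_nonneg _)
    rcases le_total ‖x‖ 2 with h2 | h2
    · rw [hSb x h2, show 4 * (‖x‖^2/4) - 1 = -(1 - ‖x‖^2) by ring, abs_neg]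
      exact div_le_self (abs_nonneg _) (by nlinarith [sq_nonneg ‖x‖])
    · refine (rho_le x).trans ((by linarith [hSo x h2] : (1:ℝ) ≤ 4 * S x - 1).trans (le_abs_self _))
  have i1 := bd_int (phi_int hF) hSc hSn
  have := integral_mono (Wd_int hF) ((i1.const_mul 4).sub (phi_int hF)) hpt
  simp only [Pi.sub_apply] at this
  rw [integral_sub (i1.const_mul 4) (phi_int hF), phi_zero hF, sub_zero, integral_const_mul] at this
  have e : ∫ x, phi F x * S x = ∑ i, ∫ x, phi F x * k (x i) := by
    simp only [hS, Finset.mul_sum]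
    exact integral_finsetSum _ fun i _ => bd_int (phi_int hF) (by fun_prop) fun x => hk2 _
  have e2 : ∑ i, ∫ x, phi F x * k (x i) ≤ n * (C * √d) := by
    have := Finset.sum_le_sum fun (i : Fin n) (_ : i ∈ Finset.univ) => (le_abs_self _).trans (hc i k hkl hk2)
    simpa using this
  unfold Wd
  nlinarith
theorem rho_far {x : Euc n} (h : 2 ≤ ‖x‖) : 1 ≤ 5 / 3 * rho x := by
  unfold rho
  rw [abs_of_nonpos (by nlinarith), mul_div_assoc', le_div_iff₀ (by positivity)]; nlinarith
theorem ridge2 (hm : 1 ≤ m) (C₀ : ℝ) (hC₀ : 0 < C₀) : ∃ C : ℝ, 0 < C ∧ ∀ (F : Set Ec m) (d : ℝ), 0 < d → d ≤ 1 → Cand (m+1) d F →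
    Cent (m+1) C₀ d F → ∀ θ : Ec m, ‖θ‖ = 1 → ∀ k : ℝ → ℝ, LipschitzWith 1 k → (∀ r, |k r| ≤ 2) →
    |∫ x, phi F x * k (inner ℝ θ x)| ≤ C * √d := by
  obtain ⟨C, hC, h⟩ := ridge hm
  set N : ℝ := ((m+1 : ℕ) : ℝ) with hN
  have hN0 : 0 ≤ N := Nat.cast_nonneg _
  set C2 : ℝ := (2 + 2 * N) * (5/3) * (4 * N * C₀) + N * C₀ with hC2
  have hC20 : 0 ≤ C2 := by positivity
  refine ⟨C + 4 * (C + C2), by positivity, fun F d hd hd1 hF hc θ hθ k hk hk2 => ?_⟩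
  obtain ⟨t, ht⟩ := h F d hd hd1 hF θ hθ
  have hW := W_small hF hc
  have hclc := clp_lip.continuous
  have hkc := hk.continuous
  have hin : ∀ x : Ec m, |(inner ℝ θ x : ℝ)| ≤ ‖x‖ := fun x => by
    have := abs_real_inner_le_norm θ x; rwa [hθ, one_mul] at this
  have hθi : ∀ i, |θ i| ≤ 1 := fun i => by have := PiLp.norm_apply_le θ i; rwa [hθ] at this
  -- step 1
  have s1 : |∫ x, phi F x * clp (inner ℝ θ x)| ≤ C2 * √d := by
    set ψ : Ec m → ℝ := fun x => clp (inner ℝ θ x) - ∑ i, θ i * clp (x i) with hψ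
    have hψc : Continuous ψ := by simp only [hψ]; fun_prop
    have hsum : ∀ x : Ec m, |∑ i, θ i * clp (x i)| ≤ 2 * N := fun x => by
      refine (Finset.abs_sum_le_sum_abs _ _).trans ?_
      have : ∀ i ∈ Finset.univ, |θ i * clp (x i)| ≤ 2 := fun i _ => by
        rw [abs_mul]; nlinarith [hθi i, clp_abs (x i), abs_nonneg (θ i), abs_nonneg (clp (x i))]
      have := Finset.sum_le_sum this
      rw [Finset.sum_const, Finset.card_univ, Fintype.card_fin, nsmul_eq_mul] at this; linarith
    have hψb : ∀ x, |ψ x| ≤ 2 + 2 * N := fun x => (abs_sub _ _).trans (add_le_add (clp_abs _) (hsum x))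
    have hψ0 : ∀ x, ‖x‖ ≤ 2 → ψ x = 0 := fun x hx => by
      simp only [hψ]
      rw [clp_eq ((hin x).trans hx), sub_eq_zero, PiLp.inner_apply]
      refine Finset.sum_congr rfl fun i _ => ?_
      rw [clp_eq ((PiLp.norm_apply_le x i).trans hx)]; simp [mul_comm]
    have b1 : |∫ x, phi F x * ψ x| ≤ (2 + 2 * N) * (5/3) * Wd F := by
      rw [Wd, ← integral_const_mul, ← Real.norm_eq_abs]
      refine norm_integral_le_of_norm_le ((Wd_int hF).const_mul _) (ae_of_all _ fun x => ?_)
      rw [Real.norm_eq_abs, abs_mul]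
      rcases le_total ‖x‖ 2 with hx | hx
      · rw [hψ0 x hx]; simp; exact mul_nonneg (by positivity) (mul_nonneg (abs_nonneg _) (rho_nonneg x))
      · have := rho_far hx
        have h2 := abs_nonneg (phi F x)
        calc |phi F x| * |ψ x| ≤ |phi F x| * (2 + 2 * N) * 1 := by rw [mul_one]; exact mLe (hψb x) h2
          _ ≤ |phi F x| * (2 + 2 * N) * (5/3 * rho x) := mLe this (by positivity)
          _ = _ := by ring
    have e : ∫ x, phi F x * clp (inner ℝ θ x) = (∫ x, phi F x * ψ x) + ∑ i, θ i * ∫ x, phi F x * clp (x i) := by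
      have i1 : ∀ i ∈ Finset.univ, Integrable fun x : Ec m => θ i * (phi F x * clp (x i)) := fun i _ =>
        (bd_int (phi_int hF) (by fun_prop) (fun x => clp_abs (x i))).const_mul _
      simp only [← integral_const_mul]
      rw [← integral_finsetSum _ i1, ← integral_add (bd_int (phi_int hF) hψc hψb) (integrable_finsetSum _ i1)]
      congr 1; ext x; simp only [hψ, mul_sub, Finset.mul_sum]
      rw [Finset.sum_congr rfl fun i _ => show phi F x * (θ i * clp (x i)) = θ i * (phi F x * clp (x i)) by ring]; ring
    have b2 : |∑ i, θ i * ∫ x, phi F x * clp (x i)| ≤ N * (C₀ * √d) := by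
      refine (Finset.abs_sum_le_sum_abs _ _).trans ?_
      have : ∀ i ∈ Finset.univ, |θ i * ∫ x, phi F x * clp (x i)| ≤ C₀ * √d := fun i _ => by
        rw [abs_mul]
        exact (mul_le_of_le_one_left (abs_nonneg _) (hθi i)).trans (hc i clp clp_lip clp_abs)
      have := Finset.sum_le_sum this
      rw [Finset.sum_const, Finset.card_univ, Fintype.card_fin, nsmul_eq_mul] at this; linarith
    rw [e]; refine (abs_add_le _ _).trans ?_
    have : (2 + 2 * N) * (5/3) * Wd F ≤ (2 + 2 * N) * (5/3) * (4 * N * C₀ * √d) := mLe hW (by positivity)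
    rw [hC2]; linarith
  have bI : ∀ ψ : Ec m → ℝ, Continuous ψ → IntegrableOn ψ (ball 0 1) := fun ψ hψ =>
    (hψ.continuousOn.integrableOn_compact (isCompact_closedBall 0 1)).mono_set ball_subset_closedBall
  have hin1 : ∀ x ∈ Bu m, |(inner ℝ θ x : ℝ)| ≤ 1 := fun x hx => (hin x).trans (by simpa using (mem_ball_zero_iff.1 hx).le)
  have eB : ∫ x in Bu m, clp (inner ℝ θ x) = 0 := by
    rw [← ball_odd θ]
    exact setIntegral_congr_fun msB fun x hx => clp_eq ((hin1 x hx).trans (by norm_num))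
  have s2 : |∫ x in Bu m, clp (inner ℝ θ x + t)| ≤ (C + C2) * √d := by
    have h1 := ht clp clp_lip clp_abs
    rw [phi_mul hF (by fun_prop) (fun x => clp_abs _), eB, sub_zero] at s1
    rw [abs_le] at h1 s1 ⊢; constructor <;> linarith [h1.1, h1.2, s1.1, s1.2]
  set w := ballVol (m+1) with hw
  have hw0 : 0 ≤ w := ENNReal.toReal_nonneg
  have cI : ∀ c : ℝ, ∫ x in Bu m, c = w * c := fun c => by
    rw [setIntegral_const]; rfl
  have s3 : w * min |t| 1 ≤ (C + C2) * √d := by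
    refine le_trans ?_ s2
    have lin : ∀ c : ℝ, ∫ x in Bu m, ((inner ℝ θ x : ℝ) + c) = w * c := fun c => by
      rw [integral_add (bI _ (by fun_prop)) (bI _ continuous_const), ball_odd, zero_add, cI]
    rcases le_total 0 t with h0 | h0
    · rw [abs_of_nonneg h0, ← lin]
      refine le_trans (setIntegral_mono_on (bI _ (by fun_prop)) (bI _ (by fun_prop)) msB fun x hx => ?_) (le_abs_self _)
      have := abs_le.1 (hin1 x hx)
      rw [← clp_eq (r := (inner ℝ θ x : ℝ) + min t 1) (abs_le.2 ⟨by linarith [this.1, le_min h0 zero_le_one], by linarith [this.2, min_le_right t 1]⟩)]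
      exact clp_mono (by linarith [min_le_left t 1])
    · rw [abs_of_nonpos h0, ← neg_neg (w * _), ← mul_neg, ← lin]
      refine le_trans (neg_le_neg (setIntegral_mono_on (bI _ (by fun_prop)) (bI _ (by fun_prop)) msB fun x hx => ?_)) (neg_le_abs _)
      have := abs_le.1 (hin1 x hx)
      rw [← clp_eq (r := (inner ℝ θ x : ℝ) + -min (-t) 1) (abs_le.2 ⟨by linarith [this.1, min_le_right (-t) 1], by linarith [this.2, le_min (neg_nonneg.2 h0) zero_le_one]⟩)]
      exact clp_mono (by linarith [min_le_left (-t) 1])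
  have s4 : |(∫ x in Bu m, k (inner ℝ θ x + t)) - ∫ x in Bu m, k (inner ℝ θ x)| ≤ 4 * (w * min |t| 1) := by
    rw [← integral_sub (bI _ (by fun_prop)) (bI _ (by fun_prop)), ← Real.norm_eq_abs]
    refine (norm_setIntegral_le_of_norm_le_const (C := 4 * min |t| 1) measure_ball_lt_top fun x hx => ?_).trans (le_of_eq ?_)
    · rw [Real.norm_eq_abs]
      rcases le_total |t| 1 with h1 | h1
      · rw [min_eq_left h1]
        have := hk.dist_le_mul (inner ℝ θ x + t) (inner ℝ θ x)
        rw [Real.dist_eq, Real.dist_eq, NNReal.coe_one, one_mul, add_sub_cancel_left] at this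
        linarith [abs_nonneg t]
      · rw [min_eq_right h1]
        exact (abs_sub _ _).trans (by linarith [hk2 (inner ℝ θ x + t), hk2 (inner ℝ θ x)])
    · change 4 * min |t| 1 * w = _; ring
  have h1 := ht k hk hk2
  rw [phi_mul hF (by fun_prop) (fun x => hk2 _)]
  rw [abs_le] at h1 s4 ⊢; constructor <;> linarith [h1.1, h1.2, s4.1, s4.2]
theorem trig (hm : 1 ≤ m) (C₀ : ℝ) (hC₀ : 0 < C₀) : ∃ C : ℝ, 0 < C ∧ ∀ (F : Set Ec m) (d : ℝ), 0 < d → d ≤ 1 → Cand (m+1) d F →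
    Cent (m+1) C₀ d F → ∀ v : Ec m, |∫ x, phi F x * Real.cos (inner ℝ v x)| ≤ C * (1 + ‖v‖) * √d ∧
      |∫ x, phi F x * Real.sin (inner ℝ v x)| ≤ C * (1 + ‖v‖) * √d := by
  obtain ⟨C, hC, h⟩ := ridge2 hm C₀ hC₀
  refine ⟨C, hC, fun F d hd hd1 hF hc v => ?_⟩
  have key : ∀ g : ℝ → ℝ, LipschitzWith 1 g → (∀ r, |g r| ≤ 1) → |∫ x, phi F x * g (inner ℝ v x)| ≤ C * (1 + ‖v‖) * √d := by
    intro g hg hg1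
    obtain ⟨θ, hθ, hv⟩ : ∃ θ : Ec m, ‖θ‖ = 1 ∧ v = ‖v‖ • θ := by
      by_cases h0 : v = 0
      · exact ⟨EuclideanSpace.single 0 1, by simp, by simp [h0]⟩
      · have : ‖v‖ ≠ 0 := norm_ne_zero_iff.2 h0
        exact ⟨‖v‖⁻¹ • v, by rw [norm_smul, norm_inv, norm_norm, inv_mul_cancel₀ this], by rw [smul_smul, mul_inv_cancel₀ this, one_smul]⟩
    set a := ‖v‖
    have ha : 0 ≤ a := norm_nonneg v
    have := h F d hd hd1 hF hc θ hθ (fun r => g (a * r) / (1 + a)) (LipschitzWith.of_dist_le_mul fun x y => by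
        have := hg.dist_le_mul (a * x) (a * y)
        rw [Real.dist_eq, Real.dist_eq, NNReal.coe_one, one_mul, ← mul_sub, abs_mul, abs_of_nonneg ha] at this
        rw [Real.dist_eq, Real.dist_eq, NNReal.coe_one, one_mul, ← sub_div, abs_div, abs_of_pos (by positivity : 0 < 1 + a), div_le_iff₀ (by positivity)]
        nlinarith [abs_nonneg (x - y)]) (fun r => by
        rw [abs_div, abs_of_pos (by positivity : 0 < 1 + a), div_le_iff₀ (by positivity)]; linarith [hg1 (a * r)])
    have e : ∫ x, phi F x * (g (a * inner ℝ θ x) / (1 + a)) = (∫ x, phi F x * g (inner ℝ v x)) / (1 + a) := by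
      rw [← integral_div]; congr 1; ext x; rw [hv, real_inner_smul_left]; ring
    rw [e, abs_div, abs_of_pos (by positivity : 0 < 1 + a), div_le_iff₀ (by positivity)] at this
    linarith
  exact ⟨key _ Real.lipschitzWith_cos Real.abs_cos_le_one, key _ Real.lipschitzWith_sin Real.abs_sin_le_one⟩
theorem lipPush {f : Euc n → Euc n} {A S : Set (Euc n)} {K : NNReal} (hf : LipschitzOnWith K f A) (hfm : Measurable f)
    (hA : MS A) (hSA : S ⊆ f '' A) {H : Euc n → ℝ≥0∞} (hH : Measurable H) :
    ∫⁻ y in S, H y ≤ (K : ℝ≥0∞)^n * ∫⁻ x in A, H (f x) := by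
  have hv : ∀ T : Set (Euc n), T ⊆ A → volume (f '' T) ≤ (K : ℝ≥0∞)^n * volume T := by
    intro T hT
    haveI : Measure.IsAddHaarMeasure (Measure.hausdorffMeasure (Module.finrank ℝ (Euc n)) : Measure (Euc n)) := isAddHaarMeasure_hausdorffMeasure
    have e := Measure.isAddLeftInvariant_eq_smul (volume : Measure (Euc n)) (Measure.hausdorffMeasure (Module.finrank ℝ (Euc n)) : Measure (Euc n))
    have h := (hf.mono hT).hausdorffMeasure_image_le (d := Module.finrank ℝ (Euc n)) (Nat.cast_nonneg _)
    rw [e, Measure.smul_apply, Measure.smul_apply, ENNReal.smul_def, ENNReal.smul_def, smul_eq_mul, smul_eq_mul, mul_left_comm]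
    refine mul_le_mul_right (h.trans (le_of_eq ?_)) _
    simp
  have hle : volume.restrict S ≤ (K : ℝ≥0∞)^n • (volume.restrict A).map f := by
    refine Measure.le_iff.2 fun T hT => ?_
    rw [Measure.restrict_apply hT, Measure.smul_apply, Measure.map_apply hfm hT, Measure.restrict_apply (hfm hT), smul_eq_mul]
    refine le_trans (measure_mono ?_) (hv _ inter_subset_right)
    rintro y ⟨hy, hyS⟩
    obtain ⟨x, hx, rfl⟩ := hSA hyS
    exact ⟨x, ⟨hy, hx⟩, rfl⟩
  refine (lintegral_mono' hle le_rfl).trans ?_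
  rw [lintegral_smul_measure, lintegral_map hH hfm, smul_eq_mul]
def Lh (e h : Euc n) : Euc n →L[ℝ] Euc n :=
  (inner ℝ e h : ℝ) • ContinuousLinearMap.id ℝ _ + (innerSL ℝ e).smulRight h - (innerSL ℝ h).smulRight e
theorem Lh_apply (e h p : Euc n) : Lh e h p = (inner ℝ e h : ℝ) • p + (inner ℝ e p : ℝ) • h - (inner ℝ h p : ℝ) • e := by
  simp [Lh]
theorem Lh_inner (e h p : Euc n) : inner ℝ (Lh e h p) p = (inner ℝ e h : ℝ) * ‖p‖^2 := by
  rw [Lh_apply, inner_sub_left, inner_add_left, real_inner_smul_left, real_inner_smul_left, real_inner_smul_left, real_inner_self_eq_norm_sq]; ring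
theorem Lh_norm {e : Euc n} (he : ‖e‖ = 1) (h p : Euc n) : ‖Lh e h p‖ ≤ 3 * ‖h‖ * ‖p‖ := by
  rw [Lh_apply]
  have h1 := norm_sub_le ((inner ℝ e h : ℝ) • p + (inner ℝ e p : ℝ) • h) ((inner ℝ h p : ℝ) • e)
  have h2 := norm_add_le ((inner ℝ e h : ℝ) • p) ((inner ℝ e p : ℝ) • h)
  rw [norm_smul, norm_smul] at h2
  rw [norm_smul, he, mul_one] at h1
  have a1 := norm_inner_le_norm (𝕜 := ℝ) e h
  have a2 := norm_inner_le_norm (𝕜 := ℝ) e p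
  have a3 := norm_inner_le_norm (𝕜 := ℝ) h p
  rw [he, one_mul] at a1 a2
  nlinarith [mRi a1 (norm_nonneg p), mRi a2 (norm_nonneg h)]
theorem Lh_sub (e h h' : Euc n) : Lh e h - Lh e h' = Lh e (h - h') := by
  ext1 p; rw [ContinuousLinearMap.sub_apply, Lh_apply, Lh_apply, Lh_apply]
  simp only [inner_sub_left, inner_sub_right]; module
theorem Lh_cont (e : Euc n) : Continuous (Lh e) := by
  unfold Lh
  have h1 : Continuous fun h : Euc n => (innerSL ℝ e).smulRight h := (ContinuousLinearMap.smulRightL ℝ (Euc n) (Euc n) (innerSL ℝ e)).continuous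
  have h2 : Continuous fun h : Euc n => (innerSL ℝ h).smulRight e :=
    ((ContinuousLinearMap.smulRightL ℝ (Euc n) (Euc n)).flip e).continuous.comp (innerSL ℝ).continuous
  fun_prop
def Tf (e h : Euc n) (t : ℝ) : Euc n →L[ℝ] Euc n := NormedSpace.exp (t • Lh e h)
theorem Tf_cont (e : Euc n) : Continuous fun q : (ℝ × Euc n) × Euc n => Tf e q.1.2 q.1.1 q.2 := by
  unfold Tf
  letI : NormedAlgebra ℚ (Euc n →L[ℝ] Euc n) := NormedAlgebra.restrictScalars ℚ ℝ _
  have h1 : Continuous fun q : (ℝ × Euc n) × Euc n => NormedSpace.exp (q.1.1 • Lh e q.1.2) :=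
    NormedSpace.exp_continuous.comp ((continuous_fst.comp continuous_fst).smul ((Lh_cont e).comp (continuous_snd.comp continuous_fst)))
  exact h1.clm_apply continuous_snd
theorem Tf_zero (e h x : Euc n) : Tf e h 0 x = x := by
  unfold Tf
  have : (0:ℝ) • Lh e h = 0 := ContinuousLinearMap.ext fun p => zero_smul ℝ (Lh e h p)
  rw [this, NormedSpace.exp_zero]; rfl
theorem Tf_deriv (e h x : Euc n) (t : ℝ) : HasDerivAt (fun t => Tf e h t x) (Lh e h (Tf e h t x)) t := by
  have := (hasDerivAt_exp_smul_const' (𝕂 := ℝ) (Lh e h) t).clm_apply (hasDerivAt_const t x)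
  simpa [Tf] using this
theorem Tf_inv (e h x : Euc n) (t : ℝ) : Tf e h t (Tf e h (-t) x) = x := by
  have : Tf e h t * Tf e h (-t) = 1 := by
    unfold Tf
    letI : NormedAlgebra ℚ (Euc n →L[ℝ] Euc n) := NormedAlgebra.restrictScalars ℚ ℝ _
    have e1 : (-t) • Lh e h = -(t • Lh e h) := ContinuousLinearMap.ext fun p => neg_smul t (Lh e h p)
    rw [e1]
    have e2 : Commute (t • Lh e h) (-(t • Lh e h)) := by
      unfold Commute SemiconjBy; ext1 p; simp
    have e3 : t • Lh e h + -(t • Lh e h) = 0 := ContinuousLinearMap.ext fun p => add_neg_cancel _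
    rw [← NormedSpace.exp_add_of_commute e2, e3, NormedSpace.exp_zero]
  exact congrArg (fun T : Euc n →L[ℝ] Euc n => T x) this
theorem Tf_norm (e h x : Euc n) (t : ℝ) : ‖Tf e h t x‖ = Real.exp (t * inner ℝ e h) * ‖x‖ := by
  set a : ℝ := inner ℝ e h with ha
  have hd : ∀ t, HasDerivAt (fun t => Real.exp (-(2 * a) * t) * ‖Tf e h t x‖^2) 0 t := fun t => by
    have h1 := ((hasDerivAt_id t).const_mul (-(2 * a))).exp
    have h2 := (Tf_deriv e h x t).norm_sq
    have h3 := h1.mul h2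
    rw [real_inner_comm, Lh_inner] at h3
    refine h3.congr_deriv ?_
    simp only [id]; ring
  have hc := is_const_of_deriv_eq_zero (fun t => (hd t).differentiableAt) (fun t => (hd t).deriv) t 0
  simp only [mul_zero, Real.exp_zero, one_mul, Tf_zero] at hc
  rw [← sq_eq_sq₀ (norm_nonneg _) (by positivity), mul_pow, ← hc, ← mul_assoc, ← Real.exp_nat_mul, ← Real.exp_add]
  rw [show ((2:ℕ):ℝ) * (t * a) + -(2 * a) * t = 0 by push_cast; ring, Real.exp_zero, one_mul]
theorem Tf_uniq (e h : Euc n) {G : ℝ → Euc n} (hG : ∀ t, HasDerivAt G (Lh e h (G t)) t) : G 1 = Tf e h 1 (G 0) := by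
  have hd : ∀ t : ℝ, HasDerivAt (fun t => Tf e h (-t) (G t)) 0 t := fun t => by
    have h1 : HasDerivAt (fun t => Tf e h (-t)) (-(Tf e h (-t) * Lh e h)) t := by
      have := (hasDerivAt_exp_smul_const (𝕂 := ℝ) (Lh e h) (-t)).scomp t (hasDerivAt_neg t)
      rw [neg_one_smul] at this
      exact this
    have := h1.clm_apply (hG t)
    simpa using this
  have hc := is_const_of_deriv_eq_zero (fun t => (hd t).differentiableAt) (fun t => (hd t).deriv) 1 0
  simp only [neg_zero, Tf_zero] at hc
  rw [← hc, Tf_inv]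
theorem Tf_lip {e : Euc n} (he : ‖e‖ = 1) {h h' : Euc n} (hh : ‖h‖ ≤ 1) (hh' : ‖h'‖ ≤ 1) (x : Euc n) {t : ℝ} (ht : t ∈ Icc (0:ℝ) 1) :
    ‖Tf e h t x - Tf e h' t x‖ ≤ 9 * ‖h - h'‖ * ‖x‖ := by
  have hd : ∀ s : ℝ, HasDerivAt (fun s => Tf e h' (t - s) (Tf e h s x)) (Tf e h' (t - s) (Lh e (h - h') (Tf e h s x))) s := fun s => by
    have h1 : HasDerivAt (fun s => Tf e h' (t - s)) (-(Tf e h' (t - s) * Lh e h')) s := by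
      have := (hasDerivAt_exp_smul_const (𝕂 := ℝ) (Lh e h') (t - s)).scomp s ((hasDerivAt_id s).const_sub t)
      simpa [Tf, Function.comp_def] using this
    have := h1.clm_apply (Tf_deriv e h x s)
    refine this.congr_deriv ?_
    rw [← Lh_sub]; simp only [ContinuousLinearMap.sub_apply, map_sub, ContinuousLinearMap.neg_apply, ContinuousLinearMap.mul_apply']
    exact neg_add_eq_sub _ _
  have hi : ∀ g : Euc n, ‖g‖ ≤ 1 → (inner ℝ e g : ℝ) ≤ 1 := fun g hg => by
    have := real_inner_le_norm e g; rw [he, one_mul] at this; linarith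
  have hb : ∀ s ∈ Ico (0:ℝ) t, ‖Tf e h' (t - s) (Lh e (h - h') (Tf e h s x))‖ ≤ 9 * ‖h - h'‖ * ‖x‖ := fun s hs => by
    rw [Tf_norm]
    have h1 := Lh_norm he (h - h') (Tf e h s x)
    rw [Tf_norm] at h1
    have hE : Real.exp ((t - s) * inner ℝ e h') * Real.exp (s * inner ℝ e h) ≤ 3 := by
      rw [← Real.exp_add]
      refine (Real.exp_le_exp.2 (?_ : _ ≤ (1:ℝ))).trans (by linarith [Real.exp_one_lt_d9])
      nlinarith [hi h hh, hi h' hh', hs.1, hs.2, ht.2]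
    calc _ ≤ Real.exp ((t - s) * inner ℝ e h') * (3 * ‖h - h'‖ * (Real.exp (s * inner ℝ e h) * ‖x‖)) := mLe h1 (Real.exp_pos _).le
      _ = (Real.exp ((t - s) * inner ℝ e h') * Real.exp (s * inner ℝ e h)) * (3 * ‖h - h'‖ * ‖x‖) := by ring
      _ ≤ 3 * (3 * ‖h - h'‖ * ‖x‖) := mRi hE (by positivity)
      _ = _ := by ring
  have := norm_image_sub_le_of_norm_deriv_le_segment' (a := 0) (b := t) (fun s _ => (hd s).hasDerivWithinAt) hb t ⟨ht.1, le_rfl⟩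
  simp only [sub_self, sub_zero, Tf_zero] at this
  have e0 : Tf e h' t x = Tf e h' t x := rfl
  refine this.trans (mul_le_of_le_one_right (by positivity) ht.2)
theorem Tf_push (e h : Euc n) {t : ℝ} (ht : 0 ≤ t * inner ℝ e h) {f : Euc n → ℝ≥0∞} (hf : Measurable f) :
    ∫⁻ x, f (Tf e h t x) ≤ ∫⁻ x, f x := by
  have hl : LipschitzOnWith 1 (Tf e h (-t)) univ := LipschitzOnWith.of_dist_le_mul fun x _ y _ => by
    rw [dist_eq_norm, ← map_sub, Tf_norm, NNReal.coe_one, dist_eq_norm]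
    refine mRi (Real.exp_le_one_iff.2 (by linarith)) (norm_nonneg _)
  have := lipPush (S := univ) hl (Tf e h (-t)).continuous.measurable MeasurableSet.univ (fun y _ => ⟨Tf e h t y, mem_univ _, by
    have := Tf_inv e h y (-t); rwa [neg_neg] at this⟩) (hf.comp (Tf e h t).continuous.measurable)
  simpa [Tf_inv] using this
set_option maxHeartbeats 1000000 in
theorem Tf_surj {e : Euc n} (he : ‖e‖ = 1) {c : ℝ} (hc : 0 < c) (hc1 : c ≤ 1) {x y : Euc n} (hx0 : 0 < ‖x‖) (hx : c * ‖x‖ ≤ inner ℝ e x)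
    (hxy : ‖x‖ < ‖y‖) (hd : ‖y - x‖ ≤ c/4 * ‖x‖) : ∃ h : Euc n, 0 < (inner ℝ e h : ℝ) ∧ Tf e h 1 x = y ∧ ‖h‖ * ‖x‖ ≤ 5 / c * ‖y - x‖ := by
  have hy0 : 0 < ‖y‖ := hx0.trans hxy
  have hee : (inner ℝ e e : ℝ) = 1 := by rw [real_inner_self_eq_norm_sq, he]; norm_num
  obtain ⟨a, ha⟩ : ∃ q, q = (Real.log (‖y‖ / ‖x‖)) := ⟨_, rfl⟩
  have ha0 : 0 < a := by rw [ha]; exact Real.log_pos (by rwa [one_lt_div hx0])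
  have hea : Real.exp a = ‖y‖ / ‖x‖ := by rw [ha]; exact Real.exp_log (by positivity)
  have ha1 : a * ‖x‖ ≤ ‖y - x‖ := by
    have h1 := Real.log_le_sub_one_of_pos (by positivity : 0 < ‖y‖ / ‖x‖)
    rw [← ha] at h1
    have h2 : a * ‖x‖ ≤ (‖y‖ / ‖x‖ - 1) * ‖x‖ := mRi h1 hx0.le
    rw [sub_mul, div_mul_cancel₀ _ hx0.ne', one_mul] at h2
    linarith [norm_sub_norm_le y x]
  obtain ⟨z, hz⟩ : ∃ q, q = (((‖x‖ / ‖y‖) • y) : Euc n) := ⟨_, rfl⟩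
  have hzn : ‖z‖ = ‖x‖ := by rw [hz, norm_smul, Real.norm_of_nonneg (by positivity), div_mul_cancel₀ _ hy0.ne']
  have hzy : Real.exp a • z = y := by rw [hz, hea, smul_smul, div_mul_div_cancel₀ hx0.ne', div_self hy0.ne', one_smul]
  obtain ⟨D, hD⟩ : ∃ q, q = (z - x) := ⟨_, rfl⟩
  have hDn : ‖D‖ ≤ 2 * ‖y - x‖ := by
    have h1 : z - y = (‖x‖ / ‖y‖ - 1) • y := by rw [hz]; module
    have h2 : ‖z - y‖ = ‖y‖ - ‖x‖ := by
      rw [h1, norm_smul, Real.norm_of_nonpos (by rw [sub_nonpos, div_le_one hy0]; exact hxy.le)]; field_simp; ring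
    calc ‖D‖ = ‖(z - y) + (y - x)‖ := by rw [hD]; congr 1; abel
      _ ≤ _ := norm_add_le _ _
      _ ≤ _ := by rw [h2]; linarith [norm_sub_norm_le y x]
  obtain ⟨w, hw⟩ : ∃ q, q = ((inner ℝ e x + inner ℝ e D / 2) : ℝ) := ⟨_, rfl⟩
  have heD : |(inner ℝ e D : ℝ)| ≤ ‖D‖ := by have := abs_real_inner_le_norm e D; rwa [he, one_mul] at this
  have hwc : c/2 * ‖x‖ ≤ w := by have := (abs_le.1 heD).1; rw [hw]; nlinarith
  have hw0 : 0 < w := lt_of_lt_of_le (by positivity) hwc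
  obtain ⟨b, hb⟩ : ∃ q, q = ((w⁻¹ • (D - (inner ℝ e D : ℝ) • e)) : Euc n) := ⟨_, rfl⟩
  have heb : (inner ℝ e b : ℝ) = 0 := by
    rw [hb, real_inner_smul_right, inner_sub_right, real_inner_smul_right, hee]; ring
  have hDm : (inner ℝ D x : ℝ) + inner ℝ D D / 2 = 0 := by
    have h1 : (inner ℝ z z : ℝ) = inner ℝ x x := by rw [real_inner_self_eq_norm_sq, real_inner_self_eq_norm_sq, hzn]
    have h2 : z = D + x := by rw [hD]; abel
    rw [h2, inner_add_left, inner_add_right, inner_add_right, real_inner_comm D x] at h1; linarith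
  have hbm : (inner ℝ b x : ℝ) + inner ℝ b D / 2 = -inner ℝ e D := by
    rw [hb, real_inner_smul_left, real_inner_smul_left, inner_sub_left, inner_sub_left, real_inner_smul_left, real_inner_smul_left]
    have : (inner ℝ D x : ℝ) = - (inner ℝ D D / 2) := by linarith
    rw [this]; field_simp; rw [hw]; ring
  have hbn : ‖b‖ * ‖x‖ ≤ 4 / c * ‖y - x‖ := by
    have h1 : ‖D - (inner ℝ e D : ℝ) • e‖ ≤ ‖D‖ := by
      rw [← sq_le_sq₀ (norm_nonneg _) (norm_nonneg _), norm_sub_sq_real, norm_smul, he, real_inner_smul_right, real_inner_comm e D, Real.norm_eq_abs, mul_one, sq_abs]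
      nlinarith [sq_nonneg (inner ℝ e D : ℝ)]
    rw [hb, norm_smul, norm_inv, Real.norm_of_nonneg hw0.le, mul_assoc, inv_mul_le_iff₀ hw0]
    calc _ ≤ (2 * ‖y - x‖) * ‖x‖ := mRi (h1.trans hDn) hx0.le
      _ = (c/2 * ‖x‖) * (4 / c * ‖y - x‖) := by field_simp; ring
      _ ≤ _ := mRi hwc (by positivity)
  obtain ⟨u, hu⟩ : ∃ q, q = ((‖b‖⁻¹ • b) : Euc n) := ⟨_, rfl⟩
  have hbu : b = ‖b‖ • u := by
    by_cases h0 : b = 0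
    · simp [hu, h0]
    · rw [hu, smul_smul, mul_inv_cancel₀ (norm_ne_zero_iff.2 h0), one_smul]
  have heu : (inner ℝ e u : ℝ) = 0 := by rw [hu, real_inner_smul_right, heb, mul_zero]
  have hun : ‖u‖ ≤ 1 := by rw [hu, norm_smul, norm_inv, norm_norm]; exact inv_mul_le_one
  have huu : ∀ q : Euc n, (inner ℝ u u : ℝ) • q = q ∨ u = 0 := fun q => by
    by_cases h0 : b = 0
    · right; simp [hu, h0]
    · left; rw [real_inner_self_eq_norm_sq, hu, norm_smul, norm_inv, norm_norm, inv_mul_cancel₀ (norm_ne_zero_iff.2 h0)]; simp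
  obtain ⟨A, hA⟩ : ∃ q, q = (Lh e u) := ⟨_, rfl⟩
  have hAp : ∀ p, A p = (inner ℝ e p : ℝ) • u - (inner ℝ u p : ℝ) • e := fun p => by rw [hA, Lh_apply, heu, zero_smul, zero_add]
  have hA3 : ∀ p, A (A (A p)) = -A p := fun p => by
    rcases huu u with h | h
    · have h' : (inner ℝ u u : ℝ) = 1 ∨ u = 0 := by
        by_cases h0 : u = 0
        · exact Or.inr h0
        · left; exact smul_left_injective ℝ h0 (by simpa using h)
      rcases h' with h' | h'
      · simp only [hAp, inner_sub_right, real_inner_smul_right, hee, heu, real_inner_comm e u, h']; module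
      · simp [hAp, h']
    · simp [hAp, h]
  have hsk : ∀ p, (inner ℝ (A p) p : ℝ) = 0 := fun p => by rw [hA, Lh_inner, heu, zero_mul]
  obtain ⟨τ, hτ⟩ : ∃ q, q = (‖b‖ / 2) := ⟨_, rfl⟩
  have hτ0 : 0 ≤ τ := by rw [hτ]; positivity
  obtain ⟨θ, hθ⟩ : ∃ q, q = (2 * Real.arctan τ) := ⟨_, rfl⟩
  have hθ0 : 0 ≤ θ := by have := Real.arctan_nonneg.2 hτ0; rw [hθ]; positivity
  have hθb : θ ≤ ‖b‖ := by
    have := Real.le_tan (Real.arctan_nonneg.2 hτ0) (Real.arctan_lt_pi_div_two τ)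
    rw [Real.tan_arctan] at this; rw [hθ]; linarith
  have hp : 0 < 1 + τ^2 := by positivity
  have hs : Real.sin θ = 2 * τ / (1 + τ^2) := by
    rw [hθ, Real.sin_two_mul, Real.sin_arctan, Real.cos_arctan, mul_div_assoc', mul_one, mul_div_assoc', div_div, Real.mul_self_sqrt hp.le]
  have hcs : 1 - Real.cos θ = 2 * τ^2 / (1 + τ^2) := by
    rw [hθ, Real.cos_two_mul, Real.cos_arctan, div_pow, Real.sq_sqrt hp.le]
    field_simp; ring
  have hDA : D = τ • A (x + z) := by
    have hz2 : x + z = (2:ℝ) • (x + (2:ℝ)⁻¹ • D) := by rw [hD]; module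
    have h1 : ‖b‖ • A (x + (2:ℝ)⁻¹ • D) = D := by
      have : ‖b‖ • A (x + (2:ℝ)⁻¹ • D) = (inner ℝ e (x + (2:ℝ)⁻¹ • D) : ℝ) • b - (inner ℝ b (x + (2:ℝ)⁻¹ • D) : ℝ) • e := by
        rw [hAp]; conv_rhs => rw [hbu]
        rw [real_inner_smul_left]; module
      rw [this, inner_add_right, inner_add_right, real_inner_smul_right, real_inner_smul_right]
      rw [show (inner ℝ b x : ℝ) + 2⁻¹ * inner ℝ b D = -inner ℝ e D by rw [← hbm]; ring, show (inner ℝ e x : ℝ) + 2⁻¹ * inner ℝ e D = w by rw [hw]; ring,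
        hb, smul_smul, mul_inv_cancel₀ hw0.ne']; module
    rw [hz2, map_smul, smul_smul, hτ, div_mul_cancel₀ _ two_ne_zero, h1]
  have hR : x + Real.sin θ • A x + (1 - Real.cos θ) • A (A x) = z := by
    set R := x + Real.sin θ • A x + (1 - Real.cos θ) • A (A x) with hRd
    have h1 : R - τ • A R = x + τ • A x := by
      rw [hRd, map_add, map_add, map_smul, map_smul, hA3, hs, hcs]
      have e1 : 2 * τ / (1 + τ^2) - τ + τ * (2 * τ^2 / (1 + τ^2)) = τ := by field_simp; ring
      have e2 : 2 * τ^2 / (1 + τ^2) - τ * (2 * τ / (1 + τ^2)) = 0 := by field_simp; ring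
      calc _ = x + (2 * τ / (1 + τ^2) - τ + τ * (2 * τ^2 / (1 + τ^2))) • A x + (2 * τ^2 / (1 + τ^2) - τ * (2 * τ / (1 + τ^2))) • A (A x) := by module
        _ = _ := by rw [e1, e2]; module
    have h2 : z - τ • A z = x + τ • A x := by
      have : z = x + D := by rw [hD]; abel
      have h3 : D = τ • A x + τ • A z := by rw [← smul_add, ← map_add]; exact hDA
      calc z - τ • A z = x + D - τ • A z := by rw [← this]
        _ = _ := by rw [h3]; abel
    have h3 : (R - z) - τ • A (R - z) = 0 := by rw [map_sub, smul_sub, ← sub_eq_zero.2 (h1.trans h2.symm)]; abel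
    have h4 : (inner ℝ ((R - z) - τ • A (R - z)) (R - z) : ℝ) = 0 := by rw [h3, inner_zero_left]
    rw [inner_sub_left, real_inner_smul_left, hsk, mul_zero, sub_zero] at h4
    exact sub_eq_zero.1 (inner_self_eq_zero.1 h4)
  refine ⟨a • e + θ • u, ?_, ?_, ?_⟩
  · rw [inner_add_right, real_inner_smul_right, real_inner_smul_right, hee, heu]; linarith
  · have hL : ∀ p, Lh e (a • e + θ • u) p = a • p + θ • A p := fun p => by
      rw [Lh_apply, hAp, inner_add_right, real_inner_smul_right, real_inner_smul_right, hee, heu, inner_add_left, real_inner_smul_left, real_inner_smul_left]; module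
    have := Tf_uniq e (a • e + θ • u) (G := fun t => Real.exp (a * t) • (x + Real.sin (θ * t) • A x + (1 - Real.cos (θ * t)) • A (A x))) (fun t => by
      have d1 := ((hasDerivAt_id t).const_mul a).exp
      have d0 := (hasDerivAt_id t).const_mul θ
      have d2 := d0.sin.smul_const (A x)
      have d3 := (d0.cos.const_sub 1).smul_const (A (A x))
      refine (d1.smul ((d2.const_add x).add d3)).congr_deriv ?_
      rw [hL]; simp only [map_smul, map_add, hA3, id, Pi.add_apply]
      module)
    simp only [mul_one, mul_zero, Real.exp_zero, Real.sin_zero, Real.cos_zero, sub_self, zero_smul, add_zero, one_smul, hR, hzy] at this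
    exact this.symm
  · have h1 : ‖a • e + θ • u‖ ≤ a + ‖b‖ := by
      refine (norm_add_le _ _).trans ?_
      rw [norm_smul, norm_smul, he, Real.norm_of_nonneg ha0.le, Real.norm_of_nonneg hθ0]
      nlinarith [norm_nonneg u]
    have h2 : ‖y - x‖ ≤ 1 / c * ‖y - x‖ := le_mul_of_one_le_left (norm_nonneg _) (by rwa [one_le_div hc])
    calc _ ≤ (a + ‖b‖) * ‖x‖ := mRi h1 hx0.le
      _ ≤ 1 / c * ‖y - x‖ + 4 / c * ‖y - x‖ := by linarith
      _ = _ := by ring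
/-- inverse of `h ↦ Lh e h p` -/
def Li (e p v : Euc n) : Euc n := (inner ℝ e p : ℝ)⁻¹ • (v - (inner ℝ v p / ‖p‖^2 : ℝ) • p + (2 * (inner ℝ v p / ‖p‖^2) * inner ℝ e p - inner ℝ e v : ℝ) • e)
theorem Li_left {e p : Euc n} (he : ‖e‖ = 1) (hp : 0 < (inner ℝ e p : ℝ)) (h : Euc n) : Li e p (Lh e h p) = h := by
  have hp0 : ‖p‖^2 ≠ 0 := by
    intro h0; have : p = 0 := by simpa using h0
    rw [this, inner_zero_right] at hp; exact lt_irrefl _ hp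
  have hee : (inner ℝ e e : ℝ) = 1 := by rw [real_inner_self_eq_norm_sq, he]; norm_num
  unfold Li
  rw [Lh_inner, mul_div_cancel_right₀ _ hp0, Lh_apply, inner_sub_right, inner_add_right, real_inner_smul_right, real_inner_smul_right, real_inner_smul_right, hee]
  rw [show (inner ℝ e h : ℝ) • p + (inner ℝ e p : ℝ) • h - (inner ℝ h p : ℝ) • e - (inner ℝ e h : ℝ) • p +
    (2 * inner ℝ e h * inner ℝ e p - (inner ℝ e h * inner ℝ e p + inner ℝ e p * inner ℝ e h - inner ℝ h p * 1) : ℝ) • e = (inner ℝ e p : ℝ) • h by module]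
  rw [smul_smul, inv_mul_cancel₀ hp.ne', one_smul]
theorem Li_lip {e p : Euc n} (he : ‖e‖ = 1) {c : ℝ} (hc : 0 < c) (hp0 : 0 < ‖p‖) (hp : c * ‖p‖ ≤ inner ℝ e p) (v v' : Euc n) :
    ‖Li e p v - Li e p v'‖ ≤ 5 / (c * ‖p‖) * ‖v - v'‖ := by
  have hP : 0 < (inner ℝ e p : ℝ) := lt_of_lt_of_le (by positivity) hp
  have : Li e p v - Li e p v' = Li e p (v - v') := by
    unfold Li; simp only [inner_sub_left, inner_sub_right, sub_div]; module
  rw [this]; set w := v - v'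
  have hpn : (inner ℝ e p : ℝ) ≤ ‖p‖ := by have := real_inner_le_norm e p; rwa [he, one_mul] at this
  have h1 : |(inner ℝ w p : ℝ) / ‖p‖^2| * ‖p‖ ≤ ‖w‖ := by
    rw [abs_div, abs_of_nonneg (sq_nonneg ‖p‖)]
    have := abs_real_inner_le_norm w p
    rw [div_mul_eq_mul_div, div_le_iff₀ (by positivity)]; nlinarith
  have h2 : |(inner ℝ e w : ℝ)| ≤ ‖w‖ := by have := abs_real_inner_le_norm e w; rwa [he, one_mul] at this
  set s : ℝ := inner ℝ w p / ‖p‖^2 with hs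
  have h3 : ‖w - s • p + (2 * s * inner ℝ e p - inner ℝ e w : ℝ) • e‖ ≤ 5 * ‖w‖ := by
    refine (norm_add_le _ _).trans ?_
    have a1 := norm_sub_le w (s • p)
    rw [norm_smul, Real.norm_eq_abs] at a1
    have a2 : |2 * s * inner ℝ e p - inner ℝ e w| ≤ 3 * ‖w‖ := by
      refine (abs_sub _ _).trans ?_
      rw [abs_mul, abs_mul, abs_two, abs_of_pos hP]
      nlinarith [mLe hpn (abs_nonneg s)]
    rw [norm_smul, he, mul_one, Real.norm_eq_abs]
    linarith
  unfold Li
  rw [norm_smul, norm_inv, Real.norm_of_nonneg hP.le]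
  calc _ ≤ (c * ‖p‖)⁻¹ * (5 * ‖w‖) := mul_le_mul (inv_anti₀ (by positivity) hp) h3 (norm_nonneg _) (by positivity)
    _ = _ := by field_simp
theorem Li_right {e p : Euc n} (he : ‖e‖ = 1) (hp : 0 < (inner ℝ e p : ℝ)) (v : Euc n) : Lh e (Li e p v) p = v := by
  have hp0 : ‖p‖^2 ≠ 0 := by
    intro h0; have : p = 0 := by simpa using h0
    rw [this, inner_zero_right] at hp; exact lt_irrefl _ hp
  have hee : (inner ℝ e e : ℝ) = 1 := by rw [real_inner_self_eq_norm_sq, he]; norm_num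
  obtain ⟨a, ha⟩ : ∃ a : ℝ, a = inner ℝ v p / ‖p‖^2 := ⟨_, rfl⟩
  have ha' : (inner ℝ v p : ℝ) = a * ‖p‖^2 := by rw [ha, div_mul_cancel₀ _ hp0]
  have h1 : (inner ℝ e (Li e p v) : ℝ) = a := by
    unfold Li; rw [← ha, real_inner_smul_right, inner_add_right, inner_sub_right, real_inner_smul_right, real_inner_smul_right, hee]
    field_simp; ring
  have h2 : (inner ℝ (Li e p v) p : ℝ) = 2 * a * inner ℝ e p - inner ℝ e v := by
    unfold Li; rw [← ha, real_inner_smul_left, inner_add_left, inner_sub_left, real_inner_smul_left, real_inner_smul_left, real_inner_self_eq_norm_sq, ha']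
    field_simp; ring
  rw [Lh_apply, h1, h2]; unfold Li; rw [← ha, smul_smul, mul_inv_cancel₀ hp.ne']; module
theorem iso_int (U : Euc n ≃ₗᵢ[ℝ] Euc n) (f : Euc n → ℝ) : ∫ x, f (U x) = ∫ x, f x :=
  U.measurePreserving.integral_comp U.toHomeomorph.measurableEmbedding f
theorem wedge {k : ℝ → ℝ≥0∞} (hk : Measurable k) (hkt : ∀ r, k r ≠ ∞) (hM : ∫⁻ v : Euc n, k ‖v‖ * oR ‖v‖ ≠ ∞)
    {u : Euc n} (hu : ‖u‖ = 1) (g : Euc n) :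
    ∫⁻ v in {v : Euc n | 0 < (inner ℝ u v : ℝ)}, k ‖v‖ * oR (inner ℝ g v) ≤
      (∫⁻ v : Euc n, k ‖v‖ * oR ‖v‖) * oR (‖g‖ + inner ℝ g u) := by
  set κ : Euc n → ℝ := fun v => (k ‖v‖).toReal with hκ
  have hκm : Measurable κ := (hk.comp measurable_norm).ennreal_toReal
  have hκ0 : ∀ v, 0 ≤ κ v := fun v => ENNReal.toReal_nonneg
  have hkκ : ∀ v : Euc n, k ‖v‖ = oR (κ v) := fun v => (ENNReal.ofReal_toReal (hkt _)).symm
  have hκU : ∀ (U : Euc n ≃ₗᵢ[ℝ] Euc n) v, κ (U v) = κ v := fun U v => by simp [hκ]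
  have hκi : Integrable fun v => κ v * ‖v‖ := by
    refine ⟨(hκm.mul measurable_norm).aestronglyMeasurable, ?_⟩
    rw [hasFiniteIntegral_iff_ofReal (ae_of_all _ fun v => mul_nonneg (hκ0 v) (norm_nonneg v))]
    refine lt_of_le_of_lt (le_of_eq ?_) hM.lt_top
    refine lintegral_congr fun v => ?_
    rw [hkκ, ENNReal.ofReal_mul (hκ0 v)]
  have bi : ∀ (ψ : Euc n → ℝ) (B : ℝ), Measurable ψ → (∀ v, |ψ v| ≤ B * ‖v‖) → Integrable fun v => κ v * ψ v := fun ψ B hm hB =>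
    (hκi.const_mul B).mono' (hκm.mul hm).aestronglyMeasurable (ae_of_all _ fun v => by
      rw [Real.norm_eq_abs, abs_mul, abs_of_nonneg (hκ0 v)]; nlinarith [hκ0 v, hB v])
  have gi : ∀ g v : Euc n, |(inner ℝ g v : ℝ)| ≤ ‖g‖ * ‖v‖ := fun g v => abs_real_inner_le_norm g v
  have gm : ∀ g : Euc n, Measurable fun v : Euc n => (inner ℝ g v : ℝ) := fun g => by fun_prop
  set sg : Euc n → ℝ := fun v => if 0 < (inner ℝ u v : ℝ) then 1 else if (inner ℝ u v : ℝ) < 0 then -1 else 0 with hsg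
  have sgm : Measurable sg := Measurable.ite (measurableSet_lt measurable_const (gm u)) measurable_const
    (Measurable.ite (measurableSet_lt (gm u) measurable_const) measurable_const measurable_const)
  have sga : ∀ v, |sg v| ≤ 1 := fun v => by simp only [hsg]; split_ifs <;> simp
  have sgu : ∀ v, sg v * inner ℝ u v = |(inner ℝ u v : ℝ)| := fun v => by
    simp only [hsg]; split_ifs with h1 h2
    · rw [abs_of_pos h1, one_mul]
    · rw [abs_of_neg h2]; ring
    · rw [le_antisymm (not_lt.1 h1) (not_lt.1 h2)]; simp
  set A := ∫ v, κ v * |(inner ℝ u v : ℝ)| with hA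
  have iA : Integrable fun v => κ v * |(inner ℝ u v : ℝ)| := bi _ ‖u‖ (gm u).abs fun v => by rw [abs_abs]; exact gi u v
  have iG : Integrable fun v => κ v * |(inner ℝ g v : ℝ)| := bi _ ‖g‖ (gm g).abs fun v => by rw [abs_abs]; exact gi g v
  have iB : Integrable fun v => κ v * (sg v * inner ℝ g v) := bi _ ‖g‖ (sgm.mul (gm g)) fun v => by
    rw [abs_mul]; exact (mul_le_of_le_one_left (abs_nonneg _) (sga v)).trans (gi g v)
  have e1 : ∫ v, κ v * |(inner ℝ g v : ℝ)| = ‖g‖ * A := by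
    obtain ⟨U, hU⟩ := exists_iso (x := ‖g‖ • u) (y := g) (by rw [norm_smul, hu, norm_norm, mul_one])
    rw [← iso_int U, hA, ← integral_const_mul]
    congr 1; ext v
    rw [hκU]; nth_rw 1 [← hU]
    rw [U.inner_map_map, real_inner_smul_left, abs_mul, abs_norm]; ring
  have e2 : ∫ v, κ v * (sg v * inner ℝ g v) = inner ℝ g u * A := by
    set R : Euc n ≃ₗᵢ[ℝ] Euc n := (Submodule.span ℝ {u}).reflection with hR
    have hRv : ∀ v, R v = (2 * inner ℝ u v : ℝ) • u - v := fun v => by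
      rw [hR, Submodule.reflection_apply, Submodule.starProjection_unit_singleton ℝ hu, mul_smul, two_smul, two_smul]
    have huu : (inner ℝ u u : ℝ) = 1 := by rw [real_inner_self_eq_norm_sq, hu]; norm_num
    have hRu : ∀ v, (inner ℝ u (R v) : ℝ) = inner ℝ u v := fun v => by rw [hRv, inner_sub_right, real_inner_smul_right, huu]; ring
    have hRs : ∀ v, sg (R v) = sg v := fun v => by simp only [hsg, hRu]
    have := iso_int R (fun v => κ v * (sg v * inner ℝ g v))
    have e : ∀ v, κ (R v) * (sg (R v) * inner ℝ g (R v)) = 2 * inner ℝ g u * (κ v * |(inner ℝ u v : ℝ)|) - κ v * (sg v * inner ℝ g v) := fun v => by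
      rw [hκU, hRs, hRv, inner_sub_right, real_inner_smul_right, ← sgu]; ring
    simp only [e] at this
    rw [integral_sub (iA.const_mul _) iB, integral_const_mul] at this
    rw [← hA] at this; linarith
  set P : Euc n → ℝ := fun v => if 0 < (inner ℝ u v : ℝ) then max (inner ℝ g v) 0 else 0 with hP
  have Pm : Measurable P := Measurable.ite (measurableSet_lt measurable_const (gm u)) ((gm g).max measurable_const) measurable_const
  have P0 : ∀ v, 0 ≤ P v := fun v => by simp only [hP]; split_ifs; exacts [le_max_right _ _, le_rfl]
  have iP : Integrable fun v => κ v * P v := bi P ‖g‖ Pm fun v => by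
    rw [abs_of_nonneg (P0 v)]; simp only [hP]
    have := gi g v
    split_ifs
    · exact max_le ((le_abs_self _).trans this) ((abs_nonneg _).trans this)
    · exact (abs_nonneg _).trans this
  have hL : ∫ v, κ v * P v ≤ (‖g‖ + inner ℝ g u) * A := by
    have h1 := iso_int (LinearIsometryEquiv.neg ℝ) (fun v => κ v * P v)
    have iP' : Integrable fun v => κ v * P (-v) := bi _ ‖g‖ (Pm.comp measurable_neg) fun v => by
      rw [abs_of_nonneg (P0 _)]; simp only [hP]
      have := gi g v
      rw [inner_neg_right, inner_neg_right]
      split_ifs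
      · exact max_le ((neg_le_abs _).trans this) ((abs_nonneg _).trans this)
      · exact (abs_nonneg _).trans this
    have h2 : ∫ v, κ v * P (-v) = ∫ v, κ v * P v := by
      rw [← h1]; congr 1; ext v; rw [hκU]; rfl
    have h3 : ∫ v, (κ v * P v + κ v * P (-v)) ≤ ∫ v, (κ v * |(inner ℝ g v : ℝ)| + κ v * (sg v * inner ℝ g v)) := by
      refine integral_mono (iP.add iP') (iG.add iB) fun v => ?_
      simp only
      rw [← mul_add, ← mul_add]
      refine mLe ?_ (hκ0 v)
      simp only [hP, hsg, inner_neg_right]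
      rcases lt_trichotomy (inner ℝ u v : ℝ) 0 with h | h | h
      · rw [if_neg h.not_gt, if_pos (by linarith), if_neg h.not_gt, if_pos h]
        rcases abs_cases (inner ℝ g v : ℝ) with ⟨a1, a2⟩ | ⟨a1, a2⟩ <;> rw [a1]
        · rw [max_eq_right (by linarith)]; linarith
        · rw [max_eq_left (by linarith)]; linarith
      · rw [h]; simp
      · rw [if_pos h, if_neg (by linarith), if_pos h]
        rcases abs_cases (inner ℝ g v : ℝ) with ⟨a1, a2⟩ | ⟨a1, a2⟩ <;> rw [a1]
        · rw [max_eq_left (by linarith)]; linarith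
        · rw [max_eq_right (by linarith)]; linarith
    rw [integral_add iP iP', integral_add iG iB, h2, e1, e2] at h3
    have : 0 ≤ ∫ v, κ v * P v := integral_nonneg fun v => mul_nonneg (hκ0 v) (P0 v)
    linarith
  have hA1 : A ≤ ∫ v, κ v * ‖v‖ := integral_mono iA hκi fun v => mLe (by have := gi u v; rwa [hu, one_mul] at this) (hκ0 v)
  have hgu : 0 ≤ ‖g‖ + inner ℝ g u := by have := (abs_le.1 (gi g u)).1; rw [hu, mul_one] at this; linarith
  calc _ = ∫⁻ v, oR (κ v * P v) := by
        rw [← lintegral_indicator (measurableSet_lt measurable_const (gm u))]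
        refine lintegral_congr fun v => ?_
        by_cases h : 0 < (inner ℝ u v : ℝ)
        · rw [indicator_of_mem (by exact h), hkκ, ENNReal.ofReal_mul (hκ0 v)]; simp [hP, h, ENNReal.ofReal_max]
        · rw [indicator_of_notMem (by exact h)]; simp [hP, h]
    _ = oR (∫ v, κ v * P v) := (ofReal_integral_eq_lintegral_ofReal iP (ae_of_all _ fun v => mul_nonneg (hκ0 v) (P0 v))).symm
    _ ≤ oR ((∫ v, κ v * ‖v‖) * (‖g‖ + inner ℝ g u)) := oRle (hL.trans (by nlinarith))
    _ = _ := by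
        rw [ENNReal.ofReal_mul (integral_nonneg fun v => mul_nonneg (hκ0 v) (norm_nonneg v)),
          ofReal_integral_eq_lintegral_ofReal hκi (ae_of_all _ fun v => mul_nonneg (hκ0 v) (norm_nonneg v))]
        congr 1
        refine lintegral_congr fun v => ?_
        rw [hkκ, ENNReal.ofReal_mul (hκ0 v)]
theorem ftc_le {f F : ℝ → ℝ} (hf : Continuous f) (hF : ∀ t, HasDerivAt F (f t) t) :
    oR (F 1 - F 0) ≤ ∫⁻ t in Ioc (0:ℝ) 1, oR (f t) := by
  rw [← intervalIntegral.integral_eq_sub_of_hasDerivAt (fun t _ => hF t) (hf.intervalIntegrable 0 1), intervalIntegral.integral_of_le zero_le_one]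
  have hi : IntegrableOn (fun t => max (f t) 0) (Ioc 0 1) := ((hf.max continuous_const).integrableOn_Icc).mono_set Ioc_subset_Icc_self
  calc _ ≤ oR (∫ t in Ioc (0:ℝ) 1, max (f t) 0) :=
        oRle (integral_mono ((hf.integrableOn_Icc).mono_set Ioc_subset_Icc_self) hi fun t => le_max_left _ _)
    _ = _ := by
        rw [ofReal_integral_eq_lintegral_ofReal hi (ae_of_all _ fun t => le_max_right _ _)]
        simp [ENNReal.ofReal_max]
theorem ms_and {X : Type*} [MeasurableSpace X] {p q : X → Prop} (hp : MS {x | p x}) (hq : MS {x | q x}) :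
    MS {x | p x ∧ q x} := hp.inter hq
/-- integrand for the cone lemma -/
def Cph (e : Euc n) (c : ℝ) (k : ℝ → ℝ≥0∞) (η : Euc n → ℝ) (q : Euc n × Euc n) : ℝ≥0∞ :=
  {p : Euc n | 0 < ‖p‖ ∧ c / 3 * ‖p‖ ≤ inner ℝ e p}.indicator 1 q.2 *
    (oR (9 * ‖q.2‖) ^ n * (k (c / 10 * ‖q.2‖ * ‖q.1‖) * oR (fderiv ℝ η q.2 (Lh e q.1 q.2))))
theorem Cph_meas (e : Euc n) (c : ℝ) {k : ℝ → ℝ≥0∞} (hk : Antitone k) {η : Euc n → ℝ} (hη : ContDiff ℝ 1 η) :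
    Measurable (Cph e c k η) := by
  have hS : MS {p : Euc n | 0 < ‖p‖ ∧ c / 3 * ‖p‖ ≤ (inner ℝ e p : ℝ)} :=
    ms_and (measurableSet_lt (by fun_prop) (by fun_prop)) (measurableSet_le (by fun_prop) (by fun_prop))
  have h1 : Continuous fun q : Euc n × Euc n => fderiv ℝ η q.2 (Lh e q.1 q.2) :=
    ((hη.continuous_fderiv one_ne_zero).comp continuous_snd).clm_apply (((Lh_cont e).comp continuous_fst).clm_apply continuous_snd)
  unfold Cph
  refine ((measurable_one.indicator hS).comp measurable_snd).mul (Measurable.mul ?_ ((hk.measurable.comp (by fun_prop)).mul h1.measurable.ennreal_ofReal))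
  exact (measurable_snd.norm.const_mul 9).ennreal_ofReal.pow_const n
theorem cone_x {e : Euc n} (he : ‖e‖ = 1) {c : ℝ} (hc : 0 < c) (hc1 : c ≤ 1) {k : ℝ → ℝ≥0∞} (hk : Antitone k)
    {η : Euc n → ℝ} (hη : ContDiff ℝ 1 η) {x : Euc n} (hx0 : 0 < ‖x‖) (hx : c * ‖x‖ ≤ inner ℝ e x) :
    ∫⁻ y in {y : Euc n | ‖x‖ < ‖y‖ ∧ ‖y - x‖ ≤ c^2 / 100 * ‖x‖}, k ‖y - x‖ * oR (η y - η x) ≤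
      ∫⁻ h in {h : Euc n | 0 < (inner ℝ e h : ℝ) ∧ ‖h‖ ≤ c / 20}, ∫⁻ t in Ioc (0:ℝ) 1, Cph e c k η (h, Tf e h t x) := by
  obtain ⟨A, hA⟩ : ∃ A, A = {h : Euc n | (0 < (inner ℝ e h : ℝ) ∧ ‖h‖ ≤ c / 20) ∧ ‖h‖ * ‖x‖ ≤ 5 / c * ‖Tf e h 1 x - x‖} := ⟨_, rfl⟩
  have hTc : Continuous fun h => Tf e h 1 x := (Tf_cont e).comp (f := fun h => ((1, h), x)) (by fun_prop)
  have hA0 : MS {h : Euc n | 0 < (inner ℝ e h : ℝ) ∧ ‖h‖ ≤ c / 20} :=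
    ms_and (measurableSet_lt (by fun_prop) (by fun_prop)) (measurableSet_le (by fun_prop) (by fun_prop))
  have hAm : MS A := by
    rw [hA]; exact ms_and hA0 (measurableSet_le (by fun_prop) (by fun_prop))
  have hlip : LipschitzOnWith (Real.toNNReal (9 * ‖x‖)) (fun h => Tf e h 1 x) A := LipschitzOnWith.of_dist_le_mul fun h hh h' hh' => by
    rw [hA] at hh hh'
    rw [dist_eq_norm, dist_eq_norm, Real.coe_toNNReal _ (by positivity)]
    have := Tf_lip he (h := h) (h' := h') (by linarith [hh.1.2]) (by linarith [hh'.1.2]) x (t := 1) (by simp)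
    linarith
  have hsub : {y : Euc n | ‖x‖ < ‖y‖ ∧ ‖y - x‖ ≤ c^2 / 100 * ‖x‖} ⊆ (fun h => Tf e h 1 x) '' A := by
    rintro y ⟨h1, h2⟩
    obtain ⟨h, a1, a2, a3⟩ := Tf_surj he hc hc1 hx0 hx h1 (h2.trans (mRi (by nlinarith) hx0.le))
    refine ⟨h, ?_, a2⟩
    rw [hA]
    refine ⟨⟨a1, ?_⟩, by rw [a2]; exact a3⟩
    have : ‖h‖ * ‖x‖ ≤ c / 20 * ‖x‖ := a3.trans ((mLe h2 (by positivity)).trans (le_of_eq (by field_simp; norm_num)))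
    exact le_of_mul_le_mul_right this hx0
  refine (lipPush hlip hTc.measurable hAm hsub (H := fun y => k ‖y - x‖ * oR (η y - η x)) ?_).trans ?_
  · exact (hk.measurable.comp (by fun_prop)).mul ((hη.continuous.measurable.sub_const _).ennreal_ofReal)
  rw [← lintegral_const_mul' _ _ (by finiteness)]
  refine (setLIntegral_mono' hAm fun h hh => ?_).trans (lintegral_mono_set (by rw [hA]; exact fun h hh => hh.1))
  rw [hA] at hh
  obtain ⟨⟨b1, b2⟩, b3⟩ := hh
  have hTt : Continuous fun t => Tf e h t x := (Tf_cont e).comp (f := fun t => ((t, h), x)) (by fun_prop)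
  have hder : ∀ t, HasDerivAt (fun t => η (Tf e h t x)) (fderiv ℝ η (Tf e h t x) (Lh e h (Tf e h t x))) t := fun t =>
    ((hη.differentiable one_ne_zero) _).hasFDerivAt.comp_hasDerivAt t (Tf_deriv e h x t)
  have hfc : Continuous fun t => fderiv ℝ η (Tf e h t x) (Lh e h (Tf e h t x)) :=
    ((hη.continuous_fderiv one_ne_zero).comp hTt).clm_apply ((Lh e h).continuous.comp hTt)
  have hf := ftc_le hfc hder
  rw [Tf_zero] at hf
  rw [← mul_assoc]
  refine (mul_le_mul_right hf _).trans ?_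
  rw [← lintegral_const_mul _ hfc.measurable.ennreal_ofReal]
  refine setLIntegral_mono' measurableSet_Ioc fun t ht => ?_
  obtain ⟨p, hp⟩ : ∃ p, p = Tf e h t x := ⟨_, rfl⟩
  have heh : (inner ℝ e h : ℝ) ≤ 1 / 20 := by
    have := real_inner_le_norm e h
    rw [he] at this; linarith
  have hpn : ‖p‖ = Real.exp (t * inner ℝ e h) * ‖x‖ := by rw [hp, Tf_norm]
  have ht0 : 0 ≤ t * inner ℝ e h := mul_nonneg ht.1.le b1.le
  have ht1 : t * inner ℝ e h ≤ 1 / 20 := by nlinarith [ht.1, ht.2]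
  have hp1 : ‖x‖ ≤ ‖p‖ := by rw [hpn]; exact le_mul_of_one_le_left hx0.le (Real.one_le_exp ht0)
  have hp2 : ‖p‖ ≤ 20 / 19 * ‖x‖ := by
    rw [hpn]; refine mRi ?_ hx0.le
    refine (Real.exp_le_exp.2 ht1).trans ((Real.exp_bound_div_one_sub_of_interval (by norm_num) (by norm_num)).trans (by norm_num))
  have hT0 : Tf e 0 t x = x := by
    have : t • Lh e (0 : Euc n) = 0 := ContinuousLinearMap.ext fun v => by
      show t • Lh e 0 v = 0
      simp [Lh_apply]
    unfold Tf; rw [this, NormedSpace.exp_zero]; rfl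
  have hpx : ‖p - x‖ ≤ 9 * ‖h‖ * ‖x‖ := by
    have := Tf_lip he (h := h) (h' := 0) (by linarith) (by simp) x (t := t) ⟨ht.1.le, ht.2⟩
    rwa [hT0, sub_zero, ← hp] at this
  have hpx' : ‖p - x‖ ≤ 9 * (c / 20) * ‖x‖ := hpx.trans (mRi (by linarith) hx0.le)
  have hpe : c / 3 * ‖p‖ ≤ inner ℝ e p := by
    have h1 : (inner ℝ e p : ℝ) = inner ℝ e x + inner ℝ e (p - x) := by rw [inner_sub_right]; ring
    have h2 := (abs_le.1 (abs_real_inner_le_norm e (p - x))).1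
    rw [he, one_mul] at h2
    have h3 : c * ‖p‖ ≤ c * (20 / 19 * ‖x‖) := mLe hp2 hc.le
    nlinarith
  have e1 : Cph e c k η (h, Tf e h t x) = oR (9 * ‖p‖) ^ n * (k (c / 10 * ‖p‖ * ‖h‖) * oR (fderiv ℝ η p (Lh e h p))) := by
    unfold Cph
    simp only [← hp]
    rw [indicator_of_mem (by exact ⟨hx0.trans_le hp1, hpe⟩)]; simp
  rw [e1, ← hp, ← mul_assoc]
  refine mul_le_mul_left (mul_le_mul' (pow_le_pow_left' ?_ n) (hk ?_)) _
  · rw [← ENNReal.ofReal.eq_1]; exact oRle (by linarith)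
  · have q1 : c / 10 * ‖p‖ * ‖h‖ ≤ c / 5 * (‖h‖ * ‖x‖) := by
      have : c / 10 * ‖h‖ * ‖p‖ ≤ c / 10 * ‖h‖ * (2 * ‖x‖) := mLe (by linarith) (by positivity)
      linarith
    refine q1.trans ((mLe b3 (by positivity)).trans (le_of_eq (by field_simp)))
theorem cone_p {e : Euc n} (he : ‖e‖ = 1) {c : ℝ} (hc : 0 < c) {k : ℝ → ℝ≥0∞} (hk : Antitone k) (hkt : ∀ r, k r ≠ ∞)
    (hM : ∫⁻ v : Euc n, k (c / 30 * ‖v‖) * oR ‖v‖ ≠ ∞) {η : Euc n → ℝ} (hη : ContDiff ℝ 1 η) (p : Euc n) :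
    ∫⁻ h in {h : Euc n | 0 < (inner ℝ e h : ℝ) ∧ ‖h‖ ≤ c / 20}, Cph e c k η (h, p) ≤
      oR (135 / c) ^ n * (∫⁻ v : Euc n, k (c / 30 * ‖v‖) * oR ‖v‖) * oR (‖fderiv ℝ η p‖ + fderiv ℝ η p (‖p‖⁻¹ • p)) := by
  by_cases hp : 0 < ‖p‖ ∧ c / 3 * ‖p‖ ≤ (inner ℝ e p : ℝ)
  swap
  · simp only [Cph]
    rw [indicator_of_notMem (by exact hp)]; simp
  obtain ⟨hp0, hpe⟩ := hp
  have hP : 0 < (inner ℝ e p : ℝ) := lt_of_lt_of_le (by positivity) hpe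
  obtain ⟨u, hu⟩ : ∃ u, u = ‖p‖⁻¹ • p := ⟨_, rfl⟩
  have hu1 : ‖u‖ = 1 := by rw [hu, norm_smul, norm_inv, norm_norm, inv_mul_cancel₀ hp0.ne']
  obtain ⟨g, hg⟩ : ∃ g, g = (InnerProductSpace.toDual ℝ (Euc n)).symm (fderiv ℝ η p) := ⟨_, rfl⟩
  have hgi : ∀ v, fderiv ℝ η p v = inner ℝ g v := fun v => by rw [hg, InnerProductSpace.toDual_symm_apply]
  have hgn : ‖fderiv ℝ η p‖ = ‖g‖ := by rw [hg, LinearIsometryEquiv.norm_map]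
  have hLc : Continuous (Li e p) := by unfold Li; fun_prop
  have hlip : LipschitzOnWith (Real.toNNReal (5 / (c / 3 * ‖p‖))) (Li e p) {v : Euc n | 0 < (inner ℝ u v : ℝ)} := LipschitzOnWith.of_dist_le_mul fun v _ v' _ => by
    rw [dist_eq_norm, dist_eq_norm, Real.coe_toNNReal _ (by positivity)]
    exact Li_lip he (by positivity) hp0 hpe v v'
  have hAm : MS {v : Euc n | 0 < (inner ℝ u v : ℝ)} := measurableSet_lt (by fun_prop) (by fun_prop)
  have hsub : {h : Euc n | 0 < (inner ℝ e h : ℝ) ∧ ‖h‖ ≤ c / 20} ⊆ Li e p '' {v : Euc n | 0 < (inner ℝ u v : ℝ)} := by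
    rintro h ⟨h1, h2⟩
    refine ⟨Lh e h p, ?_, Li_left he hP h⟩
    show 0 < (inner ℝ u (Lh e h p) : ℝ)
    rw [hu, real_inner_smul_left, real_inner_comm, Lh_inner]; positivity
  have e1 : ∀ h, Cph e c k η (h, p) = oR (9 * ‖p‖) ^ n * (k (c / 10 * ‖p‖ * ‖h‖) * oR (inner ℝ g (Lh e h p))) := fun h => by
    unfold Cph
    rw [indicator_of_mem (by exact ⟨hp0, hpe⟩), hgi]; simp
  simp only [e1]
  rw [lintegral_const_mul' _ _ (by finiteness)]
  have hLm : Continuous fun h => Lh e h p := (Lh_cont e).clm_apply continuous_const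
  have s1 := lipPush hlip hLc.measurable hAm hsub (H := fun h => k (c / 10 * ‖p‖ * ‖h‖) * oR (inner ℝ g (Lh e h p)))
    ((hk.measurable.comp (by fun_prop)).mul (Continuous.measurable (by fun_prop)).ennreal_ofReal)
  have s2 : ∫⁻ v in {v : Euc n | 0 < (inner ℝ u v : ℝ)}, k (c / 10 * ‖p‖ * ‖Li e p v‖) * oR (inner ℝ g (Lh e (Li e p v) p)) ≤
      ∫⁻ v in {v : Euc n | 0 < (inner ℝ u v : ℝ)}, k (c / 30 * ‖v‖) * oR (inner ℝ g v) := by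
    refine lintegral_mono fun v => ?_
    simp only
    have h1 := Li_right he hP v
    have h2 := Lh_norm he (Li e p v) p
    rw [h1] at h2
    rw [h1]
    refine mul_le_mul_left (hk ?_) _
    nlinarith
  have s3 := wedge (k := fun r => k (c / 30 * r)) (hk.measurable.comp (by fun_prop)) (fun r => hkt _) hM hu1 g
  refine (mul_le_mul_right (s1.trans (mul_le_mul_right (s2.trans s3) _)) _).trans (le_of_eq ?_)
  rw [hgn, hgi, ← hu, ← mul_assoc, ← mul_assoc]
  congr 2
  rw [← mul_pow]; congr 1
  rw [← ENNReal.ofReal.eq_1, ← ENNReal.ofReal_mul (by positivity)]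
  congr 1; field_simp; norm_num
theorem cone {e : Euc n} (he : ‖e‖ = 1) {c : ℝ} (hc : 0 < c) (hc1 : c ≤ 1) {k : ℝ → ℝ≥0∞} (hk : Antitone k) (hkt : ∀ r, k r ≠ ∞)
    (hM : ∫⁻ v : Euc n, k (c / 30 * ‖v‖) * oR ‖v‖ ≠ ∞) {η : Euc n → ℝ} (hη : ContDiff ℝ 1 η) :
    ∫⁻ x in {x : Euc n | 0 < ‖x‖ ∧ c * ‖x‖ ≤ inner ℝ e x}, ∫⁻ y in {y : Euc n | ‖x‖ < ‖y‖ ∧ ‖y - x‖ ≤ c^2 / 100 * ‖x‖}, k ‖y - x‖ * oR (η y - η x) ≤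
      oR (135 / c) ^ n * (∫⁻ v : Euc n, k (c / 30 * ‖v‖) * oR ‖v‖) *
        ∫⁻ p, oR (‖fderiv ℝ η p‖ + fderiv ℝ η p (‖p‖⁻¹ • p)) := by
  have hS : MS {x : Euc n | 0 < ‖x‖ ∧ c * ‖x‖ ≤ (inner ℝ e x : ℝ)} :=
    ms_and (measurableSet_lt (by fun_prop) (by fun_prop)) (measurableSet_le (by fun_prop) (by fun_prop))
  have hA0 : MS {h : Euc n | 0 < (inner ℝ e h : ℝ) ∧ ‖h‖ ≤ c / 20} :=
    ms_and (measurableSet_lt (by fun_prop) (by fun_prop)) (measurableSet_le (by fun_prop) (by fun_prop))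
  have hCm := Cph_meas e c hk hη
  have hmm : Measurable fun q : (Euc n × Euc n) × ℝ => Cph e c k η (q.1.2, Tf e q.1.2 q.2 q.1.1) := by
    refine hCm.comp (Measurable.prodMk (by fun_prop) ?_)
    exact ((Tf_cont e).comp (f := fun q : (Euc n × Euc n) × ℝ => ((q.2, q.1.2), q.1.1)) (by fun_prop)).measurable
  calc _ ≤ ∫⁻ x, ∫⁻ h in {h : Euc n | 0 < (inner ℝ e h : ℝ) ∧ ‖h‖ ≤ c / 20}, ∫⁻ t in Ioc (0:ℝ) 1, Cph e c k η (h, Tf e h t x) :=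
        (setLIntegral_mono' hS fun x hx => cone_x he hc hc1 hk hη hx.1 hx.2).trans (setLIntegral_le_lintegral _ _)
    _ = ∫⁻ h in {h : Euc n | 0 < (inner ℝ e h : ℝ) ∧ ‖h‖ ≤ c / 20}, ∫⁻ x, ∫⁻ t in Ioc (0:ℝ) 1, Cph e c k η (h, Tf e h t x) :=
        lintegral_lintegral_swap (f := fun x h => ∫⁻ t in Ioc (0:ℝ) 1, Cph e c k η (h, Tf e h t x)) (hmm.lintegral_prod_right').aemeasurable
    _ ≤ ∫⁻ h in {h : Euc n | 0 < (inner ℝ e h : ℝ) ∧ ‖h‖ ≤ c / 20}, ∫⁻ p, Cph e c k η (h, p) := by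
        refine setLIntegral_mono' hA0 fun h hh => ?_
        have hm2 : Measurable fun q : Euc n × ℝ => Cph e c k η (h, Tf e h q.2 q.1) :=
          hmm.comp (f := fun q : Euc n × ℝ => ((q.1, h), q.2)) (by fun_prop)
        rw [lintegral_lintegral_swap hm2.aemeasurable]
        calc _ ≤ ∫⁻ t in Ioc (0:ℝ) 1, ∫⁻ p, Cph e c k η (h, p) :=
              setLIntegral_mono' measurableSet_Ioc fun t ht => Tf_push e h (mul_nonneg ht.1.le hh.1.le) (f := fun p => Cph e c k η (h, p)) (hCm.comp (by fun_prop))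
          _ = _ := by simp
    _ = ∫⁻ p, ∫⁻ h in {h : Euc n | 0 < (inner ℝ e h : ℝ) ∧ ‖h‖ ≤ c / 20}, Cph e c k η (h, p) :=
        lintegral_lintegral_swap (f := fun h p => Cph e c k η (h, p)) hCm.aemeasurable
    _ ≤ _ := lintegral_mono fun p => cone_p he hc hk hkt hM hη p
    _ = _ := lintegral_const_mul' _ _ (ENNReal.mul_ne_top (by finiteness) hM)
def qf (x : Euc n) : ℝ := (1 + ‖x‖^2)⁻¹
def Xf (x : Euc n) : Euc n := (2 * qf x) • x
def kap (n : ℕ) (q : ℝ) : ℝ := 2 * n * q - 4 * q + 4 * q^2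
theorem qf_smooth : ContDiff ℝ 1 (qf (n := n)) := by
  unfold qf
  exact (contDiff_const.add (contDiff_norm_sq ℝ)).inv fun x => by positivity
theorem qf_bd (x : Euc n) : 0 < qf x ∧ qf x ≤ 1 := by
  unfold qf; exact ⟨by positivity, inv_le_one_of_one_le₀ (by nlinarith [sq_nonneg ‖x‖])⟩
theorem Xf_div (x : Euc n) : divg Xf x = kap n (qf x) := by
  have hq := (qf_smooth (n := n)).differentiable one_ne_zero x
  have h0 : HasFDerivAt (fun x : Euc n => 1 + ‖x‖^2) ((2:ℝ) • innerSL ℝ x) x :=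
    (hasStrictFDerivAt_norm_sq x).hasFDerivAt.const_add 1 |>.congr_fderiv (by ext; simp [two_smul])
  have h1 : HasFDerivAt (fun x : Euc n => 2 * qf x) ((2:ℝ) • (-((1 + ‖x‖^2)^2)⁻¹ • ((2:ℝ) • innerSL ℝ x))) x :=
    ((hasDerivAt_inv (by positivity)).comp_hasFDerivAt x h0).const_mul 2
  have := divg_smul (η := fun x : Euc n => 2 * qf x) (X := fun x => x) h1.differentiableAt differentiableAt_id
  unfold Xf
  rw [this, divg_id, h1.fderiv]
  simp only [ContinuousLinearMap.smul_apply, innerSL_apply_apply, smul_eq_mul, real_inner_self_eq_norm_sq]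
  unfold kap qf
  have : (1 + ‖x‖^2) ≠ 0 := by positivity
  field_simp; ring
theorem Xf_smooth : ContDiff ℝ 1 (Xf (n := n)) := (contDiff_const.mul qf_smooth).smul contDiff_id
theorem kap_ball (m : ℕ) : ∫ x in Bu m, kap (m+1) (qf x) = (m+1) * ballVol (m+1) := by
  have h := integral_fun_norm_addHaar (volume : Measure Ec m) (fun r => (Iio (1:ℝ)).indicator (fun r => kap (m+1) ((1 + r^2)⁻¹)) r)
  have e1 : ∫ x in Bu m, kap (m+1) (qf x) = ∫ x : Ec m, (Iio (1:ℝ)).indicator (fun r => kap (m+1) ((1 + r^2)⁻¹)) ‖x‖ := by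
    rw [← integral_indicator msB]
    congr 1; ext x; by_cases hx : ‖x‖ < 1 <;> simp [indicator, qf, hx]
  have e2 : ∫ y in Ioi (0 : ℝ), y ^ m • (Iio (1:ℝ)).indicator (fun r => kap (m+1) ((1 + r^2)⁻¹)) y = 1 := by
    have : (fun y : ℝ => y ^ m • (Iio (1:ℝ)).indicator (fun r => kap (m+1) ((1 + r^2)⁻¹)) y) = (Iio (1:ℝ)).indicator (fun y => y^m * kap (m+1) ((1 + y^2)⁻¹)) := by
      ext y; by_cases hy : y < 1 <;> simp [indicator, hy]
    rw [this, integral_indicator measurableSet_Iio, Measure.restrict_restrict measurableSet_Iio,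
      show Iio (1:ℝ) ∩ Ioi 0 = Ioo 0 1 by ext; simp [and_comm], ← integral_Ioc_eq_integral_Ioo, ← intervalIntegral.integral_of_le zero_le_one]
    have hc : Continuous fun y : ℝ => y^m * kap (m+1) ((1 + y^2)⁻¹) := by
      have : Continuous fun y : ℝ => (1 + y^2)⁻¹ := Continuous.inv₀ (by fun_prop) fun y => by positivity
      unfold kap; fun_prop
    rw [intervalIntegral.integral_eq_sub_of_hasDerivAt (f := fun y => 2 * y^(m+1) * (1 + y^2)⁻¹) (fun y _ => ?_) (hc.intervalIntegrable 0 1)]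
    · norm_num
    · have h0 : HasDerivAt (fun y : ℝ => (1 + y^2)⁻¹) (-(2 * y) / (1 + y^2)^2) y :=
        (((hasDerivAt_pow 2 y).const_add 1).inv (by positivity)).congr_deriv (by simp)
      refine (((hasDerivAt_pow (m+1) y).const_mul 2).mul h0).congr_deriv ?_
      have : (1 + y^2) ≠ 0 := by positivity
      unfold kap; push_cast
      try simp only [Nat.add_sub_cancel]
      field_simp; ring
  rw [e1, h]
  simp only [finrank_euclideanSpace, Fintype.card_fin, Nat.add_sub_cancel, e2]
  simp [ballVol, Measure.real]
theorem kap_bd (n : ℕ) {q : ℝ} (h0 : 0 ≤ q) (h1 : q ≤ 1) : |kap n q| ≤ 2 * n + 1 := by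
  have hn : (0:ℝ) ≤ n := Nat.cast_nonneg n
  have h2 : n * q ≤ n := mul_le_of_le_one_right hn h1
  have h3 : 0 ≤ n * q := by positivity
  unfold kap; rw [abs_le]; constructor <;> nlinarith [sq_nonneg (2*q-1)]
theorem kap_rho (hn : 1 ≤ n) (x : Euc n) : |kap n (qf x) - (n - 1)| ≤ (n + 1) * rho x := by
  obtain ⟨h0, h1⟩ := qf_bd x
  have e1 : kap n (qf x) - (n - 1) = (2 * qf x - 1) * (n - 1 + 2 * qf x) := by unfold kap; ring
  have e2 : |2 * qf x - 1| = rho x := by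
    have hp : 0 < 1 + ‖x‖^2 := by positivity
    unfold rho qf
    rw [show 2 * (1 + ‖x‖^2)⁻¹ - 1 = (1 - ‖x‖^2) / (1 + ‖x‖^2) by field_simp; ring, abs_div, abs_of_pos hp]
  have hn' : (1:ℝ) ≤ n := by exact_mod_cast hn
  rw [e1, abs_mul, e2, mul_comm]
  refine mRi ?_ (rho_nonneg x)
  rw [abs_of_nonneg (by linarith)]; linarith
/-- `∫ φ κ ≥ -(n+1) W` -/
theorem phi_kap {d : ℝ} {F : Set (Ec m)} (hF : Cand (m+1) d F) :
    (m+1) * ballVol (m+1) - (m+2) * Wd F ≤ ∫ x, chi F x * kap (m+1) (qf x) := by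
  have hc : Continuous fun x : Ec m => kap (m+1) (qf x) := by
    have := (qf_smooth (n := m+1)).continuous
    unfold kap; fun_prop
  have hb : ∀ x : Ec m, |kap (m+1) (qf x)| ≤ 2 * (m+1 : ℕ) + 1 := fun x => kap_bd _ (qf_bd x).1.le (qf_bd x).2
  have h1 := phi_mul hF hc hb
  rw [kap_ball, chi_mul hF.1] at h1
  have i1 : Integrable fun x => phi F x * kap (m+1) (qf x) := bd_int (phi_int hF) hc hb
  have h2 : ∫ x, phi F x * (kap (m+1) (qf x) - m) = ∫ x, phi F x * kap (m+1) (qf x) := by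
    simp only [mul_sub]
    rw [integral_sub i1 ((phi_int hF).mul_const _), integral_mul_const, phi_zero hF]; ring
  have h3 : -((m+2) * Wd F) ≤ ∫ x, phi F x * (kap (m+1) (qf x) - m) := by
    unfold Wd
    rw [← integral_const_mul, ← integral_neg]
    refine integral_mono ((Wd_int hF).const_mul _).neg (by simp only [mul_sub]; exact i1.sub ((phi_int hF).mul_const _)) fun x => ?_
    have := kap_rho (n := m+1) (by omega) x
    push_cast at this
    rw [show ((m:ℝ)+1-1) = m by ring, show ((m:ℝ)+1+1) = m+2 by ring] at this
    simp only
    have h4 : |phi F x * (kap (m+1) (qf x) - m)| ≤ |phi F x| * ((m+2) * rho x) := by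
      rw [abs_mul]; exact mLe this (abs_nonneg _)
    have := (abs_le.1 h4).1
    linarith
  linarith
theorem Xf_norm (x : Euc n) : ‖Xf x‖ ≤ 1 := by
  have hp : 0 < 1 + ‖x‖^2 := by positivity
  unfold Xf qf
  rw [norm_smul, Real.norm_of_nonneg (by positivity), ← div_eq_mul_inv, div_mul_eq_mul_div, div_le_one hp]
  nlinarith [sq_nonneg (‖x‖ - 1)]
/-- the excess bound -/
theorem excess {d δ : ℝ} {F : Set (Ec m)} (hF : Cand (m+1) d F) {η : Ec m → ℝ} (hη : ContDiff ℝ 1 η) (hc : HasCompactSupport η)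
    (h1 : ∫ x, |η x - chi F x| ≤ δ) (h2 : ∫ x, ‖fderiv ℝ η x‖ ≤ perim F + δ) :
    ∫⁻ x, oR (‖fderiv ℝ η x‖ + fderiv ℝ η x (Xf x)) ≤ oR (d + (m+2) * Wd F + (2*m+4) * δ) := by
  have hdc := hη.continuous_fderiv one_ne_zero
  have hds : HasCompactSupport (fderiv ℝ η) := hc.fderiv (𝕜 := ℝ)
  have i1 : Integrable fun x => ‖fderiv ℝ η x‖ := hdc.norm.integrable_of_hasCompactSupport hds.norm
  have c2 : Continuous fun x => fderiv ℝ η x (Xf x) := hdc.clm_apply Xf_smooth.continuous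
  have hle : ∀ x, |fderiv ℝ η x (Xf x)| ≤ ‖fderiv ℝ η x‖ := fun x =>
    ((fderiv ℝ η x).le_opNorm _).trans (mul_le_of_le_one_right (norm_nonneg _) (Xf_norm x))
  have i2 : Integrable fun x => fderiv ℝ η x (Xf x) := i1.mono' c2.aestronglyMeasurable (ae_of_all _ hle)
  have i3 : Integrable fun x => ‖fderiv ℝ η x‖ + fderiv ℝ η x (Xf x) := i1.add i2
  rw [← ofReal_integral_eq_lintegral_ofReal i3 (ae_of_all _ fun x => by have := (abs_le.1 (hle x)).1; simp only [Pi.zero_apply]; linarith)]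
  refine oRle ?_
  rw [integral_add i1 i2, ibp hη hc Xf_smooth]
  simp only [Xf_div]
  have hkc : Continuous fun x : Ec m => kap (m+1) (qf x) := by
    have := (qf_smooth (n := m+1)).continuous
    unfold kap; fun_prop
  have hb : ∀ x : Ec m, |kap (m+1) (qf x)| ≤ 2 * (m+1 : ℕ) + 1 := fun x => kap_bd _ (qf_bd x).1.le (qf_bd x).2
  have iη : Integrable η := hη.continuous.integrable_of_hasCompactSupport hc
  have iχ := chi_int hF.1 (cand_fin hF)
  have iηχ : Integrable fun x => |η x - chi F x| := (iη.sub iχ).abs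
  have h3 := phi_kap hF
  have h4 : (∫ x, chi F x * kap (m+1) (qf x)) - (2 * (m+1 : ℕ) + 1) * ∫ x, |η x - chi F x| ≤ ∫ x, η x * kap (m+1) (qf x) := by
    rw [← integral_const_mul, ← integral_sub (bd_int iχ hkc hb) (iηχ.const_mul _)]
    refine integral_mono ((bd_int iχ hkc hb).sub (iηχ.const_mul _)) (bd_int iη hkc hb) fun x => ?_
    simp only
    have : |(η x - chi F x) * kap (m+1) (qf x)| ≤ |η x - chi F x| * (2 * (m+1 : ℕ) + 1) := by
      rw [abs_mul]; exact mLe (hb x) (abs_nonneg _)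
    have := (abs_le.1 this).1
    linarith
  have hp := hF.2.2.2
  push_cast at h4 hp
  have : (2 * Rp m + 1) * ∫ x, |η x - chi F x| ≤ (2 * Rp m + 1) * δ := mLe h1 (by positivity)
  linarith
theorem exc1 (x : Euc n) (g : Euc n →L[ℝ] ℝ) : ‖g‖ + g (‖x‖⁻¹ • x) ≤ 2 * (‖g‖ + g (Xf x)) := by
  have hp : 0 < 1 + ‖x‖^2 := by positivity
  have e : Xf x = (2 * qf x * ‖x‖) • (‖x‖⁻¹ • x) := by
    rcases eq_or_ne x 0 with rfl | hx
    · simp [Xf]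
    · rw [smul_smul, mul_assoc, mul_inv_cancel₀ (norm_ne_zero_iff.2 hx), mul_one]; rfl
  have hu : ‖(‖x‖⁻¹ • x)‖ ≤ 1 := by rw [norm_smul, norm_inv, norm_norm]; exact inv_mul_le_one
  have ha : |g (‖x‖⁻¹ • x)| ≤ ‖g‖ := (g.le_opNorm _).trans (mul_le_of_le_one_right (norm_nonneg _) hu)
  have hz0 : 0 ≤ 2 * qf x * ‖x‖ := by exact mul_nonneg (by linarith [(qf_bd x).1]) (norm_nonneg x)
  have hz1 : 2 * qf x * ‖x‖ ≤ 1 := by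
    unfold qf; rw [← div_eq_mul_inv, div_mul_eq_mul_div, div_le_one hp]; nlinarith [sq_nonneg (‖x‖ - 1)]
  obtain ⟨u, hu'⟩ : ∃ u, u = ‖x‖⁻¹ • x := ⟨_, rfl⟩
  rw [e]
  rw [← hu'] at ha ⊢
  rw [map_smul, smul_eq_mul]
  have := abs_le.1 ha
  rcases le_total 0 (g u) with h | h <;> nlinarith
theorem exc2 {x : Euc n} (hx : ‖x‖ ≤ 1/2) (g : Euc n →L[ℝ] ℝ) : ‖g‖ ≤ 5 * (‖g‖ + g (Xf x)) := by
  have hp : 0 < 1 + ‖x‖^2 := by positivity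
  have h1 : ‖Xf x‖ ≤ 4/5 := by
    unfold Xf qf
    rw [norm_smul, Real.norm_of_nonneg (by positivity), ← div_eq_mul_inv, div_mul_eq_mul_div, div_le_iff₀ hp]
    nlinarith [norm_nonneg x]
  have h2 : |g (Xf x)| ≤ ‖g‖ * (4/5) := (g.le_opNorm _).trans (mLe h1 (norm_nonneg _))
  have := (abs_le.1 h2).1
  linarith
def NN (k : ℝ → ℝ≥0∞) (η : Euc n → ℝ) : ℝ≥0∞ :=
  ∫⁻ x, ∫⁻ y in {y : Euc n | ‖x‖ < ‖y‖}, k ‖y - x‖ * oR (η y - η x)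
def Mk (n : ℕ) (k : ℝ → ℝ≥0∞) : ℝ≥0∞ := ∫⁻ v : Euc n, k ‖v‖ * oR ‖v‖
theorem Mk_scale {a : ℝ} (ha : 0 < a) (k : ℝ → ℝ≥0∞) :
    ∫⁻ v : Euc n, k (a * ‖v‖) * oR ‖v‖ = oR (a⁻¹ * (a^n)⁻¹) * Mk n k := by
  have h := sim_lintegral ha (LinearIsometryEquiv.refl ℝ (Euc n)) 0 (fun v => k ‖v‖ * oR ‖v‖)
  simp only [sim, add_zero, LinearIsometryEquiv.coe_refl, id, norm_smul, Real.norm_of_nonneg ha.le] at h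
  rw [ENNReal.ofReal_mul (by positivity), mul_assoc, Mk, ← h, ← lintegral_const_mul' _ _ (by finiteness)]
  refine lintegral_congr fun v => ?_
  rw [mul_left_comm, ← ENNReal.ofReal_mul (by positivity), inv_mul_cancel_left₀ ha.ne']
theorem k_L1 {k : ℝ → ℝ≥0∞} (hk : Antitone k) (hkt : ∀ r, k r ≠ ∞) {r0 : ℝ} (hr : 0 ≤ r0) (hk0 : ∀ r, r0 ≤ r → k r = 0) :
    ∫⁻ v : Euc n, k ‖v‖ ≠ ∞ ∧ Mk n k ≤ oR r0 * ∫⁻ v : Euc n, k ‖v‖ := by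
  constructor
  · have : ∫⁻ v : Euc n, k ‖v‖ ≤ ∫⁻ v in ball (0 : Euc n) r0, k 0 := by
      rw [← lintegral_indicator msB]
      refine lintegral_mono fun v => ?_
      by_cases h : ‖v‖ < r0
      · rw [indicator_of_mem (by simpa using h)]; exact hk (norm_nonneg v)
      · simp only; rw [hk0 _ (not_lt.1 h)]; exact zero_le
    refine ne_top_of_le_ne_top ?_ this
    rw [setLIntegral_const]; exact ENNReal.mul_ne_top (hkt 0) measure_ball_lt_top.ne
  · rw [Mk, ← lintegral_const_mul' _ _ (by finiteness)]
    refine lintegral_mono fun v => ?_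
    simp only
    rw [mul_comm]
    by_cases h : ‖v‖ < r0
    · exact mul_le_mul_left (oRle h.le) _
    · rw [hk0 _ (not_lt.1 h)]; simp
theorem straight {k : ℝ → ℝ≥0∞} (hk : Antitone k) (hkt : ∀ r, k r ≠ ∞) {r0 : ℝ} (hr : r0 ≤ 1/4) (hk0 : ∀ r, r0 ≤ r → k r = 0)
    {η : Euc n → ℝ} (hη : ContDiff ℝ 1 η) :
    ∫⁻ x in ball (0 : Euc n) (1/4), ∫⁻ y, k ‖y - x‖ * oR (η y - η x) ≤ Mk n k * ∫⁻ p in ball (0 : Euc n) (1/2), oR ‖fderiv ℝ η p‖ := by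
  obtain ⟨G, hG⟩ : ∃ G : Euc n → ℝ≥0∞, G = (ball (0 : Euc n) (1/2)).indicator (fun p => oR ‖fderiv ℝ η p‖) := ⟨_, rfl⟩
  have hdc := hη.continuous_fderiv one_ne_zero
  have hGm : Measurable G := by rw [hG]; exact hdc.norm.measurable.ennreal_ofReal.indicator msB
  have hpt : ∀ x ∈ ball (0 : Euc n) (1/4), ∀ v : Euc n, k ‖v‖ * oR (η (v + x) - η x) ≤
      ∫⁻ t in Ioc (0:ℝ) 1, k ‖v‖ * oR ‖v‖ * G (t • v + x) := by
    intro x hx v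
    by_cases hv : r0 ≤ ‖v‖
    · rw [hk0 _ hv]; simp
    push Not at hv
    have hder : ∀ t : ℝ, HasDerivAt (fun t : ℝ => η (t • v + x)) (fderiv ℝ η (t • v + x) v) t := fun t =>
      ((hη.differentiable one_ne_zero) _).hasFDerivAt.comp_hasDerivAt t ((((hasDerivAt_id t).smul_const v).add_const x).congr_deriv (one_smul ℝ v))
    have hf := ftc_le (f := fun t => fderiv ℝ η (t • v + x) v) ((hdc.comp (by fun_prop)).clm_apply continuous_const) hder
    simp only [one_smul, zero_smul, zero_add] at hf
    refine (mul_le_mul_right hf _).trans ?_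
    rw [← lintegral_const_mul' _ _ (hkt _)]
    refine setLIntegral_mono' measurableSet_Ioc fun t ht => ?_
    have hin : t • v + x ∈ ball (0 : Euc n) (1/2) := by
      rw [mem_ball_zero_iff] at hx ⊢
      have : ‖t • v‖ ≤ ‖v‖ := by rw [norm_smul, Real.norm_of_nonneg ht.1.le]; exact mul_le_of_le_one_left (norm_nonneg _) ht.2
      linarith [norm_add_le (t • v) x]
    rw [hG, indicator_of_mem hin, mul_assoc, ← ENNReal.ofReal_mul (norm_nonneg _)]
    refine mul_le_mul_right (oRle ((le_abs_self _).trans (((fderiv ℝ η (t • v + x)).le_opNorm v).trans (le_of_eq (mul_comm _ _))))) _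
  have hm3 : Measurable fun q : (Euc n × Euc n) × ℝ => k ‖q.1.2‖ * oR ‖q.1.2‖ * G (q.2 • q.1.2 + q.1.1) := by
    refine ((hk.measurable.comp (by fun_prop)).mul (by fun_prop)).mul (hGm.comp (by fun_prop))
  calc _ ≤ ∫⁻ x in ball (0 : Euc n) (1/4), ∫⁻ v, ∫⁻ t in Ioc (0:ℝ) 1, k ‖v‖ * oR ‖v‖ * G (t • v + x) := by
        refine setLIntegral_mono' msB fun x hx => ?_
        rw [← lintegral_add_right_eq_self _ x]
        refine lintegral_mono fun v => ?_
        simp only [add_sub_cancel_right]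
        exact hpt x hx v
    _ ≤ ∫⁻ x, ∫⁻ v, ∫⁻ t in Ioc (0:ℝ) 1, k ‖v‖ * oR ‖v‖ * G (t • v + x) := setLIntegral_le_lintegral _ _
    _ = ∫⁻ v, ∫⁻ x, ∫⁻ t in Ioc (0:ℝ) 1, k ‖v‖ * oR ‖v‖ * G (t • v + x) :=
        lintegral_lintegral_swap (f := fun x v => ∫⁻ t in Ioc (0:ℝ) 1, k ‖v‖ * oR ‖v‖ * G (t • v + x)) (hm3.lintegral_prod_right').aemeasurable
    _ = ∫⁻ v, ∫⁻ t in Ioc (0:ℝ) 1, ∫⁻ x, k ‖v‖ * oR ‖v‖ * G (t • v + x) := by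
        refine lintegral_congr fun v => lintegral_lintegral_swap (f := fun x t => k ‖v‖ * oR ‖v‖ * G (t • v + x)) ?_
        exact (hm3.comp (f := fun q : Euc n × ℝ => ((q.1, v), q.2)) (by fun_prop)).aemeasurable
    _ = ∫⁻ v, k ‖v‖ * oR ‖v‖ * ∫⁻ p, G p := by
        refine lintegral_congr fun v => ?_
        have : ∀ t : ℝ, ∫⁻ x, k ‖v‖ * oR ‖v‖ * G (t • v + x) = k ‖v‖ * oR ‖v‖ * ∫⁻ p, G p := fun t => by
          rw [lintegral_const_mul' _ _ (ENNReal.mul_ne_top (hkt _) (by finiteness)), lintegral_add_left_eq_self]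
        simp only [this]; simp
    _ = _ := by
        rw [lintegral_mul_const _ (f := fun v : Euc n => k ‖v‖ * oR ‖v‖) ((hk.measurable.comp measurable_norm).mul (by fun_prop)), hG, lintegral_indicator msB]; rfl
theorem in_cone (hn : 1 ≤ n) (x : Euc n) : ∃ i : Fin n, ∃ b : Bool,
    (√n)⁻¹ * ‖x‖ ≤ inner ℝ ((if b then 1 else -1 : ℝ) • EuclideanSpace.single i (1:ℝ)) x := by
  haveI : Nonempty (Fin n) := ⟨⟨0, hn⟩⟩
  obtain ⟨i, hi⟩ := Finite.exists_max fun i => |x i|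
  have h1 : ‖x‖^2 ≤ n * |x i|^2 := by
    rw [EuclideanSpace.norm_sq_eq]
    calc _ ≤ ∑ j : Fin n, |x i|^2 := Finset.sum_le_sum fun j _ => by rw [Real.norm_eq_abs]; exact pow_le_pow_left₀ (abs_nonneg _) (hi j) 2
      _ = _ := by simp
  have hn' : (0:ℝ) < n := by exact_mod_cast hn
  have h2 : (√n)⁻¹ * ‖x‖ ≤ |x i| := by
    rw [inv_mul_le_iff₀ (Real.sqrt_pos.2 hn')]
    refine le_of_sq_le_sq ?_ (by positivity)
    rw [mul_pow, Real.sq_sqrt hn'.le]; exact h1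
  refine ⟨i, decide (0 ≤ x i), h2.trans (le_of_eq ?_)⟩
  rw [real_inner_smul_left, EuclideanSpace.inner_single_left]
  by_cases h : 0 ≤ x i
  · simp [h, abs_of_nonneg h]
  · simp [h, abs_of_neg (not_le.1 h)]
theorem N_eta (hn : 1 ≤ n) : ∃ C : ℝ≥0∞, C ≠ ∞ ∧ ∀ k : ℝ → ℝ≥0∞, Antitone k → (∀ r, k r ≠ ∞) → (∀ r : ℝ, 1 / (400 * n) ≤ r → k r = 0) →
    ∀ η : Euc n → ℝ, ContDiff ℝ 1 η → NN k η ≤ C * Mk n k * ∫⁻ x, oR (‖fderiv ℝ η x‖ + fderiv ℝ η x (Xf x)) := by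
  have hn' : (1:ℝ) ≤ n := by exact_mod_cast hn
  obtain ⟨c, hc⟩ : ∃ c : ℝ, c = (√n)⁻¹ := ⟨_, rfl⟩
  have hc0 : 0 < c := by rw [hc]; positivity
  have hc1 : c ≤ 1 := by rw [hc]; exact inv_le_one_of_one_le₀ (Real.one_le_sqrt.2 hn')
  have hc2 : c^2 = (n:ℝ)⁻¹ := by rw [hc, inv_pow, Real.sq_sqrt (by positivity)]
  obtain ⟨A, hA⟩ : ∃ A : ℝ≥0∞, A = oR (135 / c) ^ n * oR ((c/30)⁻¹ * ((c/30)^n)⁻¹) := ⟨_, rfl⟩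
  have hAt : A ≠ ∞ := by rw [hA]; finiteness
  refine ⟨n * (2 * (A * 2)) + 5, by finiteness, fun k hk hkt hk0 η hη => ?_⟩
  obtain ⟨E, hE⟩ : ∃ E, E = ∫⁻ x, oR (‖fderiv ℝ η x‖ + fderiv ℝ η x (Xf x)) := ⟨_, rfl⟩
  rw [← hE]
  have hMt : Mk n k ≠ ∞ := by
    have := k_L1 (n := n) hk hkt (r0 := 1 / (400 * n)) (by positivity) hk0
    exact ne_top_of_le_ne_top (ENNReal.mul_ne_top (by finiteness) this.1) this.2
  obtain ⟨ev, hev⟩ : ∃ ev : Fin n × Bool → Euc n, ev = fun q => (if q.2 then 1 else -1 : ℝ) • EuclideanSpace.single q.1 (1:ℝ) := ⟨_, rfl⟩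
  have hen : ∀ q, ‖ev q‖ = 1 := fun q => by rw [hev]; simp only; rw [norm_smul]; split_ifs <;> simp
  have hcone : ∀ q, ∫⁻ x in {x : Euc n | 0 < ‖x‖ ∧ c * ‖x‖ ≤ inner ℝ (ev q) x}, ∫⁻ y in {y : Euc n | ‖x‖ < ‖y‖ ∧ ‖y - x‖ ≤ c^2 / 100 * ‖x‖}, k ‖y - x‖ * oR (η y - η x) ≤
      A * 2 * Mk n k * E := by
    intro q
    refine (cone (hen q) hc0 hc1 hk hkt (by rw [Mk_scale (by positivity)]; exact ENNReal.mul_ne_top (by finiteness) hMt) hη).trans ?_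
    rw [Mk_scale (by positivity), ← mul_assoc, ← hA, mul_right_comm A 2, mul_assoc (A * Mk n k)]
    refine mul_le_mul_right ?_ _
    rw [hE, ← lintegral_const_mul' _ _ (by finiteness)]
    refine lintegral_mono fun x => ?_
    simp only
    have h2 : (2:ℝ≥0∞) * oR (‖fderiv ℝ η x‖ + fderiv ℝ η x (Xf x)) = oR (2 * (‖fderiv ℝ η x‖ + fderiv ℝ η x (Xf x))) := by
      rw [ENNReal.ofReal_mul (by norm_num)]; congr 1; simp
    refine le_trans ?_ h2.ge
    exact oRle (exc1 x _)
  have hst := (straight hk hkt (r0 := 1/(400*n)) (by rw [div_le_div_iff₀ (by positivity) (by positivity)]; linarith) hk0 hη)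
  have hst2 : ∫⁻ p in ball (0 : Euc n) (1/2), oR ‖fderiv ℝ η p‖ ≤ 5 * E := by
    rw [hE, ← lintegral_const_mul' _ _ (by finiteness)]
    refine (setLIntegral_mono' msB fun x hx => ?_).trans (setLIntegral_le_lintegral (ball (0 : Euc n) (1/2)) _)
    have h5 : (5:ℝ≥0∞) * oR (‖fderiv ℝ η x‖ + fderiv ℝ η x (Xf x)) = oR (5 * (‖fderiv ℝ η x‖ + fderiv ℝ η x (Xf x))) := by
      rw [ENNReal.ofReal_mul (by norm_num)]; congr 1; simp
    refine le_trans ?_ h5.ge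
    exact oRle (exc2 (mem_ball_zero_iff.1 hx).le _)
  have hSm : ∀ q, MS {x : Euc n | 0 < ‖x‖ ∧ c * ‖x‖ ≤ (inner ℝ (ev q) x : ℝ)} := fun q =>
    ms_and (measurableSet_lt (by fun_prop) (by fun_prop)) (measurableSet_le (by fun_prop) (by fun_prop))
  have hm2 : Measurable fun z : Euc n × Euc n => k ‖z.2 - z.1‖ * oR (η z.2 - η z.1) :=
    (hk.measurable.comp (by fun_prop)).mul (Continuous.measurable (by have := hη.continuous; fun_prop)).ennreal_ofReal
  have hYm : ∀ x : Euc n, MS {y : Euc n | ‖x‖ < ‖y‖ ∧ ‖y - x‖ ≤ c^2 / 100 * ‖x‖} := fun x =>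
    ms_and (measurableSet_lt (by fun_prop) (by fun_prop)) (measurableSet_le (by fun_prop) (by fun_prop))
  obtain ⟨f, hf⟩ : ∃ f : Euc n → ℝ≥0∞, f = fun x => ∫⁻ y in {y : Euc n | ‖x‖ < ‖y‖ ∧ ‖y - x‖ ≤ c^2 / 100 * ‖x‖}, k ‖y - x‖ * oR (η y - η x) := ⟨_, rfl⟩
  have hfm : Measurable f := by
    have hT : MS {z : Euc n × Euc n | ‖z.1‖ < ‖z.2‖ ∧ ‖z.2 - z.1‖ ≤ c^2 / 100 * ‖z.1‖} :=
      ms_and (measurableSet_lt (by fun_prop) (by fun_prop)) (measurableSet_le (by fun_prop) (by fun_prop))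
    have := Measurable.lintegral_prod_right' (ν := (volume : Measure (Euc n))) (hm2.indicator hT)
    have e : f = fun x => ∫⁻ y, {z : Euc n × Euc n | ‖z.1‖ < ‖z.2‖ ∧ ‖z.2 - z.1‖ ≤ c^2 / 100 * ‖z.1‖}.indicator
        (fun z => k ‖z.2 - z.1‖ * oR (η z.2 - η z.1)) (x, y) := by
      rw [hf]; funext x
      rw [← lintegral_indicator (hYm x)]; rfl
    rw [e]; exact this
  have key : ∀ᵐ x : Euc n, ∫⁻ y in {y : Euc n | ‖x‖ < ‖y‖}, k ‖y - x‖ * oR (η y - η x) ≤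
      (∑ q, {x : Euc n | 0 < ‖x‖ ∧ c * ‖x‖ ≤ (inner ℝ (ev q) x : ℝ)}.indicator f x) +
        (ball (0 : Euc n) (1/4)).indicator (fun x => ∫⁻ y, k ‖y - x‖ * oR (η y - η x)) x := by
    haveI : Nonempty (Fin n) := ⟨⟨0, hn⟩⟩
    have h0 : ∀ᵐ x : Euc n, x ≠ 0 := by simp [ae_iff]
    filter_upwards [h0] with x hx
    have hx0 := norm_pos_iff.2 hx
    obtain ⟨i, b, hib⟩ := in_cone hn x
    have hmem : x ∈ {x : Euc n | 0 < ‖x‖ ∧ c * ‖x‖ ≤ (inner ℝ (ev (i, b)) x : ℝ)} := ⟨hx0, by rw [hc, hev]; exact hib⟩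
    have hle1 : f x ≤ ∑ q, {x : Euc n | 0 < ‖x‖ ∧ c * ‖x‖ ≤ (inner ℝ (ev q) x : ℝ)}.indicator f x := by
      refine le_trans (le_of_eq ?_) (Finset.single_le_sum (f := fun q => {x : Euc n | 0 < ‖x‖ ∧ c * ‖x‖ ≤ (inner ℝ (ev q) x : ℝ)}.indicator f x) (fun _ _ => zero_le) (Finset.mem_univ (i, b)))
      exact (indicator_of_mem hmem f).symm
    refine le_trans ?_ (add_le_add_left hle1 _)
    rw [← lintegral_inter_add_diff (fun y => k ‖y - x‖ * oR (η y - η x)) {y : Euc n | ‖x‖ < ‖y‖} (hYm x)]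
    refine add_le_add (by rw [hf]; exact lintegral_mono_set inter_subset_right) ?_
    by_cases hxb : x ∈ ball (0 : Euc n) (1/4)
    · rw [indicator_of_mem hxb]; exact setLIntegral_le_lintegral _ _
    · rw [indicator_of_notMem hxb]
      refine le_of_eq ?_
      rw [setLIntegral_congr_fun (g := fun _ => 0) ((measurableSet_lt (by fun_prop) (by fun_prop)).diff (hYm x))]
      · simp
      · rintro y ⟨hy1, hy2⟩
        simp only
        have : ¬ ‖y - x‖ ≤ c^2 / 100 * ‖x‖ := fun h => hy2 ⟨hy1, h⟩
        rw [mem_ball_zero_iff] at hxb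
        rw [hk0, zero_mul]
        rw [hc2] at this
        push Not at this hxb
        refine le_trans ?_ this.le
        rw [show 1 / (400 * (n:ℝ)) = (n:ℝ)⁻¹ / 100 * (1/4) by field_simp; norm_num]
        exact mLe hxb (by positivity)
  unfold NN
  refine (lintegral_mono_ae key).trans ?_
  rw [lintegral_add_left (Finset.measurable_sum _ fun q _ => hfm.indicator (hSm q)), lintegral_finsetSum _ fun q _ => hfm.indicator (hSm q), lintegral_indicator msB]
  have e1 : ∑ q, ∫⁻ x, {x : Euc n | 0 < ‖x‖ ∧ c * ‖x‖ ≤ (inner ℝ (ev q) x : ℝ)}.indicator f x ≤ ∑ q : Fin n × Bool, A * 2 * Mk n k * E :=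
    Finset.sum_le_sum fun q _ => by rw [lintegral_indicator (hSm q), hf]; exact hcone q
  refine (add_le_add e1 (hst.trans (mul_le_mul_right hst2 _))).trans (le_of_eq ?_)
  simp only [Finset.sum_const, Finset.card_univ, Fintype.card_prod, Fintype.card_fin, Fintype.card_bool, nsmul_eq_mul]
  push_cast; ring
theorem dbl_shift {k : ℝ → ℝ≥0∞} (hk : Measurable k) {g : Euc n → ℝ≥0∞} (hg : Measurable g) :
    ∫⁻ x, ∫⁻ y, k ‖y - x‖ * g x = (∫⁻ v : Euc n, k ‖v‖) * ∫⁻ x, g x ∧ ∫⁻ x, ∫⁻ y, k ‖y - x‖ * g y = (∫⁻ v : Euc n, k ‖v‖) * ∫⁻ x, g x := by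
  have h1 : ∫⁻ x, ∫⁻ y, k ‖y - x‖ * g x = (∫⁻ v : Euc n, k ‖v‖) * ∫⁻ x, g x := by
    rw [← lintegral_const_mul _ hg]
    refine lintegral_congr fun x => ?_
    rw [lintegral_mul_const _ (f := fun y => k ‖y - x‖) (hk.comp (by fun_prop)), lintegral_sub_right_eq_self (fun v => k ‖v‖)]
  refine ⟨h1, ?_⟩
  rw [← h1, lintegral_lintegral_swap ((hk.comp (f := fun z : Euc n × Euc n => ‖z.2 - z.1‖) (by fun_prop)).mul (hg.comp measurable_snd)).aemeasurable]
  refine lintegral_congr fun y => lintegral_congr fun x => ?_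
  rw [norm_sub_rev]
theorem chi_meas {F : Set (Euc n)} (hF : MS F) : Measurable (chi F) := measurable_one.indicator hF
theorem lemN (m : ℕ) : ∃ C : ℝ≥0∞, C ≠ ∞ ∧ ∀ k : ℝ → ℝ≥0∞, Antitone k → (∀ r, k r ≠ ∞) → (∀ r : ℝ, 1 / (400 * (m+1 : ℕ)) ≤ r → k r = 0) →
    ∀ (F : Set Ec m) (d : ℝ), Cand (m+1) d F → NN k (chi F) ≤ C * Mk (m+1) k * oR (d + (m+2) * Wd F) := by
  obtain ⟨C, hC, h⟩ := N_eta (n := m+1) (by omega)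
  refine ⟨C, hC, fun k hk hkt hk0 F d hF => ?_⟩
  obtain ⟨hL, hM⟩ := k_L1 (n := m+1) hk hkt (by positivity) hk0
  have hMt : Mk (m+1) k ≠ ∞ := ne_top_of_le_ne_top (ENNReal.mul_ne_top (by finiteness) hL) hM
  obtain ⟨L, hLe⟩ : ∃ L, L = ∫⁻ v : Ec m, k ‖v‖ := ⟨_, rfl⟩
  rw [← hLe] at hL
  have key : ∀ δ : ℝ, 0 < δ → NN k (chi F) ≤ C * Mk (m+1) k * oR (d + (m+2) * Wd F + (2*m+4) * δ) + 2 * L * oR δ := by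
    intro δ hδ
    obtain ⟨η, h1, h2, h3, h4, h5⟩ := L0 hF.1 (cand_fin hF) hF.2.2.1 hδ
    obtain ⟨g, hg⟩ : ∃ g : Ec m → ℝ≥0∞, g = fun x => oR |η x - chi F x| := ⟨_, rfl⟩
    have hgm : Measurable g := by rw [hg]; exact ((h1.continuous.measurable.sub (chi_meas hF.1)).norm).ennreal_ofReal
    have hgi : ∫⁻ x, g x ≤ oR δ := by
      have i : Integrable fun x => |η x - chi F x| := ((h1.continuous.integrable_of_hasCompactSupport h2).sub (chi_int hF.1 (cand_fin hF))).abs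
      rw [hg, ← ofReal_integral_eq_lintegral_ofReal i (ae_of_all _ fun x => abs_nonneg _)]
      exact oRle h4
    have hkm : ∀ x : Ec m, Measurable fun y : Ec m => k ‖y - x‖ := fun x => hk.measurable.comp (by fun_prop)
    have hk2 : Measurable fun z : Ec m × Ec m => k ‖z.2 - z.1‖ := hk.measurable.comp (by fun_prop)
    obtain ⟨ds1, ds2⟩ := dbl_shift hk.measurable hgm
    have a1 : NN k (chi F) ≤ NN k η + (L * (∫⁻ x, g x) + L * (∫⁻ x, g x)) := by
      rw [hLe]; nth_rw 1 [← ds1]; nth_rw 1 [← ds2]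
      have m1 : Measurable fun x => ∫⁻ y, k ‖y - x‖ * g x := Measurable.lintegral_prod_right' (f := fun z : Ec m × Ec m => k ‖z.2 - z.1‖ * g z.1) (hk2.mul (hgm.comp measurable_fst))
      have m2 : Measurable fun x => ∫⁻ y, k ‖y - x‖ * g y := Measurable.lintegral_prod_right' (f := fun z : Ec m × Ec m => k ‖z.2 - z.1‖ * g z.2) (hk2.mul (hgm.comp measurable_snd))
      have m3 : Measurable fun x => (∫⁻ y, k ‖y - x‖ * g x) + ∫⁻ y, k ‖y - x‖ * g y := m1.add m2
      rw [← lintegral_add_left m1]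
      unfold NN
      rw [← lintegral_add_right _ m3]
      refine lintegral_mono fun x => ?_
      simp only
      rw [← lintegral_add_left ((hkm x).mul_const _)]
      refine le_trans ?_ (add_le_add_right (setLIntegral_le_lintegral {y : Ec m | ‖x‖ < ‖y‖} _) _)
      have m4 : Measurable fun y => k ‖y - x‖ * g x + k ‖y - x‖ * g y := ((hkm x).mul_const _).add ((hkm x).mul hgm)
      rw [← lintegral_add_right _ m4]
      refine lintegral_mono fun y => ?_
      simp only
      rw [← mul_add, ← mul_add]
      refine mul_le_mul_right ?_ _
      rw [hg, ← ENNReal.ofReal_add (abs_nonneg _) (abs_nonneg _)]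
      refine (oRle ?_).trans ENNReal.ofReal_add_le
      linarith [le_abs_self (η x - chi F x), neg_abs_le (η y - chi F y)]
    refine a1.trans (add_le_add ((h k hk hkt hk0 η h1).trans (mul_le_mul_right (excess hF h1 h2 h4 h5) _)) ?_)
    rw [← two_mul, ← mul_assoc]; exact mul_le_mul_right hgi _
  have hlim : Tendsto (fun δ : ℝ => C * Mk (m+1) k * oR (d + (m+2) * Wd F + (2*m+4) * δ) + 2 * L * oR δ) (nhdsWithin 0 (Ioi 0))
      (nhds (C * Mk (m+1) k * oR (d + (m+2) * Wd F + (2*m+4) * 0) + 2 * L * oR 0)) := by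
    refine Tendsto.mono_left ?_ nhdsWithin_le_nhds
    refine Tendsto.add (ENNReal.Tendsto.const_mul ?_ (Or.inr (ENNReal.mul_ne_top hC hMt))) (ENNReal.Tendsto.const_mul ?_ (Or.inr (ENNReal.mul_ne_top (by finiteness) hL)))
    · exact (ENNReal.continuous_ofReal.comp (by fun_prop : Continuous fun δ : ℝ => d + (m+2) * Wd F + (2*m+4) * δ)).tendsto 0
    · exact ENNReal.continuous_ofReal.tendsto 0
  have := ge_of_tendsto hlim (eventually_nhdsWithin_of_forall key)
  simpa using this
theorem annul (m : ℕ) {t : ℝ} (h0 : 0 ≤ t) (h1 : t ≤ 1) :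
    volume {y : Ec m | |‖y‖ - 1| ≤ t} ≤ oR ((m+1) * 2^(m+1) * t) * volume Bu m := by
  have hs : {y : Ec m | |‖y‖ - 1| ≤ t} ⊆ closedBall 0 (1+t) \ ball 0 (1-t) := fun y hy => by
    have := abs_le.1 (show |‖y‖ - 1| ≤ t from hy)
    simp only [Set.mem_sdiff, mem_closedBall_zero_iff, mem_ball_zero_iff, not_lt]; constructor <;> linarith
  refine (measure_mono hs).trans ?_
  rw [measure_sdiff ((ball_subset_ball (by linarith)).trans ball_subset_closedBall) measurableSet_ball.nullMeasurableSet measure_ball_lt_top.ne,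
    Measure.addHaar_closedBall _ _ (by linarith), Measure.addHaar_ball _ _ (by linarith : 0 ≤ 1 - t), ← ENNReal.sub_mul (fun _ _ => measure_ball_lt_top.ne),
    ← ENNReal.ofReal_sub _ (pow_nonneg (by linarith) _)]
  refine mul_le_mul_left (oRle ?_) _
  have h := le_trans (le_abs_self _) (abs_pow_sub_pow_le (1+t) (1-t) (m+1))
  rw [finrank_euclideanSpace_fin]
  refine h.trans ?_
  have e1 : |1 + t - (1 - t)| = 2 * t := by rw [show 1 + t - (1 - t) = 2 * t by ring]; exact abs_of_nonneg (by linarith)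
  have e2 : max |1+t| |1-t| ≤ 2 := max_le (abs_le.2 ⟨by linarith, by linarith⟩) (abs_le.2 ⟨by linarith, by linarith⟩)
  rw [e1, Nat.add_sub_cancel]
  have := pow_le_pow_left₀ (by positivity) e2 m
  calc _ ≤ 2 * t * (m+1 : ℕ) * 2^m := mLe this (by positivity)
    _ = _ := by push_cast; ring
theorem Wd_enn {d : ℝ} {F : Set (Euc n)} (h : Cand n d F) : ∫⁻ x, oR (|phi F x| * rho x) = oR (Wd F) :=
  (ofReal_integral_eq_lintegral_ofReal (Wd_int h) (ae_of_all _ fun x => mul_nonneg (abs_nonneg _) (rho_nonneg x))).symm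
theorem phi_meas {F : Set (Euc n)} (hF : MS F) : Measurable (phi F) := (chi_meas hF).sub (chi_meas msB)
theorem rho_ge {x : Euc n} (h : ‖x‖ < 2) : |‖x‖ - 1| ≤ 5 * rho x := by
  have h0 := norm_nonneg x
  have e : |1 - ‖x‖^2| = |‖x‖ - 1| * (1 + ‖x‖) := by
    rw [show 1 - ‖x‖^2 = -((‖x‖ - 1) * (1 + ‖x‖)) by ring, abs_neg, abs_mul, abs_of_nonneg (by linarith : 0 ≤ 1 + ‖x‖)]
  rw [rho, ← mul_div_assoc, le_div_iff₀ (by positivity), e]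
  nlinarith [abs_nonneg (‖x‖ - 1), mul_nonneg (abs_nonneg (‖x‖ - 1)) (by nlinarith : 0 ≤ 5 * (1 + ‖x‖) - (1 + ‖x‖^2))]
theorem tail_lem (m : ℕ) : ∃ C : ℝ≥0∞, C ≠ ∞ ∧ ∀ (k : ℝ → ℝ≥0∞) (A : ℝ≥0∞), Measurable k → (∀ r, k r ≤ A) → ∫⁻ v : Ec m, k ‖v‖ ≤ A →
    ∀ (F : Set Ec m) (d : ℝ), Cand (m+1) d F → NN k (chi F) ≤ C * A * oR (Wd F) := by
  obtain ⟨D, hD⟩ : ∃ D : ℝ≥0∞, D = oR ((m+1) * 2^(m+1) * 5) * volume Bu m := ⟨_, rfl⟩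
  have hDt : D ≠ ∞ := by rw [hD]; exact ENNReal.mul_ne_top (by finiteness) measure_ball_lt_top.ne
  refine ⟨oR (5/3) + 2 * D, ENNReal.add_ne_top.2 ⟨ENNReal.ofReal_ne_top, ENNReal.mul_ne_top ENNReal.ofNat_ne_top hDt⟩, fun k A hk hkA hkL F d hF => ?_⟩
  obtain ⟨p, hp⟩ : ∃ p : Ec m → ℝ≥0∞, p = fun x => oR |phi F x| := ⟨_, rfl⟩
  have hpm : Measurable p := by rw [hp]; exact (phi_meas hF.1).abs.ennreal_ofReal
  obtain ⟨f1, hf1⟩ : ∃ f : Ec m → ℝ≥0∞, f = {y : Ec m | 2 ≤ ‖y‖}.indicator p := ⟨_, rfl⟩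
  obtain ⟨f2, hf2⟩ : ∃ f : Ec m → ℝ≥0∞, f = {y : Ec m | ‖y‖ < 2}.indicator p := ⟨_, rfl⟩
  have hf1m : Measurable f1 := by rw [hf1]; exact hpm.indicator (measurableSet_le measurable_const measurable_norm)
  have hf2m : Measurable f2 := by rw [hf2]; exact hpm.indicator (measurableSet_lt measurable_norm measurable_const)
  obtain ⟨S, hS⟩ : ∃ S : Ec m → Ec m → ℝ≥0∞, S = fun x y => if |‖y‖ - 1| ≤ |‖x‖ - 1| then 1 else 0 := ⟨_, rfl⟩
  have hSm : Measurable (fun q : Ec m × Ec m => S q.1 q.2) := by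
    rw [hS]; exact Measurable.ite (measurableSet_le (by fun_prop) (by fun_prop)) measurable_const measurable_const
  have hpt : ∀ x y : Ec m, ‖x‖ < ‖y‖ → k ‖y - x‖ * oR (chi F y - chi F x) ≤ k ‖y - x‖ * f1 y + (A * (f2 x * S x y) + A * (f2 y * S y x)) := by
    intro x y hxy
    by_cases hF' : y ∈ F ∧ x ∉ F
    swap
    · have : chi F y - chi F x ≤ 0 := by
        unfold chi
        by_cases hx : x ∈ F
        · rw [indicator_of_mem hx]; have := indicator_le_self' (s := F) (f := (1 : Ec m → ℝ)) (fun _ _ => zero_le_one) y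
          simp only [Pi.one_apply] at *; linarith
        · rw [indicator_of_notMem hx, indicator_of_notMem fun h => hF' ⟨h, hx⟩]; simp
      rw [ENNReal.ofReal_of_nonpos this]; simp
    have h1 : chi F y - chi F x = 1 := by unfold chi; rw [indicator_of_mem hF'.1, indicator_of_notMem hF'.2]; simp
    rw [h1, ENNReal.ofReal_one, mul_one]
    have hpy : 1 ≤ ‖y‖ → p y = 1 := fun h => by
      have : phi F y = 1 := by rw [phi, chi, chi, indicator_of_mem hF'.1, indicator_of_notMem (by simpa using h)]; simp
      rw [hp]; simp [this]
    have hpx : ‖x‖ < 1 → p x = 1 := fun h => by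
      have : phi F x = -1 := by rw [phi, chi, chi, indicator_of_notMem hF'.2, indicator_of_mem (by simpa using h)]; simp
      rw [hp]; simp [this]
    by_cases h2 : 2 ≤ ‖y‖
    · refine le_add_right ?_
      rw [hf1, indicator_of_mem (show y ∈ {y : Ec m | 2 ≤ ‖y‖} from h2), hpy (by linarith), mul_one]
    push Not at h2
    refine le_add_left ((hkA _).trans ?_)
    have case1 : p x = 1 → |‖y‖ - 1| ≤ |‖x‖ - 1| → A ≤ A * (f2 x * S x y) + A * (f2 y * S y x) := fun a b => by
      refine le_add_right ?_
      rw [hf2, hS, indicator_of_mem (show x ∈ {y : Ec m | ‖y‖ < 2} from hxy.trans h2), a]; simp [b]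
    have case2 : p y = 1 → |‖x‖ - 1| ≤ |‖y‖ - 1| → A ≤ A * (f2 x * S x y) + A * (f2 y * S y x) := fun a b => by
      refine le_add_left ?_
      rw [hf2, hS, indicator_of_mem (show y ∈ {y : Ec m | ‖y‖ < 2} from h2), a]; simp [b]
    by_cases hy : 1 ≤ ‖y‖
    · by_cases hx : ‖x‖ < 1
      · rcases le_total |‖y‖ - 1| |‖x‖ - 1| with h | h
        · exact case1 (hpx hx) h
        · exact case2 (hpy hy) h
      · push Not at hx
        exact case2 (hpy hy) (by rw [abs_of_nonneg (by linarith), abs_of_nonneg (by linarith)]; linarith)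
    · push Not at hy
      exact case1 (hpx (hxy.trans hy)) (by rw [abs_of_neg (by linarith), abs_of_neg (by linarith)]; linarith)
  have hS2 : ∀ x, f2 x * ∫⁻ y, S x y ≤ D * oR (|phi F x| * rho x) := by
    intro x
    by_cases hx : ‖x‖ < 2
    · have ha : |‖x‖ - 1| ≤ 1 := abs_le.2 ⟨by linarith [norm_nonneg x], by linarith⟩
      have : ∫⁻ y, S x y = volume {y : Ec m | |‖y‖ - 1| ≤ |‖x‖ - 1|} := by
        rw [← lintegral_indicator_one (measurableSet_le (by fun_prop) (by fun_prop))]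
        refine lintegral_congr fun y => ?_
        rw [hS]; simp [indicator_apply]
      rw [this, hf2, indicator_of_mem (by exact hx), hp]
      refine (mul_le_mul_right (annul m (abs_nonneg (‖x‖ - 1)) ha) (oR |phi F x|)).trans ?_
      rw [hD, mul_left_comm, mul_right_comm _ (volume _), ← mul_assoc]
      refine mul_le_mul_left ?_ _
      rw [← ENNReal.ofReal_mul (by positivity), ← ENNReal.ofReal_mul (by positivity)]
      refine oRle ?_
      have := mLe (rho_ge hx) (by positivity : 0 ≤ (m+1) * 2^(m+1) * |phi F x|)
      linarith
    · rw [hf2, indicator_of_notMem (by exact hx)]; simp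
  have hT : ∫⁻ x, ∫⁻ y, A * (f2 x * S x y) ≤ A * (D * oR (Wd F)) := by
    rw [← Wd_enn hF, ← lintegral_const_mul' _ _ hDt, ← lintegral_const_mul _ (by
      have : Measurable (rho (n := m+1)) := rho_cont.measurable
      exact (((phi_meas hF.1).abs.mul this).ennreal_ofReal).const_mul _)]
    refine lintegral_mono fun x => ?_
    have e : Measurable fun y => S x y := hSm.comp (by fun_prop : Measurable fun y => (x, y))
    rw [lintegral_const_mul _ (e.const_mul _), lintegral_const_mul _ e]
    exact mul_le_mul_right (hS2 x) _
  have m1 : Measurable fun q : Ec m × Ec m => A * (f2 q.1 * S q.1 q.2) := ((hf2m.comp measurable_fst).mul hSm).const_mul _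
  have m2 : Measurable fun q : Ec m × Ec m => A * (f2 q.2 * S q.2 q.1) := m1.comp measurable_swap
  have m0 : Measurable fun q : Ec m × Ec m => k ‖q.2 - q.1‖ * f1 q.2 := (hk.comp (by fun_prop)).mul (hf1m.comp measurable_snd)
  have hT' : ∫⁻ x, ∫⁻ y, A * (f2 y * S y x) ≤ A * (D * oR (Wd F)) := by
    rw [lintegral_lintegral_swap (f := fun x y => A * (f2 y * S y x)) m2.aemeasurable]; exact hT
  have h0 : ∫⁻ x, ∫⁻ y, k ‖y - x‖ * f1 y ≤ A * (oR (5/3) * oR (Wd F)) := by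
    rw [(dbl_shift hk hf1m).2]
    refine mul_le_mul' hkL ?_
    rw [← Wd_enn hF, ← lintegral_const_mul' _ _ (by finiteness)]
    refine lintegral_mono fun x => ?_
    by_cases hx : 2 ≤ ‖x‖
    · simp only; rw [hf1, indicator_of_mem (by exact hx), hp, ← ENNReal.ofReal_mul (by positivity)]
      refine oRle ?_
      nlinarith [rho_far hx, abs_nonneg (phi F x)]
    · simp only; rw [hf1, indicator_of_notMem (by exact hx)]; exact zero_le
  calc NN k (chi F) ≤ ∫⁻ x, ∫⁻ y, (k ‖y - x‖ * f1 y + (A * (f2 x * S x y) + A * (f2 y * S y x))) := by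
        unfold NN
        refine lintegral_mono fun x => ?_
        have h := setLIntegral_mono' (μ := volume) (s := {y : Ec m | ‖x‖ < ‖y‖}) (measurableSet_lt measurable_const measurable_norm) fun y hy => hpt x y hy
        exact h.trans (setLIntegral_le_lintegral _ _)
    _ = (∫⁻ x, ∫⁻ y, k ‖y - x‖ * f1 y) + ((∫⁻ x, ∫⁻ y, A * (f2 x * S x y)) + ∫⁻ x, ∫⁻ y, A * (f2 y * S y x)) := by
        have l1 : Measurable fun x => ∫⁻ y, A * (f2 x * S x y) := Measurable.lintegral_prod_right' (ν := volume) m1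
        have l0 : Measurable fun x => ∫⁻ y, k ‖y - x‖ * f1 y := Measurable.lintegral_prod_right' (ν := volume) m0
        rw [← lintegral_add_left l1 (fun x => ∫⁻ y, A * (f2 y * S y x)), ← lintegral_add_left l0]
        congr 1; funext x
        have a0 : Measurable fun y => k ‖y - x‖ * f1 y := (hk.comp (by fun_prop)).mul hf1m
        have a1 : Measurable fun y => A * (f2 x * S x y) := ((hSm.comp measurable_prodMk_left).const_mul _).const_mul _
        exact (lintegral_add_left a0 _).trans (congrArg _ (lintegral_add_left a1 _))
    _ ≤ A * (oR (5/3) * oR (Wd F)) + (A * (D * oR (Wd F)) + A * (D * oR (Wd F))) := add_le_add h0 (add_le_add hT hT')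
    _ = _ := by ring
def bwn (x y : Euc n) : Prop := (1 ≤ ‖x‖ ∧ ‖x‖ < ‖y‖) ∨ (‖y‖ < ‖x‖ ∧ ‖x‖ < 1)
theorem cone_vol {A : Set (Ec m)} (hA : ∀ r : ℝ, 0 < r → ∀ x, r • x ∈ A ↔ x ∈ A) {r : ℝ} (hr : 0 ≤ r) :
    volume (A ∩ ball 0 r) = oR (r^(m+1)) * volume (A ∩ ball 0 1) ∧ volume (A ∩ closedBall 0 r) ≤ volume (A ∩ ball 0 r) := by
  constructor
  · rcases hr.eq_or_lt with rfl | hr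
    · simp
    have : A ∩ ball 0 r = r • (A ∩ Bu m) := by
      ext x
      rw [mem_smul_set_iff_inv_smul_mem₀ hr.ne']
      simp only [mem_inter_iff, hA r⁻¹ (inv_pos.2 hr) x, mem_ball_zero_iff, norm_smul, norm_inv, Real.norm_of_nonneg hr.le, inv_mul_lt_iff₀ hr, mul_one]
    rw [this, Measure.addHaar_smul, finrank_euclideanSpace_fin, abs_of_nonneg (by positivity)]
  · rw [← ball_union_sphere, inter_union_distrib_left]
    refine (measure_union_le _ _).trans ?_
    rw [measure_mono_null inter_subset_right (Measure.addHaar_sphere volume (0 : Ec m) r), add_zero]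
theorem mlow (m : ℕ) : ∃ c : ℝ, 0 < c ∧ ∀ τ : ℝ, 0 < τ → τ ≤ 1 → ∀ y : Ec m,
    oR (c * τ^(m+1) * rho y) ≤ volume ({x | bwn x y} ∩ closedBall y (2*τ)) := by
  obtain ⟨ω, hω⟩ : ∃ ω, ω = ballVol (m+1) := ⟨_, rfl⟩
  have hω0 : 0 < ω := hω ▸ ballVol_pos _
  have hωe : volume Bu m = oR ω := by rw [hω, ballVol, ENNReal.ofReal_toReal measure_ball_lt_top.ne]
  have hb : ∀ (p : Ec m) (r : ℝ), 0 ≤ r → volume (ball p r) = oR (r^(m+1) * ω) := fun p r hr => by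
    rw [Measure.addHaar_ball _ _ hr, hωe, finrank_euclideanSpace_fin, ENNReal.ofReal_mul (by positivity)]
  refine ⟨ω / (2 * 16^(m+1)), by positivity, fun τ h0 h1 y => ?_⟩
  have hu : ∃ u : Ec m, ‖u‖ = 1 ∧ y = ‖y‖ • u := by
    by_cases hy : y = 0
    · exact ⟨EuclideanSpace.single 0 1, by simp, by simp [hy]⟩
    · have := norm_pos_iff.2 hy
      exact ⟨‖y‖⁻¹ • y, by rw [norm_smul, norm_inv, norm_norm, inv_mul_cancel₀ this.ne'], by rw [smul_inv_smul₀ this.ne']⟩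
  obtain ⟨u, hu1, hu2⟩ := hu
  obtain ⟨R, hR⟩ : ∃ R, R = ‖y‖ := ⟨_, rfl⟩
  have hR0 : 0 ≤ R := hR ▸ norm_nonneg y
  rw [← hR] at hu2
  have hsm : ∀ a : ℝ, ‖a • u‖ = |a| := fun a => by rw [norm_smul, hu1, mul_one, Real.norm_eq_abs]
  by_cases hcase : τ/2 < |R - 1|
  · obtain ⟨p, hp⟩ : ∃ p : ℝ, |p - R| = τ/4 ∧ ∀ x : Ec m, ‖x - p • u‖ < τ/4 → bwn x y := by
      have key : ∀ p : ℝ, 0 ≤ p → ∀ x : Ec m, ‖x - p • u‖ < τ/4 → p - τ/4 < ‖x‖ ∧ ‖x‖ < p + τ/4 := fun p hp x hx => by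
        have := abs_lt.1 ((abs_norm_sub_norm_le x (p • u)).trans_lt hx)
        rw [hsm, abs_of_nonneg hp] at this
        constructor <;> linarith
      rcases le_or_gt 1 R with h | h
      · rw [abs_of_nonneg (by linarith)] at hcase
        refine ⟨R - τ/4, by rw [sub_sub_cancel_left, abs_neg, abs_of_nonneg (by positivity)], fun x hx => Or.inl ?_⟩
        have := key _ (by linarith) x hx
        rw [← hR]; constructor <;> linarith
      · rw [abs_of_neg (by linarith)] at hcase
        refine ⟨R + τ/4, by rw [add_sub_cancel_left, abs_of_nonneg (by positivity)], fun x hx => Or.inr ?_⟩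
        have := key _ (by linarith) x hx
        rw [← hR]; constructor <;> linarith
    refine le_trans ?_ (measure_mono (s := ball (p • u) (τ/4)) fun x hx => ⟨hp.2 x (by rwa [← dist_eq_norm]), ?_⟩)
    · rw [hb _ _ (by positivity)]
      refine oRle ?_
      calc _ ≤ ω / (2 * 16^(m+1)) * τ^(m+1) * 1 := mLe (rho_le y) (by positivity)
        _ = (τ/16)^(m+1) * ω / 2 := by rw [div_pow]; field_simp
        _ ≤ (τ/4)^(m+1) * ω := by
          have : (τ/16)^(m+1) ≤ (τ/4)^(m+1) := pow_le_pow_left₀ (by positivity) (by linarith) _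
          nlinarith [pow_pos (by positivity : 0 < τ/16) (m+1)]
    · rw [mem_ball, dist_eq_norm] at hx
      rw [mem_closedBall, dist_eq_norm]
      have : ‖p • u - y‖ = τ/4 := by rw [hu2, ← sub_smul, hsm, hp.1]
      linarith [norm_sub_le_norm_sub_add_norm_sub x (p • u) y]
  · push Not at hcase
    obtain ⟨A, hA⟩ : ∃ A : Set Ec m, A = {x | ‖x - ‖x‖ • u‖ ≤ τ/2 * ‖x‖} := ⟨_, rfl⟩
    have hAc : ∀ r : ℝ, 0 < r → ∀ x, r • x ∈ A ↔ x ∈ A := fun r hr x => by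
      rw [hA]; simp only [mem_setOf_eq]
      rw [norm_smul, Real.norm_of_nonneg hr.le, mul_smul, ← smul_sub, norm_smul, Real.norm_of_nonneg hr.le, mul_left_comm]
      exact mul_le_mul_iff_right₀ hr
    obtain ⟨r1, hr1⟩ : ∃ r, r = min 1 R := ⟨_, rfl⟩
    obtain ⟨r2, hr2⟩ : ∃ r, r = max 1 R := ⟨_, rfl⟩
    have hr10 : 0 ≤ r1 := hr1 ▸ le_min zero_le_one hR0
    have hr12 : r1 ≤ 1 := hr1 ▸ min_le_left _ _
    have hr21 : 1 ≤ r2 := hr2 ▸ le_max_left _ _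
    have hrR : r1 ≤ R ∧ R ≤ r2 := ⟨hr1 ▸ min_le_right _ _, hr2 ▸ le_max_right _ _⟩
    have hrd : r2 - r1 = |R - 1| := by rw [hr1, hr2, max_sub_min_eq_abs']; exact abs_sub_comm _ _
    have hV : oR ((τ/16)^(m+1) * ω) ≤ volume (A ∩ ball 0 1) := by
      rw [← hb ((1/2 : ℝ) • u) _ (by positivity)]
      refine measure_mono fun x hx => ?_
      rw [mem_ball, dist_eq_norm] at hx
      have h2 := abs_lt.1 ((abs_norm_sub_norm_le x ((1/2 : ℝ) • u)).trans_lt hx)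
      rw [hsm, abs_of_nonneg (by norm_num)] at h2
      refine ⟨?_, by rw [mem_ball_zero_iff]; linarith⟩
      rw [hA, mem_setOf_eq]
      have h3 : ‖(1/2 : ℝ) • u - ‖x‖ • u‖ ≤ τ/16 := by rw [← sub_smul, hsm]; exact abs_le.2 ⟨by linarith, by linarith⟩
      have := norm_sub_le_norm_sub_add_norm_sub x ((1/2 : ℝ) • u) (‖x‖ • u)
      nlinarith
    have hsub : (A ∩ ball 0 r2) \ (A ∩ closedBall 0 r1) ⊆ {x | bwn x y} ∩ closedBall y (2*τ) := fun x ⟨⟨hxA, hx2⟩, hx1⟩ => by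
      have hx1' : r1 < ‖x‖ := by by_contra h; exact hx1 ⟨hxA, by simpa using h⟩
      rw [mem_ball_zero_iff] at hx2
      rw [hA, mem_setOf_eq] at hxA
      constructor
      · rw [mem_setOf_eq, bwn, ← hR]
        rcases le_or_gt 1 R with h | h
        · rw [hr1, min_eq_left h] at hx1'; rw [hr2, max_eq_right h] at hx2; exact Or.inl ⟨hx1'.le, hx2⟩
        · rw [hr1, min_eq_right h.le] at hx1'; rw [hr2, max_eq_left h.le] at hx2; exact Or.inr ⟨hx1', hx2⟩
      · rw [mem_closedBall, dist_eq_norm]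
        have h3 : ‖‖x‖ • u - y‖ ≤ τ/2 := by
          rw [hu2, ← sub_smul, hsm]; exact abs_le.2 ⟨by linarith, by linarith⟩
        have := norm_sub_le_norm_sub_add_norm_sub x (‖x‖ • u) y
        nlinarith
    refine le_trans ?_ (measure_mono hsub)
    refine le_trans ?_ le_measure_sdiff
    obtain ⟨v1, v2⟩ := cone_vol hAc hr10
    refine le_trans ?_ (tsub_le_tsub_left v2 _)
    rw [v1, (cone_vol hAc (by linarith : 0 ≤ r2)).1, ← ENNReal.sub_mul (fun _ _ => ne_top_of_le_ne_top measure_ball_lt_top.ne (measure_mono inter_subset_right)),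
      ← ENNReal.ofReal_sub _ (by positivity)]
    refine le_trans ?_ (mul_le_mul_right hV _)
    have hpw : r2 - r1 ≤ r2^(m+1) - r1^(m+1) := by
      have a := one_le_pow₀ hr21 (n := m)
      have b := pow_le_pow_left₀ hr10 (by linarith : r1 ≤ r2) m
      have c : r1 * r1^m ≤ r1 * r2^m := mLe b hr10
      rw [pow_succ', pow_succ']
      nlinarith [mRi a (by linarith : 0 ≤ r2 - r1)]
    have hpos : 0 ≤ r2 - r1 := by linarith
    rw [← ENNReal.ofReal_mul (hpos.trans hpw)]
    refine oRle ?_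
    have hρ : rho y ≤ 2 * (r2 - r1) := by
      rw [hrd, rho, ← hR, div_le_iff₀ (by positivity), show 1 - R^2 = -((R-1)*(1+R)) by ring, abs_neg, abs_mul, abs_of_nonneg (by linarith : 0 ≤ 1 + R)]
      nlinarith [abs_nonneg (R-1), mul_nonneg (abs_nonneg (R-1)) (by nlinarith [sq_nonneg (R-1)] : 0 ≤ 2 * (1 + R^2) - (1+R))]
    calc _ ≤ ω / (2 * 16^(m+1)) * τ^(m+1) * (2 * (r2 - r1)) := mLe hρ (by positivity)
      _ = (r2 - r1) * ((τ/16)^(m+1) * ω) := by rw [div_pow]; field_simp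
      _ ≤ _ := mRi hpw (by positivity)
theorem gauss_int {b : ℝ} (hb : 0 < b) : Integrable fun v : Euc n => Real.exp (-b * ‖v‖^2) := by
  have h := (GaussianFourier.integrable_cexp_neg_mul_sq_norm_add (V := Euc n) (b := b) (by simpa using hb) 0 0).norm
  refine h.congr (ae_of_all _ fun v => ?_)
  simp only [Complex.norm_exp]
  congr 1
  simp [← Complex.ofReal_pow]
theorem gauss_cos {b : ℝ} (hb : 0 < b) (z : Euc n) :
    ∫ v : Euc n, Real.exp (-b * ‖v‖^2) * Real.cos (inner ℝ z v) = (∫ v : Euc n, Real.exp (-b * ‖v‖^2)) * Real.exp (-(‖z‖^2 / (4*b))) := by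
  have hb' : 0 < (b : ℂ).re := by simpa using hb
  have key : ∀ w : Euc n, ∫ v : Euc n, Real.exp (-b * ‖v‖^2) * Real.cos (inner ℝ w v) =
      (((Real.pi : ℂ) / b) ^ (Module.finrank ℝ (Euc n) / 2 : ℂ)).re * Real.exp (-(‖w‖^2 / (4*b))) := by
    intro w
    have h := GaussianFourier.integral_cexp_neg_mul_sq_norm_add (V := Euc n) hb' Complex.I w
    have h2 := congrArg Complex.re h
    rw [show (∫ v : Euc n, Complex.exp (-b * ‖v‖^2 + Complex.I * (inner ℝ w v : ℝ))).re = ∫ v : Euc n, (Complex.exp (-b * ‖v‖^2 + Complex.I * (inner ℝ w v : ℝ))).re from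
      (integral_re (GaussianFourier.integrable_cexp_neg_mul_sq_norm_add hb' Complex.I w)).symm] at h2
    rw [show Complex.exp (Complex.I^2 * ‖w‖^2 / (4*b)) = ((Real.exp (-(‖w‖^2 / (4*b))) : ℝ) : ℂ) by rw [Complex.ofReal_exp]; congr 1; push_cast; rw [Complex.I_sq]; ring,
      Complex.re_mul_ofReal] at h2
    rw [← h2]
    congr 1; funext v
    rw [Complex.exp_re]
    congr 1 <;> simp [← Complex.ofReal_pow]
  have k0 := key 0
  simp only [inner_zero_left, Real.cos_zero, mul_one, norm_zero] at k0
  rw [k0, key z]; simp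
theorem four {b : ℝ} (hb : 0 < b) {φ : Euc n → ℝ} (hφ : Integrable φ) :
    (∫ v : Euc n, Real.exp (-b * ‖v‖^2)) * ∫ q : Euc n × Euc n, φ q.1 * φ q.2 * Real.exp (-(‖q.2 - q.1‖^2 / (4*b))) =
      ∫ v : Euc n, Real.exp (-b * ‖v‖^2) * ((∫ x, φ x * Real.cos (inner ℝ v x))^2 + (∫ x, φ x * Real.sin (inner ℝ v x))^2) := by
  have hΦ : Integrable fun q : Euc n × Euc n => φ q.1 * φ q.2 := hφ.mul_prod hφ
  have h3 : Integrable (fun z : (Euc n × Euc n) × Euc n => φ z.1.1 * φ z.1.2 * Real.exp (-b * ‖z.2‖^2) * Real.cos (inner ℝ (z.1.2 - z.1.1) z.2)) ((volume : Measure (Euc n × Euc n)).prod volume) := by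
    refine Integrable.mul_bdd (c := 1) (hΦ.mul_prod (gauss_int (n := n) hb)) (Continuous.aestronglyMeasurable (by fun_prop)) (ae_of_all _ fun z => ?_)
    exact Real.abs_cos_le_one _
  rw [← integral_const_mul]
  calc _ = ∫ q : Euc n × Euc n, ∫ v : Euc n, φ q.1 * φ q.2 * Real.exp (-b * ‖v‖^2) * Real.cos (inner ℝ (q.2 - q.1) v) := by
        congr 1; funext q
        rw [mul_left_comm, ← gauss_cos hb, ← integral_const_mul]
        simp only [mul_assoc]
    _ = ∫ v : Euc n, ∫ q : Euc n × Euc n, φ q.1 * φ q.2 * Real.exp (-b * ‖v‖^2) * Real.cos (inner ℝ (q.2 - q.1) v) :=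
        integral_integral_swap (f := fun (q : Euc n × Euc n) (v : Euc n) => φ q.1 * φ q.2 * Real.exp (-b * ‖v‖^2) * Real.cos (inner ℝ (q.2 - q.1) v)) h3
    _ = _ := by
        congr 1; funext v
        have ic : Integrable fun x => φ x * Real.cos (inner ℝ v x) := Integrable.mul_bdd (c := 1) hφ (Continuous.aestronglyMeasurable (by fun_prop)) (ae_of_all _ fun z => Real.abs_cos_le_one _)
        have is : Integrable fun x => φ x * Real.sin (inner ℝ v x) := Integrable.mul_bdd (c := 1) hφ (Continuous.aestronglyMeasurable (by fun_prop)) (ae_of_all _ fun z => Real.abs_sin_le_one _)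
        have e1 := integral_prod_mul (μ := volume) (ν := volume) (fun x : Euc n => φ x * Real.cos (inner ℝ v x)) (fun x : Euc n => φ x * Real.cos (inner ℝ v x))
        have e2 := integral_prod_mul (μ := volume) (ν := volume) (fun x : Euc n => φ x * Real.sin (inner ℝ v x)) (fun x : Euc n => φ x * Real.sin (inner ℝ v x))
        have i1 := ic.mul_prod ic
        have i2 := is.mul_prod is
        rw [sq (∫ x, φ x * Real.cos (inner ℝ v x)), sq (∫ x, φ x * Real.sin (inner ℝ v x)), ← e1, ← e2, ← integral_add i1 i2, ← integral_const_mul]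
        congr 1; funext q
        rw [inner_sub_left, Real.cos_sub, real_inner_comm, real_inner_comm v q.1]
        ring
theorem chi_cases (F : Set (Euc n)) (x : Euc n) : chi F x = 0 ∨ chi F x = 1 := by
  unfold chi; by_cases h : x ∈ F
  · right; rw [indicator_of_mem h]; rfl
  · left; rw [indicator_of_notMem h]
theorem chiB (x : Euc n) : chi (ball (0 : Euc n) 1) x = if ‖x‖ < 1 then 1 else 0 := by
  unfold chi; rw [indicator_apply]; simp
theorem low_pt (F : Set (Euc n)) (x y : Euc n) :
    |phi F y| * (if bwn x y then 1 else 0) + |phi F x| * (if bwn y x then 1 else 0) - phi F x * phi F y ≤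
      (if ‖x‖ < ‖y‖ then max (chi F y - chi F x) 0 else 0) + (if ‖y‖ < ‖x‖ then max (chi F x - chi F y) 0 else 0) := by
  rw [phi, phi, chiB, chiB]; unfold bwn
  have t : ∀ z : Euc n, (‖z‖ < 1 ∧ ¬ 1 ≤ ‖z‖) ∨ (¬ ‖z‖ < 1 ∧ 1 ≤ ‖z‖) := fun z => (lt_or_ge ‖z‖ 1).imp (fun h => ⟨h, h.not_ge⟩) fun h => ⟨not_lt.2 h, h⟩
  have l : (‖x‖ < ‖y‖ ∧ ¬ ‖y‖ < ‖x‖) ∨ (¬ ‖x‖ < ‖y‖ ∧ ‖y‖ < ‖x‖) ∨ (¬ ‖x‖ < ‖y‖ ∧ ¬ ‖y‖ < ‖x‖) := by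
    rcases lt_trichotomy ‖x‖ ‖y‖ with h | h | h
    · exact Or.inl ⟨h, h.not_gt⟩
    · exact Or.inr (Or.inr ⟨h.not_lt, h.not_gt⟩)
    · exact Or.inr (Or.inl ⟨h.not_gt, h⟩)
  rcases chi_cases F x with h | h <;> rcases chi_cases F y with h' | h' <;> rw [h, h'] <;>
  rcases l with ⟨l1, l2⟩ | ⟨l1, l2⟩ | ⟨l1, l2⟩ <;> rcases t x with ⟨x1, x2⟩ | ⟨x1, x2⟩ <;> rcases t y with ⟨y1, y2⟩ | ⟨y1, y2⟩ <;>
  first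
  | (exfalso; linarith)
  | (simp only [l1, l2, x1, x2, y1, y2, if_true, if_false, and_true, and_false, true_and, false_and, or_true, or_false, false_or, true_or]; norm_num)
def kG (τ r : ℝ) : ℝ≥0∞ := oR (Real.exp (-((max r 0)^2 / τ^2)))
theorem kG_norm (τ : ℝ) (v : Euc n) : kG τ ‖v‖ = oR (Real.exp (-(‖v‖^2 / τ^2))) := by
  rw [kG, max_eq_left (norm_nonneg v)]
theorem kG_int {τ : ℝ} (h : 0 < τ) : Integrable fun v : Euc n => Real.exp (-(‖v‖^2 / τ^2)) := by
  refine (gauss_int (n := n) (b := (τ^2)⁻¹) (by positivity)).congr (ae_of_all _ fun v => ?_)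
  simp only; congr 1; ring
theorem bwn_meas : MS {q : Euc n × Euc n | bwn q.1 q.2} := by
  unfold bwn
  have a : Measurable fun q : Euc n × Euc n => ‖q.1‖ := by fun_prop
  have b : Measurable fun q : Euc n × Euc n => ‖q.2‖ := by fun_prop
  exact ((measurableSet_le measurable_const a).inter (measurableSet_lt a b)).union ((measurableSet_lt b a).inter (measurableSet_lt a measurable_const))
theorem phi_le (F : Set (Euc n)) (x : Euc n) : |phi F x| ≤ chi F x + chi (ball (0 : Euc n) 1) x := by
  have h1 := chi01 F x
  have h2 := chi01 (ball (0 : Euc n) 1) x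
  exact abs_le.2 ⟨by unfold phi; linarith, by unfold phi; linarith⟩
theorem W_low (m : ℕ) : ∃ c : ℝ, 0 < c ∧ ∀ τ : ℝ, 0 < τ → τ ≤ 1 → ∀ (F : Set Ec m) (d : ℝ), Cand (m+1) d F →
    oR (c * τ^(m+1) * Wd F - 1/2 * ∫ q : Ec m × Ec m, phi F q.1 * phi F q.2 * Real.exp (-(‖q.2 - q.1‖^2 / τ^2))) ≤ NN (kG τ) (chi F) := by
  obtain ⟨c, hc0, hc⟩ := mlow m
  refine ⟨Real.exp (-4) * c, by positivity, fun τ h0 h1 F d hF => ?_⟩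
  obtain ⟨K, hK⟩ : ∃ K : Ec m × Ec m → ℝ, K = fun q => Real.exp (-(‖q.2 - q.1‖^2 / τ^2)) := ⟨_, rfl⟩
  have hKc : Continuous K := by rw [hK]; fun_prop
  have hK0 : ∀ q, 0 < K q := fun q => by rw [hK]; exact Real.exp_pos _
  have hKs : ∀ q : Ec m × Ec m, K q.swap = K q := fun q => by rw [hK]; simp only [Prod.fst_swap, Prod.snd_swap]; rw [norm_sub_rev]
  have hcm := chi_meas hF.1
  have hpm := phi_meas hF.1
  have hhi : Integrable fun x => chi F x + chi Bu m x := (chi_int hF.1 (cand_fin hF)).add (chi_int msB measure_ball_lt_top.ne)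
  have hdom : Integrable fun q : Ec m × Ec m => K q * (chi F q.2 + chi Bu m q.2) := by
    refine (Integrable.convolution_integrand (ContinuousLinearMap.mul ℝ ℝ) hhi (kG_int (n := m+1) h0)).congr (ae_of_all _ fun q => ?_)
    simp only [ContinuousLinearMap.mul_apply', hK]; rw [mul_comm, norm_sub_rev]
  have dom : ∀ f : Ec m × Ec m → ℝ, Measurable f → (∀ q, |f q| ≤ chi F q.2 + chi Bu m q.2) → Integrable fun q => K q * f q := fun f hf hb => by
    refine hdom.mono' (hKc.measurable.mul hf).aestronglyMeasurable (ae_of_all _ fun q => ?_)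
    rw [norm_mul, Real.norm_of_nonneg (hK0 q).le, Real.norm_eq_abs]
    exact mLe (hb q) (hK0 q).le
  obtain ⟨f1, hf1⟩ : ∃ f : Ec m × Ec m → ℝ, f = fun q => |phi F q.2| * (if bwn q.1 q.2 then 1 else 0) := ⟨_, rfl⟩
  obtain ⟨T, hT⟩ : ∃ f : Ec m × Ec m → ℝ, f = fun q => if ‖q.1‖ < ‖q.2‖ then max (chi F q.2 - chi F q.1) 0 else 0 := ⟨_, rfl⟩
  have hf1m : Measurable f1 := by
    rw [hf1]; exact (hpm.abs.comp measurable_snd).mul (Measurable.ite bwn_meas measurable_const measurable_const)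
  have hTm : Measurable T := by
    rw [hT]; exact Measurable.ite (measurableSet_lt (by fun_prop) (by fun_prop)) (((hcm.comp measurable_snd).sub (hcm.comp measurable_fst)).max measurable_const) measurable_const
  have hT0 : ∀ q, 0 ≤ T q := fun q => by rw [hT]; simp only; split_ifs <;> simp
  have hf10 : ∀ q, 0 ≤ f1 q := fun q => by rw [hf1]; simp only; split_ifs <;> simp
  have i1 := dom f1 hf1m fun q => by
    rw [abs_of_nonneg (hf10 q), hf1]; simp only
    refine le_trans ?_ (phi_le F q.2)
    split_ifs <;> simp
  have iT := dom T hTm fun q => by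
    have a := chi01 F q.1; have b := chi01 F q.2; have e := chi01 Bu m q.2
    rw [abs_of_nonneg (hT0 q), hT]; simp only
    split_ifs
    · exact max_le (by linarith) (by linarith)
    · linarith
  have iφ := dom (fun q => phi F q.1 * phi F q.2) ((hpm.comp measurable_fst).mul (hpm.comp measurable_snd)) fun q => by
    rw [abs_mul]
    exact (mul_le_of_le_one_left (abs_nonneg _) (phi_abs F q.1)).trans (phi_le F q.2)
  have sw : ∀ f : Ec m × Ec m → ℝ, (∫ q, K q * f q.swap) = ∫ q, K q * f q := fun f => by
    have := integral_prod_swap (μ := (volume : Measure Ec m)) (ν := (volume : Measure Ec m)) fun q => K q * f q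
    simp only [hKs] at this; exact this
  have is : ∀ f : Ec m × Ec m → ℝ, (Integrable fun q => K q * f q) → Integrable fun q => K q * f q.swap := fun f hf => by
    have := Integrable.swap (μ := (volume : Measure Ec m)) (ν := (volume : Measure Ec m)) hf
    refine this.congr (ae_of_all _ fun q => ?_)
    simp only [Function.comp, hKs]
  have main : 2 * (∫ q, K q * f1 q) - (∫ q, K q * (phi F q.1 * phi F q.2)) ≤ 2 * ∫ q, K q * T q := by
    have e1 : 2 * (∫ q, K q * f1 q) - (∫ q, K q * (phi F q.1 * phi F q.2)) = ∫ q, (K q * f1 q + K q * f1 q.swap - K q * (phi F q.1 * phi F q.2)) := by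
      rw [integral_sub (f := fun q => K q * f1 q + K q * f1 q.swap) (i1.add (is f1 i1)) iφ, integral_add i1 (is f1 i1), sw]; ring
    have e2 : 2 * (∫ q, K q * T q) = ∫ q, (K q * T q + K q * T q.swap) := by
      rw [integral_add iT (is T iT), sw]; ring
    rw [e1, e2]
    refine integral_mono ((i1.add (is f1 i1)).sub iφ) (iT.add (is T iT)) fun q => ?_
    simp only
    have := mLe (low_pt F q.1 q.2) (hK0 q).le
    rw [hf1, hT]; simp only [Prod.fst_swap, Prod.snd_swap]
    linarith
  have hN : oR (∫ q, K q * T q) = NN (kG τ) (chi F) := by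
    have hm : Measurable fun q => oR (K q * T q) := (hKc.measurable.mul hTm).ennreal_ofReal
    rw [ofReal_integral_eq_lintegral_ofReal iT (ae_of_all _ fun q => mul_nonneg (hK0 q).le (hT0 q)), Measure.volume_eq_prod, lintegral_prod _ hm.aemeasurable, NN]
    congr 1; funext x
    rw [← lintegral_indicator (measurableSet_lt measurable_const measurable_norm)]
    congr 1; funext y
    rw [indicator_apply, kG_norm, hK, hT, ENNReal.ofReal_mul (Real.exp_pos _).le]
    by_cases h : ‖x‖ < ‖y‖
    · simp only [h, if_true, mem_setOf_eq]
      congr 1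
      rcases le_total (chi F y - chi F x) 0 with h' | h'
      · rw [max_eq_right h', ENNReal.ofReal_zero, ENNReal.ofReal_of_nonpos h']
      · rw [max_eq_left h']
    · simp [h]
  have hW : Real.exp (-4) * c * τ^(m+1) * Wd F ≤ ∫ q, K q * f1 q := by
    have h00 : 0 ≤ ∫ q, K q * f1 q := integral_nonneg fun q => mul_nonneg (hK0 q).le (hf10 q)
    rw [← ENNReal.ofReal_le_ofReal_iff h00, ENNReal.ofReal_mul (by positivity), ← Wd_enn hF]
    have hm : Measurable fun q => oR (K q * f1 q) := (hKc.measurable.mul hf1m).ennreal_ofReal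
    rw [ofReal_integral_eq_lintegral_ofReal i1 (ae_of_all _ fun q => mul_nonneg (hK0 q).le (hf10 q)), Measure.volume_eq_prod, lintegral_prod_symm _ hm.aemeasurable,
      ← lintegral_const_mul' _ _ (by finiteness)]
    refine lintegral_mono fun y => ?_
    have hms : MS ({x | bwn x y} ∩ closedBall y (2*τ)) := (bwn_meas.preimage (measurable_prodMk_right (y := y))).inter measurableSet_closedBall
    calc _ = oR (Real.exp (-4) * |phi F y|) * oR (c * τ^(m+1) * rho y) := by
          rw [← ENNReal.ofReal_mul (by positivity), ← ENNReal.ofReal_mul (by positivity)]; congr 1; ring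
      _ ≤ oR (Real.exp (-4) * |phi F y|) * volume ({x | bwn x y} ∩ closedBall y (2*τ)) := mul_le_mul_right (hc τ h0 h1 y) _
      _ = ∫⁻ x in {x | bwn x y} ∩ closedBall y (2*τ), oR (Real.exp (-4) * |phi F y|) := by rw [setLIntegral_const]
      _ ≤ ∫⁻ x in {x | bwn x y} ∩ closedBall y (2*τ), oR (K (x, y) * f1 (x, y)) := by
          refine setLIntegral_mono' hms fun x hx => oRle ?_
          have hb : bwn x y := hx.1
          rw [hK, hf1]; simp only [hb, if_true, mul_one]
          refine mRi (Real.exp_le_exp.2 ?_) (abs_nonneg _)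
          have h2 := hx.2
          rw [mem_closedBall, dist_comm, dist_eq_norm] at h2
          rw [neg_le_neg_iff, div_le_iff₀ (by positivity)]
          nlinarith [norm_nonneg (y - x)]
      _ ≤ _ := setLIntegral_le_lintegral _ _
  rw [← hN]
  refine oRle ?_
  have : (∫ q, K q * (phi F q.1 * phi F q.2)) = ∫ q : Ec m × Ec m, phi F q.1 * phi F q.2 * Real.exp (-(‖q.2 - q.1‖^2 / τ^2)) := by
    rw [hK]; simp only [mul_comm]
  rw [this] at main
  linarith
theorem lt_ms : MS {q : Euc n × Euc n | ‖q.1‖ < ‖q.2‖} := by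
  have a : Measurable fun q : Euc n × Euc n => ‖q.1‖ := by fun_prop
  have b : Measurable fun q : Euc n × Euc n => ‖q.2‖ := by fun_prop
  exact measurableSet_lt a b
theorem kd_meas {k : ℝ → ℝ≥0∞} (hk : Measurable k) : Measurable fun q : Euc n × Euc n => k ‖q.2 - q.1‖ := by
  have a : Measurable fun q : Euc n × Euc n => ‖q.2 - q.1‖ := by fun_prop
  exact hk.comp a
theorem NN_meas {k : ℝ → ℝ≥0∞} (hk : Measurable k) {F : Set (Euc n)} (hF : MS F) :
    Measurable fun q : Euc n × Euc n => k ‖q.2 - q.1‖ * oR (chi F q.2 - chi F q.1) := by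
  have hc := chi_meas hF
  exact (kd_meas hk).mul ((hc.comp measurable_snd).sub (hc.comp measurable_fst)).ennreal_ofReal
theorem NN_prod {k : ℝ → ℝ≥0∞} (hk : Measurable k) {F : Set (Euc n)} (hF : MS F) :
    NN k (chi F) = ∫⁻ q in {q : Euc n × Euc n | ‖q.1‖ < ‖q.2‖}, k ‖q.2 - q.1‖ * oR (chi F q.2 - chi F q.1) := by
  rw [← lintegral_indicator lt_ms, Measure.volume_eq_prod, lintegral_prod _ ((NN_meas hk hF).indicator lt_ms).aemeasurable, NN]
  congr 1; funext x
  rw [← lintegral_indicator (measurableSet_lt measurable_const measurable_norm)]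
  rfl
theorem NN_split {k : ℝ → ℝ≥0∞} (hk : Measurable k) {F : Set (Euc n)} (hF : MS F) (r0 : ℝ) :
    NN k (chi F) ≤ NN (fun r => if r < r0 then k r else 0) (chi F) + NN (fun r => if r < r0 then 0 else k r) (chi F) := by
  have hk1 : Measurable fun r => if r < r0 then k r else 0 := Measurable.ite measurableSet_Iio hk measurable_const
  have hk2 : Measurable fun r => if r < r0 then 0 else k r := Measurable.ite measurableSet_Iio measurable_const hk
  rw [NN_prod hk hF, NN_prod hk1 hF, NN_prod hk2 hF]
  refine le_trans (lintegral_mono fun q => ?_) (lintegral_add_left (NN_meas hk1 hF) _).le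
  simp only
  split_ifs <;> simp
theorem nt (m : ℕ) : ∃ (r0 : ℝ) (C : ℝ≥0∞), 0 < r0 ∧ r0 ≤ 1 ∧ C ≠ ∞ ∧ ∀ (k : ℝ → ℝ≥0∞) (A : ℝ≥0∞), Antitone k → (∀ r, k r ≠ ∞) → k r0 ≤ A →
    ∫⁻ v : Ec m, (if ‖v‖ < r0 then 0 else k ‖v‖) ≤ A → ∀ (F : Set Ec m) (d : ℝ), 0 ≤ d → Cand (m+1) d F →
    NN k (chi F) ≤ C * (Mk (m+1) (fun r => if r < r0 then k r else 0) + A) * oR (d + Wd F) := by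
  obtain ⟨C1, hC1, h1⟩ := lemN m
  obtain ⟨C2, hC2, h2⟩ := tail_lem m
  refine ⟨1 / (400 * (m+1 : ℕ)), C1 * oR (m+2) + C2, by positivity, ?_, by finiteness, ?_⟩
  · rw [div_le_one (by positivity)]; push_cast; nlinarith [(Nat.cast_nonneg m : (0:ℝ) ≤ m)]
  generalize (1 / (400 * (m+1 : ℕ)) : ℝ) = r0 at *
  intro k A hk hkt hA hA2 F d hd hF
  have hkm : Measurable k := hk.measurable
  have hW := Wd_nonneg F
  have n1 := h1 (fun r => if r < r0 then k r else 0) (fun a b hab => by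
      dsimp only; split_ifs with x y y
      · exact hk hab
      · linarith
      · exact zero_le
      · exact le_rfl) (fun r => by split_ifs <;> simp [hkt]) (fun r hr => by simp [not_lt.2 hr]) F d hF
  have n2 := h2 (fun r => if r < r0 then 0 else k r) A (Measurable.ite measurableSet_Iio measurable_const hkm) (fun r => by
      split_ifs with x
      · exact zero_le
      · exact (hk (not_lt.1 x)).trans hA) hA2 F d hF
  refine (NN_split hkm hF.1 r0).trans ((add_le_add n1 n2).trans ?_)
  generalize Mk (m+1) (fun r => if r < r0 then k r else 0) = M
  have e1 : oR (d + (m+2) * Wd F) ≤ oR (m+2) * oR (d + Wd F) := by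
    rw [← ENNReal.ofReal_mul (by positivity)]
    refine oRle ?_
    nlinarith [(Nat.cast_nonneg m : (0:ℝ) ≤ m)]
  have e2 : oR (Wd F) ≤ oR (d + Wd F) := oRle (by linarith)
  calc _ ≤ C1 * M * (oR (m+2) * oR (d + Wd F)) + C2 * A * oR (d + Wd F) := by gcongr
    _ = (C1 * oR (m+2) * M + C2 * A) * oR (d + Wd F) := by ring
    _ ≤ (C1 * oR (m+2) * (M + A) + C2 * (M + A)) * oR (d + Wd F) := by
        gcongr
        · exact le_self_add
        · exact le_add_self
    _ = _ := by ring
theorem kG_NN (m : ℕ) : ∃ C : ℝ, 0 ≤ C ∧ ∀ τ : ℝ, 0 < τ → τ ≤ 1 → ∀ (F : Set Ec m) (d : ℝ), 0 ≤ d → Cand (m+1) d F →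
    NN (kG τ) (chi F) ≤ oR (C * τ^(m+2) * (d + Wd F)) := by
  obtain ⟨r0, C, hr0, hr1, hC, h⟩ := nt m
  have hM : Mk (m+1) (kG 1) ≠ ∞ := by
    have i : Integrable fun v : Ec m => Real.exp (-(1/2) * ‖v‖^2) := by
      have := gauss_int (n := m+1) (b := 1/2) (by norm_num)
      exact this
    refine ne_top_of_le_ne_top i.lintegral_lt_top.ne (lintegral_mono fun v => ?_)
    rw [kG_norm, ← ENNReal.ofReal_mul (Real.exp_pos _).le]
    refine oRle ?_
    have h1 : ‖v‖ ≤ Real.exp ((1/2) * ‖v‖^2) := by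
      nlinarith [Real.add_one_le_exp ((1/2) * ‖v‖^2), sq_nonneg (‖v‖ - 1)]
    calc _ ≤ Real.exp (-(‖v‖^2 / 1^2)) * Real.exp ((1/2) * ‖v‖^2) := by gcongr
      _ = _ := by rw [← Real.exp_add]; congr 1; ring
  obtain ⟨I, hI⟩ : ∃ I, I = ∫ v : Ec m, Real.exp (-(1/2) * ‖v‖^2) := ⟨_, rfl⟩
  have iI : Integrable fun v : Ec m => Real.exp (-(1/2) * ‖v‖^2) := by
    have := gauss_int (n := m+1) (b := 1/2) (by norm_num)
    exact this
  have hI0 : 0 ≤ I := by rw [hI]; exact integral_nonneg fun v => (Real.exp_pos _).le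
  obtain ⟨E, hE⟩ : ∃ E : ℝ, E = (m+2).factorial * (2 / r0^2)^(m+2) * (1 + I) := ⟨_, rfl⟩
  have hE0 : 0 ≤ E := by rw [hE]; positivity
  refine ⟨(C * (Mk (m+1) (kG 1) + oR E)).toReal, ENNReal.toReal_nonneg, fun τ h0 h1 F d hd hF => ?_⟩
  have hpt : ∀ r, r0 ≤ r → Real.exp (-(r^2/τ^2)) ≤ Real.exp (-(r0^2/(2*τ^2))) * Real.exp (-(1/2) * r^2) := fun r hr => by
    rw [← Real.exp_add, Real.exp_le_exp]
    have : r0^2/(2*τ^2) + 1/2*r^2 ≤ r^2/τ^2 := by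
      rw [le_div_iff₀ (by positivity), add_mul]
      have e : r0^2/(2*τ^2)*τ^2 = r0^2/2 := by field_simp
      rw [e]
      have : τ^2 ≤ 1 := by nlinarith
      nlinarith [sq_nonneg r]
    linarith
  have hexp : Real.exp (-(r0^2/(2*τ^2))) * (1 + I) ≤ E * τ^(m+2) := by
    have hx : 0 < r0^2/(2*τ^2) := by positivity
    have h2 := Real.pow_div_factorial_le_exp _ hx.le (m+2)
    have h3 : Real.exp (-(r0^2/(2*τ^2))) ≤ (m+2).factorial * (2 / r0^2)^(m+2) * τ^(m+2) := by
      rw [Real.exp_neg]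
      refine (inv_anti₀ (by positivity) h2).trans ?_
      have : ((r0^2/(2*τ^2))^(m+2) / ((m+2).factorial : ℝ))⁻¹ = (m+2).factorial * (2 / r0^2)^(m+2) * (τ^(m+2) * τ^(m+2)) := by
        rw [inv_div, div_eq_mul_inv, ← inv_pow, inv_div, mul_assoc, ← mul_pow, ← mul_pow]; congr 2; ring
      rw [this]
      refine mLe ?_ (by positivity)
      exact mul_le_of_le_one_left (by positivity) (pow_le_one₀ h0.le h1)
    calc _ ≤ (m+2).factorial * (2 / r0^2)^(m+2) * τ^(m+2) * (1 + I) := by gcongr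
      _ = _ := by rw [hE]; ring
  have key := h (kG τ) (oR (E * τ^(m+2))) (fun a b hab => by
      unfold kG
      refine oRle (Real.exp_le_exp.2 (neg_le_neg ?_))
      gcongr) (fun r => ENNReal.ofReal_ne_top) (by
      unfold kG
      refine oRle (le_trans ?_ hexp)
      rw [max_eq_left hr0.le]
      refine (hpt r0 le_rfl).trans ?_
      refine mLe ?_ (Real.exp_pos _).le
      refine (Real.exp_le_one_iff.2 ?_).trans (by linarith)
      nlinarith [sq_nonneg r0]) (by
      refine le_trans ?_ (oRle hexp)
      refine le_trans (lintegral_mono (g := fun v => oR (Real.exp (-(r0^2/(2*τ^2))) * Real.exp (-(1/2) * ‖v‖^2))) fun v => ?_) ?_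
      · simp only
        split_ifs with hv
        · exact zero_le
        · rw [kG_norm]; exact oRle (hpt _ (not_lt.1 hv))
      · rw [← ofReal_integral_eq_lintegral_ofReal (iI.const_mul _) (ae_of_all _ fun v => by positivity), integral_const_mul, ← hI]
        refine oRle (mLe (by linarith) (Real.exp_pos _).le)) F d hd hF
  have hMk : Mk (m+1) (fun r => if r < r0 then kG τ r else 0) ≤ oR (τ^(m+2)) * Mk (m+1) (kG 1) := by
    have := Mk_scale (n := m+1) (inv_pos.2 h0) (kG 1)
    rw [show (τ⁻¹)⁻¹ * (τ⁻¹^(m+1))⁻¹ = τ^(m+2) by rw [inv_inv, inv_pow, inv_inv]; ring] at this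
    rw [← this]
    refine lintegral_mono fun v => mul_le_mul_left ?_ _
    dsimp only
    split_ifs
    · rw [kG_norm, kG, max_eq_left (by positivity)]
      refine oRle (Real.exp_le_exp.2 (le_of_eq ?_))
      congr 1; ring
    · exact zero_le
  refine key.trans ?_
  have hp : 0 ≤ τ^(m+2) := by positivity
  rw [mul_assoc _ (τ^(m+2)), ENNReal.ofReal_mul ENNReal.toReal_nonneg, ENNReal.ofReal_mul hp, ← mul_assoc, ENNReal.ofReal_toReal (by finiteness)]
  refine mul_le_mul_left ?_ _
  calc _ ≤ C * (oR (τ^(m+2)) * Mk (m+1) (kG 1) + oR (E * τ^(m+2))) := by gcongr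
    _ = _ := by rw [ENNReal.ofReal_mul hE0]; ring
theorem quad_le (hm : 1 ≤ m) (C₀ : ℝ) (hC₀ : 0 < C₀) {τ : ℝ} (h0 : 0 < τ) : ∃ C : ℝ, 0 ≤ C ∧ ∀ (F : Set Ec m) (d : ℝ), 0 < d → d ≤ 1 → Cand (m+1) d F →
    Cent (m+1) C₀ d F → (∫ q : Ec m × Ec m, phi F q.1 * phi F q.2 * Real.exp (-(‖q.2 - q.1‖^2 / τ^2))) ≤ C * d := by
  obtain ⟨C, hC, h⟩ := trig hm C₀ hC₀
  obtain ⟨b, hb⟩ : ∃ b : ℝ, b = τ^2/4 := ⟨_, rfl⟩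
  have hb0 : 0 < b := by rw [hb]; positivity
  have hG : 0 < ∫ v : Ec m, Real.exp (-b * ‖v‖^2) := integral_exp_pos (gauss_int hb0)
  have iJ := gauss_int (n := m+1) (half_pos hb0)
  have hJ0 : 0 ≤ ∫ v : Ec m, Real.exp (-(b/2) * ‖v‖^2) := integral_nonneg fun v => (Real.exp_pos _).le
  refine ⟨2 * C^2 * (2 + 4/b) * (∫ v : Ec m, Real.exp (-(b/2) * ‖v‖^2)) / ∫ v : Ec m, Real.exp (-b * ‖v‖^2), by positivity, fun F d hd hd1 hF hc => ?_⟩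
  have e := four hb0 (phi_int hF)
  rw [show (4*b) = τ^2 by rw [hb]; ring] at e
  rw [div_mul_eq_mul_div, le_div_iff₀ hG, mul_comm, e]
  have : (∫ v : Ec m, Real.exp (-(b/2) * ‖v‖^2) * (2 * C^2 * (2 + 4/b) * d)) = 2 * C^2 * (2 + 4/b) * (∫ v : Ec m, Real.exp (-(b/2) * ‖v‖^2)) * d := by
    rw [integral_mul_const]; ring
  rw [← this]
  refine integral_mono_of_nonneg (ae_of_all _ fun v => by positivity) (iJ.mul_const _) (ae_of_all _ fun v => ?_)
  simp only
  obtain ⟨t1, t2⟩ := h F d hd hd1 hF hc v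
  have sq : ∀ X : ℝ, |X| ≤ C * (1 + ‖v‖) * √d → X^2 ≤ C^2 * (1 + ‖v‖)^2 * d := fun X hX => by
    rw [← sq_abs]
    calc _ ≤ (C * (1 + ‖v‖) * √d)^2 := by gcongr
      _ = _ := by rw [mul_pow, mul_pow, Real.sq_sqrt hd.le]
  have s1 := sq _ t1
  have s2 := sq _ t2
  have hx : (1 + ‖v‖)^2 ≤ (2 + 4/b) * Real.exp (b/2 * ‖v‖^2) := by
    have x1 := Real.add_one_le_exp (b/2 * ‖v‖^2)
    have x2 : 1 ≤ Real.exp (b/2 * ‖v‖^2) := Real.one_le_exp (by positivity)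
    have x3 : 4/b * (b/2 * ‖v‖^2) = 2 * ‖v‖^2 := by field_simp; ring
    have x4 : 4/b * (b/2 * ‖v‖^2) ≤ 4/b * Real.exp (b/2 * ‖v‖^2) := mLe (by linarith) (by positivity)
    nlinarith [sq_nonneg (‖v‖ - 1)]
  calc _ ≤ Real.exp (-b * ‖v‖^2) * (2 * C^2 * d * (1 + ‖v‖)^2) := by
        refine mLe ?_ (Real.exp_pos _).le; linarith
    _ ≤ Real.exp (-b * ‖v‖^2) * (2 * C^2 * d * ((2 + 4/b) * Real.exp (b/2 * ‖v‖^2))) := by gcongr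
    _ = (Real.exp (-b * ‖v‖^2) * Real.exp (b/2 * ‖v‖^2)) * (2 * C^2 * (2 + 4/b) * d) := by ring
    _ = _ := by rw [← Real.exp_add]; congr 2; ring
theorem W_le (hm : 1 ≤ m) (C₀ : ℝ) (hC₀ : 0 < C₀) : ∃ C : ℝ, 0 ≤ C ∧ ∀ (F : Set Ec m) (d : ℝ), 0 < d → d ≤ 1 → Cand (m+1) d F →
    Cent (m+1) C₀ d F → Wd F ≤ C * d := by
  obtain ⟨c, hc, h1⟩ := W_low m
  obtain ⟨D, hD, h2⟩ := kG_NN m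
  obtain ⟨τ, hτ⟩ : ∃ τ : ℝ, τ = min 1 (c / (2 * (D + 1))) := ⟨_, rfl⟩
  have hτ0 : 0 < τ := by rw [hτ]; positivity
  have hτ1 : τ ≤ 1 := by rw [hτ]; exact min_le_left _ _
  have hτ2 : D * τ ≤ c / 2 := by
    have : τ ≤ c / (2 * (D + 1)) := by rw [hτ]; exact min_le_right _ _
    rw [le_div_iff₀ (by positivity)] at this
    nlinarith
  obtain ⟨Q, hQ, h3⟩ := quad_le hm C₀ hC₀ hτ0
  refine ⟨1 + Q / (c * τ^(m+1)), by positivity, fun F d hd hd1 hF hce => ?_⟩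
  have a1 := (h1 τ hτ0 hτ1 F d hF).trans (h2 τ hτ0 hτ1 F d hd.le hF)
  have hW := Wd_nonneg F
  rw [ENNReal.ofReal_le_ofReal_iff (by positivity)] at a1
  have a2 := h3 F d hd hd1 hF hce
  have hp : 0 < τ^(m+1) := by positivity
  have a3 : D * τ^(m+2) * (d + Wd F) ≤ c / 2 * (τ^(m+1) * (d + Wd F)) := by
    calc _ = D * τ * (τ^(m+1) * (d + Wd F)) := by ring
      _ ≤ _ := by gcongr
  have a4 : c * τ^(m+1) * Wd F ≤ c * τ^(m+1) * d + Q * d := by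
    have a5 : c / 2 * (τ^(m+1) * (d + Wd F)) = c * τ^(m+1) * d / 2 + c * τ^(m+1) * Wd F / 2 := by ring
    linarith
  have : Wd F ≤ (c * τ^(m+1) * d + Q * d) / (c * τ^(m+1)) := by
    rw [le_div_iff₀ (by positivity)]; linarith
  refine this.trans (le_of_eq ?_)
  field_simp
def PE (k : ℝ → ℝ≥0∞) (F : Set (Euc n)) : ℝ≥0∞ := ∫⁻ x, ∫⁻ y, k ‖y - x‖ * oR |chi F x - chi F y|
theorem PE_meas {k : ℝ → ℝ≥0∞} (hk : Measurable k) {F : Set (Euc n)} (hF : MS F) :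
    Measurable fun q : Euc n × Euc n => k ‖q.2 - q.1‖ * oR |chi F q.1 - chi F q.2| := by
  have hc := chi_meas hF
  have a : Measurable fun q : Euc n × Euc n => |chi F q.1 - chi F q.2| := ((hc.comp measurable_fst).sub (hc.comp measurable_snd)).norm
  exact (kd_meas hk).mul a.ennreal_ofReal
theorem half_int (f : Ec m × Ec m → ℝ≥0∞) :
    ∫⁻ q, f q = (∫⁻ q in {q : Ec m × Ec m | ‖q.1‖ < ‖q.2‖}, f q) + ∫⁻ q in {q : Ec m × Ec m | ‖q.1‖ < ‖q.2‖}, f q.swap := by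
  rw [← lintegral_add_compl f lt_ms]
  congr 1
  have mT : MS {q : Ec m × Ec m | ‖q.2‖ < ‖q.1‖} := by
    have a : Measurable fun q : Ec m × Ec m => ‖q.1‖ := by fun_prop
    have b : Measurable fun q : Ec m × Ec m => ‖q.2‖ := by fun_prop
    exact measurableSet_lt b a
  have mD : MS {q : Ec m × Ec m | ‖q.2‖ = ‖q.1‖} := by
    have a : Measurable fun q : Ec m × Ec m => ‖q.1‖ := by fun_prop
    have b : Measurable fun q : Ec m × Ec m => ‖q.2‖ := by fun_prop
    exact measurableSet_eq_fun b a
  have h0 : (volume : Measure (Ec m × Ec m)) {q | ‖q.2‖ = ‖q.1‖} = 0 := by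
    rw [Measure.volume_eq_prod, Measure.measure_prod_null mD]
    refine ae_of_all _ fun x => ?_
    have : Prod.mk x ⁻¹' {q : Ec m × Ec m | ‖q.2‖ = ‖q.1‖} = sphere 0 ‖x‖ := by ext y; simp
    show volume _ = 0
    rw [this]; exact Measure.addHaar_sphere _ _ _
  have e1 : ∫⁻ q in {q : Ec m × Ec m | ‖q.1‖ < ‖q.2‖}ᶜ, f q = ∫⁻ q in {q : Ec m × Ec m | ‖q.2‖ < ‖q.1‖}, f q := by
    refine setLIntegral_congr ?_
    have := compl_mem_ae_iff.2 h0
    filter_upwards [this] with q hq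
    refine propext ⟨fun h => ?_, fun h => not_lt.2 (le_of_lt (show ‖q.2‖ < ‖q.1‖ from h))⟩
    exact lt_of_le_of_ne (not_lt.1 h) hq
  rw [e1, ← lintegral_indicator mT, ← lintegral_indicator lt_ms]
  have := lintegral_prod_swap (μ := (volume : Measure Ec m)) (ν := (volume : Measure Ec m)) ({q : Ec m × Ec m | ‖q.2‖ < ‖q.1‖}.indicator f)
  rw [← Measure.volume_eq_prod] at this
  rw [← this]; rfl
theorem M_mono (k : ℝ → ℝ≥0∞) {y y' : Euc n} (h : ‖y‖ ≤ ‖y'‖) :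
    ∫⁻ x in ball (0 : Euc n) ‖y‖, k ‖y - x‖ ≤ ∫⁻ x in ball (0 : Euc n) ‖y'‖, k ‖y' - x‖ := by
  rcases eq_or_lt_of_le (norm_nonneg y) with h0 | h0
  · rw [← h0]; simp
  have h0' := h0.trans_le h
  obtain ⟨U, hU⟩ := exists_iso (x := y) (y := (‖y‖ / ‖y'‖) • y') (by rw [norm_smul, norm_div, norm_norm, norm_norm, div_mul_cancel₀ _ h0'.ne'])
  rw [← lintegral_indicator msB, ← lintegral_indicator msB]
  have e := sim_lintegral one_pos U (y' - U y) ((ball (0 : Euc n) ‖y'‖).indicator fun x => k ‖y' - x‖)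
  rw [one_pow, inv_one, ENNReal.ofReal_one, one_mul] at e
  rw [← e]
  refine lintegral_mono fun x => ?_
  by_cases hx : x ∈ ball (0 : Euc n) ‖y‖
  · have hs : y' - sim 1 U (y' - U y) x = U (y - x) := by rw [sim, map_sub, one_smul]; abel
    have hy : y' - U y = (1 - ‖y‖ / ‖y'‖) • y' := by rw [hU, sub_smul, one_smul]
    have hin : sim 1 U (y' - U y) x ∈ ball (0 : Euc n) ‖y'‖ := by
      rw [mem_ball_zero_iff, sim, one_smul]
      rw [mem_ball_zero_iff] at hx
      have t1 : ‖y' - U y‖ = ‖y'‖ - ‖y‖ := by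
        rw [hy, norm_smul, Real.norm_of_nonneg (by rw [sub_nonneg, div_le_one h0']; exact h), sub_mul, div_mul_cancel₀ _ h0'.ne', one_mul]
      have t2 := norm_add_le (U x) (y' - U y)
      rw [U.norm_map, t1] at t2
      linarith
    rw [indicator_of_mem hx, indicator_of_mem hin, hs, U.norm_map]
  · rw [indicator_of_notMem hx]; exact zero_le
theorem bathtub {F : Set (Euc n)} (hF : MS F) (hv : volume F = volume (ball (0 : Euc n) 1)) {M : Euc n → ℝ≥0∞}
    (hM : ∀ x y, ‖x‖ ≤ ‖y‖ → M x ≤ M y) {e : Euc n} (he : ‖e‖ = 1) : ∫⁻ x in ball (0 : Euc n) 1, M x ≤ ∫⁻ x in F, M x := by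
  rw [← lintegral_inter_add_sdiff M (ball (0 : Euc n) 1) hF, ← lintegral_inter_add_sdiff M F (measurableSet_ball (x := (0 : Euc n)) (ε := 1)), inter_comm]
  refine add_le_add le_rfl ?_
  have hv2 : volume (ball (0 : Euc n) 1 \ F) = volume (F \ ball 0 1) := by
    have a := measure_inter_add_sdiff (μ := volume) (ball (0 : Euc n) 1) hF
    have b := measure_inter_add_sdiff (μ := volume) F (measurableSet_ball (x := (0 : Euc n)) (ε := 1))
    rw [hv, ← a, inter_comm] at b
    exact ((ENNReal.add_right_inj (ne_top_of_le_ne_top measure_ball_lt_top.ne (measure_mono inter_subset_left))).1 b).symm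
  calc _ ≤ ∫⁻ x in ball (0 : Euc n) 1 \ F, M e := setLIntegral_mono' (measurableSet_ball.diff hF) fun x hx => hM _ _ (by
          rw [he]; exact (mem_ball_zero_iff.1 hx.1).le)
    _ = ∫⁻ x in F \ ball (0 : Euc n) 1, M e := by rw [setLIntegral_const, setLIntegral_const, hv2]
    _ ≤ _ := setLIntegral_mono' (MeasurableSet.diff hF msB) fun x hx => hM _ _ (by
          rw [he]; have := hx.2; rw [mem_ball_zero_iff, not_lt] at this; exact this)
theorem PE_id {k : ℝ → ℝ≥0∞} (hk : Measurable k) {F : Set (Ec m)} (hF : MS F) :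
    PE k F + 4 * (∫⁻ y in F, ∫⁻ x in ball (0 : Ec m) ‖y‖, k ‖y - x‖) = 2 * ((∫⁻ v : Ec m, k ‖v‖) * volume F) + 4 * NN k (chi F) := by
  have hc := chi_meas hF
  have m2 : Measurable fun q : Ec m × Ec m => k ‖q.2 - q.1‖ * oR (chi F q.2) := (kd_meas hk).mul (hc.comp measurable_snd).ennreal_ofReal
  have m1 : Measurable fun q : Ec m × Ec m => k ‖q.2 - q.1‖ * oR (chi F q.1) := (kd_meas hk).mul (hc.comp measurable_fst).ennreal_ofReal
  have hc1 : ∀ y, oR (chi F y) = F.indicator 1 y := fun y => by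
    by_cases h : y ∈ F <;> simp [chi, h]
  obtain ⟨J, hJ⟩ : ∃ J, J = ∫⁻ q in {q : Ec m × Ec m | ‖q.1‖ < ‖q.2‖}, k ‖q.2 - q.1‖ * oR |chi F q.1 - chi F q.2| := ⟨_, rfl⟩
  obtain ⟨I, hI⟩ : ∃ J, J = ∫⁻ q in {q : Ec m × Ec m | ‖q.1‖ < ‖q.2‖}, k ‖q.2 - q.1‖ * oR (chi F q.2) := ⟨_, rfl⟩
  obtain ⟨I', hI'⟩ : ∃ J, J = ∫⁻ q in {q : Ec m × Ec m | ‖q.1‖ < ‖q.2‖}, k ‖q.2 - q.1‖ * oR (chi F q.1) := ⟨_, rfl⟩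
  have e1 : PE k F = 2 * J := by
    have a := half_int fun q : Ec m × Ec m => k ‖q.2 - q.1‖ * oR |chi F q.1 - chi F q.2|
    simp only [Prod.fst_swap, Prod.snd_swap] at a
    rw [Measure.volume_eq_prod, lintegral_prod _ (PE_meas hk hF).aemeasurable, ← Measure.volume_eq_prod] at a
    rw [PE, a, hJ, two_mul]
    congr 2; funext q; rw [norm_sub_rev, abs_sub_comm]
  have e2 : (∫⁻ v : Ec m, k ‖v‖) * volume F = I + I' := by
    have a := half_int fun q : Ec m × Ec m => k ‖q.2 - q.1‖ * oR (chi F q.2)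
    simp only [Prod.fst_swap, Prod.snd_swap] at a
    rw [Measure.volume_eq_prod, lintegral_prod _ m2.aemeasurable, ← Measure.volume_eq_prod, (dbl_shift hk hc.ennreal_ofReal).2] at a
    have b : ∫⁻ x, oR (chi F x) = volume F := by simp only [hc1]; exact lintegral_indicator_one hF
    rw [b] at a
    rw [a, hI, hI']
    congr 2; funext q; rw [norm_sub_rev]
  have e3 : ∫⁻ y in F, ∫⁻ x in ball (0 : Ec m) ‖y‖, k ‖y - x‖ = I := by
    rw [hI, ← lintegral_indicator lt_ms, Measure.volume_eq_prod, lintegral_prod_symm _ (m2.indicator lt_ms).aemeasurable, ← lintegral_indicator hF]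
    congr 1; funext y
    by_cases hy : y ∈ F
    · rw [indicator_of_mem hy, ← lintegral_indicator msB]
      congr 1; funext x
      by_cases hx : ‖x‖ < ‖y‖
      · rw [indicator_of_mem (mem_ball_zero_iff.2 hx), indicator_of_mem (show (x, y) ∈ {q : Ec m × Ec m | ‖q.1‖ < ‖q.2‖} from hx)]
        simp [hc1, hy]
      · rw [indicator_of_notMem (fun h => hx (mem_ball_zero_iff.1 h)), indicator_of_notMem (show (x, y) ∉ {q : Ec m × Ec m | ‖q.1‖ < ‖q.2‖} from hx)]
    · rw [indicator_of_notMem hy]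
      refine ((lintegral_congr fun x => ?_).trans lintegral_zero).symm
      simp [indicator_apply, hc1, hy]
  have e4 : J + I = I' + 2 * NN k (chi F) := by
    rw [NN_prod hk hF, hJ, hI, hI', ← lintegral_add_right _ m2, ← lintegral_const_mul _ (NN_meas hk hF), ← lintegral_add_left m1]
    congr 1; funext q
    rcases chi_cases F q.1 with h1 | h1 <;> rcases chi_cases F q.2 with h2 | h2 <;> simp [h1, h2, two_mul, ENNReal.ofReal_of_nonpos (show (-1:ℝ) ≤ 0 by norm_num)]
  rw [e1, e2, e3]
  calc _ = 2 * (J + I) + 2 * I := by ring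
    _ = _ := by rw [e4]; ring
theorem NN_ball (k : ℝ → ℝ≥0∞) : NN k (chi Bu m) = 0 := by
  rw [NN]
  refine (lintegral_congr fun x => ?_).trans lintegral_zero
  refine (setLIntegral_congr_fun (measurableSet_lt measurable_const measurable_norm) fun y hy => ?_).trans lintegral_zero
  have : ‖x‖ < ‖y‖ := hy
  rw [chiB, chiB, ENNReal.ofReal_of_nonpos, mul_zero]
  split_ifs <;> first | linarith | norm_num
theorem PE_cmp {k : ℝ → ℝ≥0∞} (hk : Measurable k) (hL : ∫⁻ v : Ec m, k ‖v‖ ≠ ∞) {F : Set (Ec m)} {d : ℝ} (hF : Cand (m+1) d F) :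
    PE k F ≤ PE k Bu m + 4 * NN k (chi F) := by
  have h1 := PE_id hk hF.1
  have h2 := PE_id hk (measurableSet_ball (x := (0 : Ec m)) (ε := 1))
  rw [NN_ball, mul_zero, add_zero, ← hF.2.1] at h2
  rw [← h2] at h1
  have hb : ∫⁻ y in Bu m, ∫⁻ x in ball (0 : Ec m) ‖y‖, k ‖y - x‖ ≤ ∫⁻ y in F, ∫⁻ x in ball (0 : Ec m) ‖y‖, k ‖y - x‖ :=
    bathtub hF.1 hF.2.1 (fun x y h => M_mono k h) (e := EuclideanSpace.single 0 1) (by simp)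
  have hfin : 4 * ∫⁻ y in F, ∫⁻ x in ball (0 : Ec m) ‖y‖, k ‖y - x‖ ≠ ∞ := by
    refine ENNReal.mul_ne_top (by finiteness) (ne_top_of_le_ne_top (ENNReal.mul_ne_top hL (cand_fin hF)) ?_)
    rw [← setLIntegral_const]
    refine lintegral_mono fun y => (setLIntegral_le_lintegral _ _).trans ?_
    rw [lintegral_sub_left_eq_self (fun v => k ‖v‖)]
  refine (ENNReal.add_le_add_iff_right hfin).1 ?_
  rw [h1, add_right_comm]
  gcongr
def ks (a r : ℝ) : ℝ≥0∞ := oR (r^(-a))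
def kj (a : ℝ) (j : ℕ) (r : ℝ) : ℝ≥0∞ := oR ((max r (1/(j+1)))^(-a))
theorem ks_meas (a : ℝ) : Measurable (ks a) := (measurable_id.pow_const (-a)).ennreal_ofReal
theorem ker_near (m : ℕ) {s r0 : ℝ} (hs : s < 1) (h0 : 0 < r0) : Mk (m+1) (fun r => if r < r0 then ks ((m+1:ℕ)+s) r else 0) ≠ ∞ := by
  have i : Integrable (fun v : Ec m => (fun r : ℝ => if r < r0 then r^(-(((m+1:ℕ):ℝ)+s)) * r else 0) ‖v‖) := by
    refine (integrable_fun_norm_addHaar (volume : Measure Ec m) (f := fun r : ℝ => if r < r0 then r^(-(((m+1:ℕ):ℝ)+s)) * r else 0)).2 ?_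
    rw [finrank_euclideanSpace_fin, Nat.add_sub_cancel]
    have h := (integrable_indicator_iff measurableSet_Ioo).2 ((intervalIntegral.integrableOn_Ioo_rpow_iff h0).2 (show -1 < -s by linarith))
    refine (h.integrableOn (s := Ioi 0)).congr_fun (fun y hy => ?_) measurableSet_Ioi
    have hy0 : 0 < y := hy
    by_cases hr : y < r0
    · rw [indicator_of_mem (show y ∈ Ioo 0 r0 from ⟨hy0, hr⟩)]
      simp only [hr, if_true, smul_eq_mul]
      rw [← mul_assoc, ← Real.rpow_natCast, ← Real.rpow_add hy0, ← Real.rpow_add_one hy0.ne']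
      congr 1; push_cast; ring
    · rw [indicator_of_notMem (fun h => hr h.2)]; simp [hr]
  refine ne_top_of_le_ne_top i.lintegral_lt_top.ne (lintegral_mono fun v => ?_)
  dsimp only
  split_ifs
  · rw [ks, ← ENNReal.ofReal_mul (by positivity)]
  · simp
theorem ker_far (m : ℕ) {s r0 : ℝ} (hs : 0 < s) (h0 : 0 < r0) : ∫⁻ v : Ec m, (if ‖v‖ < r0 then 0 else ks ((m+1:ℕ)+s) ‖v‖) ≠ ∞ := by
  have i : Integrable (fun v : Ec m => (fun r : ℝ => if r < r0 then 0 else r^(-(((m+1:ℕ):ℝ)+s))) ‖v‖) := by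
    refine (integrable_fun_norm_addHaar (volume : Measure Ec m) (f := fun r : ℝ => if r < r0 then 0 else r^(-(((m+1:ℕ):ℝ)+s)))).2 ?_
    rw [finrank_euclideanSpace_fin, Nat.add_sub_cancel]
    have h := (integrable_indicator_iff measurableSet_Ici).2 ((integrableOn_Ici_iff_integrableOn_Ioi).2 (integrableOn_Ioi_rpow_of_lt (show -1-s < -1 by linarith) h0))
    refine (h.integrableOn (s := Ioi 0)).congr_fun (fun y hy => ?_) measurableSet_Ioi
    have hy0 : 0 < y := hy
    by_cases hr : y < r0
    · rw [indicator_of_notMem (show y ∉ Ici r0 from fun h => not_le.2 hr h)]; simp [hr]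
    · rw [indicator_of_mem (show y ∈ Ici r0 from not_lt.1 hr)]
      simp only [hr, if_false, smul_eq_mul]
      rw [← Real.rpow_natCast, ← Real.rpow_add hy0]
      congr 1; push_cast; ring
  refine ne_top_of_le_ne_top i.lintegral_lt_top.ne (lintegral_mono fun v => ?_)
  dsimp only
  split_ifs
  · simp
  · rfl
theorem PE_sim (a : ℝ) {l : ℝ} (hl : 0 < l) (U : Euc n ≃ₗᵢ[ℝ] Euc n) (c : Euc n) (F : Set (Euc n)) :
    PE (ks a) (sim l U c ⁻¹' F) = oR (l^a * ((l^n)⁻¹ * (l^n)⁻¹)) * PE (ks a) F := by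
  have e : ∀ x y : Euc n, ks a ‖y - x‖ * oR |chi (sim l U c ⁻¹' F) x - chi (sim l U c ⁻¹' F) y| =
      oR (l^a) * (ks a ‖sim l U c y - sim l U c x‖ * oR |chi F (sim l U c x) - chi F (sim l U c y)|) := fun x y => by
    have h1 : ‖sim l U c y - sim l U c x‖ = l * ‖y - x‖ := by
      rw [sim, sim, add_sub_add_right_eq_sub, ← smul_sub, ← map_sub, norm_smul, U.norm_map, Real.norm_of_nonneg hl.le]
    rw [h1, ← mul_assoc, ks, ks, ← ENNReal.ofReal_mul (Real.rpow_pos_of_pos hl a).le, Real.mul_rpow hl.le (norm_nonneg _), ← mul_assoc (l^a), ← Real.rpow_add hl, add_neg_cancel, Real.rpow_zero, one_mul]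
    rfl
  simp only [PE, e]
  have e2 : ∀ x : Euc n, ∫⁻ y, oR (l^a) * (ks a ‖sim l U c y - sim l U c x‖ * oR |chi F (sim l U c x) - chi F (sim l U c y)|) =
      oR (l^a * (l^n)⁻¹) * (fun x => ∫⁻ y, ks a ‖y - x‖ * oR |chi F x - chi F y|) (sim l U c x) := fun x => by
    rw [lintegral_const_mul' _ _ (by finiteness), sim_lintegral hl U c (fun y => ks a ‖y - sim l U c x‖ * oR |chi F (sim l U c x) - chi F y|),
      ← mul_assoc, ← ENNReal.ofReal_mul (by positivity)]
  simp only [e2]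
  rw [lintegral_const_mul' _ _ (by finiteness), sim_lintegral hl U c (fun x => ∫⁻ y, ks a ‖y - x‖ * oR |chi F x - chi F y|),
      ← mul_assoc, ← ENNReal.ofReal_mul (by positivity), mul_assoc (l^a)]
theorem ball_shift (m : ℕ) : ∃ D : ℝ≥0∞, D ≠ ∞ ∧ ∀ h : Ec m, ∫⁻ x, oR |chi Bu m x - chi Bu m (x + h)| ≤ D ∧
    (‖h‖ ≤ 1 → ∫⁻ x, oR |chi Bu m x - chi Bu m (x + h)| ≤ D * oR ‖h‖) := by
  obtain ⟨w, hw⟩ : ∃ w, w = volume Bu m := ⟨_, rfl⟩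
  have hwt : w ≠ ∞ := by rw [hw]; exact measure_ball_lt_top.ne
  refine ⟨2 * w + oR ((m+1) * 2^(m+1)) * w, by finiteness, fun h => ⟨?_, fun h1 => ?_⟩⟩
  · refine le_trans ?_ le_self_add
    have hm : Measurable fun x : Ec m => (Bu m).indicator (1 : Ec m → ℝ≥0∞) x := measurable_one.indicator msB
    calc _ ≤ ∫⁻ x : Ec m, ((Bu m).indicator 1 x + (Bu m).indicator 1 (x + h)) := by
          refine lintegral_mono fun x => ?_
          by_cases a : x ∈ Bu m <;> by_cases b : x + h ∈ Bu m <;> simp only [chi, a, b, indicator_of_mem, indicator_of_notMem, not_false_eq_true] <;> simp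
      _ = w + w := by
          rw [lintegral_add_left hm, lintegral_add_right_eq_self (fun x => (Bu m).indicator (1 : Ec m → ℝ≥0∞) x) h, lintegral_indicator_one msB, hw]
      _ = _ := (two_mul w).symm
  · calc _ ≤ ∫⁻ x : Ec m, {y : Ec m | |‖y‖ - 1| ≤ ‖h‖}.indicator 1 x := by
          refine lintegral_mono fun x => ?_
          have t1 := norm_add_le x h
          have t2 := norm_add_le (x + h) (-h)
          rw [add_neg_cancel_right, norm_neg] at t2
          by_cases c : |‖x‖ - 1| ≤ ‖h‖
          · rw [indicator_of_mem (show x ∈ {y : Ec m | |‖y‖ - 1| ≤ ‖h‖} from c)]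
            rw [Pi.one_apply, ← ENNReal.ofReal_one]
            refine oRle ?_
            rw [chiB, chiB]; split_ifs <;> norm_num
          · have : chi Bu m x = chi Bu m (x + h) := by
              rw [chiB, chiB]
              rw [abs_le, not_and_or, not_le, not_le] at c
              congr 1
              refine propext ⟨fun q => ?_, fun q => ?_⟩ <;> rcases c with c | c <;> linarith [norm_nonneg h]
            rw [this]; simp
      _ = volume {y : Ec m | |‖y‖ - 1| ≤ ‖h‖} := lintegral_indicator_one (measurableSet_le (continuous_norm.sub continuous_const).abs.measurable measurable_const)
      _ ≤ oR ((m+1) * 2^(m+1) * ‖h‖) * w := by rw [hw]; exact annul m (norm_nonneg h) h1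
      _ = oR ((m+1) * 2^(m+1)) * w * oR ‖h‖ := by rw [ENNReal.ofReal_mul (by positivity)]; ring
      _ ≤ _ := by gcongr; exact le_add_self
theorem PE_ball (m : ℕ) {s : ℝ} (hs : 0 < s) (hs1 : s < 1) : PE (ks ((m+1:ℕ)+s)) (Bu m) ≠ ∞ := by
  obtain ⟨D, hD, h⟩ := ball_shift m
  generalize ha : (((m+1:ℕ):ℝ)+s) = a
  have n1 := ker_near m hs1 one_pos
  have n2 := ker_far m hs one_pos
  rw [ha] at n1 n2
  have hc := chi_meas (measurableSet_ball (x := (0 : Ec m)) (ε := 1))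
  have hm : Measurable fun q : Ec m × Ec m => ks a ‖q.2‖ * oR |chi Bu m q.1 - chi Bu m (q.1 + q.2)| := by
    have a1 : Measurable fun q : Ec m × Ec m => chi Bu m q.1 - chi Bu m (q.1 + q.2) :=
      (hc.comp measurable_fst).sub (hc.comp (measurable_fst.add measurable_snd))
    exact ((ks_meas a).comp measurable_snd.norm).mul a1.norm.ennreal_ofReal
  have e : PE (ks a) (Bu m) = ∫⁻ v : Ec m, ks a ‖v‖ * ∫⁻ x, oR |chi Bu m x - chi Bu m (x + v)| := by
    have e1 : PE (ks a) (Bu m) = ∫⁻ x, ∫⁻ v, ks a ‖v‖ * oR |chi Bu m x - chi Bu m (x + v)| := by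
      unfold PE
      refine lintegral_congr fun x => ?_
      rw [← lintegral_add_left_eq_self _ x]
      refine lintegral_congr fun v => ?_
      rw [add_sub_cancel_left]
    rw [e1, lintegral_lintegral_swap hm.aemeasurable]
    refine lintegral_congr fun v => ?_
    exact lintegral_const_mul' _ _ ENNReal.ofReal_ne_top
  rw [e]
  have k1 : Measurable fun v : Ec m => (if ‖v‖ < 1 then ks a ‖v‖ else 0) * oR ‖v‖ * D :=
    ((Measurable.ite (measurableSet_lt measurable_norm measurable_const) ((ks_meas a).comp measurable_norm) measurable_const).mul measurable_norm.ennreal_ofReal).mul_const D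
  refine ne_top_of_le_ne_top (ENNReal.add_ne_top.2 ⟨ENNReal.mul_ne_top n1 hD, ENNReal.mul_ne_top n2 hD⟩) ?_
  rw [Mk, ← lintegral_mul_const' _ _ hD, ← lintegral_mul_const' _ _ hD]
  refine le_trans (lintegral_mono fun v => ?_) (lintegral_add_left k1 _).le
  by_cases hv : ‖v‖ < 1
  · simp only [hv, if_true, zero_mul, add_zero]
    rw [mul_assoc, mul_comm (oR ‖v‖)]
    exact mul_le_mul_right ((h v).2 hv.le) _
  · simp only [hv, if_false, zero_mul, zero_add]
    exact mul_le_mul_right (h v).1 _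
theorem PE_sup {a : ℝ} (ha : 0 < a) {F : Set (Euc n)} (hF : MS F) {X : ℝ≥0∞} (h : ∀ j, PE (kj a j) F ≤ X) : PE (ks a) F ≤ X := by
  have km : ∀ j, Measurable (kj a j) := fun j => ((measurable_id.max measurable_const).pow_const (-a)).ennreal_ofReal
  have eP : ∀ k : ℝ → ℝ≥0∞, Measurable k → PE k F = ∫⁻ q : Euc n × Euc n, k ‖q.2 - q.1‖ * oR |chi F q.1 - chi F q.2| := fun k hk => by
    rw [Measure.volume_eq_prod, lintegral_prod _ (PE_meas hk hF).aemeasurable, PE]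
  rw [eP _ (ks_meas a)]
  have mono : Monotone fun (j : ℕ) (q : Euc n × Euc n) => kj a j ‖q.2 - q.1‖ * oR |chi F q.1 - chi F q.2| := fun i j hij q => by
    refine mul_le_mul_left (oRle ?_) _
    refine Real.rpow_le_rpow_of_nonpos (lt_max_of_lt_right (by positivity)) (max_le_max le_rfl ?_) (by linarith)
    gcongr
  refine le_trans (lintegral_mono fun q => ?_) ((lintegral_iSup (fun j => PE_meas (km j) hF) mono).le.trans (iSup_le fun j => by rw [← eP _ (km j)]; exact h j))
  rcases eq_or_ne q.1 q.2 with hq | hq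
  · simp [hq]
  have hp : 0 < ‖q.2 - q.1‖ := norm_pos_iff.2 (sub_ne_zero.2 hq.symm)
  obtain ⟨j, hj⟩ := exists_nat_one_div_lt hp
  refine le_iSup_of_le j (le_of_eq ?_)
  simp only [kj, ks]; rw [max_eq_left hj.le]
theorem W_all (hm : 1 ≤ m) : ∃ C : ℝ, 0 ≤ C ∧ ∀ (F : Set Ec m) (d : ℝ), 0 < d → Cand (m+1) d F →
    ∃ c : Ec m, Wd (sim 1 (LinearIsometryEquiv.refl ℝ _) c ⁻¹' F) ≤ C * d := by
  obtain ⟨C₀, h0, hc⟩ := center hm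
  obtain ⟨C, hC, h⟩ := W_le hm C₀ h0
  have hb : 0 ≤ ballVol (m+1) := ENNReal.toReal_nonneg
  refine ⟨C + 2 * ballVol (m+1), by positivity, fun F d hd hF => ?_⟩
  rcases le_or_gt d 1 with h1 | h1
  · obtain ⟨c, hce⟩ := hc F d hd h1 hF
    refine ⟨c, (h _ d hd h1 (cand_iso hF _ c) hce).trans ?_⟩
    nlinarith
  · have hF' := cand_iso hF (LinearIsometryEquiv.refl ℝ _) 0
    refine ⟨0, ?_⟩
    generalize sim 1 (LinearIsometryEquiv.refl ℝ Ec m) 0 ⁻¹' F = G at hF'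
    have i1 := chi_int hF'.1 (cand_fin hF')
    have i2 := chi_int (measurableSet_ball (x := (0 : Ec m)) (ε := 1)) measure_ball_lt_top.ne
    have : Wd G ≤ ∫ x, (chi G x + chi Bu m x) := by
      refine integral_mono (Wd_int hF') (i1.add i2) fun x => ?_
      exact (mul_le_of_le_one_right (abs_nonneg _) (rho_le x)).trans (phi_le G x)
    rw [integral_add i1 i2, chi_integral hF'.1, chi_integral msB, hF'.2.1] at this
    change _ ≤ ballVol (m+1) + ballVol (m+1) at this
    nlinarith
theorem PE_main (hm : 1 ≤ m) {s : ℝ} (hs : 0 < s) (hs1 : s < 1) : ∃ C : ℝ, 0 ≤ C ∧ ∀ (F : Set Ec m) (d : ℝ), 0 < d → Cand (m+1) d F →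
    PE (ks ((m+1:ℕ)+s)) F ≤ PE (ks ((m+1:ℕ)+s)) (Bu m) + oR (C * d) := by
  obtain ⟨CW, hCW, hW⟩ := W_all hm
  obtain ⟨r0, C, hr0, hr1, hC, h⟩ := nt m
  have n1 := ker_near m hs1 hr0
  have n2 := ker_far m hs hr0
  have ha0 : 0 < (((m+1:ℕ):ℝ)+s) := by positivity
  generalize (((m+1:ℕ):ℝ)+s) = a at *
  obtain ⟨A, hA⟩ : ∃ A, A = ks a r0 + ∫⁻ v : Ec m, (if ‖v‖ < r0 then 0 else ks a ‖v‖) := ⟨_, rfl⟩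
  obtain ⟨M, hM⟩ : ∃ M, M = Mk (m+1) (fun r => if r < r0 then ks a r else 0) := ⟨_, rfl⟩
  have hAt : A ≠ ∞ := by rw [hA]; exact ENNReal.add_ne_top.2 ⟨ENNReal.ofReal_ne_top, n2⟩
  have hMt : M ≠ ∞ := by rw [hM]; exact n1
  refine ⟨(4 * (C * (M + A))).toReal * (1 + CW), by positivity, fun F d hd hF => ?_⟩
  obtain ⟨c, hc⟩ := hW F d hd hF
  have e := PE_sim a one_pos (LinearIsometryEquiv.refl ℝ Ec m) c F
  rw [Real.one_rpow, one_pow, inv_one, one_mul, one_mul, ENNReal.ofReal_one, one_mul] at e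
  rw [← e]
  have hF' := cand_iso hF (LinearIsometryEquiv.refl ℝ _) c
  generalize sim 1 (LinearIsometryEquiv.refl ℝ Ec m) c ⁻¹' F = G at *
  have kle : ∀ j r, 0 < r → kj a j r ≤ ks a r := fun j r hr =>
    oRle (Real.rpow_le_rpow_of_nonpos hr (le_max_left _ _) (by linarith))
  have anti : ∀ j, Antitone (kj a j) := fun j x y hxy =>
    oRle (Real.rpow_le_rpow_of_nonpos (lt_max_of_lt_right (by positivity)) (max_le_max hxy le_rfl) (by linarith))
  refine PE_sup ha0 hF'.1 fun j => ?_
  have tail : ∫⁻ v : Ec m, (if ‖v‖ < r0 then 0 else kj a j ‖v‖) ≤ ∫⁻ v : Ec m, (if ‖v‖ < r0 then 0 else ks a ‖v‖) := by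
    refine lintegral_mono fun v => ?_
    dsimp only
    split_ifs with hv
    · exact le_rfl
    · exact kle j _ (hr0.trans_le (not_lt.1 hv))
  have hN := h (kj a j) A (anti j) (fun r => ENNReal.ofReal_ne_top) ((kle j r0 hr0).trans (by rw [hA]; exact le_self_add)) (tail.trans (by rw [hA]; exact le_add_self)) G d hd.le hF'
  have hMj : Mk (m+1) (fun r => if r < r0 then kj a j r else 0) ≤ M := by
    rw [hM]
    refine lintegral_mono fun v => ?_
    dsimp only
    rcases eq_or_lt_of_le (norm_nonneg v) with h0 | h0
    · simp [← h0]
    · refine mul_le_mul_left ?_ _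
      split_ifs
      · exact kle j _ h0
      · exact le_rfl
  have hL : ∫⁻ v : Ec m, kj a j ‖v‖ ≠ ∞ := by
    have q : ∫⁻ v : Ec m, kj a j ‖v‖ ≤ ∫⁻ v : Ec m, ((ball (0 : Ec m) r0).indicator (fun _ => kj a j 0) v + (if ‖v‖ < r0 then 0 else kj a j ‖v‖)) := by
      refine lintegral_mono fun v => ?_
      by_cases hv : ‖v‖ < r0
      · rw [indicator_of_mem (mem_ball_zero_iff.2 hv)]; exact (anti j (norm_nonneg v)).trans le_self_add
      · simp only [hv, if_false]; exact le_add_self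
    rw [lintegral_add_left (measurable_const.indicator msB), lintegral_indicator msB, setLIntegral_const] at q
    exact ne_top_of_le_ne_top (ENNReal.add_ne_top.2 ⟨ENNReal.mul_ne_top ENNReal.ofReal_ne_top measure_ball_lt_top.ne, ne_top_of_le_ne_top n2 tail⟩) q
  refine (PE_cmp (anti j).measurable hL hF').trans (add_le_add ?_ ?_)
  · refine lintegral_mono fun x => lintegral_mono fun y => ?_
    rcases eq_or_ne x y with hq | hq
    · simp [hq]
    · exact mul_le_mul_left (kle j _ (norm_pos_iff.2 (sub_ne_zero.2 hq.symm))) _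
  · have h4 : (4 * (C * (M + A))) ≠ ∞ := by finiteness
    rw [mul_assoc, ENNReal.ofReal_mul ENNReal.toReal_nonneg, ENNReal.ofReal_toReal h4]
    calc _ ≤ 4 * (C * (M + A) * oR (d + Wd G)) := by gcongr; exact hN.trans (by gcongr)
      _ = 4 * (C * (M + A)) * oR (d + Wd G) := by ring
      _ ≤ _ := by gcongr; linarith
theorem Ps_eq (s : ℝ) {E : Set (Euc n)} (hE : MS E) (h : PE (ks ((n:ℝ)+s)) E ≠ ∞) :
    Ps n s E = (PE (ks ((n:ℝ)+s)) E).toReal := by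
  have hm := PE_meas (ks_meas ((n:ℝ)+s)) hE
  have e : ∀ x y : Euc n, |chi E x - chi E y| / ‖x-y‖^((n:ℝ)+s) = (ks ((n:ℝ)+s) ‖y-x‖ * oR |chi E x - chi E y|).toReal := by
    intro x y
    rw [ENNReal.toReal_mul, ks, ENNReal.toReal_ofReal (by positivity), ENNReal.toReal_ofReal (abs_nonneg _), Real.rpow_neg (norm_nonneg _), norm_sub_rev, div_eq_inv_mul]
  have hm2 := Measurable.lintegral_prod_right' (ν := volume) hm
  simp only [Ps, e]
  have e2 : ∀ x : Euc n, ∫ y, (ks ((n:ℝ)+s) ‖y-x‖ * oR |chi E x - chi E y|).toReal = (∫⁻ y, ks ((n:ℝ)+s) ‖y-x‖ * oR |chi E x - chi E y|).toReal := fun x =>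
    integral_toReal (hm.comp measurable_prodMk_left).aemeasurable (ae_of_all _ fun y => ENNReal.mul_lt_top ENNReal.ofReal_lt_top ENNReal.ofReal_lt_top)
  simp only [e2]
  exact integral_toReal hm2.aemeasurable (ae_lt_top hm2 h)
theorem isop (hm : 1 ≤ m) {F : Set (Ec m)} (hF : MS F) (hv : volume F = volume Bu m)
    (hP : HasFinitePerim F) : ((m+1:ℕ):ℝ) * ballVol (m+1) ≤ perim F := by
  have hω := ballVol_pos (m+1)
  have hm0 : (0:ℝ) < m := by exact_mod_cast hm
  have hm1 : (1:ℝ) ≤ m := by exact_mod_cast hm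
  have k : ∀ d : ℝ, 0 < d → d < ballVol (m+1) → Rp m^(m+1) * ballVol (m+1) * (ballVol (m+1) - d)^m ≤ (perim F + d)^(m+1) := by
    intro d hd hd1
    obtain ⟨η, h, _, _, h3, _, h5⟩ := L0' hF hv hP hd (p := Rp m/m) (by rw [le_div_iff₀ hm0]; linarith) (by rw [div_le_iff₀ hm0]; linarith)
    refine (?_ : _ ≤ _).trans ((Rn hm (Q_all hm) h).trans ?_)
    · gcongr
      linarith
    · have : 0 ≤ ∫ x, ‖fderiv ℝ η x‖ := integral_nonneg fun _ => norm_nonneg _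
      gcongr
  have t1 : Tendsto (fun d : ℝ => Rp m^(m+1) * ballVol (m+1) * (ballVol (m+1) - d)^m) (nhdsWithin 0 (Ioi 0)) (nhds (Rp m^(m+1) * ballVol (m+1) * (ballVol (m+1) - 0)^m)) :=
    (Continuous.tendsto (by fun_prop) 0).mono_left nhdsWithin_le_nhds
  have t2 : Tendsto (fun d : ℝ => (perim F + d)^(m+1)) (nhdsWithin 0 (Ioi 0)) (nhds ((perim F + 0)^(m+1))) :=
    (Continuous.tendsto (by fun_prop) 0).mono_left nhdsWithin_le_nhds
  have := le_of_tendsto_of_tendsto t1 t2 (by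
    filter_upwards [Ioo_mem_nhdsGT hω] with d hd using k d hd.1 hd.2)
  rw [sub_zero, add_zero] at this
  refine (pow_le_pow_iff_left₀ (by positivity) (perim_nonneg F) (Nat.succ_ne_zero m)).1 ?_
  refine le_trans (le_of_eq ?_) this
  push_cast; rw [mul_pow, mul_assoc, ← pow_succ']
theorem ks_anti {a : ℝ} (ha : 0 < a) {x y : ℝ} (hx : 0 < x) (h : x ≤ y) : ks a y ≤ ks a x :=
  oRle (Real.rpow_le_rpow_of_nonpos hx h (by linarith))
theorem PE_prod {a : ℝ} {F : Set (Euc n)} (hF : MS F) :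
    PE (ks a) F = ∫⁻ z : Euc n × Euc n, ks a ‖z.2 - z.1‖ * oR |chi F z.1 - chi F z.2| := by
  rw [Measure.volume_eq_prod, lintegral_prod _ (PE_meas (ks_meas a) hF).aemeasurable]; rfl
theorem two_sets {a T : ℝ} {A A' : Set (Euc n)} (hA : MS A) (hA' : MS A') (hd : Disjoint A A')
    (h : ∀ x ∈ A, ∀ y ∈ A', ks a ‖y - x‖ ≤ ks a T) :
    PE (ks a) A + PE (ks a) A' ≤ PE (ks a) (A ∪ A') + 4 * ks a T * (volume A * volume A') := by
  have m1 := PE_meas (ks_meas a) hA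
  have m3 := PE_meas (ks_meas a) (hA.union hA')
  rw [PE_prod hA, PE_prod hA', PE_prod (hA.union hA'), ← lintegral_add_left m1]
  have e : 4 * ks a T * (volume A * volume A') = ∫⁻ z : Euc n × Euc n, 2 * ks a T * ((A ×ˢ A').indicator 1 z + (A' ×ˢ A).indicator 1 z) := by
    have i1 := hA.prod hA'
    have i2 := hA'.prod hA
    have m0 : Measurable fun z : Euc n × Euc n => ((A ×ˢ A').indicator 1 z + (A' ×ˢ A).indicator 1 z : ℝ≥0∞) := (measurable_one.indicator i1).add (measurable_one.indicator i2)
    rw [lintegral_const_mul _ m0, lintegral_add_left (measurable_one.indicator i1),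
      lintegral_indicator_one i1, lintegral_indicator_one i2, Measure.volume_eq_prod, Measure.prod_prod, Measure.prod_prod, mul_comm (volume A'), ← two_mul]
    ring
  rw [e, ← lintegral_add_left m3]
  refine lintegral_mono fun z => ?_
  obtain ⟨x, y⟩ := z
  dsimp only
  have dj : ∀ z, z ∈ A → z ∉ A' := fun z h1 h2 => Set.disjoint_left.1 hd h1 h2
  by_cases x1 : x ∈ A <;> by_cases x2 : x ∈ A' <;> by_cases y1 : y ∈ A <;> by_cases y2 : y ∈ A' <;>
    first
    | exact absurd x2 (dj x x1)
    | exact absurd y2 (dj y y1)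
    | simp [chi, x1, x2, y1, y2]
  · rw [← two_mul]; exact mul_le_mul_right (h x x1 y y2) _
  · rw [← two_mul, norm_sub_rev]; exact mul_le_mul_right (h y y1 x x2) _
theorem fin_union {A A' : Set (Euc n)} (hA' : MS A') (hd : Disjoint A A')
    (h : HasFinitePerim A) (h' : HasFinitePerim A') : HasFinitePerim (A ∪ A') :=
  finPerim_of (M := perim A + perim A') fun g hg => by
    have i := divg_int hg.1 hg.2.1
    rw [setIntegral_union hd hA' i.integrableOn i.integrableOn]
    exact add_le_add (le_perim h hg) (le_perim h' hg)
theorem PE_pos (m : ℕ) {a : ℝ} (ha : 0 < a) : PE (ks a) (Bu m) ≠ 0 := by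
  have hB : MS Bu m := msB
  have hc : ‖(EuclideanSpace.single 0 3 : Ec m)‖ = 3 := by simp
  obtain ⟨c, hc⟩ : ∃ c : Ec m, ‖c‖ = 3 := ⟨_, hc⟩
  have hd : MS (ball c 1) := msB
  rw [PE_prod hB]
  refine (lt_of_lt_of_le ?_ (?_ : ks a 5 * (volume Bu m * volume (ball c 1)) ≤ _)).ne'
  · refine ENNReal.mul_pos (ENNReal.ofReal_pos.2 (by positivity)).ne' (ENNReal.mul_pos ?_ ?_).ne' <;> exact (measure_ball_pos _ _ one_pos).ne'
  · have i1 := hB.prod hd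
    rw [← Measure.prod_prod, ← Measure.volume_eq_prod, ← lintegral_indicator_one i1, ← lintegral_const_mul _ (measurable_one.indicator i1)]
    refine lintegral_mono fun z => ?_
    by_cases hz : z ∈ Bu m ×ˢ ball c 1
    · have h1 := mem_ball_zero_iff.1 hz.1
      have h2 := mem_ball_iff_norm.1 hz.2
      have h3 : ‖c‖ ≤ ‖z.2‖ + ‖z.2 - c‖ := by simpa using norm_sub_le z.2 (z.2 - c)
      have h4 : ‖z.2‖ ≤ ‖z.2 - c‖ + ‖c‖ := by simpa using norm_add_le (z.2 - c) c
      have h5 : ‖z.2‖ ≤ ‖z.2 - z.1‖ + ‖z.1‖ := by simpa using norm_add_le (z.2 - z.1) z.1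
      have h6 := norm_sub_le z.2 z.1
      have hz2 : z.2 ∉ Bu m := fun h => by rw [mem_ball_zero_iff] at h; linarith
      rw [indicator_of_mem hz, chi, indicator_of_mem hz.1, indicator_of_notMem hz2]
      simpa using ks_anti ha (by linarith) (by linarith : ‖z.2 - z.1‖ ≤ 5)
    · rw [indicator_of_notMem hz, mul_zero]; exact zero_le
theorem ex_far (m : ℕ) {s : ℝ} (hs : 0 < s) (hs1 : s < 1) : ∃ F : Set Ec m, MS F ∧ volume F = volume Bu m ∧
    HasFinitePerim F ∧ PE (ks ((m+1:ℕ)+s)) (Bu m) < PE (ks ((m+1:ℕ)+s)) F := by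
  have hfin := PE_ball m hs hs1
  have ha : 0 < (((m+1:ℕ):ℝ)+s) := by positivity
  have hpos := PE_pos m ha
  have hn0 : (0:ℝ) < (m+1:ℕ) := by positivity
  obtain ⟨l, hl⟩ : ∃ l : ℝ, l = 2^((1:ℝ)/(m+1:ℕ)) := ⟨_, rfl⟩
  have l0 : 0 < l := by rw [hl]; positivity
  have ln : l^(m+1) = 2 := by
    rw [hl, ← Real.rpow_natCast, ← Real.rpow_mul (by norm_num), one_div_mul_cancel hn0.ne', Real.rpow_one]
  have l1 : 1 < l := by
    by_contra h; push Not at h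
    have := pow_le_one₀ (n := m+1) l0.le h
    linarith
  have l2 : l ≤ 2 := by
    rw [← ln]; exact le_self_pow₀ l1.le (Nat.succ_ne_zero m)
  obtain ⟨q, hq⟩ : ∃ q : ℝ, q = l^(((m+1:ℕ):ℝ)+s) * ((l^(m+1))⁻¹ * (l^(m+1))⁻¹) := ⟨_, rfl⟩
  have q1 : 1 < q + q := by
    rw [hq, Real.rpow_add l0, Real.rpow_natCast, ln]
    have := Real.one_lt_rpow l1 hs
    linarith
  obtain ⟨a, hae⟩ : ∃ a, a = (((m+1:ℕ):ℝ)+s) := ⟨_, rfl⟩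
  rw [← hae] at hfin ha hpos hq ⊢
  by_contra hcon
  push Not at hcon
  have I : Ec m ≃ₗᵢ[ℝ] Ec m := LinearIsometryEquiv.refl ℝ _
  have hB : MS Bu m := msB
  obtain ⟨S, hS⟩ : ∃ S : Ec m → Set Ec m, S = fun c => sim l I c ⁻¹' ball 0 1 := ⟨_, rfl⟩
  have S1 : ∀ c, MS (S c) := fun c => by rw [hS]; exact (sim_cont l I c).measurable hB
  have S2 : ∀ c, volume (S c) = oR 2⁻¹ * volume Bu m := fun c => by rw [hS, ← ln]; exact sim_volume l0 I c _
  have S3 : ∀ c, PE (ks a) (S c) = oR q * PE (ks a) (Bu m) := fun c => by rw [hS, hq]; exact PE_sim a l0 I c _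
  have S4 : ∀ c, HasFinitePerim (S c) := fun c => by rw [hS]; exact (sim_perim l0 I c ball_fin).1
  have key : ∀ T : ℝ, 0 < T → oR (q+q) * PE (ks a) (Bu m) ≤
      PE (ks a) (Bu m) + 4 * ks a T * (volume (S 0) * volume (S 0)) := by
    intro T hT
    obtain ⟨c, hc⟩ : ∃ c : Ec m, ‖c‖ = 2*T+2 := ⟨EuclideanSpace.single 0 (2*T+2), by
      rw [EuclideanSpace.norm_single, Real.norm_of_nonneg (by positivity)]⟩
    have dist : ∀ x ∈ S 0, ∀ y ∈ S c, T ≤ ‖y - x‖ := by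
      intro x hx y hy
      rw [hS] at hx hy
      have hx1 : ‖l • I x + 0‖ < 1 := mem_ball_zero_iff.1 hx
      have hy1 : ‖l • I y + c‖ < 1 := mem_ball_zero_iff.1 hy
      have h1 : c = (l • I y + c) - (l • I x + 0) - l • I (y - x) := by rw [map_sub, smul_sub]; abel
      have h2 : ‖c‖ ≤ ‖l • I y + c‖ + ‖l • I x + 0‖ + ‖l • I (y-x)‖ := by
        conv_lhs => rw [h1]
        exact (norm_sub_le _ _).trans (add_le_add_left (norm_sub_le _ _) _)
      rw [norm_smul, I.norm_map, Real.norm_of_nonneg l0.le] at h2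
      have h3 := mRi l2 (norm_nonneg (y-x))
      linarith
    have dj : Disjoint (S 0) (S c) := Set.disjoint_left.2 fun x h1 h2 => by
      have := dist x h1 x h2
      rw [sub_self, norm_zero] at this; linarith
    have := two_sets (a := a) (T := T) (S1 0) (S1 c) dj fun x hx y hy => ks_anti ha hT (dist x hx y hy)
    rw [S3, S3, ← add_mul, ← ENNReal.ofReal_add (by linarith) (by linarith)] at this
    refine this.trans ?_
    rw [S2 c, ← S2 0]
    refine add_le_add_left (hcon _ ((S1 0).union (S1 c)) ?_ (fin_union (S1 c) dj (S4 0) (S4 c))) _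
    rw [measure_union dj (S1 c), S2, S2, ← add_mul, ← ENNReal.ofReal_add (by norm_num) (by norm_num)]
    norm_num
  have hv : volume (S 0) * volume (S 0) ≠ ∞ := by
    rw [S2]
    have : volume Bu m ≠ ∞ := measure_ball_lt_top.ne
    finiteness
  have t0 : Tendsto (ks a) atTop (nhds 0) := by
    have := ENNReal.tendsto_ofReal (tendsto_rpow_neg_atTop ha)
    rwa [ENNReal.ofReal_zero] at this
  have t1 : Tendsto (fun T => PE (ks a) (Bu m) + 4 * ks a T * (volume (S 0) * volume (S 0))) atTop
      (nhds (PE (ks a) (Bu m) + 4 * 0 * (volume (S 0) * volume (S 0)))) :=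
    tendsto_const_nhds.add (ENNReal.Tendsto.mul_const (ENNReal.Tendsto.const_mul t0 (Or.inr (by finiteness))) (Or.inr hv))
  have := ge_of_tendsto t1 (by filter_upwards [eventually_gt_atTop 0] with T hT using key T hT)
  rw [mul_zero, zero_mul, add_zero] at this
  refine absurd this (not_le.2 ?_)
  conv_lhs => rw [← one_mul (PE _ _)]
  exact ENNReal.mul_lt_mul_left hpos hfin (by rw [← ENNReal.ofReal_one]; exact (ENNReal.ofReal_lt_ofReal_iff (by linarith)).2 q1)
theorem Ps_main (hm : 1 ≤ m) {s : ℝ} (hs : 0 < s) (hs1 : s < 1) : ∃ C : ℝ, 0 < C ∧ ∀ F : Set Ec m, MS F →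
    volume F = volume Bu m → HasFinitePerim F → PE (ks ((m+1:ℕ)+s)) F ≠ ∞ ∧ perim Bu m ≤ perim F ∧
    Ps (m+1) s F - Ps (m+1) s (ball 0 1) ≤ C * (perim F - perim Bu m) := by
  obtain ⟨C, hC, h⟩ := PE_main hm hs hs1
  have hb := PE_ball m hs hs1
  refine ⟨C+1, by linarith, fun F hF hv hP => ?_⟩
  have i1 := isop hm hF hv hP
  have i2 := isop hm msB rfl (ball_fin (n := m+1))
  have i3 := ball_perim_le (n := m+1)
  have c : ∀ e : ℝ, 0 < e → Cand (m+1) (perim F - perim Bu m + e) F := fun e he => ⟨hF, hv, hP, by linarith⟩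
  have c' := fun e he => h F _ (by linarith) (c e he)
  have hf : PE (ks ((m+1:ℕ)+s)) F ≠ ∞ := ne_top_of_le_ne_top (ENNReal.add_ne_top.2 ⟨hb, ENNReal.ofReal_ne_top⟩) (c' 1 one_pos)
  refine ⟨hf, by linarith, ?_⟩
  rw [Ps_eq s hF hf, Ps_eq s msB hb]
  refine le_trans (?_ : _ ≤ C * (perim F - perim Bu m)) (by nlinarith)
  refine le_of_forall_pos_le_add fun e he => ?_
  have e0 : 0 < e/(C+1) := by positivity
  have k := ENNReal.toReal_mono (ENNReal.add_ne_top.2 ⟨hb, ENNReal.ofReal_ne_top⟩) (c' (e/(C+1)) (by positivity))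
  rw [ENNReal.toReal_add hb ENNReal.ofReal_ne_top, ENNReal.toReal_ofReal (mul_nonneg hC (by linarith))] at k
  have : C * (e/(C+1)) ≤ e := by rw [← mul_div_assoc, div_le_iff₀ (by linarith)]; nlinarith
  linarith
theorem Fen_sim {s α l : ℝ} (hl : 0 < l) {E : Set (Euc n)} (hE : MS E) (hP : HasFinitePerim E)
    (hf : PE (ks ((n:ℝ)+s)) E ≠ ∞) (U : Euc n ≃ₗᵢ[ℝ] Euc n) :
    Fen n s α (sim l U 0 ⁻¹' E) = l * (l^n)⁻¹ * Fen n s (α * l^(s-1)) E := by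
  have e := PE_sim ((n:ℝ)+s) hl U 0 E
  have hf' : PE (ks ((n:ℝ)+s)) (sim l U 0 ⁻¹' E) ≠ ∞ := by rw [e]; finiteness
  have lp := Real.rpow_pos_of_pos hl ((n:ℝ)+s)
  rw [Fen, Fen, (sim_perim hl U 0 hP).2, Ps_eq s ((sim_cont l U 0).measurable hE) hf', Ps_eq s hE hf, e, ENNReal.toReal_mul,
    ENNReal.toReal_ofReal (by positivity), Real.rpow_add hl, Real.rpow_natCast, Real.rpow_sub_one hl.ne']
  field_simp
theorem fmin_iff (hm : 1 ≤ m) {s : ℝ} (hs : 0 < s) (hs1 : s < 1) {α v r : ℝ} (hr : 0 < r)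
    (hv : volume (ball (0 : Ec m) r) = oR v) : IsFMin (m+1) s α v (ball (0 : Ec m) r) ↔
    ∀ F : Set Ec m, MS F → volume F = volume Bu m → HasFinitePerim F →
      α * r^(1-s) * s * (1-s) * (Ps (m+1) s F - Ps (m+1) s (ball 0 1)) ≤ perim F - perim Bu m := by
  obtain ⟨C, hC, h⟩ := Ps_main hm hs hs1
  obtain ⟨I, hI⟩ : ∃ I : Ec m ≃ₗᵢ[ℝ] Ec m, I = LinearIsometryEquiv.refl ℝ _ := ⟨_, rfl⟩
  have r' : 0 < r⁻¹ := inv_pos.2 hr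
  have hB : ball (0 : Ec m) r = sim r⁻¹ I 0 ⁻¹' ball 0 1 := by
    ext x
    rw [mem_preimage, mem_ball_zero_iff, mem_ball_zero_iff, sim, add_zero, norm_smul, I.norm_map, Real.norm_of_nonneg r'.le, inv_mul_lt_iff₀ hr, mul_one]
  have mB : MS Bu m := msB
  have fB := (h _ mB rfl ball_fin).1
  have er : r⁻¹^(s-1) = r^(1-s) := by rw [Real.inv_rpow hr.le, ← Real.rpow_neg hr.le, neg_sub]
  have q : 0 < r⁻¹ * (r⁻¹^(m+1))⁻¹ := by positivity
  have vB : volume (sim r⁻¹ I 0 ⁻¹' ball 0 1) = oR v := by rw [← hB, hv]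
  have cmp : ∀ F : Set Ec m, MS F → volume F = volume Bu m → HasFinitePerim F →
      (Fen (m+1) s α (ball (0 : Ec m) r) ≤ Fen (m+1) s α (sim r⁻¹ I 0 ⁻¹' F) ↔
      α * r^(1-s) * s * (1-s) * (Ps (m+1) s F - Ps (m+1) s (ball 0 1)) ≤ perim F - perim Bu m) := by
    intro F hF hv hP
    rw [hB, Fen_sim r' mB ball_fin fB, Fen_sim r' hF hP (h F hF hv hP).1, er, mul_le_mul_iff_right₀ q, Fen, Fen]
    constructor <;> intro h <;> linarith
  constructor
  · rintro ⟨_, _, _, H⟩ F hF hvF hP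
    refine (cmp F hF hvF hP).1 (H _ ((sim_cont _ I 0).measurable hF) (sim_perim r' I 0 hP).1 ?_)
    rw [sim_volume r', hvF, ← sim_volume r' I 0, vB]
  · intro H
    refine ⟨msB, by rw [hB]; exact (sim_perim r' I 0 ball_fin).1, hv, fun F hF hP hvF => ?_⟩
    have e : sim r⁻¹ I 0 ⁻¹' (sim r I 0 ⁻¹' F) = F := by
      ext x
      rw [mem_preimage, mem_preimage, sim, sim, add_zero, add_zero, hI]
      simp [hr.ne']
    have m1 : MS (sim r I 0 ⁻¹' F) := (sim_cont _ I 0).measurable hF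
    have m2 := (sim_perim hr I 0 hP).1
    have m3 : volume (sim r I 0 ⁻¹' F) = volume Bu m := by
      rw [sim_volume hr, hvF, ← vB, sim_volume r', ← mul_assoc, ← ENNReal.ofReal_mul (by positivity)]
      simp [hr.ne']
    have := (cmp _ m1 m3 m2).2 (H _ m1 m3 m2)
    rwa [e] at this
/-- there is a threshold `γ₁* > 0` (depending only on `n`, `s`) such that the
ball of volume `m` is a global minimizer of `F_{s,α}` iff `α m^{(1-s)/n} ≤ γ₁*`. -/
theorem stmt_5 (n : ℕ) (hn : 2 ≤ n) (s : ℝ) (hs : s ∈ Set.Ioo (0 : ℝ) 1) :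
    ∃ γ₁ : ℝ, 0 < γ₁ ∧
      ∀ α m r : ℝ, 0 < α → 0 < m → 0 < r →
        volume (ball (0 : Euc n) r) = ENNReal.ofReal m →
        (IsFMin n s α m (ball (0 : Euc n) r) ↔ α * m ^ ((1 - s) / n) ≤ γ₁) := by
  obtain ⟨m, rfl⟩ : ∃ m, n = m+1 := ⟨n-1, by omega⟩
  have hm : 1 ≤ m := by omega
  obtain ⟨hs0, hs1⟩ := hs
  obtain ⟨C, hC, h⟩ := Ps_main hm hs0 hs1
  obtain ⟨F0, a1, a2, a3, a4⟩ := ex_far m hs0 hs1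
  have hω := ballVol_pos (m+1)
  have mB : MS Bu m := msB
  have g0 : Ps (m+1) s (ball 0 1) < Ps (m+1) s F0 := by
    rw [Ps_eq s a1 (h F0 a1 a2 a3).1, Ps_eq s mB (PE_ball m hs0 hs1)]
    exact (ENNReal.toReal_lt_toReal (PE_ball m hs0 hs1) (h F0 a1 a2 a3).1).2 a4
  have ss : 0 < s * (1-s) := mul_pos hs0 (by linarith)
  obtain ⟨S, hS⟩ : ∃ S : Set ℝ, S = {t | ∃ F : Set Ec m, MS F ∧ volume F = volume Bu m ∧ HasFinitePerim F ∧
    Ps (m+1) s (ball 0 1) < Ps (m+1) s F ∧ t = (perim F - perim Bu m) / (s*(1-s)*(Ps (m+1) s F - Ps (m+1) s (ball 0 1)))} := ⟨_, rfl⟩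
  have Sne : S.Nonempty := by rw [hS]; exact ⟨_, F0, a1, a2, a3, g0, rfl⟩
  have Slb : ∀ t ∈ S, 1/(s*(1-s)*C) ≤ t := by
    rw [hS]
    rintro t ⟨F, b1, b2, b3, b4, rfl⟩
    have k := (h F b1 b2 b3).2.2
    have b5 : 0 < Ps (m+1) s F - Ps (m+1) s (ball 0 1) := by linarith
    rw [div_le_div_iff₀ (by positivity) (by positivity), one_mul]
    nlinarith
  have Sb : BddBelow S := ⟨_, Slb⟩
  have β0 : 0 < sInf S := lt_of_lt_of_le (by positivity) (le_csInf Sne Slb)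
  refine ⟨sInf S * ballVol (m+1) ^ ((1-s)/((m+1:ℕ):ℝ)), by positivity, fun α v r hα hv hr hvol => ?_⟩
  have ev : v = r^(m+1) * ballVol (m+1) := by
    have e : volume (ball (0 : Ec m) r) = oR (r^(m+1)) * volume Bu m := by
      have := Measure.addHaar_ball (volume : Measure Ec m) 0 hr.le
      rwa [finrank_euclideanSpace_fin] at this
    have := congrArg ENNReal.toReal (hvol.symm.trans e)
    rwa [ENNReal.toReal_ofReal hv.le, ENNReal.toReal_mul, ENNReal.toReal_ofReal (by positivity)] at this
  have ep : v ^ ((1-s)/((m+1:ℕ):ℝ)) = r^(1-s) * ballVol (m+1) ^ ((1-s)/((m+1:ℕ):ℝ)) := by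
    rw [ev, Real.mul_rpow (by positivity) hω.le, ← Real.rpow_natCast, ← Real.rpow_mul hr.le, mul_div_cancel₀ _ (by positivity)]
  rw [fmin_iff hm hs0 hs1 hr hvol, ep, ← mul_assoc, mul_le_mul_iff_left₀ (by positivity)]
  constructor
  · intro H
    refine le_csInf Sne fun t ht => ?_
    rw [hS] at ht
    obtain ⟨F, b1, b2, b3, b4, rfl⟩ := ht
    rw [le_div_iff₀ (mul_pos ss (by linarith))]
    have := H F b1 b2 b3
    linarith
  · intro H F b1 b2 b3
    have k := (h F b1 b2 b3).2.1
    have rp := Real.rpow_pos_of_pos hr (1-s)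
    by_cases b4 : Ps (m+1) s (ball 0 1) < Ps (m+1) s F
    · have := H.trans (csInf_le Sb (by rw [hS]; exact ⟨F, b1, b2, b3, b4, rfl⟩))
      rw [le_div_iff₀ (mul_pos ss (by linarith))] at this
      linarith
    · refine le_trans ?_ (sub_nonneg.2 k)
      have : 0 ≤ α * r^(1-s) * s * (1-s) := by have := mul_pos (mul_pos hα rp) ss; linarith
      exact mul_nonpos_of_nonneg_of_nonpos this (by linarith)
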